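/- Let J be a closed ideal of the Banach algebra H∞(𝔻×ℕ), and let H_J := {c·1 + f : c ∈ ℂ, f ∈ J} be the unital closed subalgebra generated by J. Then H_J is a B-ring: for every pair a, b ∈ H_J such that u·a + v·b = 1 for some u, v ∈ H_J, there exists c ∈ H_J such that a + c·b is invertible in H_J (i.e., has a multiplicative inverse lying in H_J). -/

import Mathlib

/-- Membership in `H^∞(𝔻 × ℕ)`: a function on the countable disjoint union of
unit disks whose every slice `z ↦ f z n` is holomorphic on `𝔻 = {z : |z| < 1}`
and which is uniformly bounded. -/
def MemHinfN (f : ℂ → ℕ → ℂ) : Prop :=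
  (∀ n : ℕ, DifferentiableOn ℂ (fun z => f z n) (Metric.ball 0 1)) ∧
    ∃ M : ℝ, ∀ z ∈ Metric.ball (0 : ℂ) 1, ∀ n : ℕ, ‖f z n‖ ≤ M

/-- For an ideal `J ⊆ H^∞(𝔻 × ℕ)`, the unital (closed) subalgebra
`H_J = {c·1 + f : c ∈ ℂ, f ∈ J}` generated by `J`. -/
def unitalHull (J : Set (ℂ → ℕ → ℂ)) : Set (ℂ → ℕ → ℂ) :=
  {h | ∃ c : ℂ, ∃ f ∈ J, h = fun z n => c + f z n}

section
open MeasureTheory Set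

/-- The open upper half plane, as a subset of `ℂ`. -/
def UH : Set ℂ := {z | 0 < z.im}

lemma mem_UH {z : ℂ} : z ∈ UH ↔ 0 < z.im := Iff.rfl

lemma isOpen_UH : IsOpen UH := isOpen_lt continuous_const Complex.continuous_im

lemma ball_subset_UH {z : ℂ} {r : ℝ} (h : r ≤ z.im) : Metric.ball z r ⊆ UH := by
  intro w hw
  have h1 := Complex.abs_im_le_norm (w - z)
  rw [Metric.mem_ball, dist_eq_norm] at hw
  rw [mem_UH]
  rw [Complex.sub_im] at h1
  have := abs_le.1 (h1.trans hw.le)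
  have := (abs_lt.1 (h1.trans_lt hw)).1
  linarith

lemma norm_deriv_le_of_UH {f : ℂ → ℂ} {B : ℝ} (hf : DifferentiableOn ℂ f UH)
    (hB : ∀ z ∈ UH, ‖f z‖ ≤ B) {z : ℂ} (hz : z ∈ UH) : ‖deriv f z‖ ≤ 2 * B / z.im := by
  have hy : 0 < z.im := hz
  have hsub : Metric.closedBall z (z.im / 2) ⊆ UH :=
    (Metric.closedBall_subset_ball (by linarith)).trans (ball_subset_UH le_rfl)
  have := Complex.norm_deriv_le_of_forall_mem_sphere_norm_le (f := f) (c := z) (R := z.im / 2)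
    (C := B) (by linarith) ((hf.mono (closure_minimal (Metric.ball_subset_closedBall.trans hsub
      |> fun h => Metric.ball_subset_closedBall) Metric.isClosed_closedBall |>.trans hsub)).diffContOnCl)
    (fun w hw => hB w (hsub (Metric.sphere_subset_closedBall hw)))
  calc _ ≤ _ := this
    _ = _ := by field_simp

lemma norm_sub_le_of_UH {f : ℂ → ℂ} {B : ℝ} (hf : DifferentiableOn ℂ f UH)
    (hB : ∀ z ∈ UH, ‖f z‖ ≤ B) {z w : ℂ} (hz : z ∈ UH) (hw : w ∈ UH) :
    ‖f w - f z‖ ≤ 4 * B * ‖w - z‖ / z.im := by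
  have hy : 0 < z.im := hz
  have hB0 : 0 ≤ B := (norm_nonneg _).trans (hB z hz)
  rcases le_or_gt (z.im / 2) ‖w - z‖ with h | h
  · rw [le_div_iff₀ hy]
    have h1 : ‖f w - f z‖ ≤ 2 * B := (norm_sub_le _ _).trans (by linarith [hB z hz, hB w hw])
    nlinarith [norm_nonneg (f w - f z)]
  · have hsub : Metric.ball z (z.im / 2) ⊆ UH := ball_subset_UH (by linarith)
    have hd : ∀ x ∈ Metric.ball z (z.im / 2), ‖deriv f x‖ ≤ 4 * B / z.im := by
      intro x hx
      refine (norm_deriv_le_of_UH hf hB (hsub hx)).trans ?_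
      have h1 := Complex.abs_im_le_norm (x - z)
      rw [Metric.mem_ball, dist_eq_norm] at hx
      rw [Complex.sub_im] at h1
      have := (abs_lt.1 (h1.trans_lt hx)).1
      rw [div_le_div_iff₀ (by linarith) hy]
      nlinarith
    have := (convex_ball z (z.im / 2)).norm_image_sub_le_of_norm_deriv_le
      (f := f) (C := 4 * B / z.im) (fun x hx => (hf.differentiableAt (isOpen_UH.mem_nhds (hsub hx))))
      hd (Metric.mem_ball_self (by linarith)) (y := w) (by rwa [Metric.mem_ball, dist_eq_norm])
    calc _ ≤ _ := this
      _ = _ := by ring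

lemma DifferentiableOn.differentiableAt_UH {f : ℂ → ℂ} (hf : DifferentiableOn ℂ f UH) {z : ℂ}
    (hz : 0 < z.im) : DifferentiableAt ℂ f z := hf.differentiableAt (isOpen_UH.mem_nhds hz)

end

section
open MeasureTheory Set Filter Topology

/-- Holomorphic dependence of an integral on a parameter, under a dominating bound. -/
lemma differentiableOn_integral_of_dominated {α : Type*} [MeasurableSpace α] {μ : Measure α}
    {U : Set ℂ} (hU : IsOpen U) {F : ℂ → α → ℂ} {B : α → ℝ}
    (hmeas : ∀ z ∈ U, AEStronglyMeasurable (F z) μ)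
    (hhol : ∀ᵐ a ∂μ, DifferentiableOn ℂ (fun z => F z a) U)
    (hbd : ∀ᵐ a ∂μ, ∀ z ∈ U, ‖F z a‖ ≤ B a) (hB : Integrable B μ) :
    DifferentiableOn ℂ (fun z => ∫ a, F z a ∂μ) U := by
  intro z₀ hz₀
  obtain ⟨r, hr, hrU⟩ := Metric.isOpen_iff.1 hU z₀ hz₀
  have hnhds : Metric.ball z₀ (r / 2) ∈ 𝓝 z₀ := Metric.ball_mem_nhds _ (by linarith)
  have hsub : ∀ x ∈ Metric.ball z₀ (r / 2), Metric.closedBall x (r / 4) ⊆ U := by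
    intro x hx w hw
    apply hrU
    rw [Metric.mem_ball] at hx ⊢
    rw [Metric.mem_closedBall] at hw
    linarith [dist_triangle w x z₀]
  have hintg : ∀ z ∈ U, Integrable (F z) μ := fun z hz =>
    hB.mono' (hmeas z hz) (hbd.mono fun a ha => ha z hz)
  refine (hasDerivAt_integral_of_dominated_loc_of_deriv_le (μ := μ) (x₀ := z₀)
    (s := Metric.ball z₀ (r / 2)) (F := F) (F' := fun z a => deriv (fun w => F w a) z)
    (bound := fun a => 4 / r * B a) hnhds
    (Filter.mem_of_superset (hU.mem_nhds hz₀) hmeas) (hintg z₀ hz₀) ?_ ?_ (hB.const_mul _)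
    ?_).2.differentiableAt.differentiableWithinAt
  · have ht : Tendsto (fun n : ℕ => ((r / 2 * (1 / ((n : ℝ) + 1)) : ℝ) : ℂ)) atTop (𝓝[≠] 0) := by
      rw [tendsto_nhdsWithin_iff]
      constructor
      · have h1 := (tendsto_one_div_add_atTop_nhds_zero_nat (𝕜 := ℝ)).const_mul (r / 2)
        rw [mul_zero] at h1
        exact (Complex.continuous_ofReal.tendsto 0).comp h1 |>.trans (by simp)
      · refine Eventually.of_forall fun n => ?_
        simp only [mem_compl_iff, mem_singleton_iff, Complex.ofReal_eq_zero]
        positivity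
    have hmem : ∀ n : ℕ, z₀ + ((r / 2 * (1 / ((n : ℝ) + 1)) : ℝ) : ℂ) ∈ U := by
      intro n
      apply hrU
      rw [Metric.mem_ball, dist_eq_norm, add_sub_cancel_left, Complex.norm_real, Real.norm_eq_abs,
        abs_of_pos (by positivity)]
      have : 1 / ((n : ℝ) + 1) ≤ 1 := by
        rw [div_le_one (by positivity)]; linarith [n.cast_nonneg (α := ℝ)]
      nlinarith
    refine aestronglyMeasurable_of_tendsto_ae atTop
      (f := fun (n : ℕ) a => (((r / 2 * (1 / ((n : ℝ) + 1)) : ℝ) : ℂ))⁻¹ •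
        (F (z₀ + ((r / 2 * (1 / ((n : ℝ) + 1)) : ℝ) : ℂ)) a - F z₀ a)) (fun n => ?_) ?_
    · exact AEStronglyMeasurable.const_smul ((hmeas _ (hmem n)).sub (hmeas _ hz₀)) (_ : ℂ)
    · filter_upwards [hhol] with a ha
      have hd := (ha.differentiableAt (hU.mem_nhds hz₀)).hasDerivAt
      exact (hasDerivAt_iff_tendsto_slope_zero.1 hd).comp ht
  · filter_upwards [hhol, hbd] with a ha hb x hx
    have := Complex.norm_deriv_le_of_forall_mem_sphere_norm_le (f := fun w => F w a) (c := x)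
      (R := r / 4) (C := B a) (by linarith)
      ((ha.mono (hsub x hx)).diffContOnCl_ball (subset_refl _))
      (fun w hw => hb w (hsub x hx (Metric.sphere_subset_closedBall hw)))
    calc _ ≤ _ := this
      _ = _ := by field_simp
  · filter_upwards [hhol] with a ha x hx
    have : x ∈ U := hsub x hx (Metric.mem_closedBall_self (by linarith))
    exact (ha.differentiableAt (hU.mem_nhds this)).hasDerivAt

/-- The Cauchy–Riemann operator `∂̄ = (∂ₓ + i ∂ᵧ) / 2`. -/
noncomputable def dbar (f : ℂ → ℂ) (z : ℂ) : ℂ :=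
  (fderiv ℝ f z 1 + Complex.I * fderiv ℝ f z Complex.I) / 2

lemma fderiv_apply_eq (f : ℂ → ℂ) (z : ℂ) (u : ℂ) :
    fderiv ℝ f z u = u.re * fderiv ℝ f z 1 + u.im * fderiv ℝ f z Complex.I := by
  conv_lhs => rw [show u = u.re • (1 : ℂ) + u.im • Complex.I by
    apply Complex.ext <;> simp]
  rw [map_add, map_smul, map_smul]
  simp

lemma continuous_dbar {f : ℂ → ℂ} (hf : ContDiff ℝ 1 f) : Continuous (dbar f) := by
  have h := hf.continuous_fderiv one_ne_zero
  unfold dbar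
  fun_prop

/-- The Cauchy–Pompeiu formula for compactly supported functions. -/
lemma cauchy_pompeiu {f : ℂ → ℂ} (hf : ContDiff ℝ 1 f) (hc : HasCompactSupport f) (z : ℂ) :
    ∫ ζ, dbar f ζ / (z - ζ) = Real.pi * f z := by
  have hD := hf.continuous_fderiv one_ne_zero
  have hdiff : Differentiable ℝ f := hf.differentiable one_ne_zero
  obtain ⟨R₀, hR₀⟩ := hc.isCompact.isBounded.subset_closedBall z
  obtain ⟨R, hR, hRR⟩ : ∃ R : ℝ, 0 < R ∧ R₀ < R := ⟨max R₀ 0 + 1, by positivity, by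
    linarith [le_max_left R₀ 0]⟩
  have hzero : ∀ u : ℂ, R ≤ ‖u‖ → z + u ∉ tsupport f := by
    intro u hu h
    have := hR₀ h
    rw [Metric.mem_closedBall, dist_eq_norm, add_sub_cancel_left] at this
    linarith
  have hDzero : ∀ u : ℂ, R ≤ ‖u‖ → fderiv ℝ f (z + u) = 0 := by
    intro u hu
    exact image_eq_zero_of_notMem_tsupport fun h => hzero u hu (tsupport_fderiv_subset ℝ h)
  -- the unit vector of angle `θ`
  set e : ℝ → ℂ := fun θ => Complex.exp (θ * Complex.I) with he
  have hec : Continuous e := by fun_prop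
  have hene : ∀ θ, e θ ≠ 0 := fun θ => Complex.exp_ne_zero _
  have henorm : ∀ θ, ‖e θ‖ = 1 := fun θ => Complex.norm_exp_ofReal_mul_I θ
  have hecs : ∀ θ, e θ = Real.cos θ + Real.sin θ * Complex.I := by
    intro θ; rw [he]; simp only; rw [Complex.exp_mul_I]; simp
  set G : ℝ → ℝ → ℂ := fun r θ => fderiv ℝ f (z + r * e θ) (e θ) with hG
  set K : ℝ → ℝ → ℂ := fun r θ => fderiv ℝ f (z + r * e θ) (Complex.I * e θ) with hK
  have hGc : Continuous (fun p : ℝ × ℝ => G p.1 p.2) := by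
    apply Continuous.clm_apply
    · exact hD.comp (by fun_prop)
    · fun_prop
  have hKc : Continuous (fun p : ℝ × ℝ => K p.1 p.2) := by
    apply Continuous.clm_apply
    · exact hD.comp (by fun_prop)
    · fun_prop
  have hpt : ∀ r θ : ℝ, 0 < r → (r : ℂ) * (dbar f (z + r * e θ) / (z - (z + r * e θ)))
      = -(G r θ + Complex.I * K r θ) / 2 := by
    intro r θ hr
    have hr' : (r : ℂ) ≠ 0 := by exact_mod_cast hr.ne'
    have h1 : (e θ).re = Real.cos θ := Complex.exp_ofReal_mul_I_re θ
    have h2 : (e θ).im = Real.sin θ := Complex.exp_ofReal_mul_I_im θ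
    have h3 : G r θ + Complex.I * K r θ = 2 * dbar f (z + r * e θ) / e θ := by
      rw [eq_div_iff (hene θ)]
      simp only [hG, hK]
      rw [fderiv_apply_eq f _ (e θ), fderiv_apply_eq f _ (Complex.I * e θ), dbar]
      simp only [Complex.mul_re, Complex.mul_im, Complex.I_re, Complex.I_im, h1, h2]
      generalize fderiv ℝ f (z + r * e θ) 1 = A
      generalize fderiv ℝ f (z + r * e θ) Complex.I = A'
      rw [hecs θ]
      have hcs : (Real.cos θ : ℂ) ^ 2 + (Real.sin θ : ℂ) ^ 2 = 1 := by
        exact_mod_cast Real.cos_sq_add_sin_sq θ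
      have hI := Complex.I_sq
      generalize Real.cos θ = c at *
      generalize Real.sin θ = s at *
      push_cast
      ring_nf
      ring_nf at hI
      simp only [hI]
      linear_combination (A + Complex.I * A') * hcs
    rw [h3]
    have := hene θ
    field_simp
    ring
  have hGint : ∀ θ, ∫ r in (0 : ℝ)..R, G r θ = - f z := by
    intro θ
    have hd : ∀ r : ℝ, HasDerivAt (fun r : ℝ => f (z + r * e θ)) (G r θ) r := by
      intro r
      have h1 : HasDerivAt (fun r : ℝ => z + r * e θ) (e θ) r := by
        simpa using ((Complex.ofRealCLM.hasDerivAt (x := r)).mul_const (e θ)).const_add z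
      exact (hdiff _).hasFDerivAt.comp_hasDerivAt r h1
    rw [intervalIntegral.integral_eq_sub_of_hasDerivAt (fun r _ => hd r)
      ((hGc.comp (Continuous.prodMk continuous_id continuous_const)).intervalIntegrable _ _)]
    have : f (z + R * e θ) = 0 := image_eq_zero_of_notMem_tsupport
      (hzero _ (by simp [henorm, abs_of_pos hR]))
    rw [this]; simp
  have hKint : ∀ r : ℝ, ∫ θ in (-Real.pi)..Real.pi, ((r : ℝ) : ℂ) * K r θ = 0 := by
    intro r
    have hd : ∀ θ : ℝ, HasDerivAt (fun θ : ℝ => f (z + r * e θ)) (r * K r θ) θ := by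
      intro θ
      have h0 : HasDerivAt (fun θ : ℝ => (θ : ℂ) * Complex.I) Complex.I θ := by
        simpa using (Complex.ofRealCLM.hasDerivAt (x := θ)).mul_const Complex.I
      have h1 : HasDerivAt (fun θ : ℝ => z + r * e θ) (r * (e θ * Complex.I)) θ :=
        (h0.cexp.const_mul (r : ℂ)).const_add z
      have := (hdiff (z + r * e θ)).hasFDerivAt.comp_hasDerivAt θ h1
      have key : fderiv ℝ f (z + r * e θ) (r * (e θ * Complex.I)) = r * K r θ := by
        rw [show (r : ℂ) * (e θ * Complex.I) = r • (Complex.I * e θ) by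
          rw [Complex.real_smul]; ring, map_smul, Complex.real_smul]
      rwa [key] at this
    rw [intervalIntegral.integral_eq_sub_of_hasDerivAt (fun r _ => hd r)
      ((continuous_const.mul (hKc.comp (Continuous.prodMk continuous_const continuous_id))).intervalIntegrable _ _)]
    have : e Real.pi = e (-Real.pi) := by rw [hecs, hecs]; simp
    rw [this, sub_self]
  have hKint' : ∀ r : ℝ, 0 < r → ∫ θ in (-Real.pi)..Real.pi, K r θ = 0 := by
    intro r hr
    have := hKint r
    rw [intervalIntegral.integral_const_mul] at this
    exact (mul_eq_zero.1 this).resolve_left (by exact_mod_cast hr.ne')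
  have htrans : ∫ ζ, dbar f ζ / (z - ζ) = ∫ u, dbar f (z + u) / (z - (z + u)) :=
    (integral_add_left_eq_self (fun ζ => dbar f ζ / (z - ζ)) z).symm
  rw [htrans, ← Complex.integral_comp_polarCoord_symm]
  have hset : polarCoord.target = Ioi (0 : ℝ) ×ˢ Ioo (-Real.pi) Real.pi := polarCoord_target
  set H : ℝ × ℝ → ℂ := fun p => -(G p.1 p.2 + Complex.I * K p.1 p.2) / 2 with hH
  have hHc : Continuous H := by
    simp only [hH]
    fun_prop
  have hHzero : ∀ p : ℝ × ℝ, R ≤ p.1 → H p = 0 := by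
    intro p hp
    have : fderiv ℝ f (z + p.1 * e p.2) = 0 := hDzero _ (by
      rw [norm_mul, henorm, mul_one, Complex.norm_real, Real.norm_eq_abs]
      exact hp.trans (le_abs_self _))
    simp [hH, hG, hK, this]
  have e1 : ∫ p in polarCoord.target, p.1 • (dbar f (z + Complex.polarCoord.symm p) /
      (z - (z + Complex.polarCoord.symm p))) = ∫ p in Ioc (0 : ℝ) R ×ˢ Ioc (-Real.pi) Real.pi, H p := by
    have e2 : ∫ p in polarCoord.target, p.1 • (dbar f (z + Complex.polarCoord.symm p) /
      (z - (z + Complex.polarCoord.symm p))) = ∫ p in Ioi (0 : ℝ) ×ˢ Ioo (-Real.pi) Real.pi, H p := by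
      rw [hset]
      refine setIntegral_congr_fun (measurableSet_Ioi.prod measurableSet_Ioo) ?_
      rintro ⟨r, θ⟩ ⟨hr, -⟩
      have h4 : Complex.polarCoord.symm (r, θ) = r * e θ := by
        rw [Complex.polarCoord_symm_apply, hecs]
      simp only [h4, Complex.real_smul]
      exact hpt r θ hr
    rw [e2]
    have e3 : ∫ p in Ioi (0 : ℝ) ×ˢ Ioo (-Real.pi) Real.pi, H p
        = ∫ p in Ioc (0 : ℝ) R ×ˢ Ioo (-Real.pi) Real.pi, H p := by
      refine setIntegral_eq_of_subset_of_forall_sdiff_eq_zero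
        (measurableSet_Ioi.prod measurableSet_Ioo) (Set.prod_mono Ioc_subset_Ioi_self subset_rfl) ?_
      rintro ⟨r, θ⟩ ⟨⟨h1, h2⟩, h3⟩
      apply hHzero
      by_contra hlt
      exact h3 ⟨⟨h1, (not_le.1 hlt).le⟩, h2⟩
    rw [e3]
    refine setIntegral_congr_set ?_
    exact Measure.set_prod_ae_eq (ae_eq_refl _) Ioo_ae_eq_Ioc
  rw [e1]
  have hintg : IntegrableOn H (Ioc (0 : ℝ) R ×ˢ Ioc (-Real.pi) Real.pi) :=
    (hHc.continuousOn.integrableOn_compact (isCompact_Icc.prod isCompact_Icc)).mono_set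
      (prod_mono Ioc_subset_Icc_self Ioc_subset_Icc_self)
  have hpi : -Real.pi ≤ Real.pi := by linarith [Real.pi_pos]
  have hGi : IntegrableOn (fun p : ℝ × ℝ => G p.1 p.2) (Ioc (0 : ℝ) R ×ˢ Ioc (-Real.pi) Real.pi) :=
    (hGc.continuousOn.integrableOn_compact (isCompact_Icc.prod isCompact_Icc)).mono_set
      (prod_mono Ioc_subset_Icc_self Ioc_subset_Icc_self)
  have hKi : IntegrableOn (fun p : ℝ × ℝ => K p.1 p.2) (Ioc (0 : ℝ) R ×ˢ Ioc (-Real.pi) Real.pi) :=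
    (hKc.continuousOn.integrableOn_compact (isCompact_Icc.prod isCompact_Icc)).mono_set
      (prod_mono Ioc_subset_Icc_self Ioc_subset_Icc_self)
  have i1 : ∫ p in Ioc (0 : ℝ) R ×ˢ Ioc (-Real.pi) Real.pi, G p.1 p.2 = 2 * Real.pi * (-f z) := by
    have hGi' : IntegrableOn (fun p : ℝ × ℝ => G p.1 p.2)
      (Ioc (0 : ℝ) R ×ˢ Ioc (-Real.pi) Real.pi) (volume.prod volume) := hGi
    have := setIntegral_prod_swap (μ := volume) (ν := volume) (Ioc (0 : ℝ) R)
      (Ioc (-Real.pi) Real.pi) (fun p : ℝ × ℝ => G p.1 p.2)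
    rw [Measure.volume_eq_prod, ← this, setIntegral_prod]
    · simp only [Prod.fst_swap, Prod.snd_swap]
      have : ∀ θ : ℝ, ∫ r in Ioc 0 R, G r θ = - f z := fun θ => by
        rw [← intervalIntegral.integral_of_le hR.le, hGint]
      simp only [this]
      rw [setIntegral_const]
      simp
      left
      rw [max_eq_left (by positivity)]; push_cast; ring
    · exact hGi'.swap
  have i2 : ∫ p in Ioc (0 : ℝ) R ×ˢ Ioc (-Real.pi) Real.pi, K p.1 p.2 = 0 := by
    rw [Measure.volume_eq_prod, setIntegral_prod _ hKi]
    rw [setIntegral_eq_zero_of_forall_eq_zero]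
    intro r hr
    rw [← intervalIntegral.integral_of_le hpi, hKint' r hr.1]
  calc ∫ p in Ioc (0 : ℝ) R ×ˢ Ioc (-Real.pi) Real.pi, H p
      = ∫ p in Ioc (0 : ℝ) R ×ˢ Ioc (-Real.pi) Real.pi,
        ((-1 / 2 : ℂ) * G p.1 p.2 + (-Complex.I / 2) * K p.1 p.2) := by
        congr 1; ext p; simp only [hH]; ring
    _ = _ := by
        rw [integral_add (hGi.const_mul _) (hKi.const_mul _), integral_const_mul,
          integral_const_mul, i1, i2]
        ring

lemma measure_setOf_cdf_le (μ : Measure ℝ) [IsFiniteMeasure μ] (u : ℝ) :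
    μ {t | μ.real (Iic t) ≤ u} ≤ ENNReal.ofReal u := by
  have hmono : Monotone fun t => μ.real (Iic t) := fun s t hst =>
    measureReal_mono (Iic_subset_Iic.2 hst)
  have hmeas : MeasurableSet {t | μ.real (Iic t) ≤ u} :=
    measurableSet_le hmono.measurable measurable_const
  rw [hmeas.measure_eq_iSup_isCompact]
  refine iSup_le fun K => iSup_le fun hK => iSup_le fun hKc => ?_
  rcases K.eq_empty_or_nonempty with rfl | hne
  · simp
  obtain ⟨m, hmK, hm⟩ := hKc.exists_isMaxOn hne continuousOn_id
  calc μ K ≤ μ (Iic m) := measure_mono fun x hx => hm hx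
    _ = ENNReal.ofReal (μ.real (Iic m)) := by rw [ofReal_measureReal]
    _ ≤ _ := ENNReal.ofReal_le_ofReal (hK hmK)

lemma lintegral_exp_neg_cdf_le_one (μ : Measure ℝ) [IsFiniteMeasure μ] :
    ∫⁻ t, ENNReal.ofReal (Real.exp (-μ.real (Iic t))) ∂μ ≤ 1 := by
  have hmono : Monotone fun t => μ.real (Iic t) := fun s t hst =>
    measureReal_mono (Iic_subset_Iic.2 hst)
  have h1 : ∀ F : ℝ, ENNReal.ofReal (Real.exp (-F)) =
      ∫⁻ u in Ioi F, ENNReal.ofReal (Real.exp (-u)) := by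
    intro F
    rw [← ofReal_integral_eq_lintegral_ofReal (integrableOn_exp_neg_Ioi F)
      (Eventually.of_forall fun u => (Real.exp_pos _).le), integral_exp_neg_Ioi]
  have h2 : ∀ t : ℝ, ENNReal.ofReal (Real.exp (-μ.real (Iic t))) =
      ∫⁻ u, {p : ℝ × ℝ | μ.real (Iic p.1) < p.2}.indicator
        (fun p => ENNReal.ofReal (Real.exp (-p.2))) (t, u) := by
    intro t
    rw [h1, ← lintegral_indicator measurableSet_Ioi]
    rfl
  have hset : MeasurableSet {p : ℝ × ℝ | μ.real (Iic p.1) < p.2} :=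
    measurableSet_lt (hmono.measurable.comp measurable_fst) measurable_snd
  simp_rw [h2]
  rw [lintegral_lintegral_swap]
  swap
  · refine Measurable.aemeasurable ?_
    exact (by fun_prop : Measurable fun p : ℝ × ℝ => ENNReal.ofReal (Real.exp (-p.2))).indicator hset
  calc ∫⁻ u, ∫⁻ t, {p : ℝ × ℝ | μ.real (Iic p.1) < p.2}.indicator
        (fun p => ENNReal.ofReal (Real.exp (-p.2))) (t, u) ∂μ
      ≤ ∫⁻ u, (Ioi (0:ℝ)).indicator (fun u => ENNReal.ofReal (Real.exp (-u) * u)) u := by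
        refine lintegral_mono fun u => ?_
        have e1 : ∀ t, {p : ℝ × ℝ | μ.real (Iic p.1) < p.2}.indicator
          (fun p => ENNReal.ofReal (Real.exp (-p.2))) (t, u) =
          {t | μ.real (Iic t) < u}.indicator (fun _ => ENNReal.ofReal (Real.exp (-u))) t :=
          fun t => rfl
        simp_rw [e1]
        rw [lintegral_indicator_const (measurableSet_lt hmono.measurable measurable_const)]
        by_cases hu : 0 < u
        · rw [indicator_of_mem (by exact hu), ENNReal.ofReal_mul (Real.exp_pos _).le]
          gcongr
          exact (measure_mono fun t (ht : μ.real (Iic t) < u) => show t ∈ {t | μ.real (Iic t) ≤ u} from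
            ht.le).trans (measure_setOf_cdf_le μ u)
        · have : {t | μ.real (Iic t) < u} = ∅ := by
            ext t
            simp only [mem_ofPred_eq, mem_empty_iff_false, iff_false, not_lt]
            exact (not_lt.1 hu).trans measureReal_nonneg
          rw [this]; simp
    _ = ENNReal.ofReal (∫ u in Ioi (0:ℝ), Real.exp (-u) * u) := by
        rw [lintegral_indicator measurableSet_Ioi, ofReal_integral_eq_lintegral_ofReal]
        · have := Real.GammaIntegral_convergent (s := 2) (by norm_num)
          refine this.congr_fun (fun u hu => ?_) measurableSet_Ioi
          norm_num
        · refine (ae_restrict_iff' measurableSet_Ioi).2 (Eventually.of_forall fun u hu => ?_)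
          exact mul_nonneg (Real.exp_pos _).le (le_of_lt hu)
    _ ≤ 1 := by
        have := Real.Gamma_eq_integral (s := 2) (by norm_num)
        rw [Real.Gamma_two] at this
        have e : ∫ u in Ioi (0:ℝ), Real.exp (-u) * u = 1 := by
          rw [this]
          refine setIntegral_congr_fun measurableSet_Ioi fun u hu => ?_
          norm_num
        rw [e]; simp

/-- Exponential decay against a cumulative distribution integrates to at most one. -/
lemma lintegral_exp_neg_measure_le_one {α : Type*} [MeasurableSpace α] (ν : Measure α)
    [IsFiniteMeasure ν] {φ : α → ℝ} (hφ : Measurable φ) :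
    ∫⁻ x, ENNReal.ofReal (Real.exp (-ν.real {y | φ y ≤ φ x})) ∂ν ≤ 1 := by
  have h := lintegral_exp_neg_cdf_le_one (ν.map φ)
  have hmono : Monotone fun t => (ν.map φ).real (Iic t) := fun s t hst =>
    measureReal_mono (Iic_subset_Iic.2 hst)
  have hm : Measurable fun t => ENNReal.ofReal (Real.exp (-(ν.map φ).real (Iic t))) :=
    (hmono.measurable.neg.exp).ennreal_ofReal
  rw [lintegral_map hm hφ] at h
  refine le_of_eq_of_le (lintegral_congr fun x => ?_) h
  rw [map_measureReal_apply hφ measurableSet_Iic]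
  rfl

lemma lintegral_ball_inv_norm (z : ℂ) {r : ℝ} (hr : 0 ≤ r) :
    ∫⁻ ζ in Metric.ball z r, ENNReal.ofReal (1 / ‖z - ζ‖) ≤ ENNReal.ofReal (2 * Real.pi * r) := by
  have e1 : ∫⁻ ζ in Metric.ball z r, ENNReal.ofReal (1 / ‖z - ζ‖) =
      ∫⁻ ζ, (Metric.ball (0 : ℂ) r).indicator (fun u => ENNReal.ofReal (1 / ‖u‖)) ζ := by
    rw [← lintegral_indicator Metric.isOpen_ball.measurableSet,
      ← lintegral_sub_left_eq_self _ z]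
    congr 1; ext ζ
    simp only [indicator, Metric.mem_ball, dist_eq_norm, sub_zero, sub_sub_cancel]
    congr 1
    · rw [show z - ζ - z = -ζ by ring, norm_neg]
  rw [e1, ← Complex.lintegral_comp_polarCoord_symm, polarCoord_target]
  calc ∫⁻ p in Ioi (0:ℝ) ×ˢ Ioo (-Real.pi) Real.pi, ENNReal.ofReal p.1 •
        (Metric.ball (0 : ℂ) r).indicator (fun u => ENNReal.ofReal (1 / ‖u‖))
          (Complex.polarCoord.symm p)
      = ∫⁻ p in Ioi (0:ℝ) ×ˢ Ioo (-Real.pi) Real.pi,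
          (Iio r ×ˢ univ).indicator (fun _ => 1) p := by
        refine setLIntegral_congr_fun (measurableSet_Ioi.prod measurableSet_Ioo) ?_
        rintro ⟨s, θ⟩ ⟨hs : 0 < s, -⟩
        have hn : ‖Complex.polarCoord.symm (s, θ)‖ = s := by
          rw [Complex.norm_polarCoord_symm, abs_of_pos hs]
        by_cases h : s < r
        · simp only [smul_eq_mul]
          rw [indicator_of_mem, indicator_of_mem, hn, ← ENNReal.ofReal_mul hs.le]
          · rw [mul_one_div_cancel hs.ne', ENNReal.ofReal_one]
          · exact ⟨h, trivial⟩
          · simpa using hn.trans_lt h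
        · simp only [smul_eq_mul]
          rw [indicator_of_notMem, indicator_of_notMem, mul_zero]
          · exact fun hh => h hh.1
          · simpa [hn, abs_of_pos hs] using h
    _ = volume ((Iio r ×ˢ univ) ∩ (Ioi (0:ℝ) ×ˢ Ioo (-Real.pi) Real.pi)) := by
        rw [lintegral_indicator_const (measurableSet_Iio.prod MeasurableSet.univ), one_mul,
          Measure.restrict_apply (measurableSet_Iio.prod MeasurableSet.univ)]
    _ ≤ volume (Ioo 0 r ×ˢ Ioo (-Real.pi) Real.pi) :=
        measure_mono fun p hp => ⟨⟨hp.2.1, hp.1.1⟩, hp.2.2⟩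
    _ = _ := by
        rw [Measure.volume_eq_prod, Measure.prod_prod, Real.volume_Ioo, Real.volume_Ioo,
          ← ENNReal.ofReal_mul (by linarith)]
        congr 1; ring

end

section
open MeasureTheory Set Filter Topology ComplexConjugate

lemma im_add_im_le_norm_sub_conj (z ω : ℂ) : z.im + ω.im ≤ ‖z - conj ω‖ := by
  have := Complex.abs_im_le_norm (z - conj ω)
  simp at this
  exact (le_abs_self _).trans this

lemma norm_sub_conj_symm (z ω : ℂ) : ‖z - conj ω‖ = ‖ω - conj z‖ := by
  rw [← Complex.norm_conj (z - conj ω)]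
  simp [norm_sub_rev]

lemma sub_conj_ne_zero {z ω : ℂ} (hz : 0 < z.im) (hω : 0 < ω.im) : z - conj ω ≠ 0 := by
  have := im_add_im_le_norm_sub_conj z ω
  exact norm_pos_iff.1 (by linarith)

lemma re_I_div (w : ℂ) : (Complex.I / w).re = w.im / ‖w‖ ^ 2 := by
  rw [Complex.div_re, Complex.sq_norm]; simp

/-- The exponent in Jones' kernel. -/
noncomputable def jonesX (g : ℂ → ℂ) (z ζ : ℂ) : ℂ :=
  ∫ ω, {ω : ℂ | ω.im ≤ ζ.im}.indicator (fun ω => Complex.I / (z - conj ω) * ‖g ω‖) ω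

/-- Jones' kernel. -/
noncomputable def jonesE (g : ℂ → ℂ) (z ζ : ℂ) : ℂ :=
  Complex.exp (-(jonesX g z ζ - jonesX g ζ ζ)) * (2 * Complex.I * ζ.im / (z - conj ζ))

/-- Jones' bounded solution of `∂̄ w = g`. -/
noncomputable def jonesSol (g : ℂ → ℂ) (z : ℂ) : ℂ :=
  (1 / Real.pi : ℂ) * ∫ ζ, g ζ * jonesE g z ζ / (z - ζ)

/-- Data for which Jones' construction yields a bounded solution. -/
structure JonesDatum (g : ℂ → ℂ) (C : ℝ) : Prop where
  cont : Continuous g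
  cpt : HasCompactSupport g
  supp : tsupport g ⊆ UH
  bound : ∀ ζ ∈ UH, ‖g ζ‖ ≤ C / ζ.im
  carleson : ∀ ζ ∈ UH, ∫ ω, ζ.im / ‖ω - conj ζ‖ ^ 2 * ‖g ω‖ ≤ C

namespace JonesDatum
variable {g : ℂ → ℂ} {C : ℝ} (h : JonesDatum g C)
include h

lemma exists_im_lower : ∃ η : ℝ, 0 < η ∧ ∀ ω, g ω ≠ 0 → η ≤ ω.im := by
  rcases (tsupport g).eq_empty_or_nonempty with he | hne
  · refine ⟨1, one_pos, fun ω hω => ?_⟩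
    have := subset_tsupport g hω
    rw [he] at this; exact this.elim
  · obtain ⟨m, hm, hmin⟩ := h.cpt.isCompact.exists_isMinOn hne Complex.continuous_im.continuousOn
    exact ⟨m.im, h.supp hm, fun ω hω => hmin (subset_tsupport g hω)⟩

lemma eq_zero_of_notMem {ω : ℂ} (hω : ω ∉ UH) : g ω = 0 :=
  image_eq_zero_of_notMem_tsupport fun hh => hω (h.supp hh)

lemma integrable_norm : Integrable fun ω => ‖g ω‖ :=
  (h.cont.norm.integrable_of_hasCompactSupport h.cpt.norm)

omit h in
lemma norm_jonesX_integrand_le {η : ℝ} (hη : 0 < η) (hη' : ∀ ω, g ω ≠ 0 → η ≤ ω.im) {z : ℂ}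
    (hz : z ∈ UH) (ζ ω : ℂ) :
    ‖{ω : ℂ | ω.im ≤ ζ.im}.indicator (fun ω => Complex.I / (z - conj ω) * ‖g ω‖) ω‖
      ≤ 1 / η * ‖g ω‖ := by
  refine (norm_indicator_le_norm_self _ _).trans ?_
  by_cases hg : g ω = 0
  · simp [hg]
  rw [norm_mul, norm_div, Complex.norm_I, Complex.norm_real, norm_norm]
  gcongr
  have := im_add_im_le_norm_sub_conj z ω
  have h1 : 0 < z.im := hz
  linarith [hη' ω hg]

omit h in
lemma measurableSet_im_le (ζ : ℂ) : MeasurableSet {ω : ℂ | ω.im ≤ ζ.im} :=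
  measurableSet_le Complex.measurable_im measurable_const

lemma measurable_uncurry_integrand :
    Measurable fun p : (ℂ × ℂ) × ℂ => {ω : ℂ | ω.im ≤ p.1.2.im}.indicator
      (fun ω => Complex.I / (p.1.1 - conj ω) * (‖g ω‖ : ℂ)) p.2 := by
  have hs : MeasurableSet {p : (ℂ × ℂ) × ℂ | p.2.im ≤ p.1.2.im} :=
    measurableSet_le (by fun_prop) (by fun_prop)
  have hg := h.cont.measurable
  have hf : Measurable fun p : (ℂ × ℂ) × ℂ => Complex.I / (p.1.1 - conj p.2) * (‖g p.2‖ : ℂ) := by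
    have : Measurable (fun ω : ℂ => conj ω) := Complex.continuous_conj.measurable
    fun_prop
  exact hf.indicator hs

lemma measurable_jonesX : Measurable fun p : ℂ × ℂ => jonesX g p.1 p.2 := by
  have := h.measurable_uncurry_integrand.stronglyMeasurable.integral_prod_right' (ν := volume)
  exact this.measurable

lemma measurable_jonesE : Measurable fun p : ℂ × ℂ => jonesE g p.1 p.2 := by
  have h1 := h.measurable_jonesX
  have h2 : Measurable fun p : ℂ × ℂ => jonesX g p.2 p.2 :=
    h1.comp (measurable_snd.prodMk measurable_snd)
  have : Measurable (fun ω : ℂ => conj ω) := Complex.continuous_conj.measurable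
  unfold jonesE
  fun_prop

lemma integrable_jonesX_integrand {z : ℂ} (hz : z ∈ UH) (ζ : ℂ) :
    Integrable ({ω : ℂ | ω.im ≤ ζ.im}.indicator
      (fun ω => Complex.I / (z - conj ω) * (‖g ω‖ : ℂ))) := by
  obtain ⟨η, hη, hη'⟩ := h.exists_im_lower
  refine (h.integrable_norm.const_mul (1 / η)).mono' ?_
    (Eventually.of_forall fun ω => norm_jonesX_integrand_le hη hη' hz ζ ω)
  exact (h.measurable_uncurry_integrand.comp
    (measurable_const.prodMk measurable_id : Measurable fun ω : ℂ => ((z, ζ), ω))).aestronglyMeasurable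

lemma differentiableOn_jonesX (ζ : ℂ) : DifferentiableOn ℂ (fun z => jonesX g z ζ) UH := by
  obtain ⟨η, hη, hη'⟩ := h.exists_im_lower
  refine differentiableOn_integral_of_dominated isOpen_UH
    (fun z hz => (h.integrable_jonesX_integrand hz ζ).aestronglyMeasurable)
    (Eventually.of_forall fun ω => ?_)
    (Eventually.of_forall fun ω z hz => norm_jonesX_integrand_le hη hη' hz ζ ω)
    (h.integrable_norm.const_mul (1 / η))
  by_cases hω : ω.im ≤ ζ.im
  · simp only [indicator, mem_ofPred_eq, hω, if_true]
    by_cases hg : g ω = 0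
    · simp [hg]
    · intro z hz
      have : z - conj ω ≠ 0 := sub_conj_ne_zero hz (hη.trans_le (hη' ω hg))
      fun_prop (disch := assumption)
  · simp [indicator, hω]

lemma differentiableOn_jonesE {ζ : ℂ} (hζ : ζ ∈ UH) :
    DifferentiableOn ℂ (fun z => jonesE g z ζ) UH := by
  have h1 := h.differentiableOn_jonesX ζ
  unfold jonesE
  refine DifferentiableOn.mul ?_ ?_
  · exact ((h1.sub_const _).neg).cexp
  · intro z hz
    have : z - conj ζ ≠ 0 := sub_conj_ne_zero hz hζ
    fun_prop (disch := assumption)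

omit h in
lemma jonesE_self {ζ : ℂ} (hζ : ζ ∈ UH) : jonesE g ζ ζ = 1 := by
  have h1 : ζ - conj ζ ≠ 0 := sub_conj_ne_zero hζ hζ
  have h2 : ζ - conj ζ = 2 * Complex.I * ζ.im := by
    rw [Complex.sub_conj]; push_cast; ring
  rw [jonesE, ← h2, div_self h1]; simp

lemma re_jonesX {z : ℂ} (hz : z ∈ UH) (ζ : ℂ) : (jonesX g z ζ).re =
    ∫ ω, {ω : ℂ | ω.im ≤ ζ.im}.indicator
      (fun ω => (z.im + ω.im) / ‖z - conj ω‖ ^ 2 * ‖g ω‖) ω := by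
  have := integral_re (h.integrable_jonesX_integrand hz ζ)
  simp only [RCLike.re_eq_complex_re] at this
  rw [jonesX, ← this]
  congr 1; ext ω
  simp only [indicator]
  split_ifs
  · rw [Complex.re_mul_ofReal, re_I_div]; simp
  · simp

lemma integrable_re {z : ℂ} (hz : z ∈ UH) (ζ : ℂ) : Integrable ({ω : ℂ | ω.im ≤ ζ.im}.indicator
      (fun ω => (z.im + ω.im) / ‖z - conj ω‖ ^ 2 * ‖g ω‖)) := by
  refine (h.integrable_jonesX_integrand hz ζ).re.congr (Eventually.of_forall fun ω => ?_)
  simp only [indicator, RCLike.re_eq_complex_re]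
  split_ifs
  · rw [Complex.re_mul_ofReal, re_I_div]; simp
  · simp

/-- The density of the Carleson measure seen from `z`. -/
lemma integrable_carleson {z : ℂ} (hz : z ∈ UH) :
    Integrable fun ω => z.im / ‖ω - conj z‖ ^ 2 * ‖g ω‖ := by
  have hz' : 0 < z.im := hz
  have hg := h.cont.measurable
  refine (h.integrable_norm.const_mul (z.im / z.im ^ 2)).mono' ?_ (Eventually.of_forall fun ω => ?_)
  · exact Measurable.aestronglyMeasurable (by fun_prop)
  · by_cases hω : ω ∈ UH
    · rw [norm_mul, norm_div, norm_norm, Real.norm_of_nonneg hz'.le, norm_pow, norm_norm]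
      have := im_add_im_le_norm_sub_conj ω z
      have h2 : 0 < ω.im := hω
      gcongr
      linarith
    · simp [h.eq_zero_of_notMem hω]

lemma integrable_im {z : ℂ} (hz : z ∈ UH) :
    Integrable fun ω => ω.im / ‖z - conj ω‖ ^ 2 * ‖g ω‖ := by
  have hz' : 0 < z.im := hz
  have hg := h.cont.measurable
  have : Measurable (fun ω : ℂ => conj ω) := Complex.continuous_conj.measurable
  refine (h.integrable_norm.const_mul (1 / z.im)).mono' ?_ (Eventually.of_forall fun ω => ?_)
  · exact Measurable.aestronglyMeasurable (by fun_prop)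
  · by_cases hω : ω ∈ UH
    · have h1 := im_add_im_le_norm_sub_conj z ω
      have h2 : 0 < ω.im := hω
      have h3 : 0 < ‖z - conj ω‖ := by linarith
      rw [norm_mul, norm_div, norm_norm, Real.norm_of_nonneg h2.le, norm_pow, norm_norm]
      refine mul_le_mul_of_nonneg_right ?_ (norm_nonneg _)
      rw [div_le_div_iff₀ (by positivity) hz']
      nlinarith
    · simp [h.eq_zero_of_notMem hω]

lemma nonneg : 0 ≤ C := by
  have := h.bound Complex.I (by simp [UH])
  simp at this
  exact (norm_nonneg _).trans this

lemma re_jonesX_self_le {ζ : ℂ} (hζ : ζ ∈ UH) : (jonesX g ζ ζ).re ≤ 2 * C := by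
  rw [h.re_jonesX hζ]
  have hζ' : 0 < ζ.im := hζ
  calc _ ≤ ∫ ω, 2 * (ζ.im / ‖ω - conj ζ‖ ^ 2 * ‖g ω‖) := by
        refine integral_mono (h.integrable_re hζ ζ) ((h.integrable_carleson hζ).const_mul 2)
          fun ω => ?_
        simp only [indicator]
        split_ifs with hω
        · rw [norm_sub_conj_symm ζ ω, ← mul_assoc]
          gcongr
          rw [← mul_div_assoc]
          gcongr
          have : ω.im ≤ ζ.im := hω
          linarith
        · positivity
    _ ≤ _ := by
        rw [integral_const_mul]
        linarith [h.carleson ζ hζ]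

lemma indicator_le_re_jonesX {z : ℂ} (hz : z ∈ UH) (ζ : ℂ) :
    ∫ ω in {ω : ℂ | ω.im ≤ ζ.im}, ω.im / ‖z - conj ω‖ ^ 2 * ‖g ω‖ ≤ (jonesX g z ζ).re := by
  rw [h.re_jonesX hz, ← integral_indicator (measurableSet_im_le ζ)]
  refine integral_mono ((h.integrable_im hz).indicator (measurableSet_im_le ζ))
    (h.integrable_re hz ζ) fun ω => ?_
  simp only [indicator]
  split_ifs
  · have : 0 < z.im := hz
    gcongr
    linarith
  · exact le_rfl

lemma norm_jonesE_le_exp {z ζ : ℂ} (hζ : ζ ∈ UH) :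
    ‖jonesE g z ζ‖ ≤ Real.exp (2 * C) * (Real.exp (-(jonesX g z ζ).re) *
      (2 * ζ.im / ‖z - conj ζ‖)) := by
  have hζ' : 0 < ζ.im := hζ
  rw [jonesE, norm_mul, Complex.norm_exp, ← mul_assoc, ← Real.exp_add]
  gcongr
  · simp only [Complex.neg_re, Complex.sub_re]
    linarith [h.re_jonesX_self_le hζ]
  · rw [norm_div, norm_mul, norm_mul, Complex.norm_real, Real.norm_of_nonneg hζ'.le]
    simp

lemma re_jonesX_nonneg {z : ℂ} (hz : z ∈ UH) (ζ : ℂ) : 0 ≤ (jonesX g z ζ).re := by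
  refine le_trans (integral_nonneg fun ω => ?_) (h.indicator_le_re_jonesX hz ζ)
  by_cases hω : ω ∈ UH
  · have : 0 < ω.im := hω
    positivity
  · simp [h.eq_zero_of_notMem hω]

lemma norm_jonesE_le {z ζ : ℂ} (hz : z ∈ UH) (hζ : ζ ∈ UH) :
    ‖jonesE g z ζ‖ ≤ 2 * Real.exp (2 * C) := by
  have hζ' : 0 < ζ.im := hζ
  have hz' : 0 < z.im := hz
  refine (h.norm_jonesE_le_exp hζ).trans ?_
  rw [mul_comm]
  gcongr
  have h1 : Real.exp (-(jonesX g z ζ).re) ≤ 1 := Real.exp_le_one_iff.2 (by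
    linarith [h.re_jonesX_nonneg hz ζ])
  have h2 : 2 * ζ.im / ‖z - conj ζ‖ ≤ 2 := by
    have := im_add_im_le_norm_sub_conj z ζ
    rw [div_le_iff₀ (by linarith)]
    linarith
  calc _ ≤ 1 * (2 : ℝ) := by gcongr
    _ = 2 := one_mul _

end JonesDatum

namespace JonesDatum
variable {g : ℂ → ℂ} {C : ℝ} (h : JonesDatum g C)
include h

lemma lintegral_near_le {z : ℂ} (hz : z ∈ UH) :
    ∫⁻ ζ in Metric.ball z (z.im / 2), ENNReal.ofReal ‖g ζ * jonesE g z ζ / (z - ζ)‖ ≤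
      ENNReal.ofReal (4 * Real.pi * C * Real.exp (2 * C)) := by
  have hz' : 0 < z.im := hz
  have hC := h.nonneg
  calc _ ≤ ∫⁻ ζ in Metric.ball z (z.im / 2), ENNReal.ofReal (4 * C * Real.exp (2 * C) / z.im) *
        ENNReal.ofReal (1 / ‖z - ζ‖) := by
        refine setLIntegral_mono' Metric.isOpen_ball.measurableSet fun ζ hζ => ?_
        rw [← ENNReal.ofReal_mul (by positivity)]
        apply ENNReal.ofReal_le_ofReal
        rw [Metric.mem_ball, dist_eq_norm] at hζ
        have h1 := Complex.abs_im_le_norm (ζ - z)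
        rw [Complex.sub_im] at h1
        have h2 := (abs_lt.1 (h1.trans_lt hζ)).1
        have h3 : 0 < ζ.im := by linarith
        have hb := h.bound ζ h3
        have hE := h.norm_jonesE_le hz h3
        rw [norm_div, norm_mul, div_eq_mul_one_div]
        gcongr
        calc _ ≤ C / ζ.im * (2 * Real.exp (2 * C)) := by gcongr
          _ ≤ C / (z.im / 2) * (2 * Real.exp (2 * C)) := by
            gcongr
            linarith
          _ = _ := by field_simp; ring
    _ ≤ ENNReal.ofReal (4 * C * Real.exp (2 * C) / z.im) * ENNReal.ofReal (2 * Real.pi * (z.im / 2)) := by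
        rw [lintegral_const_mul _ (by fun_prop)]
        gcongr
        exact lintegral_ball_inv_norm z (by linarith)
    _ = _ := by
        rw [← ENNReal.ofReal_mul (by positivity)]
        congr 1
        field_simp

lemma lintegral_far_le {z : ℂ} (hz : z ∈ UH) :
    ∫⁻ ζ in (Metric.ball z (z.im / 2))ᶜ, ENNReal.ofReal ‖g ζ * jonesE g z ζ / (z - ζ)‖ ≤
      ENNReal.ofReal (14 * Real.exp (2 * C)) := by
  have hz' : 0 < z.im := hz
  have hC := h.nonneg
  set p : ℂ → ℝ := fun ω => ω.im / ‖z - conj ω‖ ^ 2 * ‖g ω‖ with hp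
  have hpm : Measurable p := by
    have hg := h.cont.measurable
    have : Measurable (fun ω : ℂ => conj ω) := Complex.continuous_conj.measurable
    fun_prop
  have hp0 : ∀ ω, 0 ≤ p ω := by
    intro ω
    by_cases hω : ω ∈ UH
    · have : 0 < ω.im := hω
      positivity
    · simp [hp, h.eq_zero_of_notMem hω]
  have hpi : Integrable p := h.integrable_im hz
  set ν : Measure ℂ := volume.withDensity fun ω => ENNReal.ofReal (p ω) with hν
  have : IsFiniteMeasure ν := isFiniteMeasure_withDensity_ofReal hpi.2
  have hνr : ∀ ζ : ℂ, ν.real {ω | ω.im ≤ ζ.im} = ∫ ω in {ω : ℂ | ω.im ≤ ζ.im}, p ω := by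
    intro ζ
    rw [measureReal_def, hν, withDensity_apply _ (measurableSet_im_le ζ),
      integral_eq_lintegral_of_nonneg_ae (Eventually.of_forall hp0) hpm.aestronglyMeasurable]
  have hbd := lintegral_exp_neg_measure_le_one ν Complex.measurable_im
  have hmono : Monotone fun t : ℝ => ν.real {ω | ω.im ≤ t} := fun s t hst =>
    measureReal_mono fun ω (hω : ω.im ≤ s) => le_trans hω hst
  have hem : Measurable fun ζ : ℂ => ENNReal.ofReal (Real.exp (-ν.real {ω | ω.im ≤ ζ.im})) :=
    ((hmono.measurable.comp Complex.measurable_im).neg.exp).ennreal_ofReal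
  calc _ ≤ ∫⁻ ζ in (Metric.ball z (z.im / 2))ᶜ, ENNReal.ofReal (14 * Real.exp (2 * C)) *
        (ENNReal.ofReal (p ζ) * ENNReal.ofReal (Real.exp (-ν.real {ω | ω.im ≤ ζ.im}))) := by
        refine setLIntegral_mono' Metric.isOpen_ball.measurableSet.compl fun ζ hζ => ?_
        rw [← ENNReal.ofReal_mul (hp0 ζ), ← ENNReal.ofReal_mul (by positivity)]
        apply ENNReal.ofReal_le_ofReal
        by_cases hζU : ζ ∈ UH
        swap
        · simp only [h.eq_zero_of_notMem hζU]
          have := hp0 ζ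
          simp only [zero_mul, zero_div, norm_zero]
          positivity
        have hζ' : 0 < ζ.im := hζU
        rw [mem_compl_iff, Metric.mem_ball, dist_eq_norm, not_lt, norm_sub_rev] at hζ
        have hE := h.norm_jonesE_le_exp (z := z) hζU
        have hX := h.indicator_le_re_jonesX hz ζ
        rw [hνr]
        have hX' : Real.exp (-(jonesX g z ζ).re) ≤
            Real.exp (-∫ ω in {ω : ℂ | ω.im ≤ ζ.im}, p ω) := Real.exp_le_exp.2 (neg_le_neg hX)
        have h7 : ‖z - conj ζ‖ ≤ 7 * ‖z - ζ‖ := by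
          have e1 : z - conj ζ = (z - ζ) + 2 * Complex.I * ζ.im := by
            have := Complex.sub_conj ζ
            push_cast at this
            linear_combination this
          have e2 : ‖(2 * Complex.I * ζ.im : ℂ)‖ = 2 * ζ.im := by
            rw [norm_mul, norm_mul, Complex.norm_real, Real.norm_of_nonneg hζ'.le]; simp
          have e3 : ζ.im ≤ z.im + ‖z - ζ‖ := by
            have := Complex.abs_im_le_norm (z - ζ)
            rw [Complex.sub_im] at this
            linarith [(abs_le.1 this).1]
          rw [e1]
          refine (norm_add_le _ _).trans ?_
          rw [e2]
          linarith
        have hn : 0 < ‖z - conj ζ‖ := by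
          have := im_add_im_le_norm_sub_conj z ζ
          linarith
        have hn2 : 0 < ‖z - ζ‖ := by linarith
        have hinv : 1 / ‖z - ζ‖ ≤ 7 / ‖z - conj ζ‖ := by
          rw [div_le_div_iff₀ hn2 hn]; linarith
        rw [norm_div, norm_mul, div_eq_mul_one_div]
        calc ‖g ζ‖ * ‖jonesE g z ζ‖ * (1 / ‖z - ζ‖) ≤ ‖g ζ‖ * (Real.exp (2 * C) *
              (Real.exp (-∫ ω in {ω : ℂ | ω.im ≤ ζ.im}, p ω) *
                (2 * ζ.im / ‖z - conj ζ‖))) * (7 / ‖z - conj ζ‖) := by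
              gcongr
              refine hE.trans ?_
              gcongr
          _ = _ := by
              simp only [hp]
              field_simp
              ring
    _ ≤ ∫⁻ ζ, ENNReal.ofReal (14 * Real.exp (2 * C)) *
        (ENNReal.ofReal (p ζ) * ENNReal.ofReal (Real.exp (-ν.real {ω | ω.im ≤ ζ.im}))) :=
        setLIntegral_le_lintegral _ _
    _ = ENNReal.ofReal (14 * Real.exp (2 * C)) *
        ∫⁻ ζ, ENNReal.ofReal (Real.exp (-ν.real {ω | ω.im ≤ ζ.im})) ∂ν := by
        have e := lintegral_const_mul (μ := volume) (ENNReal.ofReal (14 * Real.exp (2 * C)))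
          (hpm.ennreal_ofReal.mul hem)
        simp only [Pi.mul_apply] at e
        rw [e, lintegral_withDensity_eq_lintegral_mul _ hpm.ennreal_ofReal hem]
        rfl
    _ ≤ _ := by
        calc _ ≤ ENNReal.ofReal (14 * Real.exp (2 * C)) * 1 := by gcongr
          _ = _ := mul_one _

lemma lintegral_le {z : ℂ} (hz : z ∈ UH) :
    ∫⁻ ζ, ENNReal.ofReal ‖g ζ * jonesE g z ζ / (z - ζ)‖ ≤
      ENNReal.ofReal ((4 * Real.pi * C + 14) * Real.exp (2 * C)) := by
  have hC := h.nonneg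
  have hpi := Real.pi_pos
  rw [← lintegral_add_compl _ (Metric.isOpen_ball (x := z) (ε := z.im / 2)).measurableSet]
  refine (add_le_add (h.lintegral_near_le hz) (h.lintegral_far_le hz)).trans ?_
  rw [← ENNReal.ofReal_add (by positivity) (by positivity)]
  exact ENNReal.ofReal_le_ofReal (by linarith)

lemma integrable_jonesSol {z : ℂ} (hz : z ∈ UH) :
    Integrable fun ζ => g ζ * jonesE g z ζ / (z - ζ) := by
  refine ⟨?_, ?_⟩
  · have h0 : Measurable fun ζ : ℂ => (z, ζ) := measurable_const.prodMk measurable_id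
    have h1 : Measurable fun ζ => jonesE g z ζ := by
      have := Measurable.comp h.measurable_jonesE h0
      simp only [Function.comp_def] at this
      exact this
    have h2 := h.cont.measurable
    have h3 : Measurable fun ζ : ℂ => z - ζ := measurable_const.sub measurable_id
    exact ((h2.mul h1).div h3).aestronglyMeasurable
  · rw [hasFiniteIntegral_iff_norm]
    exact (h.lintegral_le hz).trans_lt ENNReal.ofReal_lt_top

lemma norm_jonesSol_le {z : ℂ} (hz : z ∈ UH) :
    ‖jonesSol g z‖ ≤ (4 * Real.pi * C + 14) * Real.exp (2 * C) := by
  have hC := h.nonneg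
  have hpi := Real.pi_pos
  have h1 : ‖∫ ζ, g ζ * jonesE g z ζ / (z - ζ)‖ ≤ (4 * Real.pi * C + 14) * Real.exp (2 * C) :=
    (norm_integral_le_lintegral_norm _).trans (ENNReal.toReal_le_of_le_ofReal (by positivity)
      (h.lintegral_le hz))
  have h2 : ‖(1 / Real.pi : ℂ)‖ ≤ 1 := by
    rw [norm_div, norm_one, Complex.norm_real, Real.norm_of_nonneg hpi.le, div_le_one hpi]
    linarith [Real.pi_gt_three]
  rw [jonesSol, norm_mul]
  calc _ ≤ 1 * ((4 * Real.pi * C + 14) * Real.exp (2 * C)) := by gcongr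
    _ = _ := one_mul _

end JonesDatum

lemma integrable_div_sub {φ : ℂ → ℂ} (hφ : Continuous φ) (hc : HasCompactSupport φ) (z : ℂ) :
    Integrable fun ζ => φ ζ / (z - ζ) := by
  obtain ⟨M, hM⟩ := hφ.bounded_above_of_compact_support hc
  have hM0 : 0 ≤ M := (norm_nonneg _).trans (hM 0)
  obtain ⟨R₀, hR₀⟩ := hc.isCompact.isBounded.subset_ball z
  set R := max R₀ 0
  have hR : tsupport φ ⊆ Metric.ball z R := hR₀.trans (Metric.ball_subset_ball (le_max_left _ _))
  have hm := hφ.measurable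
  have h3 : Measurable fun ζ : ℂ => z - ζ := measurable_const.sub measurable_id
  refine ⟨(hm.div h3).aestronglyMeasurable, ?_⟩
  rw [hasFiniteIntegral_iff_norm]
  calc ∫⁻ ζ, ENNReal.ofReal ‖φ ζ / (z - ζ)‖
      ≤ ∫⁻ ζ, (Metric.ball z R).indicator (fun ζ => ENNReal.ofReal M * ENNReal.ofReal (1 / ‖z - ζ‖)) ζ := by
        refine lintegral_mono fun ζ => ?_
        by_cases hζ : ζ ∈ Metric.ball z R
        · simp only [indicator_of_mem hζ]
          rw [← ENNReal.ofReal_mul hM0, norm_div, div_eq_mul_one_div]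
          apply ENNReal.ofReal_le_ofReal
          gcongr
          exact hM ζ
        · rw [image_eq_zero_of_notMem_tsupport fun h => hζ (hR h)]
          simp
    _ = ENNReal.ofReal M * ∫⁻ ζ in Metric.ball z R, ENNReal.ofReal (1 / ‖z - ζ‖) := by
        rw [lintegral_indicator Metric.isOpen_ball.measurableSet, lintegral_const_mul _ (by fun_prop)]
    _ < ⊤ := ENNReal.mul_lt_top ENNReal.ofReal_lt_top
        ((lintegral_ball_inv_norm z (le_max_right _ _)).trans_lt ENNReal.ofReal_lt_top)

lemma differentiableOn_cauchy_transform {k : ℂ → ℂ} (hk : Continuous k) (hc : HasCompactSupport k)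
    {O : Set ℂ} (hO : IsOpen O) (hkO : ∀ z ∈ O, k z = 0) :
    DifferentiableOn ℂ (fun z => ∫ ζ, k ζ / (z - ζ)) O := by
  intro z₀ hz₀
  obtain ⟨r, hr, hrO⟩ := Metric.isOpen_iff.1 hO z₀ hz₀
  have hfar : ∀ z ∈ Metric.ball z₀ (r / 2), ∀ ζ, k ζ ≠ 0 → r / 2 ≤ ‖z - ζ‖ := by
    intro z hz ζ hζ
    by_contra! hlt
    refine hζ (hkO ζ (hrO ?_))
    rw [Metric.mem_ball, dist_eq_norm] at hz ⊢
    calc ‖ζ - z₀‖ = ‖(z - z₀) - (z - ζ)‖ := by congr 1; ring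
      _ ≤ ‖z - z₀‖ + ‖z - ζ‖ := norm_sub_le _ _
      _ < r := by linarith
  have := differentiableOn_integral_of_dominated (μ := volume) (U := Metric.ball z₀ (r / 2))
    Metric.isOpen_ball (F := fun z ζ => k ζ / (z - ζ)) (B := fun ζ => ‖k ζ‖ / (r / 2))
    (fun z _ => (integrable_div_sub hk hc z).aestronglyMeasurable)
    (Eventually.of_forall fun ζ => ?_) (Eventually.of_forall fun ζ z hz => ?_)
    ((hk.norm.integrable_of_hasCompactSupport hc.norm).div_const _)
  · exact (this.differentiableAt (Metric.ball_mem_nhds _ (by linarith))).differentiableWithinAt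
  · by_cases hζ : k ζ = 0
    · simp [hζ]
    · intro z hz
      have : z - ζ ≠ 0 := norm_pos_iff.1 (lt_of_lt_of_le (by linarith) (hfar z hz ζ hζ))
      fun_prop (disch := assumption)
  · by_cases hζ : k ζ = 0
    · simp [hζ]
    · rw [norm_div]
      have := hfar z hz ζ hζ
      gcongr

lemma norm_dslope_le_of_UH {N : ℂ → ℂ} {B : ℝ} (hN : DifferentiableOn ℂ N UH)
    (hB : ∀ z ∈ UH, ‖N z‖ ≤ B) {ζ z : ℂ} (hζ : ζ ∈ UH) (hz : z ∈ UH) :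
    ‖dslope N ζ z‖ ≤ 4 * B / ζ.im := by
  have hζ' : 0 < ζ.im := hζ
  have hB0 : 0 ≤ B := (norm_nonneg _).trans (hB z hz)
  by_cases h : z = ζ
  · subst h
    rw [dslope_same]
    refine (norm_deriv_le_of_UH hN hB hz).trans ?_
    gcongr
    norm_num
  · rw [dslope_of_ne _ h, slope_def_field, norm_div]
    have hpos : 0 < ‖z - ζ‖ := norm_pos_iff.2 (sub_ne_zero.2 h)
    rw [div_le_iff₀ hpos]
    calc _ ≤ _ := norm_sub_le_of_UH hN hB hζ hz
      _ = _ := by ring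

/-- Correcting a smooth function by a multiple of `b` so that it becomes holomorphic. -/
theorem differentiableOn_sub_mul_jonesSol {f g k b : ℂ → ℂ} {C : ℝ} (hf : ContDiff ℝ 1 f)
    (hfc : HasCompactSupport f) (hg : JonesDatum g C) (hk : Continuous k)
    (hkc : HasCompactSupport k) (hb : DifferentiableOn ℂ b UH) (hb1 : ∀ z ∈ UH, ‖b z‖ ≤ 1)
    {O : Set ℂ} (hO : IsOpen O) (hOU : O ⊆ UH) (hkO : ∀ z ∈ O, k z = 0)
    (hdbar : ∀ ζ, dbar f ζ = b ζ * g ζ + k ζ) :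
    DifferentiableOn ℂ (fun z => f z - b z * jonesSol g z) O := by
  have hpi : (Real.pi : ℂ) ≠ 0 := by exact_mod_cast Real.pi_ne_zero
  have hbg : (fun ζ => b ζ * g ζ) = fun ζ => dbar f ζ - k ζ := by
    ext ζ; rw [hdbar]; ring
  have hbgc : Continuous fun ζ => b ζ * g ζ := by
    rw [hbg]; exact (continuous_dbar hf).sub hk
  have hbgs : HasCompactSupport fun ζ => b ζ * g ζ := hg.cpt.mul_left
  set N : ℂ → ℂ → ℂ := fun ζ z => b z * jonesE g z ζ with hN
  set B : ℝ := 2 * Real.exp (2 * C) with hBdef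
  have hNd : ∀ ζ ∈ UH, DifferentiableOn ℂ (N ζ) UH := fun ζ hζ => hb.mul (hg.differentiableOn_jonesE hζ)
  have hNB : ∀ ζ ∈ UH, ∀ z ∈ UH, ‖N ζ z‖ ≤ B := by
    intro ζ hζ z hz
    rw [hN, norm_mul]
    calc _ ≤ 1 * B := by
          gcongr
          · exact hb1 z hz
          · exact hg.norm_jonesE_le hz hζ
      _ = B := one_mul _
  have hrep : ∀ z ∈ O, f z - b z * jonesSol g z = (1 / Real.pi : ℂ) *
      ((∫ ζ, -(g ζ * dslope (N ζ) ζ z)) + ∫ ζ, k ζ / (z - ζ)) := by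
    intro z hz
    have hzU := hOU hz
    have e1 : f z = (1 / Real.pi : ℂ) * ∫ ζ, dbar f ζ / (z - ζ) := by
      rw [cauchy_pompeiu hf hfc]; field_simp
    have e2 : ∫ ζ, dbar f ζ / (z - ζ) = (∫ ζ, b ζ * g ζ / (z - ζ)) + ∫ ζ, k ζ / (z - ζ) := by
      rw [← integral_add (integrable_div_sub hbgc hbgs z) (integrable_div_sub hk hkc z)]
      congr 1; ext ζ; rw [hdbar]; ring
    have e3 : ∫ ζ, -(g ζ * dslope (N ζ) ζ z) =
        (∫ ζ, b ζ * g ζ / (z - ζ)) - b z * ∫ ζ, g ζ * jonesE g z ζ / (z - ζ) := by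
      rw [← integral_const_mul, ← integral_sub (integrable_div_sub hbgc hbgs z)
        ((hg.integrable_jonesSol hzU).const_mul _)]
      refine integral_congr_ae ?_
      have hne : ∀ᵐ ζ : ℂ, ζ ≠ z := by
        simp [ae_iff]
      filter_upwards [hne] with ζ hζ
      by_cases hgζ : g ζ = 0
      · simp [hgζ]
      have hζU : ζ ∈ UH := by
        by_contra hh; exact hgζ (hg.eq_zero_of_notMem hh)
      rw [dslope_of_ne _ hζ.symm, slope_def_field]
      simp only [hN, JonesDatum.jonesE_self hζU]
      ring
    rw [e3, e1, e2, jonesSol]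
    ring
  refine DifferentiableOn.congr ?_ hrep
  refine DifferentiableOn.const_mul (DifferentiableOn.add ?_ ?_) _
  · obtain ⟨η, hη, hη'⟩ := hg.exists_im_lower
    refine (differentiableOn_integral_of_dominated (μ := volume) isOpen_UH
      (B := fun ζ => 4 * B / η * ‖g ζ‖) (fun z hz => ?_) (Eventually.of_forall fun ζ => ?_)
      (Eventually.of_forall fun ζ z hz => ?_) (hg.integrable_norm.const_mul _)).mono hOU
    · have h1 := (integrable_div_sub hbgc hbgs z).sub ((hg.integrable_jonesSol hz).const_mul (b z))
      refine h1.aestronglyMeasurable.congr ?_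
      have hne : ∀ᵐ ζ : ℂ, ζ ≠ z := by
        simp [ae_iff]
      filter_upwards [hne] with ζ hζ
      by_cases hgζ : g ζ = 0
      · simp [hgζ]
      have hζU : ζ ∈ UH := by
        by_contra hh; exact hgζ (hg.eq_zero_of_notMem hh)
      rw [dslope_of_ne _ hζ.symm, slope_def_field]
      simp only [hN, JonesDatum.jonesE_self hζU, Pi.sub_apply]
      ring
    · by_cases hgζ : g ζ = 0
      · simp [hgζ]
      have hζU : ζ ∈ UH := by
        by_contra hh; exact hgζ (hg.eq_zero_of_notMem hh)
      exact (((Complex.differentiableOn_dslope (isOpen_UH.mem_nhds hζU)).2 (hNd ζ hζU)).const_mul _).neg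
    · by_cases hgζ : g ζ = 0
      · simp [hgζ]
      have hζU : ζ ∈ UH := by
        by_contra hh; exact hgζ (hg.eq_zero_of_notMem hh)
      rw [norm_neg, norm_mul, mul_comm]
      gcongr
      refine (norm_dslope_le_of_UH (hNd ζ hζU) (hNB ζ hζU) hζU hz).trans ?_
      have : 0 ≤ B := by positivity
      have := hη' ζ hgζ
      gcongr
  · exact differentiableOn_cauchy_transform hk hkc hO hkO

end

section
open MeasureTheory Set Filter Topology

/-- The Carleson box over the interval of radius `ℓ` about `x₀`. -/
def cbox (x₀ ℓ : ℝ) : Set ℂ := {z | |z.re - x₀| ≤ ℓ ∧ 0 < z.im ∧ z.im ≤ ℓ}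

lemma measurableSet_cbox (x₀ ℓ : ℝ) : MeasurableSet (cbox x₀ ℓ) := by
  have h1 : MeasurableSet {z : ℂ | |z.re - x₀| ≤ ℓ} :=
    measurableSet_le (Complex.measurable_re.sub_const x₀).abs measurable_const
  exact h1.inter ((measurableSet_lt measurable_const Complex.measurable_im).inter
      (measurableSet_le Complex.measurable_im measurable_const))

lemma lintegral_complex (f : ℂ → ENNReal) (hf : Measurable f) :
    ∫⁻ z, f z = ∫⁻ x : ℝ, ∫⁻ y : ℝ, f ⟨x, y⟩ := by
  have h := Complex.volume_preserving_equiv_real_prod.symm.lintegral_comp hf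
  rw [← h, Measure.volume_eq_prod, lintegral_prod _ (by
    exact (hf.comp Complex.measurableEquivRealProd.symm.measurable).aemeasurable)]
  rfl

lemma lintegral_complex_symm (f : ℂ → ENNReal) (hf : Measurable f) :
    ∫⁻ z, f z = ∫⁻ y : ℝ, ∫⁻ x : ℝ, f ⟨x, y⟩ := by
  have h := Complex.volume_preserving_equiv_real_prod.symm.lintegral_comp hf
  rw [← h, Measure.volume_eq_prod, lintegral_prod_symm _ (by
    exact (hf.comp Complex.measurableEquivRealProd.symm.measurable).aemeasurable)]
  rfl

lemma setLIntegral_reProdIm (f : ℂ → ENNReal) (hf : Measurable f) {s t : Set ℝ}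
    (hs : MeasurableSet s) (ht : MeasurableSet t) :
    ∫⁻ z in s ×ℂ t, f z = ∫⁻ x in s, ∫⁻ y in t, f ⟨x, y⟩ := by
  have hst : MeasurableSet (s ×ℂ t) :=
    (Complex.measurable_re hs).inter (Complex.measurable_im ht)
  rw [← lintegral_indicator hst, lintegral_complex _ (hf.indicator hst),
    ← lintegral_indicator hs]
  congr 1; ext x
  by_cases hx : x ∈ s
  · rw [indicator_of_mem hx, ← lintegral_indicator ht]
    congr 1; ext y
    have : ((⟨x, y⟩ : ℂ) ∈ s ×ℂ t) ↔ y ∈ t := by simp [Complex.mem_reProdIm, hx]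
    by_cases h : y ∈ t
    · rw [indicator_of_mem (this.2 h), indicator_of_mem h]
    · rw [indicator_of_notMem (mt this.1 h), indicator_of_notMem h]
  · rw [indicator_of_notMem hx]
    simp [indicator, Complex.mem_reProdIm, hx]

lemma setLIntegral_reProdIm_symm (f : ℂ → ENNReal) (hf : Measurable f) {s t : Set ℝ}
    (hs : MeasurableSet s) (ht : MeasurableSet t) :
    ∫⁻ z in s ×ℂ t, f z = ∫⁻ y in t, ∫⁻ x in s, f ⟨x, y⟩ := by
  have hst : MeasurableSet (s ×ℂ t) :=
    (Complex.measurable_re hs).inter (Complex.measurable_im ht)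
  rw [← lintegral_indicator hst, lintegral_complex_symm _ (hf.indicator hst),
    ← lintegral_indicator ht]
  congr 1; ext y
  by_cases hy : y ∈ t
  · rw [indicator_of_mem hy, ← lintegral_indicator hs]
    congr 1; ext x
    have : ((⟨x, y⟩ : ℂ) ∈ s ×ℂ t) ↔ x ∈ s := by simp [Complex.mem_reProdIm, hy]
    by_cases h : x ∈ s
    · rw [indicator_of_mem (this.2 h), indicator_of_mem h]
    · rw [indicator_of_notMem (mt this.1 h), indicator_of_notMem h]
  · rw [indicator_of_notMem hy]
    simp [indicator, Complex.mem_reProdIm, hy]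

lemma ofReal_intervalIntegral_eq {f : ℝ → ℝ} {a b : ℝ} (hab : a ≤ b)
    (hf : ContinuousOn f (Icc a b)) (h0 : ∀ x ∈ Icc a b, 0 ≤ f x) :
    ENNReal.ofReal (∫ x in a..b, f x) = ∫⁻ x in Icc a b, ENNReal.ofReal (f x) := by
  rw [intervalIntegral.integral_of_le hab, ← integral_Icc_eq_integral_Ioc,
    ofReal_integral_eq_lintegral_ofReal (hf.integrableOn_Icc)]
  exact (ae_restrict_iff' measurableSet_Icc).2 (Eventually.of_forall h0)

section
variable {E : Type*} [NormedAddCommGroup E]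

lemma continuous_mk_max {f : ℂ → E} (hf : ContinuousOn f UH) {c : ℝ} (hc : 0 < c) :
    Continuous fun p : ℝ × ℝ => f ⟨p.1, max p.2 c⟩ := by
  refine hf.comp_continuous (f := fun p : ℝ × ℝ => (⟨p.1, max p.2 c⟩ : ℂ)) ?_ fun p => ?_
  · have : (fun p : ℝ × ℝ => (⟨p.1, max p.2 c⟩ : ℂ)) =
        fun p : ℝ × ℝ => ((p.1 : ℂ) + ((max p.2 c : ℝ) : ℂ) * Complex.I) := by
      ext p; simp [Complex.ext_iff]
    rw [this]; fun_prop
  · exact lt_max_of_lt_right hc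

variable [NormedSpace ℝ E]

lemma continuous_intervalIntegral_im {f : ℂ → E} (hf : ContinuousOn f UH) {c d : ℝ} (hc : 0 < c)
    (hcd : c ≤ d) : Continuous fun x : ℝ => ∫ y in c..d, f ⟨x, y⟩ := by
  have h : (fun x : ℝ => ∫ y in c..d, f ⟨x, y⟩) = fun x => ∫ y in c..d, f ⟨x, max y c⟩ := by
    ext x
    refine intervalIntegral.integral_congr fun y hy => ?_
    rw [uIcc_of_le hcd] at hy
    simp only [max_eq_left hy.1]
  rw [h]
  exact intervalIntegral.continuous_parametric_intervalIntegral_of_continuous'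
    (f := fun (x y : ℝ) => f ⟨x, max y c⟩) (continuous_mk_max hf hc) c d

lemma continuousOn_intervalIntegral_re {f : ℂ → E} (hf : ContinuousOn f UH) (x₀ : ℝ) :
    ContinuousOn (fun z : ℂ => ∫ t in x₀..z.re, f ⟨t, z.im⟩) UH := by
  intro z hz
  have hz' : 0 < z.im := hz
  refine ContinuousAt.continuousWithinAt ?_
  have h : Continuous fun w : ℂ => ∫ t in x₀..w.re, f ⟨t, max w.im (z.im / 2)⟩ := by
    refine intervalIntegral.continuous_parametric_intervalIntegral_of_continuous
      (f := fun (w : ℂ) (t : ℝ) => f ⟨t, max w.im (z.im / 2)⟩) ?_ Complex.continuous_re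
    have := (continuous_mk_max hf (half_pos hz')).comp
      (g := fun p : ℝ × ℝ => f ⟨p.1, max p.2 (z.im / 2)⟩)
      (f := fun q : ℂ × ℝ => (q.2, q.1.im)) (by fun_prop)
    exact this
  refine h.continuousAt.congr ?_
  filter_upwards [(isOpen_lt continuous_const Complex.continuous_im).mem_nhds
    (show z.im / 2 < z.im by linarith)] with w hw
  have hw' : z.im / 2 < w.im := hw
  rw [max_eq_left hw'.le]

end

end

section
open MeasureTheory Set Filter Topology Complex ComplexConjugate

lemma norm_deriv_mul_im_le {a : ℂ → ℂ} (ha : DifferentiableOn ℂ a UH)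
    (ha1 : ∀ z ∈ UH, ‖a z‖ ≤ 1) {z : ℂ} (hz : z ∈ UH) : ‖deriv a z‖ * z.im ≤ 2 := by
  have h := norm_deriv_le_of_UH ha ha1 hz
  have hz' : 0 < z.im := hz
  rw [le_div_iff₀ hz'] at h
  linarith

lemma continuousOn_deriv_UH {a : ℂ → ℂ} (ha : DifferentiableOn ℂ a UH) :
    ContinuousOn (deriv a) UH := (ha.deriv isOpen_UH).continuousOn

lemma energy_rect {a : ℂ → ℂ} (ha : DifferentiableOn ℂ a UH)
    (ha1 : ∀ z ∈ UH, ‖a z‖ ≤ 1) (x₀ : ℝ) {ℓ τ : ℝ} (hτ : 0 < τ) (hτℓ : τ ≤ ℓ) :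
    ∫ x in (x₀ - ℓ)..(x₀ + ℓ), ∫ y in τ..ℓ, 2 * (y - τ) * ‖deriv a ⟨x, y⟩‖ ^ 2 ≤ 11 * ℓ := by
  have hℓ : 0 < ℓ := hτ.trans_le hτℓ
  set F : ℂ → ℂ := fun z => ((z.im - τ : ℝ) : ℂ) * deriv a z * conj (a z) +
    (I / 2) * (a z * conj (a z)) with hF
  set F' : ℂ → ℂ →L[ℝ] ℂ := fun z =>
    ((((z.im - τ : ℝ) : ℂ) * deriv a z) • ((conjCLE : ℂ →L[ℝ] ℂ).comp
        ((fderiv ℂ a z).restrictScalars ℝ)) +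
      conj (a z) • (((z.im - τ : ℝ) : ℂ) • (fderiv ℂ (deriv a) z).restrictScalars ℝ +
        deriv a z • (ofRealCLM.comp imCLM))) +
    (I / 2) • (a z • ((conjCLE : ℂ →L[ℝ] ℂ).comp ((fderiv ℂ a z).restrictScalars ℝ)) +
      conj (a z) • (fderiv ℂ a z).restrictScalars ℝ) with hF'
  have hFd : ∀ z ∈ UH, HasFDerivAt F (F' z) z := by
    intro z hz
    have h1 : HasFDerivAt a ((fderiv ℂ a z).restrictScalars ℝ) z :=
      (ha.differentiableAt_UH hz).hasFDerivAt.restrictScalars ℝ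
    have h2 : HasFDerivAt (deriv a) ((fderiv ℂ (deriv a) z).restrictScalars ℝ) z :=
      ((ha.deriv isOpen_UH).differentiableAt_UH hz).hasFDerivAt.restrictScalars ℝ
    have h3 : HasFDerivAt (fun z => conj (a z)) ((conjCLE : ℂ →L[ℝ] ℂ).comp
        ((fderiv ℂ a z).restrictScalars ℝ)) z :=
      (conjCLE : ℂ →L[ℝ] ℂ).hasFDerivAt.comp z h1
    have h4 : HasFDerivAt (fun z : ℂ => ((z.im - τ : ℝ) : ℂ)) (ofRealCLM.comp imCLM) z :=
      ofRealCLM.hasFDerivAt.comp z (imCLM.hasFDerivAt.sub_const τ)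
    exact ((h4.mul h2).mul h3).add ((h1.mul h3).const_mul (I / 2))
  have hFc : ContinuousOn F UH := fun z hz => (hFd z hz).continuousAt.continuousWithinAt
  have hcalc : ∀ z ∈ UH, I • F' z 1 - F' z I =
      ((-2 * (deriv a z * conj (a z)).re : ℝ) : ℂ) +
        ((2 * (z.im - τ) * ‖deriv a z‖ ^ 2 : ℝ) : ℂ) * I := by
    intro z hz
    have e1 : ∀ v : ℂ, fderiv ℂ a z v = v * deriv a z := fun v => by
      rw [fderiv_eq_smul_deriv, smul_eq_mul]
    have e2 : ∀ v : ℂ, fderiv ℂ (deriv a) z v = v * deriv (deriv a) z := fun v => by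
      rw [fderiv_eq_smul_deriv, smul_eq_mul]
    have e3 : ((‖deriv a z‖ ^ 2 : ℝ) : ℂ) = deriv a z * conj (deriv a z) := by
      rw [mul_conj, normSq_eq_norm_sq]
    have e4 : (((deriv a z * conj (a z)).re : ℝ) : ℂ) =
        (deriv a z * conj (a z) + conj (deriv a z) * a z) / 2 := by
      rw [re_eq_add_conj]; simp
    simp only [hF', add_apply, smul_apply, ContinuousLinearMap.comp_apply, ContinuousLinearMap.coe_restrictScalars', e1, e2, ContinuousLinearEquiv.coe_coe, conjCLE_apply, ofRealCLM_apply, imCLM_apply, smul_eq_mul]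
    push_cast at e3 e4
    push_cast
    rw [e3, e4]
    simp only [one_im, I_im, map_mul, conj_I, ofReal_zero, ofReal_one, map_one]
    linear_combination a z * conj (deriv a z) * I_sq
  set z1 : ℂ := ⟨x₀ - ℓ, τ⟩
  set w1 : ℂ := ⟨x₀ + ℓ, ℓ⟩
  have hsub : (uIcc z1.re w1.re ×ℂ uIcc z1.im w1.im) ⊆ UH := by
    intro z hz
    have := hz.2
    simp only [z1, w1, mem_preimage, uIcc_of_le hτℓ] at this
    exact hτ.trans_le this.1
  have hcont : ContinuousOn (fun z => I • F' z 1 - F' z I) UH := by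
    have : ContinuousOn (fun z => ((-2 * (deriv a z * conj (a z)).re : ℝ) : ℂ) +
        ((2 * (z.im - τ) * ‖deriv a z‖ ^ 2 : ℝ) : ℂ) * I) UH := by
      have h1 := continuousOn_deriv_UH ha
      have h2 := ha.continuousOn
      have h3 : ContinuousOn (fun z => conj (a z)) UH := continuous_conj.comp_continuousOn h2
      have h4 : ContinuousOn (fun z => (deriv a z * conj (a z)).re) UH :=
        continuous_re.comp_continuousOn (h1.mul h3)
      have h5 : Continuous (fun z : ℂ => z.im) := continuous_im
      refine (continuous_ofReal.comp_continuousOn (continuousOn_const.mul h4)).add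
        ((continuous_ofReal.comp_continuousOn ?_).mul continuousOn_const)
      exact ((continuousOn_const.mul (h5.continuousOn.sub continuousOn_const)).mul (h1.norm.pow 2))
    exact this.congr hcalc
  have hcpt : IsCompact (uIcc z1.re w1.re ×ℂ uIcc z1.im w1.im) :=
    isCompact_uIcc.reProdIm isCompact_uIcc
  have key := integral_boundary_rect_of_hasFDerivAt_real_off_countable F F' z1 w1 ∅
    countable_empty (hFc.mono hsub) (fun z hz => hFd z (hsub (by
      have := hz.1
      exact ⟨Ioo_subset_Icc_self this.1, Ioo_subset_Icc_self this.2⟩)))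
    ((hcont.mono hsub).integrableOn_compact hcpt)
  have hmk : ∀ x y : ℝ, (x : ℂ) + y * I = ⟨x, y⟩ := fun x y => by simp [Complex.ext_iff]
  have hR : (∫ x : ℝ in z1.re..w1.re, ∫ y : ℝ in z1.im..w1.im,
        I • F' (x + y * I) 1 - F' (x + y * I) I).im =
      ∫ x in (x₀ - ℓ)..(x₀ + ℓ), ∫ y in τ..ℓ, 2 * (y - τ) * ‖deriv a ⟨x, y⟩‖ ^ 2 := by
    have h1 := continuous_intervalIntegral_im hcont hτ hτℓ
    simp only [hmk, z1, w1]
    rw [← imCLM_apply, ← ContinuousLinearMap.intervalIntegral_comp_comm _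
      (h1.intervalIntegrable _ _)]
    refine intervalIntegral.integral_congr fun x _ => ?_
    have h2 : ContinuousOn (fun y : ℝ => I • F' ⟨x, y⟩ 1 - F' ⟨x, y⟩ I) (uIcc τ ℓ) := by
      refine hcont.comp (f := fun y : ℝ => (⟨x, y⟩ : ℂ)) ?_ fun y hy => ?_
      · simp only [← hmk]; fun_prop
      · rw [uIcc_of_le hτℓ] at hy
        exact hτ.trans_le hy.1
    rw [← ContinuousLinearMap.intervalIntegral_comp_comm _ h2.intervalIntegrable]
    refine intervalIntegral.integral_congr fun y hy => ?_
    rw [uIcc_of_le hτℓ] at hy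
    rw [hcalc _ (show (⟨x, y⟩ : ℂ) ∈ UH from hτ.trans_le hy.1)]
    rw [imCLM_apply, add_im, ofReal_im, im_ofReal_mul, I_im]; ring
  have hFb : ∀ z : ℂ, τ ≤ z.im → ‖F z‖ ≤ 5 / 2 := by
    intro z hz
    have hz' : z ∈ UH := hτ.trans_le hz
    have h1 := norm_deriv_mul_im_le ha ha1 hz'
    have h2 := ha1 z hz'
    have h3 : ‖((z.im - τ : ℝ) : ℂ) * deriv a z * conj (a z)‖ ≤ 2 := by
      rw [norm_mul, norm_mul, norm_real, Real.norm_of_nonneg (by linarith), RCLike.norm_conj]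
      have h4 : (z.im - τ) * ‖deriv a z‖ ≤ 2 := by nlinarith [norm_nonneg (deriv a z)]
      have h5 : 0 ≤ (z.im - τ) * ‖deriv a z‖ := mul_nonneg (by linarith) (norm_nonneg _)
      nlinarith [norm_nonneg (a z)]
    have h6 : ‖(I / 2) * (a z * conj (a z))‖ ≤ 1 / 2 := by
      rw [norm_mul, norm_mul, norm_div, norm_I, RCLike.norm_conj]
      simp only [RCLike.norm_ofNat]
      nlinarith [norm_nonneg (a z)]
    calc ‖F z‖ ≤ _ := norm_add_le _ _
      _ ≤ 5 / 2 := by linarith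
  have hFb0 : ∀ x : ℝ, ‖F ⟨x, τ⟩‖ ≤ 1 / 2 := by
    intro x
    have h2 := ha1 ⟨x, τ⟩ hτ
    simp only [hF, sub_self, ofReal_zero, zero_mul, zero_add]
    rw [norm_mul, norm_mul, norm_div, norm_I, RCLike.norm_conj]
    simp only [RCLike.norm_ofNat]
    nlinarith [norm_nonneg (a ⟨x, τ⟩)]
  have hi := congrArg Complex.im key
  rw [hR] at hi
  simp only [hmk, z1, w1, add_im, sub_im, smul_eq_mul, I_mul_im] at hi
  have b1 : ‖∫ x in (x₀ - ℓ)..(x₀ + ℓ), F ⟨x, τ⟩‖ ≤ 1 / 2 * |x₀ + ℓ - (x₀ - ℓ)| :=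
    intervalIntegral.norm_integral_le_of_norm_le_const fun x _ => hFb0 x
  have b2 : ‖∫ x in (x₀ - ℓ)..(x₀ + ℓ), F ⟨x, ℓ⟩‖ ≤ 5 / 2 * |x₀ + ℓ - (x₀ - ℓ)| :=
    intervalIntegral.norm_integral_le_of_norm_le_const fun x _ => hFb _ hτℓ
  have b3 : ∀ x, ‖∫ y in τ..ℓ, F ⟨x, y⟩‖ ≤ 5 / 2 * |ℓ - τ| := fun x =>
    intervalIntegral.norm_integral_le_of_norm_le_const fun y hy => hFb _ (by
      rw [uIoc_of_le hτℓ] at hy; exact hy.1.le)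
  rw [abs_of_nonneg (by linarith)] at b1 b2
  have c1 := (abs_im_le_norm _).trans b1
  have c2 := (abs_im_le_norm _).trans b2
  have c3 := (abs_re_le_norm _).trans (b3 (x₀ + ℓ))
  have c4 := (abs_re_le_norm _).trans (b3 (x₀ - ℓ))
  rw [abs_of_nonneg (sub_nonneg.2 hτℓ)] at c3 c4
  rw [abs_le] at c1 c2 c3 c4
  linarith [c1.1, c1.2, c2.1, c2.2, c3.1, c3.2, c4.1, c4.2]

theorem energy_cbox {a : ℂ → ℂ} (ha : DifferentiableOn ℂ a UH)
    (ha1 : ∀ z ∈ UH, ‖a z‖ ≤ 1) (x₀ : ℝ) {ℓ : ℝ} (hℓ : 0 < ℓ) :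
    ∫⁻ z in cbox x₀ ℓ, ENNReal.ofReal (‖deriv a z‖ ^ 2 * z.im) ≤ ENNReal.ofReal (11 * ℓ) := by
  set φ : ℂ → ENNReal := fun z => ENNReal.ofReal (‖deriv a z‖ ^ 2 * z.im) with hφ
  have hφm : Measurable φ := by
    have := measurable_deriv a
    have h2 := Complex.measurable_im
    exact ((this.norm.pow_const 2).mul h2).ennreal_ofReal
  set R : ℕ → Set ℂ := fun n => Icc (x₀ - ℓ) (x₀ + ℓ) ×ℂ Icc (2 * (ℓ / (n + 2))) ℓ with hRdef
  have hRm : ∀ n, MeasurableSet (R n) := fun n =>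
    (Complex.measurable_re measurableSet_Icc).inter (Complex.measurable_im measurableSet_Icc)
  have hmono : Monotone R := by
    intro m n hmn z hz
    refine ⟨hz.1, ?_, hz.2.2⟩
    refine le_trans ?_ hz.2.1
    have : (m : ℝ) ≤ n := by exact_mod_cast hmn
    gcongr
  have hun : cbox x₀ ℓ = ⋃ n, R n := by
    ext z
    simp only [cbox, mem_iUnion, hRdef, mem_reProdIm, mem_Icc]
    constructor
    · rintro ⟨h1, h2, h3⟩
      obtain ⟨n, hn⟩ := exists_nat_gt (2 * ℓ / z.im)
      rw [abs_le] at h1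
      refine ⟨n, ⟨by linarith, by linarith⟩, ?_, h3⟩
      rw [div_lt_iff₀ h2] at hn
      rw [← mul_div_assoc, div_le_iff₀ (by positivity)]
      nlinarith
    · rintro ⟨n, ⟨h1, h2⟩, h3, h4⟩
      have : 0 < 2 * (ℓ / (n + 2)) := by positivity
      exact ⟨abs_le.2 ⟨by linarith, by linarith⟩, by linarith, h4⟩
  rw [hun, setLIntegral_iUnion_of_directed _ (hmono.directed_le)]
  refine iSup_le fun n => ?_
  set τ := ℓ / ((n : ℝ) + 2) with hτdef
  have hτ : 0 < τ := by positivity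
  have hτℓ : 2 * τ ≤ ℓ := by
    rw [hτdef, ← mul_div_assoc, div_le_iff₀ (by positivity)]
    nlinarith [(Nat.cast_nonneg n : (0:ℝ) ≤ n)]
  have hcont : ContinuousOn (fun z : ℂ => 2 * (z.im - τ) * ‖deriv a z‖ ^ 2) UH := by
    have h5 : Continuous (fun z : ℂ => z.im) := continuous_im
    exact (continuousOn_const.mul (h5.continuousOn.sub continuousOn_const)).mul
      ((continuousOn_deriv_UH ha).norm.pow 2)
  have e := energy_rect ha ha1 x₀ hτ (by linarith : τ ≤ ℓ)
  refine le_trans ?_ (ENNReal.ofReal_le_ofReal e)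
  rw [ofReal_intervalIntegral_eq (by linarith)
    (continuous_intervalIntegral_im hcont hτ (by linarith)).continuousOn (fun x _ =>
      intervalIntegral.integral_nonneg (by linarith) fun y hy =>
        mul_nonneg (by linarith [hy.1]) (by positivity)),
    setLIntegral_reProdIm φ hφm measurableSet_Icc measurableSet_Icc]
  refine lintegral_mono fun x => ?_
  simp only
  rw [ofReal_intervalIntegral_eq (by linarith) ?_ (fun y hy =>
        mul_nonneg (by linarith [hy.1]) (by positivity))]
  · refine (setLIntegral_mono' measurableSet_Icc fun y hy => ?_).trans
      (lintegral_mono_set (Icc_subset_Icc_left (by linarith : τ ≤ 2 * τ)))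
    refine ENNReal.ofReal_le_ofReal ?_
    simp only
    rw [mul_comm]
    exact mul_le_mul_of_nonneg_right (by linarith [hy.1]) (by positivity)
  · refine hcont.comp (f := fun y : ℝ => (⟨x, y⟩ : ℂ)) ?_ fun y hy => hτ.trans_le hy.1
    have : (fun y : ℝ => (⟨x, y⟩ : ℂ)) = fun y : ℝ => (x : ℂ) + y * I := by
      ext y; simp [Complex.ext_iff]
    rw [this]; fun_prop

lemma exists_dyadic_annulus {η D : ℝ} (hη : 0 < η) (hD : η ≤ D) :
    ∃ k : ℕ, 2 ^ k * η ≤ D ∧ D < 2 ^ (k + 1) * η := by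
  obtain ⟨n, h1, h2⟩ := exists_nat_pow_near (x := D / η) (y := (2 : ℝ)) (by rwa [le_div_iff₀ hη, one_mul]) (by norm_num)
  exact ⟨n, by rwa [le_div_iff₀ hη] at h1, by rwa [div_lt_iff₀ hη] at h2⟩

lemma lintegral_poisson_le_of_cbox {f : ℂ → ENNReal} (hf : Measurable f)
    (hf0 : ∀ ω, ω ∉ UH → f ω = 0) {C : ℝ} (hC : 0 ≤ C)
    (hbox : ∀ x₀ ℓ : ℝ, 0 < ℓ → ∫⁻ z in cbox x₀ ℓ, f z ≤ ENNReal.ofReal (C * ℓ))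
    {ζ : ℂ} (hζ : ζ ∈ UH) :
    ∫⁻ ω, ENNReal.ofReal (ζ.im / ‖ω - conj ζ‖ ^ 2) * f ω ≤ ENNReal.ofReal (4 * C) := by
  have hη : 0 < ζ.im := hζ
  set η := ζ.im with hηdef
  have hpt : ∀ ω, ENNReal.ofReal (η / ‖ω - conj ζ‖ ^ 2) * f ω ≤
      ∑' k : ℕ, ENNReal.ofReal ((1 / 4) ^ k / η) *
        (cbox ζ.re (2 ^ (k + 1) * η)).indicator f ω := by
    intro ω
    by_cases hω : ω ∈ UH
    · have hω' : 0 < ω.im := hω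
      have him : ω.im + η ≤ ‖ω - conj ζ‖ := by
        have := (le_abs_self _).trans (abs_im_le_norm (ω - conj ζ))
        simpa [sub_im, hηdef] using this
      have hre : |ω.re - ζ.re| ≤ ‖ω - conj ζ‖ := by
        have := abs_re_le_norm (ω - conj ζ)
        simpa [sub_re] using this
      obtain ⟨k, hk1, hk2⟩ := exists_dyadic_annulus hη (by linarith : η ≤ ‖ω - conj ζ‖)
      refine le_trans ?_ (ENNReal.le_tsum k)
      have hmem : ω ∈ cbox ζ.re (2 ^ (k + 1) * η) :=
        ⟨by linarith, hω', by linarith⟩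
      rw [indicator_of_mem hmem]
      refine mul_le_mul_left (ENNReal.ofReal_le_ofReal ?_) _
      have h2 : 0 < 2 ^ k * η := by positivity
      calc η / ‖ω - conj ζ‖ ^ 2 ≤ η / (2 ^ k * η) ^ 2 :=
            div_le_div_of_nonneg_left hη.le (by positivity) (pow_le_pow_left₀ h2.le hk1 2)
        _ = (1 / 4) ^ k / η := by
            rw [div_pow, one_pow, show (4:ℝ) = 2 ^ 2 by norm_num, ← pow_mul, mul_comm 2 k, pow_mul]
            field_simp
    · simp [hf0 ω hω]
  calc ∫⁻ ω, ENNReal.ofReal (η / ‖ω - conj ζ‖ ^ 2) * f ω ≤ ∫⁻ ω, ∑' k : ℕ, ENNReal.ofReal ((1 / 4) ^ k / η) *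
        (cbox ζ.re (2 ^ (k + 1) * η)).indicator f ω := lintegral_mono hpt
    _ = ∑' k : ℕ, ∫⁻ ω, ENNReal.ofReal ((1 / 4) ^ k / η) *
        (cbox ζ.re (2 ^ (k + 1) * η)).indicator f ω :=
      lintegral_tsum fun k => ((hf.indicator (measurableSet_cbox _ _)).const_mul _).aemeasurable
    _ ≤ ∑' k : ℕ, ENNReal.ofReal (2 * C) * 2⁻¹ ^ k := by
      refine ENNReal.tsum_le_tsum fun k => ?_
      rw [lintegral_const_mul _ (hf.indicator (measurableSet_cbox _ _)),
        lintegral_indicator (measurableSet_cbox _ _)]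
      refine (mul_le_mul_right (hbox _ _ (by positivity)) _).trans ?_
      rw [← ENNReal.ofReal_mul (by positivity)]
      have h2 : (2⁻¹ : ENNReal) ^ k = ENNReal.ofReal ((1 / 2) ^ k) := by
        rw [ENNReal.ofReal_pow (by norm_num)]
        congr 1
        rw [one_div, ENNReal.ofReal_inv_of_pos (by norm_num)]; simp
      rw [h2, ← ENNReal.ofReal_mul (by positivity)]
      refine ENNReal.ofReal_le_ofReal (le_of_eq ?_)
      rw [div_pow, div_pow, one_pow, show (4:ℝ) = 2 * 2 by norm_num, mul_pow]
      field_simp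
      ring
    _ = ENNReal.ofReal (4 * C) := by
      rw [ENNReal.tsum_mul_left, ENNReal.tsum_geometric, ENNReal.one_sub_inv_two, inv_inv,
        show (4 : ℝ) * C = (2 * C) * 2 by ring, ENNReal.ofReal_mul (q := 2) (by positivity)]
      simp

/-- An integrable majorant for Green potentials of disjoint boxes. -/
noncomputable def greenMajorant (u : ℝ) : ℝ :=
  8 / (1 + u ^ 2) + (Ioo (-1) 1).indicator (fun u => 5 * |u| ^ (-(1 / 2) : ℝ)) u

lemma greenMajorant_nonneg (u : ℝ) : 0 ≤ greenMajorant u :=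
  add_nonneg (by positivity) (indicator_nonneg (fun _ _ => by positivity) _)

lemma integrable_greenMajorant : Integrable greenMajorant := by
  refine Integrable.add ?_ ?_
  · simpa only [div_eq_mul_inv] using integrable_inv_one_add_sq.const_mul 8
  · rw [integrable_indicator_iff measurableSet_Ioo]
    refine Integrable.const_mul ?_ 5
    have h := (intervalIntegral.intervalIntegrable_rpow' (a := 0) (b := 1)
      (r := (-(1 / 2) : ℝ)) (by norm_num))
    have h1 : IntervalIntegrable (fun u : ℝ => |u| ^ (-(1 / 2) : ℝ)) volume 0 1 := by
      refine h.congr fun u hu => ?_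
      rw [uIoc_of_le zero_le_one] at hu
      rw [abs_of_pos hu.1]
    have h2 : IntervalIntegrable (fun u : ℝ => |u| ^ (-(1 / 2) : ℝ)) volume (-1) 0 := by
      have := ((IntervalIntegrable.iff_comp_neg).1 h1).symm
      simpa using this
    have h3 := (h2.trans h1)
    rw [intervalIntegrable_iff_integrableOn_Ioo_of_le (by norm_num)] at h3
    exact h3

lemma norm_sub_conj_sq (z p : ℂ) : ‖z - conj p‖ ^ 2 = ‖z - p‖ ^ 2 + 4 * z.im * p.im := by
  rw [← normSq_eq_norm_sq, ← normSq_eq_norm_sq, normSq_apply, normSq_apply]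
  simp; ring

lemma green_le_majorant {z p : ℂ} (hz : 0 < z.im) (hp : 0 < p.im) {κ t : ℝ} (hκ : 0 < κ)
    (hd : κ * p.im ≤ ‖z - p‖) (ht : |t - p.re| ≤ κ * p.im) (htz : t ≠ z.re) :
    1 / (4 * p.im) * Real.log (1 + 4 * z.im * p.im / ‖z - p‖ ^ 2) ≤
      1 / z.im * greenMajorant ((t - z.re) / z.im) := by
  set d := ‖z - p‖ with hd_def
  set y := z.im
  set q := p.im
  set s := t - z.re with hs
  have hd0 : 0 < d := (mul_pos hκ hp).trans_le hd
  have hre : |z.re - p.re| ≤ d := by simpa using abs_re_le_norm (z - p)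
  have him : |y - q| ≤ d := by simpa using abs_im_le_norm (z - p)
  have hs2 : |s| ≤ 2 * d := by
    rw [abs_le] at *
    constructor <;> linarith [hre.1, hre.2, ht.1, ht.2]
  rcases le_or_gt (y / 2) d with h | h
  · have h1 : Real.log (1 + 4 * y * q / d ^ 2) ≤ 4 * y * q / d ^ 2 := by
      have := Real.log_le_sub_one_of_pos (show 0 < 1 + 4 * y * q / d ^ 2 by positivity)
      linarith
    have h2 : y ^ 2 + s ^ 2 ≤ 8 * d ^ 2 := by
      have : s ^ 2 ≤ (2 * d) ^ 2 := by rw [← sq_abs]; exact pow_le_pow_left₀ (abs_nonneg _) hs2 2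
      nlinarith
    calc 1 / (4 * q) * Real.log (1 + 4 * y * q / d ^ 2)
        ≤ 1 / (4 * q) * (4 * y * q / d ^ 2) := mul_le_mul_of_nonneg_left h1 (by positivity)
      _ = y / d ^ 2 := by field_simp
      _ ≤ y / ((y ^ 2 + s ^ 2) / 8) :=
        div_le_div_of_nonneg_left hz.le (by positivity) (by linarith)
      _ = 1 / y * (8 / (1 + (s / y) ^ 2)) := by field_simp
      _ ≤ _ := by
        refine mul_le_mul_of_nonneg_left ?_ (by positivity)
        rw [greenMajorant]
        exact le_add_of_nonneg_right (indicator_nonneg (fun _ _ => by positivity) _)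
  · have hq : y / 2 ≤ q ∧ q ≤ 3 / 2 * y := by
      rw [abs_le] at him
      constructor <;> linarith [him.1, him.2]
    have hs0 : s ≠ 0 := sub_ne_zero.2 htz
    set u := s / y with hu
    have hu1 : |u| < 1 := by
      rw [hu, abs_div, abs_of_pos hz, div_lt_one hz]; linarith
    have hu0 : 0 < |u| := abs_pos.2 (div_ne_zero hs0 hz.ne')
    set w := |u| ^ (-(1 / 2) : ℝ) with hw
    have hw0 : 0 < w := Real.rpow_pos_of_pos hu0 _
    have hw4 : w ^ 4 = 1 / u ^ 2 := by
      rw [hw, ← Real.rpow_natCast, ← Real.rpow_mul hu0.le, ← sq_abs, one_div (|u| ^ 2),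
        ← Real.rpow_natCast, ← Real.rpow_neg hu0.le]
      norm_num
    have hX : 4 * y * q / d ^ 2 ≤ 24 * w ^ 4 := by
      have hsd : s ^ 2 ≤ (2 * d) ^ 2 := by
        rw [← sq_abs]; exact pow_le_pow_left₀ (abs_nonneg _) hs2 2
      have hspos : 0 < s ^ 2 := by positivity
      rw [hw4, hu, div_pow, one_div_div, mul_div_assoc', div_le_div_iff₀ (by positivity) hspos]
      nlinarith [mul_le_mul hq.2 hsd hspos.le (by positivity), mul_pos hz hz]
    have hlog : Real.log (1 + 4 * y * q / d ^ 2) ≤ 10 * w := by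
      have h1 : 1 + 4 * y * q / d ^ 2 ≤ (1 + 5 / 2 * w) ^ 4 := by
        refine (add_le_add_right hX 1).trans ?_
        nlinarith [pow_pos hw0 2, pow_pos hw0 3, pow_pos hw0 4]
      calc _ ≤ Real.log ((1 + 5 / 2 * w) ^ 4) := Real.log_le_log (by positivity) h1
        _ = 4 * Real.log (1 + 5 / 2 * w) := by rw [Real.log_pow]; norm_num
        _ ≤ 4 * (5 / 2 * w) := by
          have := Real.log_le_sub_one_of_pos (show 0 < 1 + 5 / 2 * w by positivity)
          linarith
        _ = _ := by ring
    calc 1 / (4 * q) * Real.log (1 + 4 * y * q / d ^ 2)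
        ≤ 1 / (2 * y) * (10 * w) := by
          refine mul_le_mul (one_div_le_one_div_of_le (by positivity) (by linarith [hq.1])) hlog
            (Real.log_nonneg ?_) (by positivity)
          have : 0 ≤ 4 * y * q / d ^ 2 := by positivity
          linarith
      _ = 1 / y * (5 * w) := by field_simp; ring
      _ ≤ _ := by
        refine mul_le_mul_of_nonneg_left ?_ (by positivity)
        rw [greenMajorant, indicator_of_mem (show u ∈ Ioo (-1 : ℝ) 1 from abs_lt.1 hu1)]
        exact le_add_of_nonneg_left (by positivity)

lemma integrable_greenMajorant_comp (x : ℝ) {y : ℝ} (hy : 0 < y) :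
    Integrable fun t : ℝ => 1 / y * greenMajorant ((t - x) / y) :=
  ((integrable_greenMajorant.comp_div hy.ne').comp_sub_right x).const_mul _

lemma integral_greenMajorant_comp (x : ℝ) {y : ℝ} (hy : 0 < y) :
    ∫ t : ℝ, 1 / y * greenMajorant ((t - x) / y) = ∫ u, greenMajorant u := by
  rw [integral_const_mul, integral_sub_right_eq_self (fun t => greenMajorant (t / y)) x,
    Measure.integral_comp_div, abs_of_pos hy, smul_eq_mul]
  field_simp

lemma sum_green_le (T : Finset ℂ) {κ : ℝ} (hκ : 0 < κ) (hT : ∀ p ∈ T, 0 < p.im)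
    (hdisj : (T : Set ℂ).PairwiseDisjoint fun p => Metric.closedBall p.re (κ * p.im))
    {z : ℂ} (hz : 0 < z.im) (hd : ∀ p ∈ T, κ * p.im ≤ ‖z - p‖) :
    κ * ∑ p ∈ T, 1 / 2 * Real.log (1 + 4 * z.im * p.im / ‖z - p‖ ^ 2) ≤
      ∫ u, greenMajorant u := by
  have hintg := integrable_greenMajorant_comp z.re hz
  have h1 : ∀ p ∈ T, κ * (1 / 2 * Real.log (1 + 4 * z.im * p.im / ‖z - p‖ ^ 2)) ≤
      ∫ t in Metric.closedBall p.re (κ * p.im), 1 / z.im * greenMajorant ((t - z.re) / z.im) := by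
    intro p hp
    have hp0 := hT p hp
    have hr : 0 ≤ κ * p.im := by positivity
    calc κ * (1 / 2 * Real.log (1 + 4 * z.im * p.im / ‖z - p‖ ^ 2))
        = ∫ t in Metric.closedBall p.re (κ * p.im),
            1 / (4 * p.im) * Real.log (1 + 4 * z.im * p.im / ‖z - p‖ ^ 2) := by
          rw [setIntegral_const, smul_eq_mul, measureReal_def, Real.volume_closedBall,
            ENNReal.toReal_ofReal (by positivity)]
          field_simp
          ring
      _ ≤ _ := by
          refine setIntegral_mono_on_ae ?_ hintg.integrableOn
            Metric.isClosed_closedBall.measurableSet ?_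
          · exact integrableOn_const (by rw [Real.volume_closedBall]; exact ENNReal.ofReal_ne_top)
          · have : ∀ᵐ t : ℝ, t ≠ z.re := by simp [ae_iff]
            filter_upwards [this] with t ht htm
            exact green_le_majorant hz hp0 hκ (hd p hp) (by simpa [Real.dist_eq] using htm) ht
  rw [Finset.mul_sum]
  calc _ ≤ ∑ p ∈ T, ∫ t in Metric.closedBall p.re (κ * p.im),
        1 / z.im * greenMajorant ((t - z.re) / z.im) := Finset.sum_le_sum h1
    _ = ∫ t in ⋃ p ∈ T, Metric.closedBall p.re (κ * p.im),
        1 / z.im * greenMajorant ((t - z.re) / z.im) :=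
      (integral_biUnion_finset T (fun p _ => Metric.isClosed_closedBall.measurableSet) hdisj
        fun p _ => hintg.integrableOn).symm
    _ ≤ ∫ t, 1 / z.im * greenMajorant ((t - z.re) / z.im) :=
      setIntegral_le_integral hintg (Eventually.of_forall fun t =>
        mul_nonneg (by positivity) (greenMajorant_nonneg _))
    _ = _ := integral_greenMajorant_comp z.re hz

lemma pow_norm_le_prod_green (T : Finset ℂ) {κ : ℝ} (hκ : 0 < κ) (hT : ∀ p ∈ T, 0 < p.im)
    {b : ℂ → ℂ} (hb : DifferentiableOn ℂ b UH) (hb1 : ∀ z ∈ UH, ‖b z‖ ≤ 1) {η C : ℝ} {M : ℕ}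
    (hη : ∀ p ∈ T, ∀ w ∈ UH, ‖w - p‖ = κ * p.im → ‖b w‖ ≤ η) (hMC : η ^ M * C ≤ 1)
    (hC : ∀ z ∈ UH, (∀ p ∈ T, κ * p.im ≤ ‖z - p‖) → ∏ p ∈ T, ‖z - conj p‖ / ‖z - p‖ ≤ C)
    {z₀ : ℂ} (hz₀ : z₀ ∈ UH) (hd : ∀ p ∈ T, κ * p.im < ‖z₀ - p‖) :
    ‖b z₀‖ ^ M * ∏ p ∈ T, ‖z₀ - conj p‖ / ‖z₀ - p‖ ≤ 1 := by
  set F : ℂ → ℂ := fun z => b z ^ M * ∏ p ∈ T, (z - conj p) / (z - p) with hF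
  have hFn : ∀ z, ‖F z‖ = ‖b z‖ ^ M * ∏ p ∈ T, ‖z - conj p‖ / ‖z - p‖ := by
    intro z; simp only [hF, norm_mul, norm_pow, norm_prod, norm_div]
  rw [← hFn]
  set τ : ℕ → ℝ := fun n => 1 / ((n : ℝ) + 1) with hτ
  set R : ℕ → ℝ := fun n => (n : ℝ) + 1 with hR
  have hτ0 : Tendsto τ atTop (𝓝 0) := tendsto_one_div_add_atTop_nhds_zero_nat
  have hRt : Tendsto R atTop atTop := tendsto_natCast_atTop_atTop.atTop_add tendsto_const_nhds
  have hτpos : ∀ n, 0 < τ n := fun n => by simp only [hτ]; positivity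
  have hRτ : ∀ n, R n = 1 / τ n := fun n => by simp [hR, hτ]
  have hlim1 : Tendsto (fun n => ∏ p ∈ T, (p.im + τ n) / (p.im - τ n)) atTop (𝓝 1) := by
    have : Tendsto (fun n => ∏ p ∈ T, (p.im + τ n) / (p.im - τ n)) atTop
        (𝓝 (∏ p ∈ T, (p.im + 0) / (p.im - 0))) :=
      tendsto_finsetProd _ fun p hp => (tendsto_const_nhds.add hτ0).div
        (tendsto_const_nhds.sub hτ0) (by simpa using (hT p hp).ne')
    rwa [Finset.prod_congr rfl (g := fun _ => (1 : ℝ)) (fun p hp => by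
      have := (hT p hp).ne'; simp [this]), Finset.prod_const_one] at this
  have hlim2 : Tendsto (fun n => ∏ p ∈ T, (R n + ‖p‖) / (R n - ‖p‖)) atTop (𝓝 1) := by
    have h : ∀ n, ∏ p ∈ T, (R n + ‖p‖) / (R n - ‖p‖) =
        ∏ p ∈ T, (1 + ‖p‖ * τ n) / (1 - ‖p‖ * τ n) := fun n => by
      refine Finset.prod_congr rfl fun p _ => ?_
      rw [hRτ, ← mul_div_mul_right _ _ (hτpos n).ne']
      have := (hτpos n).ne'
      congr 1 <;> field_simp
    simp only [h]
    have : Tendsto (fun n => ∏ p ∈ T, (1 + ‖p‖ * τ n) / (1 - ‖p‖ * τ n)) atTop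
        (𝓝 (∏ p ∈ T, (1 + ‖p‖ * 0) / (1 - ‖p‖ * 0))) :=
      tendsto_finsetProd _ fun p hp => (tendsto_const_nhds.add (hτ0.const_mul _)).div
        (tendsto_const_nhds.sub (hτ0.const_mul _)) (by simp)
    simpa using this
  have hlim : Tendsto (fun n => max 1 (max (∏ p ∈ T, (p.im + τ n) / (p.im - τ n))
      (∏ p ∈ T, (R n + ‖p‖) / (R n - ‖p‖)))) atTop (𝓝 1) := by
    simpa using (tendsto_const_nhds (x := (1 : ℝ))).max (hlim1.max hlim2)
  have hev : ∀ᶠ n in atTop, (∀ p ∈ T, τ n < p.im) ∧ (∀ p ∈ T, ‖p‖ < R n) ∧ τ n < z₀.im ∧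
      ‖z₀‖ < R n := by
    refine ((T.eventually_all).2 fun p hp => hτ0.eventually_lt_const (hT p hp)).and
      (((T.eventually_all).2 fun p hp => hRt.eventually_gt_atTop _).and
      ((hτ0.eventually_lt_const hz₀).and (hRt.eventually_gt_atTop _)))
  refine ge_of_tendsto hlim ?_
  filter_upwards [hev] with n ⟨h1, h2, h3, h4⟩
  set U : Set ℂ := {z | τ n < z.im} ∩ Metric.ball 0 (R n) ∩
    ⋂ p ∈ T, {z | κ * p.im < ‖z - p‖} with hU
  have hUo : IsOpen U := by
    refine ((isOpen_lt continuous_const continuous_im).inter Metric.isOpen_ball).inter ?_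
    exact isOpen_biInter_finset fun p _ => isOpen_lt continuous_const (by fun_prop)
  have hcl : closure U ⊆ {z | τ n ≤ z.im} ∩ Metric.closedBall 0 (R n) ∩
      ⋂ p ∈ T, {z | κ * p.im ≤ ‖z - p‖} := by
    refine closure_minimal ?_ ?_
    · rintro z ⟨⟨a1, a2⟩, a3⟩
      refine ⟨⟨show τ n ≤ z.im from le_of_lt (show τ n < z.im from a1),
        Metric.ball_subset_closedBall a2⟩, ?_⟩
      simp only [mem_iInter] at a3 ⊢
      exact fun p hp => show κ * p.im ≤ ‖z - p‖ from
        le_of_lt (show κ * p.im < ‖z - p‖ from a3 p hp)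
    · refine ((isClosed_le continuous_const continuous_im).inter Metric.isClosed_closedBall).inter ?_
      exact isClosed_biInter fun p _ => isClosed_le continuous_const (by fun_prop)
  have hclU : closure U ⊆ UH := fun z hz => (hτpos n).trans_le (hcl hz).1.1
  have hne : ∀ z ∈ closure U, ∀ p ∈ T, z - p ≠ 0 := by
    intro z hz p hp h0
    have := (hcl hz).2
    simp only [mem_iInter] at this
    have h := this p hp
    have h' : κ * p.im ≤ ‖z - p‖ := h
    rw [h0, norm_zero] at h'
    have := mul_pos hκ (hT p hp)
    linarith
  have hdiff : ∀ z ∈ closure U, DifferentiableAt ℂ F z := by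
    intro z hz
    have hbz := hb.differentiableAt_UH (hclU hz)
    refine (hbz.pow M).mul ?_
    refine DifferentiableAt.fun_finsetProd fun p hp => ?_
    exact (differentiableAt_id.sub_const _).div (differentiableAt_id.sub_const _) (hne z hz p hp)
  have hdc : DiffContOnCl ℂ F U :=
    ⟨fun z hz => (hdiff z (subset_closure hz)).differentiableWithinAt,
      fun z hz => (hdiff z hz).continuousAt.continuousWithinAt⟩
  have hmem : z₀ ∈ U := by
    refine ⟨⟨h3, by simpa using h4⟩, ?_⟩
    simp only [mem_iInter]
    exact hd
  refine norm_le_of_forall_mem_frontier_norm_le (U := U)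
    (Metric.isBounded_ball.subset fun z hz => hz.1.2) hdc ?_ (subset_closure hmem)
  intro z hz
  rw [hUo.frontier_eq] at hz
  have hzc := hcl hz.1
  have hzU : z ∈ UH := hclU hz.1
  have hzim : τ n ≤ z.im := hzc.1.1
  have hzR : ‖z‖ ≤ R n := by simpa using hzc.1.2
  have hzp : ∀ p ∈ T, κ * p.im ≤ ‖z - p‖ := by
    have := hzc.2
    simp only [mem_iInter] at this
    exact this
  have hbM : ‖b z‖ ^ M ≤ 1 := pow_le_one₀ (norm_nonneg _) (hb1 z hzU)
  have hprod0 : 0 ≤ ∏ p ∈ T, ‖z - conj p‖ / ‖z - p‖ :=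
    Finset.prod_nonneg fun p _ => by positivity
  rw [hFn]
  by_cases c1 : z.im = τ n
  · refine le_max_of_le_right (le_max_of_le_left ?_)
    refine (mul_le_of_le_one_left hprod0 hbM).trans ?_
    refine Finset.prod_le_prod (fun p _ => by positivity) fun p hp => ?_
    have hp1 := h1 p hp
    have hp2 : p.im - τ n ≤ ‖z - p‖ := by
      have := (neg_abs_le _).trans' (neg_le_neg (abs_im_le_norm (z - p)))
      rw [sub_im, c1] at this
      linarith
    have hpos : 0 < ‖z - p‖ := by linarith
    rw [div_le_div_iff₀ hpos (by linarith)]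
    refine le_of_sq_le_sq ?_ (by have := hT p hp; have := hτpos n; positivity)
    rw [mul_pow, mul_pow, norm_sub_conj_sq, c1]
    have := pow_le_pow_left₀ (by linarith) hp2 2
    nlinarith [mul_pos (hτpos n) (hT p hp)]
  by_cases c2 : ‖z‖ = R n
  · refine le_max_of_le_right (le_max_of_le_right ?_)
    refine (mul_le_of_le_one_left hprod0 hbM).trans ?_
    refine Finset.prod_le_prod (fun p _ => by positivity) fun p hp => ?_
    have hp1 := h2 p hp
    refine div_le_div₀ (by positivity) ?_ (by linarith) ?_
    · calc ‖z - conj p‖ ≤ ‖z‖ + ‖conj p‖ := norm_sub_le _ _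
        _ = _ := by rw [c2, RCLike.norm_conj]
    · rw [← c2]; exact norm_sub_norm_le _ _
  refine le_max_of_le_left ?_
  have : ∃ p ∈ T, ‖z - p‖ = κ * p.im := by
    by_contra! hcon
    refine hz.2 ⟨⟨lt_of_le_of_ne hzim (Ne.symm c1), ?_⟩, ?_⟩
    · simpa using lt_of_le_of_ne hzR c2
    · simp only [mem_iInter]
      exact fun p hp => lt_of_le_of_ne (hzp p hp) (hcon p hp).symm
  obtain ⟨p, hp, hpe⟩ := this
  refine le_trans ?_ hMC
  have hη1 := hη p hp z hzU hpe
  exact mul_le_mul (pow_le_pow_left₀ (norm_nonneg _) hη1 M) (hC z hzU hzp) hprod0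
    (pow_nonneg ((norm_nonneg _).trans hη1) M)

lemma norm_sub_conj_div_eq_exp {z p : ℂ} (hz : 0 < z.im) (hp : 0 < p.im) (hne : 0 < ‖z - p‖) :
    ‖z - conj p‖ / ‖z - p‖ =
      Real.exp (1 / 2 * Real.log (1 + 4 * z.im * p.im / ‖z - p‖ ^ 2)) := by
  have h1 : 1 + 4 * z.im * p.im / ‖z - p‖ ^ 2 = (‖z - conj p‖ / ‖z - p‖) ^ 2 := by
    rw [div_pow, norm_sub_conj_sq]
    field_simp
  have h2 : 0 < ‖z - conj p‖ / ‖z - p‖ := by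
    have := norm_sub_conj_sq z p
    refine div_pos ?_ hne
    refine lt_of_le_of_ne (norm_nonneg _) fun h => ?_
    rw [← h] at this
    have := mul_pos hz hp
    nlinarith
  rw [h1, Real.log_pow]
  push_cast
  rw [show (1 / 2 * (2 * Real.log (‖z - conj p‖ / ‖z - p‖))) =
    Real.log (‖z - conj p‖ / ‖z - p‖) by ring, Real.exp_log h2]

lemma le_half_log_green {z p : ℂ} (hz : 0 < z.im) (hp : 0 < p.im) (hne : 0 < ‖z - p‖)
    (h1 : |p.re - z.re| ≤ 2 * z.im) (h2 : p.im ≤ 2 * z.im) :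
    2 * p.im / (13 * z.im) ≤ 1 / 2 * Real.log (1 + 4 * z.im * p.im / ‖z - p‖ ^ 2) := by
  have hzp := mul_pos hz hp
  have hX : 0 < 1 + 4 * z.im * p.im / ‖z - p‖ ^ 2 := by positivity
  have h3 := Real.one_sub_inv_le_log_of_pos hX
  have h4 : ‖z - p‖ ^ 2 + 4 * z.im * p.im ≤ 13 * z.im ^ 2 := by
    rw [← normSq_eq_norm_sq, normSq_apply, sub_re, sub_im]
    have := sq_le_sq' (by linarith [neg_abs_le (p.re - z.re)]) ((le_abs_self _).trans h1)
    nlinarith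
  have h5 : 1 - (1 + 4 * z.im * p.im / ‖z - p‖ ^ 2)⁻¹ =
      4 * z.im * p.im / (‖z - p‖ ^ 2 + 4 * z.im * p.im) := by
    field_simp
    ring
  have h6 : 4 * z.im * p.im / (13 * z.im ^ 2) ≤
      4 * z.im * p.im / (‖z - p‖ ^ 2 + 4 * z.im * p.im) :=
    div_le_div_of_nonneg_left (by positivity) (by positivity) h4
  have h7 : 4 * z.im * p.im / (13 * z.im ^ 2) = 2 * (2 * p.im / (13 * z.im)) := by
    field_simp; ring
  linarith

lemma sum_im_le_of_pairwiseDisjoint {δ η : ℝ} (hη : 0 < η) (hηδ : η < δ)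
    {b : ℂ → ℂ} (hb : DifferentiableOn ℂ b UH) (hb1 : ∀ z ∈ UH, ‖b z‖ ≤ 1)
    {z₀ : ℂ} (hz₀ : z₀ ∈ UH) (hδ : δ ≤ ‖b z₀‖) (T : Finset ℂ)
    (hT : ∀ p ∈ T, p ∈ UH ∧ |p.re - z₀.re| ≤ 2 * z₀.im ∧ p.im ≤ 2 * z₀.im ∧ ‖b p‖ < η / 2)
    (hdisj : (T : Set ℂ).PairwiseDisjoint fun p => Metric.closedBall p.re (η / 8 * p.im)) :
    10 * (η / 8) * ∑ p ∈ T, p.im ≤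
      65 * Real.log (1 / δ) * ((∫ u, greenMajorant u) / Real.log (1 / η) + η / 8) * z₀.im := by
  have hz : 0 < z₀.im := hz₀
  have hδ1 : δ ≤ 1 := hδ.trans (hb1 _ hz₀)
  have hδ0 : 0 < δ := hη.trans hηδ
  have hTp : ∀ p ∈ T, 0 < p.im := fun p hp => (hT p hp).1
  set κ := η / 8 with hκ_def
  have hκ : 0 < κ := by positivity
  set C₀ := ∫ u, greenMajorant u with hC₀
  have hC₀0 : 0 ≤ C₀ := integral_nonneg greenMajorant_nonneg
  have hlη : 0 < Real.log (1 / η) := Real.log_pos (by rw [lt_div_iff₀ hη]; linarith)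
  have hlδ : 0 ≤ Real.log (1 / δ) := Real.log_nonneg (by rw [le_div_iff₀ hδ0]; linarith)
  have hsmall : ∀ p ∈ T, ∀ w ∈ UH, ‖w - p‖ ≤ κ * p.im → ‖b w‖ ≤ η := by
    intro p hp w hw hwp
    have h1 := norm_sub_le_of_UH hb hb1 (hT p hp).1 hw
    have h2 : 4 * 1 * ‖w - p‖ / p.im ≤ η / 2 := by
      rw [div_le_iff₀ (hTp p hp)]
      calc 4 * 1 * ‖w - p‖ ≤ 4 * 1 * (κ * p.im) := by linarith
        _ = _ := by rw [hκ_def]; ring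
    have h3 := norm_sub_norm_le (b w) (b p)
    have h4 := (hT p hp).2.2.2
    linarith
  have hd : ∀ p ∈ T, κ * p.im < ‖z₀ - p‖ := by
    intro p hp
    by_contra! h
    have := hsmall p hp z₀ hz₀ h
    linarith
  have hgreen : ∀ z ∈ UH, (∀ p ∈ T, κ * p.im ≤ ‖z - p‖) →
      ∏ p ∈ T, ‖z - conj p‖ / ‖z - p‖ ≤ Real.exp (C₀ / κ) := by
    intro z hzU hdz
    rw [Finset.prod_congr rfl fun p hp => norm_sub_conj_div_eq_exp hzU (hTp p hp)
      ((mul_pos hκ (hTp p hp)).trans_le (hdz p hp)), ← Real.exp_sum, Real.exp_le_exp,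
      le_div_iff₀ hκ, mul_comm]
    exact sum_green_le T hκ hTp hdisj hzU hdz
  set M := ⌈C₀ / (κ * Real.log (1 / η))⌉₊ with hM
  have hMge : C₀ / (κ * Real.log (1 / η)) ≤ M := Nat.le_ceil _
  have hMle : (M : ℝ) ≤ C₀ / (κ * Real.log (1 / η)) + 1 :=
    (Nat.ceil_lt_add_one (by positivity)).le
  have hMC : η ^ M * Real.exp (C₀ / κ) ≤ 1 := by
    rw [← Real.rpow_natCast, Real.rpow_def_of_pos hη, ← Real.exp_add, Real.exp_le_one_iff]
    rw [div_le_iff₀ (by positivity)] at hMge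
    have h1 : C₀ / κ ≤ M * Real.log (1 / η) := by
      rw [div_le_iff₀ hκ]; linarith
    rw [one_div, Real.log_inv] at h1
    linarith
  have key := pow_norm_le_prod_green T hκ hTp hb hb1
    (fun p hp w hw h => hsmall p hp w hw h.le) hMC hgreen hz₀ hd
  have hsum : ∑ p ∈ T, 1 / 2 * Real.log (1 + 4 * z₀.im * p.im / ‖z₀ - p‖ ^ 2) ≤
      M * Real.log (1 / δ) := by
    have h1 : δ ^ M * Real.exp (∑ p ∈ T, 1 / 2 *
        Real.log (1 + 4 * z₀.im * p.im / ‖z₀ - p‖ ^ 2)) ≤ 1 := by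
      rw [Real.exp_sum, ← Finset.prod_congr rfl fun p hp => norm_sub_conj_div_eq_exp hz₀ (hTp p hp)
        ((mul_pos hκ (hTp p hp)).trans (hd p hp))]
      refine le_trans ?_ key
      exact mul_le_mul_of_nonneg_right (pow_le_pow_left₀ hδ0.le hδ M)
        (Finset.prod_nonneg fun p _ => by positivity)
    rw [← Real.rpow_natCast, Real.rpow_def_of_pos hδ0, ← Real.exp_add, Real.exp_le_one_iff] at h1
    rw [one_div δ, Real.log_inv]
    linarith
  have hsum2 : (∑ p ∈ T, p.im) * (2 / (13 * z₀.im)) ≤ M * Real.log (1 / δ) := by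
    refine le_trans ?_ hsum
    rw [Finset.sum_mul]
    refine Finset.sum_le_sum fun p hp => ?_
    have := le_half_log_green hz (hTp p hp) ((mul_pos hκ (hTp p hp)).trans (hd p hp))
      (hT p hp).2.1 (hT p hp).2.2.1
    calc p.im * (2 / (13 * z₀.im)) = 2 * p.im / (13 * z₀.im) := by ring
      _ ≤ _ := this
  have hsum3 : ∑ p ∈ T, p.im ≤ M * Real.log (1 / δ) * (13 / 2 * z₀.im) := by
    calc ∑ p ∈ T, p.im = (∑ p ∈ T, p.im) * (2 / (13 * z₀.im)) * (13 / 2 * z₀.im) := by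
          field_simp
      _ ≤ _ := mul_le_mul_of_nonneg_right hsum2 (by positivity)
  have h8 : κ * M ≤ C₀ / Real.log (1 / η) + κ := by
    calc κ * M ≤ κ * (C₀ / (κ * Real.log (1 / η)) + 1) := mul_le_mul_of_nonneg_left hMle hκ.le
      _ = _ := by field_simp
  calc 10 * κ * ∑ p ∈ T, p.im ≤ 10 * κ * (M * Real.log (1 / δ) * (13 / 2 * z₀.im)) :=
        mul_le_mul_of_nonneg_left hsum3 (by positivity)
    _ = (65 * Real.log (1 / δ) * z₀.im) * (κ * M) := by ring
    _ ≤ (65 * Real.log (1 / δ) * z₀.im) * (C₀ / Real.log (1 / η) + κ) :=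
        mul_le_mul_of_nonneg_left h8 (by positivity)
    _ = _ := by ring

lemma exists_small_eta {δ κ : ℝ} (hδ : 0 < δ) (hκ : 0 < κ) : ∃ η, 0 < η ∧ η < δ ∧ η < 1 ∧
    65 * Real.log (1 / δ) * ((∫ u, greenMajorant u) / Real.log (1 / η) + η / 8) ≤ κ := by
  have h1 : Tendsto (fun η : ℝ => η) (𝓝[>] 0) (𝓝 0) := tendsto_nhdsWithin_of_tendsto_nhds tendsto_id
  have h2 : Tendsto (fun η : ℝ => Real.log (1 / η)) (𝓝[>] 0) atTop := by
    have := Real.tendsto_log_atTop.comp (tendsto_inv_nhdsGT_zero (𝕜 := ℝ))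
    simpa [Function.comp_def] using this
  have h3 : Tendsto (fun η : ℝ => 65 * Real.log (1 / δ) *
      ((∫ u, greenMajorant u) / Real.log (1 / η) + η / 8)) (𝓝[>] 0)
      (𝓝 (65 * Real.log (1 / δ) * (0 + 0 / 8))) :=
    ((h2.const_div_atTop _).add (h1.div_const 8)).const_mul _
  simp only [zero_div, add_zero, mul_zero] at h3
  obtain ⟨η, h4, h5, h6, h7⟩ := ((h3.eventually_le_const hκ).and
    ((h1.eventually_lt_const hδ).and ((h1.eventually_lt_const one_pos).and
      self_mem_nhdsWithin))).exists
  exact ⟨η, h7, h5, h6, h4⟩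

/-- The vertical projection of the set where a bounded holomorphic function is very small has
small measure below a point where it is not small. -/
theorem exists_forall_volume_projection_le {δ κ : ℝ} (hδ : 0 < δ) (hκ : 0 < κ) :
    ∃ ε, 0 < ε ∧ ε < 1 ∧ ε < δ ∧ ∀ b : ℂ → ℂ, DifferentiableOn ℂ b UH → (∀ z ∈ UH, ‖b z‖ ≤ 1) →
      ∀ z₀ ∈ UH, δ ≤ ‖b z₀‖ →
        volume {x : ℝ | |x - z₀.re| ≤ 2 * z₀.im ∧
          ∃ y, 0 < y ∧ y ≤ 2 * z₀.im ∧ ‖b ⟨x, y⟩‖ < ε} ≤ ENNReal.ofReal (κ * z₀.im) := by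
  obtain ⟨η, hη, hηδ, hη1, hηκ⟩ := exists_small_eta hδ hκ
  refine ⟨η / 2, by positivity, by linarith, by linarith, fun b hb hb1 z₀ hz₀ hbz => ?_⟩
  have hz : 0 < z₀.im := hz₀
  set t : Set ℂ := {p | p ∈ UH ∧ |p.re - z₀.re| ≤ 2 * z₀.im ∧ p.im ≤ 2 * z₀.im ∧ ‖b p‖ < η / 2}
    with ht
  obtain ⟨u, hut, hud, hcov⟩ := Vitali.exists_disjoint_subfamily_covering_enlargement_closedBall
    t re (fun p => η / 8 * p.im) (η / 8 * (2 * z₀.im))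
    (fun p hp => mul_le_mul_of_nonneg_left hp.2.2.1 (by positivity)) 5 (by norm_num)
  have huc : u.Countable := hud.countable_of_nonempty_interior fun p hp => by
    have : 0 < p.im := (hut hp).1
    exact ⟨p.re, Metric.ball_subset_interior_closedBall (Metric.mem_ball_self (by positivity))⟩
  have hsub : {x : ℝ | |x - z₀.re| ≤ 2 * z₀.im ∧
      ∃ y, 0 < y ∧ y ≤ 2 * z₀.im ∧ ‖b ⟨x, y⟩‖ < η / 2} ⊆
      ⋃ p ∈ u, Metric.closedBall p.re (5 * (η / 8 * p.im)) := by
    rintro x ⟨hx, y, hy0, hy1, hy2⟩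
    obtain ⟨p, hp, hpp⟩ := hcov ⟨x, y⟩ ⟨hy0, hx, hy1, hy2⟩
    exact mem_biUnion hp (hpp (Metric.mem_closedBall_self (by positivity)))
  refine (measure_mono hsub).trans ((measure_biUnion_le _ huc _).trans ?_)
  rw [ENNReal.tsum_eq_iSup_sum]
  refine iSup_le fun s => ?_
  have h1 := sum_im_le_of_pairwiseDisjoint hη hηδ hb hb1 hz₀ hbz (s.map (Function.Embedding.subtype _))
    (fun p hp => by
      simp only [Finset.mem_map, Function.Embedding.subtype_apply] at hp
      obtain ⟨q, hq, rfl⟩ := hp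
      exact hut q.2)
    (hud.subset fun p hp => by
      simp only [Finset.coe_map, Function.Embedding.subtype_apply] at hp
      obtain ⟨q, hq, rfl⟩ := hp
      exact q.2)
  rw [Finset.sum_map] at h1
  calc ∑ p ∈ s, volume (Metric.closedBall (p : ℂ).re (5 * (η / 8 * (p : ℂ).im)))
      = ENNReal.ofReal (∑ p ∈ s, 2 * (5 * (η / 8 * (p : ℂ).im))) := by
        rw [ENNReal.ofReal_sum_of_nonneg fun p hp => by
          have : 0 < (p : ℂ).im := (hut p.2).1
          positivity]
        exact Finset.sum_congr rfl fun p _ => Real.volume_closedBall _ _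
    _ ≤ _ := by
        refine ENNReal.ofReal_le_ofReal ?_
        refine le_trans (le_of_eq ?_) (h1.trans (mul_le_mul_of_nonneg_right hηκ hz.le))
        rw [Finset.mul_sum]
        exact Finset.sum_congr rfl fun p _ => by simp; ring

end

section
open Set Filter Topology

lemma interp_eq_of_step {N : ℕ} (c θ : ℕ → ℝ) {i : ℕ} (hi : i < N) (h1 : ∀ k < i, θ k = 1)
    (h0 : ∀ k, i < k → k < N → θ k = 0) :
    c 0 + ∑ k ∈ Finset.range N, (c (k + 1) - c k) * θ k = c i + (c (i + 1) - c i) * θ i := by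
  have h : ∀ j ≤ i, c 0 + ∑ k ∈ Finset.range j, (c (k + 1) - c k) * θ k = c j := by
    intro j hj
    rw [Finset.sum_congr rfl (g := fun k => c (k + 1) - c k) fun k hk => by
      rw [h1 k ((Finset.mem_range.1 hk).trans_le hj), mul_one], Finset.sum_range_sub]
    ring
  have hs : ∑ k ∈ Finset.range N, (c (k + 1) - c k) * θ k =
      ∑ k ∈ Finset.range (i + 1), (c (k + 1) - c k) * θ k := by
    symm
    refine Finset.sum_subset (Finset.range_mono hi) fun k hk hk' => ?_
    rw [h0 k (by simpa using hk') (Finset.mem_range.1 hk), mul_zero]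
  rw [hs, Finset.sum_range_succ, ← add_assoc, h i le_rfl]

lemma deriv_smoothTransition_of_nonpos {u : ℝ} (hu : u ≤ 0) : deriv Real.smoothTransition u = 0 := by
  refine IsLocalMin.deriv_eq_zero (Eventually.of_forall fun v => ?_)
  rw [Real.smoothTransition.zero_of_nonpos hu]
  exact Real.smoothTransition.nonneg v

lemma deriv_smoothTransition_of_one_le {u : ℝ} (hu : 1 ≤ u) : deriv Real.smoothTransition u = 0 := by
  refine IsLocalMax.deriv_eq_zero (Eventually.of_forall fun v => ?_)
  rw [Real.smoothTransition.one_of_one_le hu]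
  exact Real.smoothTransition.le_one v

lemma exists_deriv_smoothTransition_bound :
    ∃ C, 1 ≤ C ∧ ∀ u : ℝ, |deriv Real.smoothTransition u| ≤ C := by
  have hcont : Continuous (deriv Real.smoothTransition) :=
    (Real.smoothTransition.contDiff (n := 1)).continuous_deriv le_rfl
  obtain ⟨C, hC⟩ := isCompact_Icc.exists_bound_of_continuousOn (s := Icc (0 : ℝ) 1)
    hcont.continuousOn
  refine ⟨max C 1, le_max_right _ _, fun u => ?_⟩
  rcases le_or_gt u 0 with h | h
  · rw [deriv_smoothTransition_of_nonpos h]; simp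
  rcases le_or_gt 1 u with h' | h'
  · rw [deriv_smoothTransition_of_one_le h']; simp
  · exact (hC u ⟨h.le, h'.le⟩).trans (le_max_left _ _)


/-- Smooth interpolation of a function on `ℤ`, at mesh width `w`, using nodes in `[-J, J]`. -/
noncomputable def meshInterp (J : ℕ) (w : ℝ) (c : ℤ → ℝ) (x : ℝ) : ℝ :=
  c (-J - 1) + ∑ k ∈ Finset.range (2 * J + 1), (c ((k + 1 : ℕ) - J - 1) - c (k - J - 1)) *
    Real.smoothTransition (x / w - (k - J))

/-- The derivative of `meshInterp`. -/
noncomputable def meshInterpDeriv (J : ℕ) (w : ℝ) (c : ℤ → ℝ) (x : ℝ) : ℝ :=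
  ∑ k ∈ Finset.range (2 * J + 1), (c ((k + 1 : ℕ) - J - 1) - c (k - J - 1)) *
    (deriv Real.smoothTransition (x / w - (k - J)) / w)

lemma contDiff_meshInterp (J : ℕ) (w : ℝ) (c : ℤ → ℝ) : ContDiff ℝ 1 (meshInterp J w c) := by
  unfold meshInterp
  refine contDiff_const.add (ContDiff.sum fun k _ => contDiff_const.mul ?_)
  exact Real.smoothTransition.contDiff.comp ((contDiff_id.div_const _).sub contDiff_const)

lemma hasDerivAt_meshInterp (J : ℕ) (w : ℝ) (c : ℤ → ℝ) (x : ℝ) :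
    HasDerivAt (meshInterp J w c) (meshInterpDeriv J w c x) x := by
  unfold meshInterp meshInterpDeriv
  refine HasDerivAt.const_add _ (HasDerivAt.fun_sum fun k _ => HasDerivAt.const_mul _ ?_)
  have h1 : HasDerivAt Real.smoothTransition
      (deriv Real.smoothTransition (x / w - (k - J))) (x / w - (k - J)) :=
    ((Real.smoothTransition.contDiff (n := 1)).differentiable one_ne_zero _).hasDerivAt
  have h2 : HasDerivAt (fun x : ℝ => x / w - (k - J)) (1 / w) x :=
    ((hasDerivAt_id x).div_const w).sub_const _
  simpa [Function.comp_def, div_eq_mul_inv] using h1.comp x h2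

lemma meshInterp_eq {J : ℕ} {w : ℝ} (c : ℤ → ℝ) {x : ℝ} (h1 : -J ≤ ⌊x / w⌋) (h2 : ⌊x / w⌋ ≤ J) :
    meshInterp J w c x = c (⌊x / w⌋ - 1) + (c ⌊x / w⌋ - c (⌊x / w⌋ - 1)) *
      Real.smoothTransition (x / w - ⌊x / w⌋) := by
  set j := ⌊x / w⌋ with hj
  obtain ⟨i, hi⟩ := Int.eq_ofNat_of_zero_le (show 0 ≤ j + J by linarith)
  have hiN : i < 2 * J + 1 := by omega
  have := interp_eq_of_step (N := 2 * J + 1) (fun k => c (k - J - 1))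
    (fun k => Real.smoothTransition (x / w - (k - J))) hiN (fun k hk => ?_) (fun k hk _ => ?_)
  · have e1 : (i : ℤ) - J - 1 = j - 1 := by omega
    have e2 : ((i + 1 : ℕ) : ℤ) - J - 1 = j := by push_cast; omega
    have e3 : (i : ℝ) - J = j := by
      have : ((j + J : ℤ) : ℝ) = ((i : ℕ) : ℤ) := by rw [hi]
      push_cast at this; linarith
    rw [e1, e2, e3] at this
    rw [← this]
    simp [meshInterp]
  · refine Real.smoothTransition.one_of_one_le ?_
    have h3 : (j : ℝ) ≤ x / w := Int.floor_le _
    have h4 : ((k : ℤ) + 1 - J : ℤ) ≤ j := by omega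
    have h5 : (((k : ℤ) + 1 - J : ℤ) : ℝ) ≤ j := by exact_mod_cast h4
    push_cast at h5
    linarith
  · refine Real.smoothTransition.zero_of_nonpos ?_
    have h3 : x / w < j + 1 := Int.lt_floor_add_one _
    have h4 : j + 1 ≤ ((k : ℤ) - J : ℤ) := by omega
    have h5 : (j : ℝ) + 1 ≤ (((k : ℤ) - J : ℤ) : ℝ) := by exact_mod_cast h4
    push_cast at h5
    linarith

lemma abs_meshInterpDeriv_le {C : ℝ} (hC : ∀ u : ℝ, |deriv Real.smoothTransition u| ≤ C)
    {J : ℕ} {w : ℝ} (hw : 0 < w) (c : ℤ → ℝ) {x : ℝ} (h1 : -J ≤ ⌊x / w⌋) (h2 : ⌊x / w⌋ ≤ J) :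
    |meshInterpDeriv J w c x| ≤ C / w * |c ⌊x / w⌋ - c (⌊x / w⌋ - 1)| := by
  set j := ⌊x / w⌋ with hj
  obtain ⟨i, hi⟩ := Int.eq_ofNat_of_zero_le (show 0 ≤ j + J by linarith)
  have hiN : i < 2 * J + 1 := by omega
  have h : meshInterpDeriv J w c x = (c ((i + 1 : ℕ) - J - 1) - c (i - J - 1)) *
      (deriv Real.smoothTransition (x / w - (i - J)) / w) := by
    refine Finset.sum_eq_single i (fun k _ hk => ?_) (fun h => absurd (Finset.mem_range.2 hiN) h)
    suffices deriv Real.smoothTransition (x / w - (k - J)) = 0 by simp [this]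
    rcases lt_or_gt_of_ne hk with hk | hk
    · refine deriv_smoothTransition_of_one_le ?_
      have h3 : (j : ℝ) ≤ x / w := Int.floor_le _
      have h4 : ((k : ℤ) + 1 - J : ℤ) ≤ j := by omega
      have h5 : (((k : ℤ) + 1 - J : ℤ) : ℝ) ≤ j := by exact_mod_cast h4
      push_cast at h5
      linarith
    · refine deriv_smoothTransition_of_nonpos ?_
      have h3 : x / w < j + 1 := Int.lt_floor_add_one _
      have h4 : j + 1 ≤ ((k : ℤ) - J : ℤ) := by omega
      have h5 : (j : ℝ) + 1 ≤ (((k : ℤ) - J : ℤ) : ℝ) := by exact_mod_cast h4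
      push_cast at h5
      linarith
  have e1 : (i : ℤ) - J - 1 = j - 1 := by omega
  have e2 : ((i + 1 : ℕ) : ℤ) - J - 1 = j := by push_cast; omega
  rw [h, e1, e2, abs_mul, abs_div, abs_of_pos hw, mul_comm]
  exact mul_le_mul_of_nonneg_right (div_le_div_of_nonneg_right (hC _) hw.le) (abs_nonneg _)

end

section
open Set Filter Topology Complex

/-- Smooth interpolation of a function on a multiscale mesh in the plane. -/
noncomputable def planeInterp (J L : ℕ) (w Y : ℕ → ℝ) (c : ℕ → ℤ → ℝ) (z : ℂ) : ℝ :=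
  meshInterp J (w 0) (c 0) z.re + ∑ k ∈ Finset.range L,
    (meshInterp J (w (k + 1)) (c (k + 1)) z.re - meshInterp J (w k) (c k) z.re) *
      Real.smoothTransition ((Y k - z.im) / (Y k - Y (k + 1)))

/-- The differential of `planeInterp`. -/
noncomputable def planeInterpDeriv (J L : ℕ) (w Y : ℕ → ℝ) (c : ℕ → ℤ → ℝ) (z : ℂ) : ℂ →L[ℝ] ℝ :=
  meshInterpDeriv J (w 0) (c 0) z.re • reCLM + ∑ k ∈ Finset.range L,
    ((meshInterp J (w (k + 1)) (c (k + 1)) z.re - meshInterp J (w k) (c k) z.re) •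
      ((deriv Real.smoothTransition ((Y k - z.im) / (Y k - Y (k + 1))) * (-1 / (Y k - Y (k + 1)))) •
        imCLM) +
      Real.smoothTransition ((Y k - z.im) / (Y k - Y (k + 1))) •
      ((meshInterpDeriv J (w (k + 1)) (c (k + 1)) z.re - meshInterpDeriv J (w k) (c k) z.re) •
        reCLM))

lemma contDiff_planeInterp (J L : ℕ) (w Y : ℕ → ℝ) (c : ℕ → ℤ → ℝ) :
    ContDiff ℝ 1 (planeInterp J L w Y c) := by
  unfold planeInterp
  have hm : ∀ k, ContDiff ℝ 1 fun z : ℂ => meshInterp J (w k) (c k) z.re := fun k =>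
    (contDiff_meshInterp J (w k) (c k)).comp reCLM.contDiff
  refine (hm 0).add (ContDiff.sum fun k _ => ((hm (k + 1)).sub (hm k)).mul ?_)
  exact Real.smoothTransition.contDiff.comp
    ((contDiff_const.sub imCLM.contDiff).div_const _)

lemma hasFDerivAt_planeInterp (J L : ℕ) (w Y : ℕ → ℝ) (c : ℕ → ℤ → ℝ) (z : ℂ) :
    HasFDerivAt (planeInterp J L w Y c) (planeInterpDeriv J L w Y c z) z := by
  unfold planeInterp planeInterpDeriv
  have hm : ∀ k, HasFDerivAt (fun z : ℂ => meshInterp J (w k) (c k) z.re)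
      (meshInterpDeriv J (w k) (c k) z.re • reCLM) z := fun k =>
    (hasDerivAt_meshInterp J (w k) (c k) z.re).comp_hasFDerivAt z reCLM.hasFDerivAt
  refine (hm 0).add (HasFDerivAt.fun_sum fun k _ => ?_)
  refine HasFDerivAt.mul (((hm (k + 1)).sub (hm k)).congr_fderiv (sub_smul _ _ _).symm) ?_
  have h1 : HasDerivAt Real.smoothTransition
      (deriv Real.smoothTransition ((Y k - z.im) / (Y k - Y (k + 1))))
      ((Y k - z.im) / (Y k - Y (k + 1))) :=
    ((Real.smoothTransition.contDiff (n := 1)).differentiable one_ne_zero _).hasDerivAt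
  have h2 : HasDerivAt (fun y : ℝ => (Y k - y) / (Y k - Y (k + 1))) (-1 / (Y k - Y (k + 1))) z.im :=
    ((hasDerivAt_id z.im).const_sub (Y k)).div_const _
  exact (h1.comp z.im h2).comp_hasFDerivAt z imCLM.hasFDerivAt

section
variable {J L : ℕ} {w Y : ℕ → ℝ} {c : ℕ → ℤ → ℝ} {z : ℂ} {i : ℕ}

lemma step_eq_one (hY : StrictAnti Y) (h2 : z.im ≤ Y i) {k : ℕ} (hk : k < i) :
    1 ≤ (Y k - z.im) / (Y k - Y (k + 1)) := by
  rw [le_div_iff₀ (sub_pos.2 (hY (Nat.lt_succ_self k)))]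
  have := hY.antitone (show k + 1 ≤ i from hk)
  linarith

lemma step_eq_zero (hY : StrictAnti Y) (h1 : Y (i + 1) ≤ z.im) {k : ℕ} (hk : i < k) :
    (Y k - z.im) / (Y k - Y (k + 1)) ≤ 0 := by
  refine div_nonpos_of_nonpos_of_nonneg ?_ (sub_pos.2 (hY (Nat.lt_succ_self k))).le
  have := hY.antitone (show i + 1 ≤ k from hk)
  linarith

lemma planeInterp_eq (hY : StrictAnti Y) (hi : i < L) (h1 : Y (i + 1) ≤ z.im) (h2 : z.im ≤ Y i) :
    planeInterp J L w Y c z = meshInterp J (w i) (c i) z.re +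
      (meshInterp J (w (i + 1)) (c (i + 1)) z.re - meshInterp J (w i) (c i) z.re) *
      Real.smoothTransition ((Y i - z.im) / (Y i - Y (i + 1))) :=
  interp_eq_of_step (fun k => meshInterp J (w k) (c k) z.re)
    (fun k => Real.smoothTransition ((Y k - z.im) / (Y k - Y (k + 1)))) hi
    (fun _ hk => Real.smoothTransition.one_of_one_le (step_eq_one hY h2 hk))
    (fun _ hk _ => Real.smoothTransition.zero_of_nonpos (step_eq_zero hY h1 hk))

lemma planeInterpDeriv_apply (hY : StrictAnti Y) (hi : i < L) (h1 : Y (i + 1) ≤ z.im)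
    (h2 : z.im ≤ Y i) (v : ℂ) :
    planeInterpDeriv J L w Y c z v = v.re * (meshInterpDeriv J (w i) (c i) z.re +
      (meshInterpDeriv J (w (i + 1)) (c (i + 1)) z.re - meshInterpDeriv J (w i) (c i) z.re) *
      Real.smoothTransition ((Y i - z.im) / (Y i - Y (i + 1)))) +
      v.im * ((meshInterp J (w (i + 1)) (c (i + 1)) z.re - meshInterp J (w i) (c i) z.re) *
        (deriv Real.smoothTransition ((Y i - z.im) / (Y i - Y (i + 1))) *
          (-1 / (Y i - Y (i + 1))))) := by
  have e1 := interp_eq_of_step (fun k => meshInterpDeriv J (w k) (c k) z.re)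
    (fun k => Real.smoothTransition ((Y k - z.im) / (Y k - Y (k + 1)))) hi
    (fun _ hk => Real.smoothTransition.one_of_one_le (step_eq_one hY h2 hk))
    (fun _ hk _ => Real.smoothTransition.zero_of_nonpos (step_eq_zero hY h1 hk))
  have e2 : ∑ k ∈ Finset.range L, (meshInterp J (w (k + 1)) (c (k + 1)) z.re -
      meshInterp J (w k) (c k) z.re) * (deriv Real.smoothTransition
      ((Y k - z.im) / (Y k - Y (k + 1))) * (-1 / (Y k - Y (k + 1)))) =
      (meshInterp J (w (i + 1)) (c (i + 1)) z.re - meshInterp J (w i) (c i) z.re) *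
        (deriv Real.smoothTransition ((Y i - z.im) / (Y i - Y (i + 1))) *
          (-1 / (Y i - Y (i + 1)))) := by
    refine Finset.sum_eq_single i (fun k _ hk => ?_) (fun h => absurd (Finset.mem_range.2 hi) h)
    suffices deriv Real.smoothTransition ((Y k - z.im) / (Y k - Y (k + 1))) = 0 by simp [this]
    rcases lt_or_gt_of_ne hk with hk | hk
    · exact deriv_smoothTransition_of_one_le (step_eq_one hY h2 hk)
    · exact deriv_smoothTransition_of_nonpos (step_eq_zero hY h1 hk)
  rw [← e1, ← e2]
  simp only [planeInterpDeriv, add_apply, sum_apply, smul_apply, reCLM_apply, imCLM_apply,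
    smul_eq_mul, mul_add, Finset.mul_sum, Finset.sum_add_distrib]
  rw [add_assoc, mul_comm v.re, add_right_inj, add_comm]
  congr 1 <;> exact Finset.sum_congr rfl fun k _ => by ring

lemma planeInterp_mem_Icc (hY : StrictAnti Y) (hi : i < L) (h1 : Y (i + 1) ≤ z.im)
    (h2 : z.im ≤ Y i) (hj : ∀ k, k = i ∨ k = i + 1 → -J ≤ ⌊z.re / w k⌋ ∧ ⌊z.re / w k⌋ ≤ J)
    {p q : ℝ} (hc : ∀ k, k = i ∨ k = i + 1 →
      c k ⌊z.re / w k⌋ ∈ Icc p q ∧ c k (⌊z.re / w k⌋ - 1) ∈ Icc p q) :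
    planeInterp J L w Y c z ∈ Icc p q := by
  have key : ∀ {s t u : ℝ}, s ∈ Icc p q → t ∈ Icc p q →
      s + (t - s) * Real.smoothTransition u ∈ Icc p q := by
    intro s t u hs ht
    have := Real.smoothTransition.nonneg u
    have := Real.smoothTransition.le_one u
    constructor <;> nlinarith [hs.1, hs.2, ht.1, ht.2]
  have hm : ∀ k, k = i ∨ k = i + 1 → meshInterp J (w k) (c k) z.re ∈ Icc p q := by
    intro k hk
    rw [meshInterp_eq _ (hj k hk).1 (hj k hk).2]
    exact key (hc k hk).2 (hc k hk).1
  rw [planeInterp_eq hY hi h1 h2]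
  exact key (hm i (Or.inl rfl)) (hm (i + 1) (Or.inr rfl))

lemma abs_meshInterp_sub_le {w : ℝ} (c : ℤ → ℝ) {x : ℝ} (h1 : -J ≤ ⌊x / w⌋) (h2 : ⌊x / w⌋ ≤ J) :
    |meshInterp J w c x - c ⌊x / w⌋| ≤ |c ⌊x / w⌋ - c (⌊x / w⌋ - 1)| := by
  rw [meshInterp_eq _ h1 h2]
  set T := Real.smoothTransition (x / w - ⌊x / w⌋)
  have h0 : 0 ≤ T := Real.smoothTransition.nonneg _
  have h1 : T ≤ 1 := Real.smoothTransition.le_one _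
  rw [show c (⌊x / w⌋ - 1) + (c ⌊x / w⌋ - c (⌊x / w⌋ - 1)) * T - c ⌊x / w⌋ =
    -((1 - T) * (c ⌊x / w⌋ - c (⌊x / w⌋ - 1))) by ring, abs_neg, abs_mul,
    abs_of_nonneg (by linarith : 0 ≤ 1 - T)]
  exact mul_le_of_le_one_left (abs_nonneg _) (by linarith)

lemma norm_fderiv_planeInterp_le {C : ℝ} (hC : ∀ u : ℝ, |deriv Real.smoothTransition u| ≤ C)
    (hw : ∀ k, 0 < w k) (hY : StrictAnti Y) (hi : i < L) (h1 : Y (i + 1) ≤ z.im)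
    (h2 : z.im ≤ Y i) (hj : ∀ k, k = i ∨ k = i + 1 → -J ≤ ⌊z.re / w k⌋ ∧ ⌊z.re / w k⌋ ≤ J) :
    ‖fderiv ℝ (planeInterp J L w Y c) z‖ ≤
      C * (1 / w i + 1 / w (i + 1) + 1 / (Y i - Y (i + 1))) *
      (|c i ⌊z.re / w i⌋ - c i (⌊z.re / w i⌋ - 1)| +
       |c (i + 1) ⌊z.re / w (i + 1)⌋ - c (i + 1) (⌊z.re / w (i + 1)⌋ - 1)| +
       |c i ⌊z.re / w i⌋ - c (i + 1) ⌊z.re / w (i + 1)⌋|) := by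
  have hC0 : 0 ≤ C := (abs_nonneg _).trans (hC 0)
  have hYp : 0 < Y i - Y (i + 1) := sub_pos.2 (hY (Nat.lt_succ_self i))
  have hwi := hw i
  have hwi' := hw (i + 1)
  rw [(hasFDerivAt_planeInterp J L w Y c z).fderiv]
  obtain ⟨a1, a2⟩ := hj i (Or.inl rfl)
  obtain ⟨b1, b2⟩ := hj (i + 1) (Or.inr rfl)
  have d1 := abs_meshInterpDeriv_le hC hwi (c i) a1 a2
  have d2 := abs_meshInterpDeriv_le hC hwi' (c (i + 1)) b1 b2
  have m1 := abs_meshInterp_sub_le (c i) a1 a2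
  have m2 := abs_meshInterp_sub_le (c (i + 1)) b1 b2
  set α := |c i ⌊z.re / w i⌋ - c i (⌊z.re / w i⌋ - 1)|
  set β := |c (i + 1) ⌊z.re / w (i + 1)⌋ - c (i + 1) (⌊z.re / w (i + 1)⌋ - 1)|
  set γ := |c i ⌊z.re / w i⌋ - c (i + 1) ⌊z.re / w (i + 1)⌋| with hγ
  have hα : 0 ≤ α := abs_nonneg _
  have hβ : 0 ≤ β := abs_nonneg _
  have hγ0 : 0 ≤ γ := abs_nonneg _
  refine ContinuousLinearMap.opNorm_le_bound _ (by positivity) fun v => ?_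
  rw [planeInterpDeriv_apply hY hi h1 h2, Real.norm_eq_abs]
  set T := Real.smoothTransition ((Y i - z.im) / (Y i - Y (i + 1)))
  have hT0 : 0 ≤ T := Real.smoothTransition.nonneg _
  have hT1 : T ≤ 1 := Real.smoothTransition.le_one _
  set M1 := meshInterp J (w i) (c i) z.re
  set M2 := meshInterp J (w (i + 1)) (c (i + 1)) z.re
  set D1 := meshInterpDeriv J (w i) (c i) z.re
  set D2 := meshInterpDeriv J (w (i + 1)) (c (i + 1)) z.re
  have hx : |D1 + (D2 - D1) * T| ≤ C / w i * α + C / w (i + 1) * β := by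
    rw [show D1 + (D2 - D1) * T = (1 - T) * D1 + T * D2 by ring]
    refine (abs_add_le _ _).trans (add_le_add ?_ ?_)
    · rw [abs_mul, abs_of_nonneg (by linarith : 0 ≤ 1 - T)]
      exact (mul_le_of_le_one_left (abs_nonneg _) (by linarith)).trans d1
    · rw [abs_mul, abs_of_nonneg hT0]
      exact (mul_le_of_le_one_left (abs_nonneg _) hT1).trans d2
  have hM : |M2 - M1| ≤ α + β + γ := by
    have : M2 - M1 = (M2 - c (i + 1) ⌊z.re / w (i + 1)⌋) - (M1 - c i ⌊z.re / w i⌋) -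
      (c i ⌊z.re / w i⌋ - c (i + 1) ⌊z.re / w (i + 1)⌋) := by ring
    rw [this]
    refine (abs_sub _ _).trans ?_
    have := abs_sub (M2 - c (i + 1) ⌊z.re / w (i + 1)⌋) (M1 - c i ⌊z.re / w i⌋)
    linarith
  have hy : |(M2 - M1) * (deriv Real.smoothTransition ((Y i - z.im) / (Y i - Y (i + 1))) *
      (-1 / (Y i - Y (i + 1))))| ≤ C * (1 / (Y i - Y (i + 1))) * (α + β + γ) := by
    rw [abs_mul, abs_mul, abs_div, abs_neg, abs_one, abs_of_pos hYp, mul_comm]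
    exact mul_le_mul (mul_le_mul_of_nonneg_right (hC _) (by positivity)) hM (abs_nonneg _)
      (by positivity)
  refine (abs_add_le _ _).trans ?_
  rw [abs_mul, abs_mul]
  have n1 := abs_re_le_norm v
  have n2 := abs_im_le_norm v
  calc |v.re| * |D1 + (D2 - D1) * T| + |v.im| * _
      ≤ ‖v‖ * (C / w i * α + C / w (i + 1) * β) +
        ‖v‖ * (C * (1 / (Y i - Y (i + 1))) * (α + β + γ)) :=
        add_le_add (mul_le_mul n1 hx (abs_nonneg _) (norm_nonneg _))
          (mul_le_mul n2 hy (abs_nonneg _) (norm_nonneg _))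
    _ ≤ _ := by
        have q1 : C / w i * α + C / w (i + 1) * β ≤
            C * (1 / w i + 1 / w (i + 1)) * (α + β + γ) := by
          have e : C * (1 / w i + 1 / w (i + 1)) * (α + β + γ) -
            (C / w i * α + C / w (i + 1) * β) =
            C / w i * (β + γ) + C / w (i + 1) * (α + γ) := by ring
          have : 0 ≤ C / w i * (β + γ) + C / w (i + 1) * (α + γ) := by positivity
          linarith
        calc _ ≤ ‖v‖ * (C * (1 / w i + 1 / w (i + 1)) * (α + β + γ)) +
              ‖v‖ * (C * (1 / (Y i - Y (i + 1))) * (α + β + γ)) := by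
              have := mul_le_mul_of_nonneg_left q1 (norm_nonneg v)
              linarith
          _ = _ := by ring

end

end

section
open MeasureTheory Set Filter Topology
open scoped ENNReal

/-- A set is dyadic of order `n` if it is a union of dyadic intervals of length `2⁻ⁿ`. -/
def IsDyadicSet (n : ℕ) (E : Set ℝ) : Prop :=
  ∀ x y : ℝ, ⌊x / (1 / 2 : ℝ) ^ n⌋ = ⌊y / (1 / 2 : ℝ) ^ n⌋ → x ∈ E → y ∈ E

/-- The dyadic interval of length `2⁻ⁿ` with index `j`. -/
def dyadicIco (n : ℕ) (j : ℤ) : Set ℝ := {x | ⌊x / (1 / 2 : ℝ) ^ n⌋ = j}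

lemma floor_dyadic_of_succ {n : ℕ} {x y : ℝ}
    (h : ⌊x / (1 / 2 : ℝ) ^ (n + 1)⌋ = ⌊y / (1 / 2 : ℝ) ^ (n + 1)⌋) :
    ⌊x / (1 / 2 : ℝ) ^ n⌋ = ⌊y / (1 / 2 : ℝ) ^ n⌋ := by
  have e : ∀ x : ℝ, x / (1 / 2 : ℝ) ^ n = x / (1 / 2 : ℝ) ^ (n + 1) / (2 : ℕ) := fun x => by
    rw [pow_succ]; push_cast; field_simp
  rw [e x, e y, Int.floor_div_natCast, Int.floor_div_natCast, h]

lemma floor_dyadic_mono {n m : ℕ} (hnm : n ≤ m) {x y : ℝ}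
    (h : ⌊x / (1 / 2 : ℝ) ^ m⌋ = ⌊y / (1 / 2 : ℝ) ^ m⌋) :
    ⌊x / (1 / 2 : ℝ) ^ n⌋ = ⌊y / (1 / 2 : ℝ) ^ n⌋ := by
  induction m, hnm using Nat.le_induction with
  | base => exact h
  | succ m _ ih => exact ih (floor_dyadic_of_succ h)

lemma IsDyadicSet.mono {n m : ℕ} (hnm : n ≤ m) {E : Set ℝ} (hE : IsDyadicSet n E) :
    IsDyadicSet m E := fun x y h => hE x y (floor_dyadic_mono hnm h)

lemma IsDyadicSet.inter {n : ℕ} {E F : Set ℝ} (hE : IsDyadicSet n E) (hF : IsDyadicSet n F) :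
    IsDyadicSet n (E ∩ F) := fun x y h hx => ⟨hE x y h hx.1, hF x y h hx.2⟩

lemma IsDyadicSet.compl {n : ℕ} {E : Set ℝ} (hE : IsDyadicSet n E) : IsDyadicSet n Eᶜ :=
  fun x y h hx hy => hx (hE y x h.symm hy)

lemma isDyadicSet_dyadicIco (n : ℕ) (j : ℤ) : IsDyadicSet n (dyadicIco n j) :=
  fun _ _ h hx => h.symm.trans hx

lemma measurable_floor_dyadic (n : ℕ) : Measurable fun x : ℝ => ⌊x / (1 / 2 : ℝ) ^ n⌋ :=
  Int.measurable_floor.comp (measurable_id.div_const _)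

lemma IsDyadicSet.measurableSet {n : ℕ} {E : Set ℝ} (hE : IsDyadicSet n E) : MeasurableSet E := by
  have : E = (fun x : ℝ => ⌊x / (1 / 2 : ℝ) ^ n⌋) ⁻¹' ((fun x : ℝ => ⌊x / (1 / 2 : ℝ) ^ n⌋) '' E) := by
    refine (subset_preimage_image _ _).antisymm ?_
    rintro x ⟨y, hy, hxy⟩
    exact hE y x hxy hy
  rw [this]
  exact measurable_floor_dyadic n (MeasurableSet.of_discrete)

lemma dyadicIco_eq_Ico (n : ℕ) (j : ℤ) :
    dyadicIco n j = Ico (j * (1 / 2 : ℝ) ^ n) ((j + 1) * (1 / 2 : ℝ) ^ n) := by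
  ext x
  have h : (0 : ℝ) < (1 / 2) ^ n := by positivity
  simp only [dyadicIco, mem_ofPred_eq, Int.floor_eq_iff, mem_Ico]
  rw [le_div_iff₀ h, div_lt_iff₀ h]

lemma volume_dyadicIco (n : ℕ) (j : ℤ) :
    volume (dyadicIco n j) = ENNReal.ofReal ((1 / 2 : ℝ) ^ n) := by
  rw [dyadicIco_eq_Ico, Real.volume_Ico]
  congr 1; ring

lemma lintegral_le_of_dyadicIco {n : ℕ} {E : Set ℝ} (hE : IsDyadicSet n E) {f : ℝ → ℝ≥0∞}
    {K : ℝ≥0∞} (h : ∀ j, ∫⁻ x in dyadicIco n j, f x ≤ K * volume (dyadicIco n j)) :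
    ∫⁻ x in E, f x ≤ K * volume E := by
  have hU : E = ⋃ j, (E ∩ dyadicIco n j) := by
    ext x; simp [dyadicIco]
  have hm : ∀ j, MeasurableSet (E ∩ dyadicIco n j) := fun j =>
    (hE.inter (isDyadicSet_dyadicIco n j)).measurableSet
  have hd : Pairwise (Function.onFun Disjoint fun j => E ∩ dyadicIco n j) := by
    intro i j hij
    refine Set.disjoint_left.2 fun x hx hx' => hij ?_
    exact hx.2.symm.trans hx'.2
  rw [hU, lintegral_iUnion hm hd, measure_iUnion hd hm, ← ENNReal.tsum_mul_left]
  refine ENNReal.tsum_le_tsum fun j => ?_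
  by_cases hj : ∃ x, x ∈ E ∩ dyadicIco n j
  · obtain ⟨x, hx, hxj⟩ := hj
    have : E ∩ dyadicIco n j = dyadicIco n j :=
      inter_eq_right.2 fun y hy => hE x y (hxj.trans hy.symm) hx
    rw [this]; exact h j
  · have : E ∩ dyadicIco n j = ∅ := not_nonempty_iff_eq_empty.1 hj
    simp [this]

section
variable (Bd Gd : ℕ → ℝ → Prop)

open Classical in
/-- Two-state automaton: bad nodes switch it on, good nodes switch it off. -/
noncomputable def nextState (s : Bool) (m : ℕ) (x : ℝ) : Bool :=
  if Bd m x then true else if Gd m x then false else s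

/-- Number of switches in `F` steps from level `m`. -/
noncomputable def switchCount : Bool → ℕ → ℕ → ℝ → ℕ
  | _, 0, _, _ => 0
  | s, F + 1, m, x => (if nextState Bd Gd s m x = s then 0 else 1) +
      switchCount (nextState Bd Gd s m x) F (m + 1) x

variable {Bd Gd}

lemma switchCount_le_add_one (s s' : Bool) (F m : ℕ) (x : ℝ) :
    switchCount Bd Gd s F m x ≤ switchCount Bd Gd s' F m x + 1 := by
  induction F generalizing m with
  | zero => simp [switchCount]
  | succ F ih =>
    have ih := ih (m + 1)
    by_cases hB : Bd m x
    · simp only [switchCount, nextState, hB, if_true]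
      split_ifs <;> omega
    · by_cases hG : Gd m x
      · simp only [switchCount, nextState, hB, hG, if_true, if_false]
        split_ifs <;> omega
      · simp only [switchCount, nextState, hB, hG, if_true, if_false]
        omega

lemma switchCount_add_le (s : Bool) (p F m : ℕ) (x : ℝ) :
    switchCount Bd Gd s (p + F) m x ≤ p + 1 + switchCount Bd Gd true F (m + p) x := by
  induction p generalizing s m with
  | zero =>
    have := switchCount_le_add_one (Bd := Bd) (Gd := Gd) s true F m x
    simpa [add_comm] using this
  | succ p ih =>
    have := ih (nextState Bd Gd s m x) (m + 1)
    rw [show p + 1 + F = (p + F) + 1 by ring]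
    simp only [switchCount]
    rw [show m + (p + 1) = m + 1 + p by ring]
    split_ifs <;> omega

lemma switchCount_true_of_not_good {p F m : ℕ} {x : ℝ} (h : ∀ i < p, ¬ Gd (m + i) x) :
    switchCount Bd Gd true (p + F) m x = switchCount Bd Gd true F (m + p) x := by
  induction p generalizing m with
  | zero => simp
  | succ p ih =>
    have h0 : ¬ Gd m x := by simpa using h 0 (Nat.succ_pos p)
    have h1 : nextState Bd Gd true m x = true := by simp [nextState, h0]
    rw [show p + 1 + F = (p + F) + 1 by ring]
    simp only [switchCount, h1, if_true, zero_add]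
    rw [ih fun i hi => by
      have := h (i + 1) (by omega)
      rwa [show m + (i + 1) = m + 1 + i by ring] at this]
    congr 1; ring

lemma switchCount_false_of_not_bad {F m : ℕ} {x : ℝ} (h : ¬ Bd m x) :
    switchCount Bd Gd false (F + 1) m x = switchCount Bd Gd false F (m + 1) x := by
  have h1 : nextState Bd Gd false m x = false := by simp [nextState, h]
  simp [switchCount, h1]

/-- Hypotheses on the bad and good nodes of a mesh with `H` levels per octave. -/
structure SwitchData (H k : ℕ) (Bd Gd : ℕ → ℝ → Prop) : Prop where
  H_pos : 0 < H
  k_pos : 0 < k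
  bad : ∀ m, IsDyadicSet (k + m / H) {x | Bd m x}
  pack : ∀ m x, Gd m x → volume {x' | x' ∈ dyadicIco (m / H) ⌊x / (1 / 2 : ℝ) ^ (m / H)⌋ ∧
    ∃ m', m / H * H ≤ m' ∧ Bd m' x'} ≤ ENNReal.ofReal ((1 / 2 : ℝ) ^ (m / H)) / 4

namespace SwitchData
variable {H k : ℕ} (h : SwitchData H k Bd Gd)
include h

lemma lintegral_switchCount_false_le {F : ℕ}
    (hQ : ∀ F' < F, ∀ n E, IsDyadicSet n E →
      ∫⁻ x in E, (switchCount Bd Gd true F' (n * H) x : ℝ≥0∞) ≤ ((k * H + 2 : ℕ) : ℝ≥0∞) * volume E)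
    {F' : ℕ} (hF' : F' ≤ F) {m : ℕ} {E : Set ℝ} (hE : IsDyadicSet (k + m / H) E) :
    ∫⁻ x in E, (switchCount Bd Gd false F' m x : ℝ≥0∞) ≤
      ((2 * (k * H) + 3 : ℕ) : ℝ≥0∞) * volume (E ∩ {x | ∃ i < F', Bd (m + i) x}) := by
  induction F' generalizing m E with
  | zero => simp [switchCount]
  | succ F' ih =>
    have hH := h.H_pos
    have hE1 := hE.inter (h.bad m)
    have hE2 := hE.inter (h.bad m).compl
    have hmB := (h.bad m).measurableSet
    rw [← lintegral_inter_add_sdiff _ E hmB, ← measure_inter_add_sdiff _ hmB, mul_add]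
    refine add_le_add ?_ ?_
    · have e : E ∩ {x | ∃ i < F' + 1, Bd (m + i) x} ∩ {x | Bd m x} = E ∩ {x | Bd m x} := by
        ext x
        simp only [mem_inter_iff, mem_ofPred_eq]
        exact ⟨fun hx => ⟨hx.1.1, hx.2⟩, fun hx => ⟨⟨hx.1, 0, by omega, by simpa using hx.2⟩, hx.2⟩⟩
      rw [e]
      set p := (k + m / H) * H - m with hp
      have hk := h.k_pos
      have hm1 : m / H * H ≤ m := Nat.div_mul_le_self m H
      have hm2 : m < m / H * H + H := by
        have := Nat.lt_div_mul_add hH (a := m); omega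
      have hkH : H ≤ k * H := Nat.le_mul_of_pos_left H hk
      have hexp : (k + m / H) * H = k * H + m / H * H := by ring
      have hp0 : 0 < p := by omega
      have hpk : p ≤ k * H := by omega
      have hmp : m + p = (k + m / H) * H := by omega
      have hle : ∀ x, switchCount Bd Gd false (F' + 1) m x ≤
          k * H + 1 + switchCount Bd Gd true (F' + 1 - p) ((k + m / H) * H) x := by
        intro x
        rcases le_total (F' + 1) p with hc | hc
        · have := switchCount_add_le (Bd := Bd) (Gd := Gd) false (F' + 1) 0 m x
          simp only [switchCount, add_zero] at this
          simp only [Nat.sub_eq_zero_of_le hc]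
          simp only [switchCount] at this ⊢
          omega
        · have := switchCount_add_le (Bd := Bd) (Gd := Gd) false p (F' + 1 - p) m x
          rw [hmp, Nat.add_sub_cancel' hc] at this
          omega
      calc ∫⁻ x in E ∩ {x | Bd m x}, (switchCount Bd Gd false (F' + 1) m x : ℝ≥0∞)
          ≤ ∫⁻ x in E ∩ {x | Bd m x}, (((k * H + 1 : ℕ) : ℝ≥0∞) +
            (switchCount Bd Gd true (F' + 1 - p) ((k + m / H) * H) x : ℝ≥0∞)) :=
            lintegral_mono fun x => by
              rw [← Nat.cast_add]; exact Nat.cast_le.2 (hle x)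
        _ = ((k * H + 1 : ℕ) : ℝ≥0∞) * volume (E ∩ {x | Bd m x}) +
            ∫⁻ x in E ∩ {x | Bd m x},
              (switchCount Bd Gd true (F' + 1 - p) ((k + m / H) * H) x : ℝ≥0∞) := by
            rw [lintegral_add_left measurable_const, setLIntegral_const]
        _ ≤ ((k * H + 1 : ℕ) : ℝ≥0∞) * volume (E ∩ {x | Bd m x}) +
            ((k * H + 2 : ℕ) : ℝ≥0∞) * volume (E ∩ {x | Bd m x}) := by
            gcongr
            exact hQ _ (by omega) _ _ hE1
        _ = _ := by
            rw [← add_mul, ← Nat.cast_add]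
            congr 2; ring
    · have e : (E ∩ {x | ∃ i < F' + 1, Bd (m + i) x}) \ {x | Bd m x} =
          (E ∩ {x | Bd m x}ᶜ) ∩ {x | ∃ i < F', Bd (m + 1 + i) x} := by
        ext x
        simp only [mem_inter_iff, Set.mem_sdiff, mem_ofPred_eq, mem_compl_iff]
        constructor
        · rintro ⟨⟨h1, i, hi, h2⟩, h3⟩
          refine ⟨⟨h1, h3⟩, ?_⟩
          cases i with
          | zero => exact absurd (by simpa using h2) h3
          | succ i => exact ⟨i, by omega, by rwa [show m + 1 + i = m + (i + 1) by ring]⟩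
        · rintro ⟨⟨h1, h3⟩, i, hi, h2⟩
          exact ⟨⟨h1, i + 1, by omega, by rwa [show m + (i + 1) = m + 1 + i by ring]⟩, h3⟩
      rw [e]
      refine le_trans (le_of_eq ?_) (ih (by omega) (hE2.mono (by gcongr; omega)))
      rw [Set.sdiff_eq]
      refine setLIntegral_congr_fun hE2.measurableSet fun x hx => ?_
      rw [switchCount_false_of_not_bad hx.2]

theorem lintegral_switchCount_true_le (F n : ℕ) {E : Set ℝ} (hE : IsDyadicSet n E) :
    ∫⁻ x in E, (switchCount Bd Gd true F (n * H) x : ℝ≥0∞) ≤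
      ((k * H + 2 : ℕ) : ℝ≥0∞) * volume E := by
  induction F using Nat.strong_induction_on generalizing n E with
  | _ F ih =>
    have hH := h.H_pos
    refine lintegral_le_of_dyadicIco hE fun j => ?_
    have hm := (isDyadicSet_dyadicIco n j).measurableSet
    by_cases hg : ∃ x ∈ dyadicIco n j, ∃ i < H, Gd (n * H + i) x
    · obtain ⟨x₀, hx₀, i, hi, hG⟩ := hg
      have hdiv : (n * H + i) / H = n := by
        rw [Nat.add_comm, Nat.add_mul_div_right _ _ hH, Nat.div_eq_of_lt hi, zero_add]
      have hp := h.pack _ _ hG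
      rw [hdiv, show ⌊x₀ / (1 / 2 : ℝ) ^ n⌋ = j from hx₀] at hp
      have hfalse := h.lintegral_switchCount_false_le (F := F)
        (fun F' hF' n E hE => ih F' hF' n hE) le_rfl (m := n * H)
        ((isDyadicSet_dyadicIco n j).mono (by rw [Nat.mul_div_cancel _ hH]; omega))
      calc ∫⁻ x in dyadicIco n j, (switchCount Bd Gd true F (n * H) x : ℝ≥0∞)
          ≤ ∫⁻ x in dyadicIco n j, (1 + (switchCount Bd Gd false F (n * H) x : ℝ≥0∞)) :=
            lintegral_mono fun x => by
              have := switchCount_le_add_one (Bd := Bd) (Gd := Gd) true false F (n * H) x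
              rw [add_comm, ← Nat.cast_one, ← Nat.cast_add]
              exact Nat.cast_le.2 this
        _ = volume (dyadicIco n j) +
            ∫⁻ x in dyadicIco n j, (switchCount Bd Gd false F (n * H) x : ℝ≥0∞) := by
            rw [lintegral_add_left measurable_const, setLIntegral_const, one_mul]
        _ ≤ volume (dyadicIco n j) + ((2 * (k * H) + 3 : ℕ) : ℝ≥0∞) *
            (volume (dyadicIco n j) / 4) := by
            gcongr
            refine hfalse.trans ?_
            gcongr
            rw [volume_dyadicIco]
            refine le_trans (measure_mono ?_) hp
            rintro x ⟨hx, i, -, hb⟩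
            exact ⟨hx, _, by omega, hb⟩
        _ ≤ _ := by
            rw [volume_dyadicIco]
            set t := (1 / 2 : ℝ) ^ n
            have ht : 0 < t := by positivity
            rw [← ENNReal.ofReal_natCast, ← ENNReal.ofReal_natCast,
              show (4 : ℝ≥0∞) = ENNReal.ofReal 4 by simp, ← ENNReal.ofReal_div_of_pos (by norm_num),
              ← ENNReal.ofReal_mul (by positivity), ← ENNReal.ofReal_mul (by positivity),
              ← ENNReal.ofReal_add ht.le (by positivity)]
            refine ENNReal.ofReal_le_ofReal ?_
            push_cast
            have : (0 : ℝ) ≤ k * H * t := by positivity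
            nlinarith
    · push Not at hg
      rcases le_total F H with hF | hF
      · have : ∀ x ∈ dyadicIco n j, (switchCount Bd Gd true F (n * H) x : ℝ≥0∞) = 0 := by
          intro x hx
          have := switchCount_true_of_not_good (Bd := Bd) (Gd := Gd) (p := F) (F := 0) (m := n * H)
            (x := x) fun i hi => hg x hx i (by omega)
          rw [add_zero] at this
          rw [this]; simp [switchCount]
        rw [setLIntegral_congr_fun hm this]; simp
      · have : ∀ x ∈ dyadicIco n j, (switchCount Bd Gd true F (n * H) x : ℝ≥0∞) =
            (switchCount Bd Gd true (F - H) ((n + 1) * H) x : ℝ≥0∞) := by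
          intro x hx
          have := switchCount_true_of_not_good (Bd := Bd) (Gd := Gd) (p := H) (F := F - H)
            (m := n * H) (x := x) fun i hi => hg x hx i hi
          rw [Nat.add_sub_cancel' hF] at this
          rw [this, add_mul, one_mul]
        rw [setLIntegral_congr_fun hm this]
        exact ih (F - H) (by omega) (n + 1) ((isDyadicSet_dyadicIco n j).mono (by omega))

end SwitchData
end

section
variable (Bd Gd : ℕ → ℝ → Prop)

/-- State of the automaton before level `m` is processed. -/
noncomputable def stateBefore : ℕ → ℝ → Bool
  | 0, _ => false
  | m + 1, x => nextState Bd Gd (stateBefore m x) m x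

open Classical in
/-- Indicator of a switch at level `m`. -/
noncomputable def switchAt (m : ℕ) (x : ℝ) : ℕ :=
  if stateBefore Bd Gd (m + 1) x = stateBefore Bd Gd m x then 0 else 1

open Classical in
/-- Indicator of a difference between horizontally adjacent cells at level `m`. -/
noncomputable def cellJump (H k m : ℕ) (x : ℝ) : ℕ :=
  if stateBefore Bd Gd (m + 1) x = stateBefore Bd Gd (m + 1) (x - (1 / 2) ^ (k + m / H))
  then 0 else 1

variable {Bd Gd}

lemma sum_switchAt (F m : ℕ) (x : ℝ) :
    ∑ i ∈ Finset.range F, switchAt Bd Gd (m + i) x =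
      switchCount Bd Gd (stateBefore Bd Gd m x) F m x := by
  induction F generalizing m with
  | zero => simp [switchCount]
  | succ F ih =>
    rw [Finset.sum_range_succ', switchCount, add_comm]
    congr 1
    rw [← stateBefore, ← ih]
    exact Finset.sum_congr rfl fun i _ => by rw [show m + (i + 1) = m + 1 + i by ring]

lemma floor_dyadic_sub_self {n : ℕ} (x : ℝ) :
    ⌊(x - (1 / 2 : ℝ) ^ n) / (1 / 2 : ℝ) ^ n⌋ = ⌊x / (1 / 2 : ℝ) ^ n⌋ - 1 := by
  have h : (0 : ℝ) < (1 / 2) ^ n := by positivity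
  rw [sub_div, div_self h.ne', Int.floor_sub_one]

lemma floor_dyadic_sub_half {n : ℕ} (x : ℝ) :
    ⌊(x - (1 / 2 : ℝ) ^ (n + 1)) / (1 / 2 : ℝ) ^ n⌋ = ⌊x / (1 / 2 : ℝ) ^ n⌋ ∨
    (⌊(x - (1 / 2 : ℝ) ^ (n + 1)) / (1 / 2 : ℝ) ^ n⌋ = ⌊x / (1 / 2 : ℝ) ^ n⌋ - 1 ∧
      x < (⌊x / (1 / 2 : ℝ) ^ n⌋ + 1 / 2) * (1 / 2 : ℝ) ^ n) := by
  have h : (0 : ℝ) < (1 / 2) ^ n := by positivity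
  have e : (x - (1 / 2 : ℝ) ^ (n + 1)) / (1 / 2 : ℝ) ^ n = x / (1 / 2 : ℝ) ^ n - 1 / 2 := by
    rw [pow_succ]; field_simp
  rw [e]
  set t := x / (1 / 2 : ℝ) ^ n with ht
  have hx : x = t * (1 / 2 : ℝ) ^ n := by rw [ht]; field_simp
  have h1 := Int.floor_le t
  have h2 := Int.lt_floor_add_one t
  by_cases hc : t < ⌊t⌋ + 1 / 2
  · right
    refine ⟨?_, ?_⟩
    · rw [Int.floor_eq_iff]; push_cast; constructor <;> linarith
    · nth_rw 1 [hx]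
      exact mul_lt_mul_of_pos_right hc h
  · left
    rw [Int.floor_eq_iff]; constructor <;> linarith

lemma nextState_congr {m : ℕ} {x y : ℝ} (hB : Bd m x ↔ Bd m y) (hG : Gd m x ↔ Gd m y) (s : Bool) :
    nextState Bd Gd s m x = nextState Bd Gd s m y := by
  by_cases h1 : Bd m y
  · simp [nextState, h1, hB.2 h1]
  · by_cases h2 : Gd m y
    · simp [nextState, h1, hB.not.2 h1, h2, hG.2 h2]
    · simp [nextState, h1, hB.not.2 h1, h2, hG.not.2 h2]

/-- Node predicates which are constant on cells. -/
structure CellData (H k : ℕ) (Bd Gd : ℕ → ℝ → Prop) : Prop extends SwitchData H k Bd Gd where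
  good : ∀ m, IsDyadicSet (k + m / H) {x | Gd m x}

namespace CellData
variable {H k : ℕ} (h : CellData H k Bd Gd)
include h

lemma stateBefore_congr (m : ℕ) {x y : ℝ}
    (hxy : ⌊x / (1 / 2 : ℝ) ^ (k + m / H)⌋ = ⌊y / (1 / 2 : ℝ) ^ (k + m / H)⌋) :
    stateBefore Bd Gd (m + 1) x = stateBefore Bd Gd (m + 1) y := by
  have key : ∀ m, ⌊x / (1 / 2 : ℝ) ^ (k + m / H)⌋ = ⌊y / (1 / 2 : ℝ) ^ (k + m / H)⌋ →
      (Bd m x ↔ Bd m y) ∧ (Gd m x ↔ Gd m y) := fun m hm =>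
    ⟨⟨h.bad m x y hm, h.bad m y x hm.symm⟩, ⟨h.good m x y hm, h.good m y x hm.symm⟩⟩
  induction m with
  | zero =>
    have := key 0 hxy
    exact nextState_congr this.1 this.2 _
  | succ m ih =>
    have h1 := key (m + 1) hxy
    have h2 := ih (floor_dyadic_mono (by gcongr; omega) hxy)
    rw [stateBefore, h2]
    exact nextState_congr h1.1 h1.2 _

lemma measurable_comp_state {α : Type*} [MeasurableSpace α] (m : ℕ) (φ : Bool → α) :
    Measurable fun x => φ (stateBefore Bd Gd m x) := by
  have : Measurable (stateBefore Bd Gd m) := by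
    cases m with
    | zero => exact measurable_const
    | succ m =>
      refine measurable_to_bool ?_
      refine IsDyadicSet.measurableSet (n := k + m / H) fun x y hxy hx => ?_
      simp only [mem_preimage, mem_singleton_iff] at hx ⊢
      rw [← h.stateBefore_congr m hxy, hx]
  exact (measurable_of_finite φ).comp this

lemma measurable_switchAt (m : ℕ) : Measurable fun x => (switchAt Bd Gd m x : ℝ≥0∞) := by
  have hm := (h.measurable_comp_state (m + 1) id).prodMk (h.measurable_comp_state m id)
  exact (measurable_of_finite
    (fun p : Bool × Bool => (((if p.1 = p.2 then 0 else 1 : ℕ)) : ℝ≥0∞))).comp hm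

lemma measurable_cellJump (m : ℕ) : Measurable fun x => (cellJump Bd Gd H k m x : ℝ≥0∞) := by
  have hm := (h.measurable_comp_state (m + 1) id).prodMk
    ((h.measurable_comp_state (m + 1) id).comp (measurable_id.sub_const ((1 / 2) ^ (k + m / H))))
  exact (measurable_of_finite
    (fun p : Bool × Bool => (((if p.1 = p.2 then 0 else 1 : ℕ)) : ℝ≥0∞))).comp hm

theorem sum_lintegral_switchAt_le (F n : ℕ) {E : Set ℝ} (hE : IsDyadicSet n E) :
    ∑ i ∈ Finset.range F, ∫⁻ x in E, (switchAt Bd Gd (n * H + i) x : ℝ≥0∞) ≤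
      ((k * H + 3 : ℕ) : ℝ≥0∞) * volume E := by
  rw [← lintegral_finsetSum _ fun i _ => h.measurable_switchAt _]
  calc ∫⁻ x in E, ∑ i ∈ Finset.range F, (switchAt Bd Gd (n * H + i) x : ℝ≥0∞)
      ≤ ∫⁻ x in E, (1 + (switchCount Bd Gd true F (n * H) x : ℝ≥0∞)) := by
        refine lintegral_mono fun x => ?_
        rw [← Nat.cast_sum, sum_switchAt, add_comm, ← Nat.cast_one, ← Nat.cast_add]
        exact Nat.cast_le.2 (switchCount_le_add_one _ _ _ _ _)
    _ = volume E + ∫⁻ x in E, (switchCount Bd Gd true F (n * H) x : ℝ≥0∞) := by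
        rw [lintegral_add_left measurable_const, setLIntegral_const, one_mul]
    _ ≤ volume E + ((k * H + 2 : ℕ) : ℝ≥0∞) * volume E := by
        gcongr
        exact h.lintegral_switchCount_true_le F n hE
    _ = _ := by
        rw [show k * H + 3 = 1 + (k * H + 2) by ring, Nat.cast_add 1, Nat.cast_one, add_mul,
          one_mul]

end CellData
end

lemma lintegral_comp_sub_le {I I' : Set ℝ} {f : ℝ → ℝ≥0∞} (hI : MeasurableSet I)
    (hI' : MeasurableSet I') {t : ℝ} (h : ∀ x ∈ I, x - t ∈ I') :
    ∫⁻ x in I, f (x - t) ≤ ∫⁻ x in I', f x := by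
  rw [← lintegral_indicator hI, ← lintegral_indicator hI',
    ← lintegral_sub_right_eq_self (I'.indicator f) t]
  refine lintegral_mono fun x => ?_
  by_cases hx : x ∈ I
  · rw [indicator_of_mem hx, indicator_of_mem (h x hx)]
  · rw [indicator_of_notMem hx]; exact zero_le

/-- Left halves of the dyadic intervals of order `n`. -/
def dyadicLeft (n : ℕ) : Set ℝ :=
  {x | x < (⌊x / (1 / 2 : ℝ) ^ n⌋ + 1 / 2) * (1 / 2 : ℝ) ^ n}

lemma measurableSet_dyadicLeft (n : ℕ) : MeasurableSet (dyadicLeft n) := by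
  refine measurableSet_lt measurable_id ?_
  have : Measurable fun x : ℝ => ((⌊x / (1 / 2 : ℝ) ^ n⌋ : ℤ) : ℝ) :=
    (measurable_of_countable (fun j : ℤ => (j : ℝ))).comp (measurable_floor_dyadic n)
  exact (this.add_const _).mul_const _

lemma two_mul_lintegral_dyadicLeft_le {n : ℕ} {E : Set ℝ} (hE : IsDyadicSet n E) {f : ℝ → ℝ≥0∞}
    (hf : ∀ x y : ℝ, ⌊x / (1 / 2 : ℝ) ^ n⌋ = ⌊y / (1 / 2 : ℝ) ^ n⌋ → f x = f y) :
    2 * ∫⁻ x in E ∩ dyadicLeft n, f x ≤ ∫⁻ x in E, f x := by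
  have hw : (0 : ℝ) < (1 / 2) ^ n := by positivity
  have hL := measurableSet_dyadicLeft n
  have key : ∀ x ∈ dyadicLeft n, ⌊(x - -((1 / 2 : ℝ) ^ n / 2)) / (1 / 2 : ℝ) ^ n⌋ =
      ⌊x / (1 / 2 : ℝ) ^ n⌋ ∧ x - -((1 / 2 : ℝ) ^ n / 2) ∉ dyadicLeft n := by
    intro x hx
    have e : (x - -((1 / 2 : ℝ) ^ n / 2)) / (1 / 2 : ℝ) ^ n = x / (1 / 2 : ℝ) ^ n + 1 / 2 := by
      field_simp; ring
    have hx' : x / (1 / 2 : ℝ) ^ n < ⌊x / (1 / 2 : ℝ) ^ n⌋ + 1 / 2 := by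
      rw [div_lt_iff₀ hw]; exact hx
    have h1 := Int.floor_le (x / (1 / 2 : ℝ) ^ n)
    have h2 : ⌊(x - -((1 / 2 : ℝ) ^ n / 2)) / (1 / 2 : ℝ) ^ n⌋ = ⌊x / (1 / 2 : ℝ) ^ n⌋ := by
      rw [e, Int.floor_eq_iff]; constructor <;> linarith
    refine ⟨h2, ?_⟩
    simp only [dyadicLeft, mem_ofPred_eq, h2, not_lt]
    have : (⌊x / (1 / 2 : ℝ) ^ n⌋ : ℝ) * (1 / 2 : ℝ) ^ n ≤ x := by
      rwa [le_div_iff₀ hw] at h1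
    linarith
  rw [← lintegral_inter_add_sdiff f E hL, two_mul]
  refine add_le_add le_rfl ?_
  calc ∫⁻ x in E ∩ dyadicLeft n, f x
      = ∫⁻ x in E ∩ dyadicLeft n, f (x - -((1 / 2 : ℝ) ^ n / 2)) :=
        setLIntegral_congr_fun (hE.measurableSet.inter hL) fun x hx => hf _ _ (key x hx.2).1.symm
    _ ≤ _ := lintegral_comp_sub_le (hE.measurableSet.inter hL) (hE.measurableSet.diff hL)
        fun x hx => ⟨hE x _ (key x hx.2).1.symm hx.1, (key x hx.2).2⟩

section
variable {Bd Gd : ℕ → ℝ → Prop}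

lemma cellJump_succ_le_of_eq {H k m : ℕ} (hm : (m + 1) / H = m / H) (x : ℝ) :
    cellJump Bd Gd H k (m + 1) x ≤ cellJump Bd Gd H k m x + (switchAt Bd Gd (m + 1) x +
      switchAt Bd Gd (m + 1) (x - (1 / 2) ^ (k + (m + 1) / H))) := by
  unfold cellJump switchAt
  rw [hm]
  split_ifs <;> simp_all

namespace CellData
variable {H k : ℕ} (h : CellData H k Bd Gd)
include h

lemma cellJump_succ_le_of_ne {m : ℕ} (hm : (m + 1) / H = m / H + 1) (x : ℝ) :
    (cellJump Bd Gd H k (m + 1) x : ℝ≥0∞) ≤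
      (dyadicLeft (k + m / H)).indicator (fun x => (cellJump Bd Gd H k m x : ℝ≥0∞)) x +
      ((switchAt Bd Gd (m + 1) x : ℝ≥0∞) +
      (switchAt Bd Gd (m + 1) (x - (1 / 2) ^ (k + (m + 1) / H)) : ℝ≥0∞)) := by
  rw [hm, ← add_assoc k (m / H) 1]
  rcases floor_dyadic_sub_half (n := k + m / H) x with h1 | ⟨h1, h2⟩
  · have e := h.stateBefore_congr m h1
    refine le_trans ?_ le_add_self
    rw [← Nat.cast_add]
    refine Nat.cast_le.2 ?_
    unfold cellJump switchAt
    rw [hm, ← add_assoc k (m / H) 1]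
    split_ifs <;> simp_all
  · have e := h.stateBefore_congr m (h1.trans (floor_dyadic_sub_self x).symm)
    rw [indicator_of_mem (show x ∈ dyadicLeft (k + m / H) from h2), ← Nat.cast_add, ← Nat.cast_add]
    refine Nat.cast_le.2 ?_
    unfold cellJump switchAt
    rw [hm, ← add_assoc k (m / H) 1]
    split_ifs <;> simp_all

lemma cellJump_congr (m : ℕ) (x y : ℝ)
    (hxy : ⌊x / (1 / 2 : ℝ) ^ (k + m / H)⌋ = ⌊y / (1 / 2 : ℝ) ^ (k + m / H)⌋) :
    cellJump Bd Gd H k m x = cellJump Bd Gd H k m y := by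
  unfold cellJump
  rw [h.stateBefore_congr m hxy, h.stateBefore_congr m (x := x - (1 / 2) ^ (k + m / H))
    (y := y - (1 / 2) ^ (k + m / H)) (by rw [floor_dyadic_sub_self, floor_dyadic_sub_self, hxy])]

/-- The weighted recursion for cell jumps over one dyadic interval. -/
lemma sum_lintegral_cellJump_aux {n : ℕ} (j : ℤ) (F : ℕ) :
    (∑ i ∈ Finset.range F, ∫⁻ x in dyadicIco n j, (cellJump Bd Gd H k (n * H + i) x : ℝ≥0∞)) +
      ((2 * H - F % H : ℕ) : ℝ≥0∞) *
        ∫⁻ x in dyadicIco n j, (cellJump Bd Gd H k (n * H + F) x : ℝ≥0∞) ≤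
    ((2 * H : ℕ) : ℝ≥0∞) *
      (volume (dyadicIco n j) + 2 * ∑ i ∈ Finset.range F,
        ∫⁻ x in dyadicIco n j ∪ dyadicIco n (j - 1),
          (switchAt Bd Gd (n * H + (i + 1)) x : ℝ≥0∞)) := by
  have hH := h.H_pos
  set I := dyadicIco n j with hI
  have hId : IsDyadicSet n I := isDyadicSet_dyadicIco n j
  have hIm := hId.measurableSet
  have hI2m : MeasurableSet (I ∪ dyadicIco n (j - 1)) :=
    hIm.union (isDyadicSet_dyadicIco n _).measurableSet
  induction F with
  | zero =>
    simp only [Finset.range_zero, Finset.sum_empty, zero_add, mul_zero, add_zero, Nat.zero_mod,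
      Nat.sub_zero]
    gcongr
    refine (lintegral_mono (g := fun _ => 1) fun x => ?_).trans (by simp)
    rw [← Nat.cast_one]
    refine Nat.cast_le.2 ?_
    unfold cellJump; split_ifs <;> simp
  | succ F ih =>
    set M := n * H + F with hM
    have hMn : n ≤ M / H := by rw [Nat.le_div_iff_mul_le hH]; omega
    set w : ℝ := (1 / 2) ^ (k + (M + 1) / H) with hw
    have hdiv : (M + 1) / H = M / H ∨ (M + 1) / H = M / H + 1 := by
      rw [Nat.succ_div]; split_ifs <;> simp
    set d := ∫⁻ x in I ∪ dyadicIco n (j - 1), (switchAt Bd Gd (M + 1) x : ℝ≥0∞) with hd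
    have hshift : ∫⁻ x in I, ((switchAt Bd Gd (M + 1) x : ℝ≥0∞) +
        (switchAt Bd Gd (M + 1) (x - w) : ℝ≥0∞)) ≤ 2 * d := by
      rw [lintegral_add_left (h.measurable_switchAt _), two_mul]
      refine add_le_add (lintegral_mono_set subset_union_left) ?_
      refine lintegral_comp_sub_le (f := fun x => (switchAt Bd Gd (M + 1) x : ℝ≥0∞)) hIm hI2m
        fun x hx => ?_
      have hw0 : 0 < w := by positivity
      have hw1 : w ≤ (1 / 2) ^ n :=
        pow_le_pow_of_le_one (by norm_num) (by norm_num) (by omega)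
      have ht : (0 : ℝ) < (1 / 2) ^ n := by positivity
      rw [hI, dyadicIco_eq_Ico] at hx
      rw [hI, dyadicIco_eq_Ico, dyadicIco_eq_Ico]
      rcases le_or_gt (j * (1 / 2 : ℝ) ^ n) (x - w) with hc | hc
      · left; exact ⟨hc, by linarith [hx.2]⟩
      · right; push_cast; constructor
        · linarith [hx.1]
        · linarith
    have hMe : n * H + (F + 1) = M + 1 := by omega
    rw [Finset.sum_range_succ, Finset.sum_range_succ, hMe, mul_add 2, ← add_assoc (volume I),
      mul_add _ _ (2 * d)]
    refine le_trans ?_ (add_le_add ih le_rfl)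
    refine (add_assoc _ _ _).le.trans (le_trans ?_ (add_assoc _ _ _).ge)
    refine add_le_add le_rfl ?_
    set a := ∫⁻ x in I, (cellJump Bd Gd H k M x : ℝ≥0∞) with ha
    set a' := ∫⁻ x in I, (cellJump Bd Gd H k (M + 1) x : ℝ≥0∞) with ha'
    have hmod : M % H = F % H := by rw [hM, add_comm, Nat.add_mul_mod_self_right]
    have hFlt := Nat.mod_lt F hH
    rcases hdiv with hdiv | hdiv
    · have h1 : a' ≤ a + 2 * d := by
        refine le_trans (lintegral_mono fun x => ?_) ((lintegral_add_left
          (h.measurable_cellJump M) _).le.trans (add_le_add le_rfl hshift))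
        rw [← Nat.cast_add, ← Nat.cast_add]
        exact Nat.cast_le.2 (cellJump_succ_le_of_eq hdiv x)
      have hF : (F + 1) % H = F % H + 1 := by
        have h1 := Nat.div_add_mod M H
        have h2 := Nat.div_add_mod (M + 1) H
        rw [hdiv] at h2
        have : (M + 1) % H = (F + 1) % H := by
          rw [← hMe, add_comm, Nat.add_mul_mod_self_right]
        omega
      rw [hF, show 2 * H - F % H = 1 + (2 * H - (F % H + 1)) by omega, Nat.cast_add 1, Nat.cast_one,
        add_mul, one_mul, add_assoc]
      refine add_le_add le_rfl ?_
      calc _ ≤ ((2 * H - (F % H + 1) : ℕ) : ℝ≥0∞) * (a + 2 * d) := by gcongr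
        _ ≤ _ := by
          rw [mul_add]
          refine add_le_add le_rfl (mul_le_mul_left (Nat.cast_le.2 (by omega)) _)
    · have h1 : a' ≤ (∫⁻ x in I ∩ dyadicLeft (k + M / H), (cellJump Bd Gd H k M x : ℝ≥0∞)) +
          2 * d := by
        refine le_trans (lintegral_mono fun x => h.cellJump_succ_le_of_ne hdiv x) ?_
        rw [lintegral_add_left ((h.measurable_cellJump M).indicator (measurableSet_dyadicLeft _)),
          setLIntegral_indicator (measurableSet_dyadicLeft _), inter_comm]
        exact add_le_add le_rfl hshift
      have h2 := two_mul_lintegral_dyadicLeft_le (n := k + M / H)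
        (f := fun x => (cellJump Bd Gd H k M x : ℝ≥0∞))
        (hId.mono (by omega : n ≤ k + M / H)) fun x y hxy => by rw [h.cellJump_congr M x y hxy]
      have hF : F % H = H - 1 ∧ (F + 1) % H = 0 := by
        have h1 := Nat.div_add_mod M H
        have h2 := Nat.div_add_mod (M + 1) H
        rw [hdiv] at h2
        have : (M + 1) % H = (F + 1) % H := by
          rw [← hMe, add_comm, Nat.add_mul_mod_self_right]
        have : H * (M / H + 1) = H * (M / H) + H := by ring
        omega
      rw [hF.1, hF.2, Nat.sub_zero, show 2 * H - (H - 1) = 1 + H by omega, Nat.cast_add 1,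
        Nat.cast_one, add_mul, one_mul, add_assoc]
      refine add_le_add le_rfl ?_
      calc _ ≤ ((2 * H : ℕ) : ℝ≥0∞) * ((∫⁻ x in I ∩ dyadicLeft (k + M / H),
            (cellJump Bd Gd H k M x : ℝ≥0∞)) + 2 * d) := by gcongr
        _ = (H : ℝ≥0∞) * (2 * ∫⁻ x in I ∩ dyadicLeft (k + M / H),
            (cellJump Bd Gd H k M x : ℝ≥0∞)) + ((2 * H : ℕ) : ℝ≥0∞) * (2 * d) := by
            rw [mul_add]; push_cast; ring
        _ ≤ _ := by gcongr

theorem sum_lintegral_cellJump_le {n : ℕ} (j : ℤ) (F : ℕ) :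
    ∑ i ∈ Finset.range F, ∫⁻ x in dyadicIco n j, (cellJump Bd Gd H k (n * H + i) x : ℝ≥0∞) ≤
      ((2 * H * (1 + 4 * (k * H + 3)) : ℕ) : ℝ≥0∞) * ENNReal.ofReal ((1 / 2) ^ n) := by
  refine (le_self_add.trans (h.sum_lintegral_cellJump_aux j F)).trans ?_
  have hd : IsDyadicSet n (dyadicIco n j ∪ dyadicIco n (j - 1)) := fun x y hxy hx =>
    hx.imp (isDyadicSet_dyadicIco n j x y hxy) (isDyadicSet_dyadicIco n _ x y hxy)
  have h1 := h.sum_lintegral_switchAt_le (F + 1) n hd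
  rw [Finset.sum_range_succ'] at h1
  have h2 := le_self_add.trans h1
  have hv : volume (dyadicIco n j ∪ dyadicIco n (j - 1)) ≤
      2 * ENNReal.ofReal ((1 / 2) ^ n) := by
    refine (measure_union_le _ _).trans ?_
    rw [volume_dyadicIco, volume_dyadicIco, two_mul]
  rw [volume_dyadicIco]
  calc _ ≤ ((2 * H : ℕ) : ℝ≥0∞) * (ENNReal.ofReal ((1 / 2) ^ n) + 2 *
        (((k * H + 3 : ℕ) : ℝ≥0∞) * (2 * ENNReal.ofReal ((1 / 2) ^ n)))) := by
        gcongr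
        exact h2.trans (mul_le_mul_right hv _)
    _ = _ := by push_cast; ring

end CellData
end

/-- Heights of the mesh, with `H` levels per octave. -/
noncomputable def levelY (H m : ℕ) : ℝ := (1 / 2 : ℝ) ^ (m / H) * (1 - (m % H : ℕ) / (2 * H))

/-- Widths of the cells of the mesh. -/
noncomputable def levelW (H k m : ℕ) : ℝ := (1 / 2 : ℝ) ^ (k + m / H)

lemma levelW_pos (H k m : ℕ) : 0 < levelW H k m := by unfold levelW; positivity

section
variable {H : ℕ} (hH : 0 < H)
include hH

lemma levelY_sub (m : ℕ) : levelY H m - levelY H (m + 1) = (1 / 2 : ℝ) ^ (m / H) / (2 * H) := by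
  have hH' : (0 : ℝ) < H := by exact_mod_cast hH
  have h1 := Nat.div_add_mod m H
  have h2 := Nat.div_add_mod (m + 1) H
  have h3 := Nat.mod_lt m hH
  have h4 := Nat.mod_lt (m + 1) hH
  have hdiv : (m + 1) / H = m / H ∨ (m + 1) / H = m / H + 1 := by
    rw [Nat.succ_div]; split_ifs <;> simp
  unfold levelY
  rcases hdiv with hd | hd
  · rw [hd] at h2
    rw [hd, show (m + 1) % H = m % H + 1 by omega]
    push_cast
    field_simp
    ring
  · rw [hd] at h2
    have : H * (m / H + 1) = H * (m / H) + H := by ring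
    have e1 : (m + 1) % H = 0 := by omega
    have e2 : m % H + 1 = H := by omega
    have e3 : ((m % H : ℕ) : ℝ) = H - 1 := by rw [eq_sub_iff_add_eq]; exact_mod_cast e2
    rw [hd, e1, e3, pow_succ]
    push_cast
    field_simp
    ring

lemma strictAnti_levelY : StrictAnti (levelY H) := by
  refine strictAnti_nat_of_succ_lt fun m => ?_
  have := levelY_sub hH m
  have h2 : (0 : ℝ) < (1 / 2 : ℝ) ^ (m / H) / (2 * H) := by positivity
  linarith

lemma levelY_le (m : ℕ) : levelY H m ≤ (1 / 2 : ℝ) ^ (m / H) := by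
  unfold levelY
  refine mul_le_of_le_one_right (by positivity) ?_
  have : (0 : ℝ) ≤ (m % H : ℕ) / (2 * H) := by positivity
  linarith

lemma le_levelY_succ (m : ℕ) : (1 / 2 : ℝ) ^ (m / H) / 2 ≤ levelY H (m + 1) := by
  have hH' : (0 : ℝ) < H := by exact_mod_cast hH
  have h := levelY_sub hH m
  have h3 : ((m % H : ℕ) : ℝ) + 1 ≤ H := by exact_mod_cast Nat.mod_lt m hH
  have e : levelY H (m + 1) = (1 / 2 : ℝ) ^ (m / H) * (1 - ((m % H : ℕ) + 1) / (2 * H)) := by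
    have : levelY H (m + 1) = levelY H m - (1 / 2 : ℝ) ^ (m / H) / (2 * H) := by linarith
    rw [this, levelY]; field_simp; ring
  rw [e, div_eq_mul_inv]
  refine mul_le_mul_of_nonneg_left ?_ (by positivity)
  have : (((m % H : ℕ) : ℝ) + 1) / (2 * H) ≤ 1 / 2 := by
    rw [div_le_div_iff₀ (by positivity) (by norm_num)]; linarith
  linarith

lemma levelY_mul (n : ℕ) : levelY H (n * H) = (1 / 2 : ℝ) ^ n := by
  simp [levelY, Nat.mul_div_cancel _ hH]

lemma exists_strip {m₀ L : ℕ} {y : ℝ} (h1 : y ≤ levelY H m₀) (h2 : levelY H L < y) :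
    ∃ i < L, i + m₀ < L ∧ levelY H (m₀ + i + 1) ≤ y ∧ y ≤ levelY H (m₀ + i) := by
  classical
  have hY := strictAnti_levelY hH
  have hL : m₀ < L := by
    by_contra hc
    have := hY.antitone (not_lt.1 hc)
    linarith
  have hex : ∃ i, levelY H (m₀ + i + 1) ≤ y :=
    ⟨L - m₀ - 1, by rw [show m₀ + (L - m₀ - 1) + 1 = L by omega]; exact h2.le⟩
  have hf := Nat.find_spec hex
  set i := Nat.find hex
  have h3 : y ≤ levelY H (m₀ + i) := by
    rcases Nat.eq_zero_or_pos i with h0 | h0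
    · rw [h0]; exact h1
    · have := Nat.find_min hex (show i - 1 < i by omega)
      rw [show m₀ + (i - 1) + 1 = m₀ + i by omega] at this
      exact (not_le.1 this).le
  have h4 : m₀ + i < L := by
    by_contra hc
    have := hY.antitone (not_lt.1 hc)
    linarith
  exact ⟨i, by omega, by omega, hf, h3⟩

end

section
variable (Bd Gd : ℕ → ℝ → Prop)

/-- The state on the cell with index `j` at level `m`, as a real number. -/
noncomputable def cellVal (H k m : ℕ) (j : ℤ) : ℝ :=
  if stateBefore Bd Gd (m + 1) (j * levelW H k m) = true then 1 else 0

variable {Bd Gd}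

namespace CellData
variable {H k : ℕ} (h : CellData H k Bd Gd)
include h

lemma cellVal_floor (m : ℕ) (x : ℝ) :
    cellVal Bd Gd H k m ⌊x / levelW H k m⌋ =
      if stateBefore Bd Gd (m + 1) x = true then 1 else 0 := by
  unfold cellVal
  rw [h.stateBefore_congr m (x := ⌊x / levelW H k m⌋ * levelW H k m) (y := x)]
  change ⌊(⌊x / levelW H k m⌋ * levelW H k m) / levelW H k m⌋ = ⌊x / levelW H k m⌋
  rw [mul_div_assoc, div_self (levelW_pos H k m).ne', mul_one, Int.floor_intCast]

lemma cellVal_floor_sub_one (m : ℕ) (x : ℝ) :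
    cellVal Bd Gd H k m (⌊x / levelW H k m⌋ - 1) =
      if stateBefore Bd Gd (m + 1) (x - levelW H k m) = true then 1 else 0 := by
  rw [← h.cellVal_floor]
  congr 1
  exact (floor_dyadic_sub_self (n := k + m / H) x).symm

lemma abs_cellVal_sub (m : ℕ) (x : ℝ) :
    |cellVal Bd Gd H k m ⌊x / levelW H k m⌋ - cellVal Bd Gd H k m (⌊x / levelW H k m⌋ - 1)| =
      cellJump Bd Gd H k m x := by
  rw [h.cellVal_floor, h.cellVal_floor_sub_one]
  unfold cellJump levelW
  cases stateBefore Bd Gd (m + 1) x <;>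
    cases stateBefore Bd Gd (m + 1) (x - (1 / 2) ^ (k + m / H)) <;> simp

lemma abs_cellVal_sub_succ (m : ℕ) (x : ℝ) :
    |cellVal Bd Gd H k m ⌊x / levelW H k m⌋ -
      cellVal Bd Gd H k (m + 1) ⌊x / levelW H k (m + 1)⌋| = switchAt Bd Gd (m + 1) x := by
  rw [h.cellVal_floor, h.cellVal_floor]
  unfold switchAt
  cases stateBefore Bd Gd (m + 1) x <;>
    cases stateBefore Bd Gd (m + 1 + 1) x <;> simp

omit h in
lemma floor_levelW_bounds {J L i : ℕ} (hJ : 3 * 2 ^ (k + L) ≤ J) (hi : i ≤ L) {x : ℝ}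
    (hx : |x| ≤ 2) : -(J : ℤ) ≤ ⌊x / levelW H k i⌋ ∧ ⌊x / levelW H k i⌋ ≤ J := by
  have hw : x / levelW H k i = x * 2 ^ (k + i / H) := by
    unfold levelW; rw [one_div, inv_pow, div_inv_eq_mul]
  have h1 : (2 : ℝ) ^ (k + i / H) ≤ 2 ^ (k + L) :=
    pow_le_pow_right₀ (by norm_num) (by have := Nat.div_le_self i H; omega)
  have h2 : (3 : ℝ) * 2 ^ (k + L) ≤ J := by exact_mod_cast hJ
  have h0 : (0 : ℝ) < 2 ^ (k + i / H) := by positivity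
  obtain ⟨h3, h4⟩ := abs_le.1 hx
  rw [hw]
  constructor
  · rw [Int.le_floor]; push_cast; nlinarith
  · refine Int.cast_le.1 ((Int.floor_le _).trans (?_ : _ ≤ (((J : ℕ) : ℤ) : ℝ)))
    push_cast; nlinarith

lemma norm_fderiv_planeInterp_le {C : ℝ} (hC1 : 1 ≤ C)
    (hC : ∀ u : ℝ, |deriv Real.smoothTransition u| ≤ C)
    {J L i : ℕ} (hJ : 3 * 2 ^ (k + L) ≤ J) (hi : i < L) {z : ℂ} (hx : |z.re| ≤ 2)
    (h1 : levelY H (i + 1) ≤ z.im) (h2 : z.im ≤ levelY H i) :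
    ‖fderiv ℝ (planeInterp J L (levelW H k) (levelY H) (cellVal Bd Gd H k)) z‖ ≤
      C * (3 * 2 ^ k + 2 * H) * 2 ^ (i / H) * ((cellJump Bd Gd H k i z.re : ℝ) +
        cellJump Bd Gd H k (i + 1) z.re + switchAt Bd Gd (i + 1) z.re) := by
  have hH := h.H_pos
  have hH' : (0 : ℝ) < H := by exact_mod_cast hH
  refine (_root_.norm_fderiv_planeInterp_le hC (levelW_pos H k) (strictAnti_levelY hH) hi h1 h2
    ?_).trans ?_
  · rintro j (rfl | rfl)
    · exact floor_levelW_bounds hJ (by omega) hx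
    · exact floor_levelW_bounds hJ (by omega) hx
  rw [h.abs_cellVal_sub, h.abs_cellVal_sub, h.abs_cellVal_sub_succ]
  refine mul_le_mul_of_nonneg_right ?_ (by positivity)
  rw [mul_assoc C]
  refine mul_le_mul_of_nonneg_left ?_ (by linarith)
  have hdiv : (i + 1) / H ≤ i / H + 1 := by
    rw [Nat.succ_div]; split_ifs <;> omega
  have e1 : 1 / levelW H k i = 2 ^ k * 2 ^ (i / H) := by
    unfold levelW; rw [one_div, one_div, inv_pow, inv_inv, pow_add]
  have e2 : 1 / levelW H k (i + 1) ≤ 2 ^ k * (2 * 2 ^ (i / H)) := by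
    unfold levelW; rw [one_div, one_div, inv_pow, inv_inv, pow_add]
    refine mul_le_mul_of_nonneg_left ?_ (by positivity)
    rw [mul_comm, ← pow_succ]
    exact pow_le_pow_right₀ (by norm_num) hdiv
  have e3 : 1 / (levelY H i - levelY H (i + 1)) = 2 * H * 2 ^ (i / H) := by
    rw [levelY_sub hH, one_div_div, one_div, inv_pow, div_inv_eq_mul]
  rw [e1, e3]
  linarith

end CellData
end

lemma exists_pow_half_near {ℓ : ℝ} (h0 : 0 < ℓ) (h1 : ℓ ≤ 1) :
    ∃ n : ℕ, ℓ ≤ (1 / 2 : ℝ) ^ n ∧ (1 / 2 : ℝ) ^ n ≤ 2 * ℓ := by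
  obtain ⟨n, hn1, hn2⟩ := exists_nat_pow_near_of_lt_one h0 h1 (by norm_num : (0 : ℝ) < 1 / 2)
    (by norm_num)
  refine ⟨n, hn2, ?_⟩
  rw [pow_succ] at hn1
  linarith

section
variable {Bd Gd : ℕ → ℝ → Prop}
namespace CellData
variable {H k : ℕ} (h : CellData H k Bd Gd)
include h

/-- The sum of all jumps between neighbouring cells near level `m`. -/
lemma sum_lintegral_jumps_le {n : ℕ} (j : ℤ) (L : ℕ) :
    ∑ i ∈ Finset.range L, ∫⁻ x in dyadicIco n j, ((cellJump Bd Gd H k (n * H + i) x : ℝ≥0∞) +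
      (cellJump Bd Gd H k (n * H + i + 1) x : ℝ≥0∞) +
      (switchAt Bd Gd (n * H + i + 1) x : ℝ≥0∞)) ≤
    ((2 * (2 * H * (1 + 4 * (k * H + 3))) + (k * H + 3) : ℕ) : ℝ≥0∞) *
      ENNReal.ofReal ((1 / 2) ^ n) := by
  have e : ∀ i, ∫⁻ x in dyadicIco n j, ((cellJump Bd Gd H k (n * H + i) x : ℝ≥0∞) +
      (cellJump Bd Gd H k (n * H + i + 1) x : ℝ≥0∞) +
      (switchAt Bd Gd (n * H + i + 1) x : ℝ≥0∞)) =
      (∫⁻ x in dyadicIco n j, (cellJump Bd Gd H k (n * H + i) x : ℝ≥0∞)) +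
      (∫⁻ x in dyadicIco n j, (cellJump Bd Gd H k (n * H + (i + 1)) x : ℝ≥0∞)) +
      ∫⁻ x in dyadicIco n j, (switchAt Bd Gd (n * H + (i + 1)) x : ℝ≥0∞) := fun i => by
    have h1 : Measurable fun x => (cellJump Bd Gd H k (n * H + i) x : ℝ≥0∞) +
      (cellJump Bd Gd H k (n * H + i + 1) x : ℝ≥0∞) :=
      (h.measurable_cellJump _).add (h.measurable_cellJump _)
    rw [lintegral_add_left h1, lintegral_add_left (h.measurable_cellJump _)]
    rfl
  simp only [e, Finset.sum_add_distrib]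
  have h1 := h.sum_lintegral_cellJump_le (n := n) j L
  have h2 := h.sum_lintegral_cellJump_le (n := n) j (L + 1)
  have h3 := h.sum_lintegral_switchAt_le (L + 1) n (isDyadicSet_dyadicIco n j)
  rw [Finset.sum_range_succ'] at h2 h3
  rw [volume_dyadicIco] at h3
  refine (add_le_add (add_le_add h1 (le_self_add.trans h2)) (le_self_add.trans h3)).trans
    (le_of_eq ?_)
  push_cast; ring

/-- Carleson estimate for the gradient of the interpolated state. -/
theorem lintegral_norm_fderiv_planeInterp_le {C : ℝ} (hC1 : 1 ≤ C)
    (hC : ∀ u : ℝ, |deriv Real.smoothTransition u| ≤ C)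
    {J L : ℕ} (hJ : 3 * 2 ^ (k + L) ≤ J) {τ : ℝ} (hτ : levelY H L < τ)
    (x₀ : ℝ) {ℓ : ℝ} (hℓ0 : 0 < ℓ) (hℓ1 : ℓ ≤ 1) :
    ∫⁻ z in cbox x₀ ℓ ∩ {z | |z.re| ≤ 2 ∧ τ ≤ z.im}, ENNReal.ofReal
      ‖fderiv ℝ (planeInterp J L (levelW H k) (levelY H) (cellVal Bd Gd H k)) z‖ ≤
    ENNReal.ofReal (C * (3 * 2 ^ k + 2 * H) *
      (6 * (2 * (2 * H * (1 + 4 * (k * H + 3))) + (k * H + 3))) * ℓ) := by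
  have hH := h.H_pos
  have hH' : (1 : ℝ) ≤ H := by exact_mod_cast hH
  obtain ⟨n, hn1, hn2⟩ := exists_pow_half_near hℓ0 hℓ1
  set D := C * (3 * 2 ^ k + 2 * H) with hD
  have hD0 : 0 ≤ D := by positivity
  set f := fun z : ℂ => ENNReal.ofReal
      ‖fderiv ℝ (planeInterp J L (levelW H k) (levelY H) (cellVal Bd Gd H k)) z‖ with hf
  set q := fun (i : ℕ) (x : ℝ) => ((cellJump Bd Gd H k (n * H + i) x : ℝ≥0∞) +
      (cellJump Bd Gd H k (n * H + i + 1) x : ℝ≥0∞) +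
      (switchAt Bd Gd (n * H + i + 1) x : ℝ≥0∞)) with hq
  have hqm : ∀ i, Measurable (q i) := fun i =>
    ((h.measurable_cellJump _).add (h.measurable_cellJump _)).add (h.measurable_switchAt _)
  set j₀ := ⌊x₀ / (1 / 2 : ℝ) ^ n⌋ with hj₀
  set jj : Fin 3 → ℤ := fun s => j₀ - 1 + s
  set t := fun i : ℕ => Icc (levelY H (n * H + i + 1)) (levelY H (n * H + i)) with ht
  have htm : ∀ i, MeasurableSet (t i) := fun i => measurableSet_Icc
  have hdm : ∀ s, MeasurableSet (dyadicIco n (jj s)) := fun s =>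
    (isDyadicSet_dyadicIco n _).measurableSet
  set Φ := fun (i : ℕ) (s : Fin 3) (z : ℂ) => (dyadicIco n (jj s) ×ℂ t i).indicator
    (fun z => ENNReal.ofReal (D * 2 ^ ((n * H + i) / H)) * q i z.re) z with hΦ
  have hsm : ∀ i s, MeasurableSet (dyadicIco n (jj s) ×ℂ t i) := fun i s =>
    (Complex.measurable_re (hdm s)).inter (Complex.measurable_im (htm i))
  have hgm : ∀ i, Measurable fun z : ℂ =>
      ENNReal.ofReal (D * 2 ^ ((n * H + i) / H)) * q i z.re := fun i =>
    ((hqm i).comp Complex.measurable_re).const_mul _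
  have hpt : ∀ z ∈ cbox x₀ ℓ ∩ {z | |z.re| ≤ 2 ∧ τ ≤ z.im}, f z ≤
      ∑ i ∈ Finset.range L, ∑ s, Φ i s z := by
    rintro z ⟨⟨hz1, hz2, hz3⟩, hz4, hz5⟩
    obtain ⟨i, hiL, hiL', hi1, hi2⟩ := exists_strip hH (m₀ := n * H) (L := L) (y := z.im)
      (by rw [levelY_mul hH]; linarith) (by linarith)
    have hs : ∃ s, z.re ∈ dyadicIco n (jj s) := by
      have hw : (0 : ℝ) < (1 / 2) ^ n := by positivity
      obtain ⟨h3, h4⟩ := abs_le.1 hz1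
      have h5 : x₀ / (1 / 2 : ℝ) ^ n - 1 ≤ z.re / (1 / 2 : ℝ) ^ n := by
        rw [div_sub_one hw.ne', div_le_div_iff_of_pos_right hw]; linarith
      have h6 : z.re / (1 / 2 : ℝ) ^ n ≤ x₀ / (1 / 2 : ℝ) ^ n + 1 := by
        rw [div_add_one hw.ne', div_le_div_iff_of_pos_right hw]; linarith
      have h7 := Int.floor_mono h5
      have h8 := Int.floor_mono h6
      rw [Int.floor_sub_one] at h7
      rw [Int.floor_add_one] at h8
      have h9 : ⌊z.re / (1 / 2 : ℝ) ^ n⌋ = j₀ - 1 ∨ ⌊z.re / (1 / 2 : ℝ) ^ n⌋ = j₀ ∨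
        ⌊z.re / (1 / 2 : ℝ) ^ n⌋ = j₀ + 1 := by omega
      rcases h9 with h9 | h9 | h9
      · exact ⟨0, h9.trans (by simp [jj])⟩
      · exact ⟨1, h9.trans (by simp [jj])⟩
      · refine ⟨2, h9.trans ?_⟩
        simp only [jj, Fin.val_two]; push_cast; ring
    obtain ⟨s, hs⟩ := hs
    refine le_trans ?_ (Finset.single_le_sum (f := fun i => ∑ s, Φ i s z) (fun _ _ => zero_le)
      (Finset.mem_range.2 hiL))
    refine le_trans ?_ (Finset.single_le_sum (f := fun s => Φ i s z) (fun _ _ => zero_le)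
      (Finset.mem_univ s))
    have hmem : z ∈ dyadicIco n (jj s) ×ℂ t i := ⟨hs, hi1, hi2⟩
    simp only [hΦ]
    rw [indicator_of_mem hmem]
    refine (ENNReal.ofReal_le_ofReal (h.norm_fderiv_planeInterp_le hC1 hC hJ (by omega) hz4
      hi1 hi2)).trans (le_of_eq ?_)
    rw [ENNReal.ofReal_mul (by positivity), ENNReal.ofReal_add (by positivity) (by positivity),
      ENNReal.ofReal_add (by positivity) (by positivity)]
    simp only [ENNReal.ofReal_natCast, hq, hD]
  have hintg : ∀ i s, ∫⁻ z, Φ i s z ≤ ENNReal.ofReal D * ∫⁻ x in dyadicIco n (jj s), q i x := by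
    intro i s
    simp only [hΦ]
    rw [lintegral_indicator (hsm i s), setLIntegral_reProdIm _ (hgm i) (hdm s) (htm i)]
    simp only [setLIntegral_const]
    simp only [ht, Real.volume_Icc, levelY_sub hH]
    rw [lintegral_mul_const _ ((hqm i).const_mul _), lintegral_const_mul _ (hqm i), mul_right_comm,
      ← ENNReal.ofReal_mul (by positivity)]
    refine mul_le_mul_left (ENNReal.ofReal_le_ofReal ?_) _
    rw [one_div, inv_pow]
    have : (0 : ℝ) < 2 ^ ((n * H + i) / H) := by positivity
    rw [mul_assoc, mul_div_assoc', mul_inv_cancel₀ this.ne']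
    refine mul_le_of_le_one_right hD0 ?_
    rw [div_le_one (by positivity)]; linarith
  calc ∫⁻ z in cbox x₀ ℓ ∩ {z | |z.re| ≤ 2 ∧ τ ≤ z.im}, f z
      ≤ ∫⁻ z in cbox x₀ ℓ ∩ {z | |z.re| ≤ 2 ∧ τ ≤ z.im},
          ∑ i ∈ Finset.range L, ∑ s, Φ i s z := by
        refine setLIntegral_mono' ((measurableSet_cbox _ _).inter ?_) hpt
        exact (measurableSet_le Complex.measurable_re.abs measurable_const).inter
          (measurableSet_le measurable_const Complex.measurable_im)
    _ ≤ ∫⁻ z, ∑ i ∈ Finset.range L, ∑ s, Φ i s z := setLIntegral_le_lintegral _ _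
    _ = ∑ s, ∑ i ∈ Finset.range L, ∫⁻ z, Φ i s z := by
        have hm : ∀ i s, Measurable (Φ i s) := fun i s => (hgm i).indicator (hsm i s)
        rw [lintegral_finsetSum _ fun i _ => Finset.measurable_sum _ fun s _ => hm i s,
          Finset.sum_comm]
        exact Finset.sum_congr rfl fun i _ => lintegral_finsetSum _ fun s _ => hm i s
    _ ≤ ∑ s, ∑ i ∈ Finset.range L, ENNReal.ofReal D * ∫⁻ x in dyadicIco n (jj s), q i x :=
        Finset.sum_le_sum fun s _ => Finset.sum_le_sum fun i _ => hintg i s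
    _ ≤ ∑ s : Fin 3, ENNReal.ofReal D *
        (((2 * (2 * H * (1 + 4 * (k * H + 3))) + (k * H + 3) : ℕ) : ℝ≥0∞) *
          ENNReal.ofReal ((1 / 2) ^ n)) := by
        refine Finset.sum_le_sum fun s _ => ?_
        rw [← Finset.mul_sum]
        exact mul_le_mul_right (h.sum_lintegral_jumps_le (jj s) L) _
    _ ≤ _ := by
        rw [Finset.sum_const, Finset.card_univ, Fintype.card_fin, nsmul_eq_mul,
          ← ENNReal.ofReal_natCast, ← ENNReal.ofReal_natCast, ← ENNReal.ofReal_mul (by positivity),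
          ← ENNReal.ofReal_mul (by positivity), ← ENNReal.ofReal_mul (by positivity)]
        refine ENNReal.ofReal_le_ofReal ?_
        push_cast
        calc _ = D * (3 * (2 * (2 * H * (1 + 4 * (k * H + 3))) + (k * H + 3))) *
              (1 / 2 : ℝ) ^ n := by ring
          _ ≤ D * (3 * (2 * (2 * H * (1 + 4 * (k * H + 3))) + (k * H + 3))) * (2 * ℓ) := by gcongr
          _ = _ := by ring

end CellData
end

/-- The corner of the cell at level `m` containing `x`. -/
noncomputable def meshNode (H k m : ℕ) (x : ℝ) : ℂ :=
  ⟨⌊x / levelW H k m⌋ * levelW H k m, levelY H m⟩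

section
variable {H k : ℕ} (hH : 0 < H)
include hH

lemma levelY_pos (m : ℕ) : 0 < levelY H m :=
  lt_of_lt_of_le (by positivity) ((le_levelY_succ hH m).trans
    ((strictAnti_levelY hH).antitone (Nat.le_succ m)))

lemma half_le_levelY (m : ℕ) : (1 / 2 : ℝ) ^ (m / H) / 2 ≤ levelY H m :=
  (le_levelY_succ hH m).trans ((strictAnti_levelY hH).antitone (Nat.le_succ m))

omit hH in
lemma abs_meshNode_re_sub_le (m : ℕ) (x : ℝ) :
    |(meshNode H k m x).re - x| ≤ levelW H k m := by
  have hw := levelW_pos H k m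
  have h1 := Int.floor_le (x / levelW H k m)
  have h2 := Int.lt_floor_add_one (x / levelW H k m)
  rw [le_div_iff₀ hw] at h1
  rw [div_lt_iff₀ hw] at h2
  change |⌊x / levelW H k m⌋ * levelW H k m - x| ≤ _
  rw [abs_le]; constructor <;> linarith

lemma norm_meshNode_sub_le {i m : ℕ} (hm : m = i ∨ m = i + 1) {x : ℝ} {z : ℂ}
    (hx : |x - z.re| ≤ levelW H k m)
    (h1 : levelY H (i + 1) ≤ z.im) (h2 : z.im ≤ levelY H i) :
    ‖meshNode H k m x - z‖ ≤ (1 / 2 : ℝ) ^ (i / H) * (2 * (1 / 2) ^ k + 1 / (2 * H)) := by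
  have hH' : (0 : ℝ) < H := by exact_mod_cast hH
  have e1 : levelW H k m ≤ (1 / 2 : ℝ) ^ (i / H) * (1 / 2) ^ k := by
    unfold levelW
    rw [pow_add, mul_comm]
    refine mul_le_mul_of_nonneg_right ?_ (by positivity)
    refine pow_le_pow_of_le_one (by norm_num) (by norm_num) (Nat.div_le_div_right (by omega))
  have e2 := abs_meshNode_re_sub_le (H := H) (k := k) m x
  have e3 := levelY_sub hH i
  refine (Complex.norm_le_abs_re_add_abs_im _).trans ?_
  have e4 : |(meshNode H k m x - z).re| ≤ 2 * levelW H k m := by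
    rw [Complex.sub_re]
    have := abs_sub_le (meshNode H k m x).re x z.re
    linarith
  have e5 : |(meshNode H k m x - z).im| ≤ (1 / 2 : ℝ) ^ (i / H) / (2 * H) := by
    rw [Complex.sub_im, ← e3]
    change |levelY H m - z.im| ≤ _
    rw [abs_le]
    rcases hm with rfl | rfl <;> constructor <;> linarith
  calc _ ≤ 2 * ((1 / 2 : ℝ) ^ (i / H) * (1 / 2) ^ k) + (1 / 2 : ℝ) ^ (i / H) / (2 * H) := by
        linarith
    _ = _ := by ring

lemma norm_sub_meshNode_le {b : ℂ → ℂ} (hb : DifferentiableOn ℂ b UH) (hb1 : ∀ z ∈ UH, ‖b z‖ ≤ 1)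
    {i m : ℕ} (hm : m = i ∨ m = i + 1) {x : ℝ} {z : ℂ} (hx : |x - z.re| ≤ levelW H k m)
    (h1 : levelY H (i + 1) ≤ z.im) (h2 : z.im ≤ levelY H i) :
    ‖b (meshNode H k m x) - b z‖ ≤ 8 * (2 * (1 / 2) ^ k + 1 / (2 * H)) := by
  have hz : 0 < z.im := (levelY_pos hH _).trans_le h1
  refine (norm_sub_le_of_UH hb hb1 hz (levelY_pos hH m : 0 < (meshNode H k m x).im)).trans ?_
  rw [div_le_iff₀ hz]
  have e1 := norm_meshNode_sub_le hH (k := k) hm hx h1 h2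
  have e2 := (le_levelY_succ hH i).trans h1
  have e3 : (0 : ℝ) ≤ 2 * (1 / 2) ^ k + 1 / (2 * H) := by positivity
  nlinarith

lemma cellData_of_holomorphic {b : ℂ → ℂ} (hb : DifferentiableOn ℂ b UH)
    (hb1 : ∀ z ∈ UH, ‖b z‖ ≤ 1) (hk : 0 < k) {ε g : ℝ}
    (hP : ∀ z₀ ∈ UH, g ≤ ‖b z₀‖ → volume {x : ℝ | |x - z₀.re| ≤ 2 * z₀.im ∧
      ∃ y, 0 < y ∧ y ≤ 2 * z₀.im ∧ ‖b ⟨x, y⟩‖ < ε} ≤ ENNReal.ofReal (1 / 4 * z₀.im))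
    (hkε : 8 * (1 / 2 : ℝ) ^ k ≤ ε / 2) :
    CellData H k (fun m x => ‖b (meshNode H k m x)‖ < ε / 2)
      (fun m x => g ≤ ‖b (meshNode H k m x)‖) := by
  have hcong : ∀ m (x y : ℝ), ⌊x / (1 / 2 : ℝ) ^ (k + m / H)⌋ = ⌊y / (1 / 2 : ℝ) ^ (k + m / H)⌋ →
      meshNode H k m x = meshNode H k m y := by
    intro m x y hxy
    unfold meshNode levelW
    rw [hxy]
  refine { H_pos := hH, k_pos := hk, bad := ?_, good := ?_, pack := ?_ }
  · intro m x y hxy hx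
    simp only [mem_ofPred_eq] at hx ⊢
    rwa [← hcong m x y hxy]
  · intro m x hG
    have ht : (0 : ℝ) < (1 / 2) ^ (m / H) := by positivity
    have h1 := half_le_levelY hH m
    have h2 := levelY_le hH m
    have hpos := levelY_pos hH m
    refine (measure_mono ?_).trans ((hP (meshNode H k m x) hpos hG).trans ?_)
    · rintro x' ⟨hx', m', hm', hB⟩
      have hdiv : m / H ≤ m' / H := by rw [Nat.le_div_iff_mul_le hH]; exact hm'
      refine ⟨?_, levelY H m', levelY_pos hH m', ?_, ?_⟩
      · have hx : (meshNode H k m x).re ∈ dyadicIco (m / H) ⌊x / (1 / 2 : ℝ) ^ (m / H)⌋ := by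
          refine floor_dyadic_mono (Nat.le_add_left (m / H) k) ?_
          change ⌊(⌊x / levelW H k m⌋ * levelW H k m) / levelW H k m⌋ = ⌊x / levelW H k m⌋
          rw [mul_div_assoc, div_self (levelW_pos H k m).ne', mul_one, Int.floor_intCast]
        rw [dyadicIco_eq_Ico] at hx hx'
        have : (meshNode H k m x).im = levelY H m := rfl
        rw [this, abs_le]
        constructor <;> linarith [hx.1, hx.2, hx'.1, hx'.2]
      · have h3 : (1 / 2 : ℝ) ^ (m' / H) ≤ (1 / 2 : ℝ) ^ (m / H) :=
          pow_le_pow_of_le_one (by norm_num) (by norm_num) hdiv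
        have := levelY_le hH m'
        change levelY H m' ≤ 2 * levelY H m
        linarith
      · have hpos' := levelY_pos hH m'
        have h3 := norm_sub_le_of_UH hb hb1 (z := meshNode H k m' x') (w := ⟨x', levelY H m'⟩)
          hpos' hpos'
        have h4 : ‖(⟨x', levelY H m'⟩ : ℂ) - meshNode H k m' x'‖ ≤ levelW H k m' := by
          refine (Complex.norm_le_abs_re_add_abs_im _).trans ?_
          rw [Complex.sub_re, Complex.sub_im]
          have := abs_meshNode_re_sub_le (H := H) (k := k) m' x'
          rw [abs_sub_comm] at this
          simpa [meshNode] using this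
        have h5 := half_le_levelY hH m'
        have h6 : ‖b ⟨x', levelY H m'⟩ - b (meshNode H k m' x')‖ ≤ ε / 2 := by
          refine h3.trans (le_trans ?_ hkε)
          change 4 * 1 * _ / levelY H m' ≤ _
          rw [div_le_iff₀ hpos']
          have h7 : levelW H k m' = (1 / 2 : ℝ) ^ k * (1 / 2) ^ (m' / H) := pow_add _ _ _
          have h8 : (0 : ℝ) < (1 / 2) ^ k := by positivity
          nlinarith
        have h7 := norm_le_norm_add_norm_sub' (b ⟨x', levelY H m'⟩) (b (meshNode H k m' x'))
        linarith
    · rw [show (4 : ℝ≥0∞) = ENNReal.ofReal 4 by simp, ← ENNReal.ofReal_div_of_pos (by norm_num)]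
      refine ENNReal.ofReal_le_ofReal ?_
      change 1 / 4 * levelY H m ≤ _
      linarith
  · intro m x y hxy hx
    simp only [mem_ofPred_eq] at hx ⊢
    rwa [← hcong m x y hxy]

end

/-- **Cutoff lemma**: a smooth cutoff adapted to the sublevel sets of a bounded holomorphic
function, whose gradient is a Carleson measure. -/
theorem exists_carleson_cutoff {ε₂ : ℝ} (hε₂ : 0 < ε₂) :
    ∃ ε₃ C : ℝ, 0 < ε₃ ∧ ε₃ < ε₂ ∧ 0 < C ∧ ∀ b : ℂ → ℂ, DifferentiableOn ℂ b UH →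
      (∀ z ∈ UH, ‖b z‖ ≤ 1) → ∀ τ : ℝ, 0 < τ → ∃ χ : ℂ → ℝ, ContDiff ℝ 1 χ ∧
      (∀ z : ℂ, |z.re| ≤ 2 → τ ≤ z.im → z.im ≤ 1 → χ z ∈ Icc 0 1 ∧ (‖b z‖ < ε₃ → χ z = 1) ∧
        (ε₂ ≤ ‖b z‖ → χ z = 0) ∧ ‖fderiv ℝ χ z‖ ≤ C / z.im) ∧
      ∀ x₀ ℓ, 0 < ℓ → ℓ ≤ 1 → ∫⁻ z in cbox x₀ ℓ ∩ {z | |z.re| ≤ 2 ∧ τ ≤ z.im},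
        ENNReal.ofReal ‖fderiv ℝ χ z‖ ≤ ENNReal.ofReal (C * ℓ) := by
  obtain ⟨ε, hε0, hε1, hεδ, hP⟩ := exists_forall_volume_projection_le (half_pos hε₂)
    (by norm_num : (0 : ℝ) < 1 / 4)
  obtain ⟨C₀, hC1, hC₀⟩ := exists_deriv_smoothTransition_bound
  obtain ⟨k, hk⟩ := exists_pow_lt_of_lt_one (show 0 < ε / 256 by positivity)
    (by norm_num : (1 / 2 : ℝ) < 1)
  have hk0 : 0 < k := by
    rcases Nat.eq_zero_or_pos k with rfl | h0
    · norm_num at hk; linarith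
    · exact h0
  obtain ⟨H, hHε⟩ := exists_nat_gt (256 / ε)
  have hH0 : (0 : ℝ) < H := lt_trans (by positivity) hHε
  have hH : 0 < H := by exact_mod_cast hH0
  have hHε' : 1 / (2 * H : ℝ) ≤ ε / 256 := by
    rw [div_lt_iff₀ hε0] at hHε
    rw [div_le_div_iff₀ (by positivity) (by norm_num)]
    linarith
  set A := C₀ * (3 * 2 ^ k + 2 * H) with hA
  have hA0 : 0 < A := by positivity
  set B := A * (6 * (2 * (2 * H * (1 + 4 * (k * H + 3))) + (k * H + 3))) with hB
  have hB0 : 0 < B := by positivity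
  refine ⟨ε / 4, 3 * A + B, by positivity, by linarith, by positivity, fun b hb hb1 τ hτ => ?_⟩
  have hcd := cellData_of_holomorphic hH hb hb1 hk0 (hP b hb hb1) (by linarith)
  obtain ⟨N, hN⟩ := exists_pow_lt_of_lt_one hτ (by norm_num : (1 / 2 : ℝ) < 1)
  set L := N * H with hL
  have hLτ : levelY H L < τ := by rw [hL, levelY_mul hH]; exact hN
  set J := 3 * 2 ^ (k + L) with hJ
  set Bd := fun m x => ‖b (meshNode H k m x)‖ < ε / 2 with hBd
  set Gd := fun m x => ε₂ / 2 ≤ ‖b (meshNode H k m x)‖ with hGd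
  refine ⟨planeInterp J L (levelW H k) (levelY H) (cellVal Bd Gd H k), contDiff_planeInterp _ _ _ _ _,
    fun z hz1 hz2 hz3 => ?_, fun x₀ ℓ hℓ0 hℓ1 => ?_⟩
  · obtain ⟨i, hiL, -, hi1, hi2⟩ := exists_strip hH (m₀ := 0) (L := L) (y := z.im)
      (by simpa [levelY] using hz3) (by linarith)
    rw [zero_add] at hi1 hi2
    have hY := strictAnti_levelY hH
    have hz0 : 0 < z.im := by linarith
    have hj : ∀ m, m = i ∨ m = i + 1 → -(J : ℤ) ≤ ⌊z.re / levelW H k m⌋ ∧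
        ⌊z.re / levelW H k m⌋ ≤ J := fun m hm =>
      CellData.floor_levelW_bounds le_rfl (by omega) hz1
    have hη : 8 * (2 * (1 / 2 : ℝ) ^ k + 1 / (2 * H)) ≤ ε / 4 := by linarith
    have hnode : ∀ m, m = i ∨ m = i + 1 → ‖b (meshNode H k m z.re) - b z‖ ≤ ε / 4 ∧
        ‖b (meshNode H k m (z.re - levelW H k m)) - b z‖ ≤ ε / 4 := fun m hm =>
      ⟨(norm_sub_meshNode_le hH hb hb1 hm (by simpa using (levelW_pos H k m).le) hi1 hi2).trans hη,
        (norm_sub_meshNode_le hH hb hb1 hm (by simp [abs_of_pos (levelW_pos H k m)])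
          hi1 hi2).trans hη⟩
    have hval : ∀ p q : ℝ, (∀ m, m = i ∨ m = i + 1 →
        (if stateBefore Bd Gd (m + 1) z.re = true then (1 : ℝ) else 0) ∈ Icc p q ∧
        (if stateBefore Bd Gd (m + 1) (z.re - levelW H k m) = true then (1 : ℝ) else 0) ∈ Icc p q) →
        planeInterp J L (levelW H k) (levelY H) (cellVal Bd Gd H k) z ∈ Icc p q := by
      intro p q hpq
      refine planeInterp_mem_Icc hY hiL hi1 hi2 hj fun m hm => ?_
      rw [hcd.cellVal_floor, hcd.cellVal_floor_sub_one]
      exact hpq m hm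
    refine ⟨?_, fun hbz => ?_, fun hbz => ?_, ?_⟩
    · refine hval 0 1 fun m _ => ⟨?_, ?_⟩ <;> split_ifs <;> simp
    · have key : ∀ m x, ‖b (meshNode H k m x) - b z‖ ≤ ε / 4 →
          stateBefore Bd Gd (m + 1) x = true := by
        intro m x hmx
        have h1 : Bd m x := by
          have := norm_le_norm_add_norm_sub' (b (meshNode H k m x)) (b z)
          simp only [hBd]; linarith
        simp [stateBefore, nextState, h1]
      have := hval 1 1 fun m hm => by
        rw [key m _ (hnode m hm).1, key m _ (hnode m hm).2]; simp
      exact le_antisymm this.2 this.1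
    · have key : ∀ m x, ‖b (meshNode H k m x) - b z‖ ≤ ε / 4 →
          stateBefore Bd Gd (m + 1) x = false := by
        intro m x hmx
        have h0 : ε₂ / 2 ≤ ‖b (meshNode H k m x)‖ := by
          have := norm_le_norm_add_norm_sub' (b z) (b (meshNode H k m x))
          rw [norm_sub_rev] at this
          linarith
        have h1 : ¬ Bd m x := by simp only [hBd]; linarith
        have h2 : Gd m x := h0
        simp [stateBefore, nextState, h1, h2]
      have := hval 0 0 fun m hm => by
        rw [key m _ (hnode m hm).1, key m _ (hnode m hm).2]; simp
      exact le_antisymm this.2 this.1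
    · refine (hcd.norm_fderiv_planeInterp_le hC1 hC₀ le_rfl hiL hz1 hi1 hi2).trans ?_
      have hpow : (2 : ℝ) ^ (i / H) ≤ 1 / z.im := by
        rw [le_div_iff₀ hz0]
        have := hi2.trans (levelY_le hH i)
        rw [one_div, inv_pow] at this
        calc _ ≤ (2 : ℝ) ^ (i / H) * (2 ^ (i / H))⁻¹ := by gcongr
          _ = 1 := mul_inv_cancel₀ (by positivity)
      have hjump : (cellJump Bd Gd H k i z.re : ℝ) + cellJump Bd Gd H k (i + 1) z.re +
          switchAt Bd Gd (i + 1) z.re ≤ 3 := by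
        have h1 : cellJump Bd Gd H k i z.re ≤ 1 := by unfold cellJump; split_ifs <;> simp
        have h2 : cellJump Bd Gd H k (i + 1) z.re ≤ 1 := by unfold cellJump; split_ifs <;> simp
        have h3 : switchAt Bd Gd (i + 1) z.re ≤ 1 := by unfold switchAt; split_ifs <;> simp
        have : cellJump Bd Gd H k i z.re + cellJump Bd Gd H k (i + 1) z.re +
          switchAt Bd Gd (i + 1) z.re ≤ 3 := by omega
        exact_mod_cast this
      calc A * 2 ^ (i / H) * _ ≤ A * (1 / z.im) * 3 := by gcongr
        _ = 3 * A / z.im := by ring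
        _ ≤ _ := by gcongr; linarith
  · refine (hcd.lintegral_norm_fderiv_planeInterp_le hC1 hC₀ le_rfl hLτ x₀ hℓ0 hℓ1).trans ?_
    refine ENNReal.ofReal_le_ofReal (mul_le_mul_of_nonneg_right ?_ hℓ0.le)
    rw [← hB]; linarith

end

section
open MeasureTheory Set Filter Topology

lemma hasDerivAt_intervalIntegral_param {f f' : ℝ → ℝ → ℝ} {s : Set ℝ} (hs : IsOpen s) {y a b : ℝ}
    (hy : y ∈ s) (hf : ∀ x ∈ s, ContinuousOn (f x) (uIcc a b))
    (hd : ∀ x ∈ s, ∀ t ∈ uIcc a b, HasDerivAt (fun x => f x t) (f' x t) x)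
    (hc : ContinuousOn (fun p : ℝ × ℝ => f' p.1 p.2) (s ×ˢ uIcc a b)) :
    HasDerivAt (fun x => ∫ t in a..b, f x t) (∫ t in a..b, f' y t) y := by
  obtain ⟨r, hr, hrs⟩ := Metric.nhds_basis_closedBall.mem_iff.1 (hs.mem_nhds hy)
  obtain ⟨B, hB⟩ := ((isCompact_closedBall y r).prod (isCompact_uIcc (a := a) (b := b))).exists_bound_of_continuousOn
    (hc.mono (prod_mono hrs Subset.rfl))
  refine (intervalIntegral.hasDerivAt_integral_of_dominated_loc_of_deriv_le (bound := fun _ => B)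
    (Metric.closedBall_mem_nhds y hr) ?_ ?_ ?_ ?_ intervalIntegrable_const ?_).2
  · filter_upwards [hs.mem_nhds hy] with x hx
    exact ((hf x hx).mono uIoc_subset_uIcc).aestronglyMeasurable measurableSet_uIoc
  · exact (hf y hy).intervalIntegrable
  · have : ContinuousOn (f' y) (uIcc a b) :=
      hc.comp (f := fun t : ℝ => (y, t)) (by fun_prop) fun t ht => ⟨hy, ht⟩
    exact (this.mono uIoc_subset_uIcc).aestronglyMeasurable measurableSet_uIoc
  · exact Eventually.of_forall fun t ht x hx => hB (x, t) ⟨hx, uIoc_subset_uIcc ht⟩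
  · exact Eventually.of_forall fun t ht x hx => hd x (hrs hx) t (uIoc_subset_uIcc ht)

section
variable {V Vx Vy : ℂ → ℂ} {U : Set ℂ}

lemma hasFDerivAt_of_partials (hU : IsOpen U) (hcx : ContinuousOn Vx U) (hcy : ContinuousOn Vy U)
    (hx : ∀ z ∈ U, HasDerivAt (fun x : ℝ => V ⟨x, z.im⟩) (Vx z) z.re)
    (hy : ∀ z ∈ U, HasDerivAt (fun y : ℝ => V ⟨z.re, y⟩) (Vy z) z.im) {z : ℂ} (hz : z ∈ U) :
    HasFDerivAt V (Complex.reCLM.smulRight (Vx z) + Complex.imCLM.smulRight (Vy z)) z := by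
  have hmk : Continuous fun p : ℝ × ℝ => (⟨p.1, p.2⟩ : ℂ) :=
    Complex.equivRealProdCLM.symm.continuous
  have hnear : ∀ᶠ v : ℝ × ℝ in 𝓝 (z.re, z.im), (⟨v.1, v.2⟩ : ℂ) ∈ U :=
    hmk.continuousAt.eventually (hU.mem_nhds hz)
  have hct : ∀ W : ℂ → ℂ, ContinuousOn W U → ContinuousAt
      (fun v : ℝ × ℝ => (ContinuousLinearMap.toSpanSingleton ℝ (W ⟨v.1, v.2⟩) : ℝ →L[ℝ] ℂ))
        (z.re, z.im) := by
    intro W hW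
    have h1 : ContinuousAt (fun v : ℝ × ℝ => W ⟨v.1, v.2⟩) (z.re, z.im) :=
      ContinuousAt.comp (f := fun v : ℝ × ℝ => (⟨v.1, v.2⟩ : ℂ))
        (hW.continuousAt (hU.mem_nhds hz)) hmk.continuousAt
    exact ((ContinuousLinearMap.toSpanSingletonCLE (𝕜 := ℝ) (E := ℂ)).continuous.continuousAt).comp h1
  have h := hasStrictFDerivAt_uncurry_coprod (𝕜 := ℝ) (u := (z.re, z.im))
    (f := fun x y : ℝ => V ⟨x, y⟩)
    (f₁ := fun x y => ContinuousLinearMap.toSpanSingleton ℝ (Vx ⟨x, y⟩))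
    (f₂ := fun x y => ContinuousLinearMap.toSpanSingleton ℝ (Vy ⟨x, y⟩))
    (hnear.mono fun v hv => (hx _ hv).hasFDerivAt)
    (hnear.mono fun v hv => (hy _ hv).hasFDerivAt) (hct Vx hcx) (hct Vy hcy)
  have h2 := h.hasFDerivAt.comp z
    (f := fun w : ℂ => (w.re, w.im)) (Complex.equivRealProdCLM.hasFDerivAt (x := z))
  refine h2.congr_fderiv ?_
  ext
  · simp [Function.HasUncurry.uncurry]

lemma contDiffOn_of_partials (hU : IsOpen U) (hcx : ContinuousOn Vx U) (hcy : ContinuousOn Vy U)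
    (hx : ∀ z ∈ U, HasDerivAt (fun x : ℝ => V ⟨x, z.im⟩) (Vx z) z.re)
    (hy : ∀ z ∈ U, HasDerivAt (fun y : ℝ => V ⟨z.re, y⟩) (Vy z) z.im) :
    ContDiffOn ℝ 1 V U := by
  have h := fun z (hz : z ∈ U) => hasFDerivAt_of_partials hU hcx hcy hx hy hz
  rw [show (1 : WithTop ℕ∞) = 0 + 1 from (zero_add 1).symm,
    contDiffOn_succ_iff_fderiv_of_isOpen hU]
  refine ⟨fun z hz => (h z hz).differentiableAt.differentiableWithinAt, by simp, ?_⟩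
  rw [contDiffOn_zero]
  refine ContinuousOn.congr ?_ fun z hz => (h z hz).fderiv
  have hsm : ∀ L : ℂ →L[ℝ] ℝ, ∀ W, ContinuousOn W U → ContinuousOn (fun z => L.smulRight (W z)) U := 
    fun L W hW => (ContinuousLinearMap.smulRightL ℝ ℂ ℂ L).continuous.comp_continuousOn hW
  exact (hsm _ _ hcx).add (hsm _ _ hcy)
end

end

section
open MeasureTheory Set Filter Topology Complex ComplexConjugate

section
variable {s : ℝ}

/-- A smooth cutoff equal to `0` for `t ≤ s / 2` and to `1` for `t ≥ s`. -/
noncomputable def logCutoff (s t : ℝ) : ℝ := Real.smoothTransition (2 * t / s - 1)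

/-- A smooth function equal to `1 / t` for `t ≥ s`. -/
noncomputable def logWeight (s t : ℝ) : ℝ := logCutoff s t / t

/-- A smooth function equal to `log t / 2` for `t ≥ s`. -/
noncomputable def logPrim (s t : ℝ) : ℝ := Real.log s / 2 + ∫ u in s..t, logWeight s u / 2

lemma contDiff_logCutoff (s : ℝ) : ContDiff ℝ 2 (logCutoff s) :=
  Real.smoothTransition.contDiff.comp (by fun_prop)

lemma logCutoff_of_le (hs : 0 < s) {t : ℝ} (ht : t ≤ s / 2) : logCutoff s t = 0 :=
  Real.smoothTransition.zero_of_nonpos (by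
    have : 2 * t / s ≤ 1 := by rw [div_le_one hs]; linarith
    linarith)

lemma logCutoff_of_ge (hs : 0 < s) {t : ℝ} (ht : s ≤ t) : logCutoff s t = 1 :=
  Real.smoothTransition.one_of_one_le (by
    have : 2 ≤ 2 * t / s := by rw [le_div_iff₀ hs]; linarith
    linarith)

lemma logCutoff_nonneg (s t : ℝ) : 0 ≤ logCutoff s t := Real.smoothTransition.nonneg _

lemma logCutoff_le_one (s t : ℝ) : logCutoff s t ≤ 1 := Real.smoothTransition.le_one _

lemma hasDerivAt_logCutoff (s t : ℝ) :
    HasDerivAt (logCutoff s) (deriv Real.smoothTransition (2 * t / s - 1) * (2 / s)) t := by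
  have h1 : HasDerivAt Real.smoothTransition (deriv Real.smoothTransition (2 * t / s - 1))
      (2 * t / s - 1) :=
    ((Real.smoothTransition.contDiff (n := 1)).differentiable one_ne_zero _).hasDerivAt
  have h2 : HasDerivAt (fun t : ℝ => 2 * t / s - 1) (2 / s) t := by
    simpa using (((hasDerivAt_id t).const_mul 2).div_const s).sub_const 1
  exact h1.comp t h2

lemma deriv_logCutoff_nonneg (hs : 0 < s) (t : ℝ) : 0 ≤ deriv (logCutoff s) t := by
  refine Monotone.deriv_nonneg fun x y hxy => Real.smoothTransition.monotone ?_
  have : 2 * x / s ≤ 2 * y / s := by gcongr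
  linarith

lemma deriv_logCutoff_of_ge (hs : 0 < s) {t : ℝ} (ht : s ≤ t) : deriv (logCutoff s) t = 0 := by
  rw [(hasDerivAt_logCutoff s t).deriv, deriv_smoothTransition_of_one_le, zero_mul]
  have : 2 ≤ 2 * t / s := by rw [le_div_iff₀ hs]; linarith
  linarith

lemma exists_deriv_logCutoff_bound (hs : 0 < s) :
    ∃ C, 0 < C ∧ ∀ t, deriv (logCutoff s) t ≤ C := by
  obtain ⟨C, hC, h⟩ := exists_deriv_smoothTransition_bound
  refine ⟨C * (2 / s), by positivity, fun t => ?_⟩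
  rw [(hasDerivAt_logCutoff s t).deriv]
  exact mul_le_mul_of_nonneg_right ((le_abs_self _).trans (h _)) (by positivity)

lemma contDiff_logWeight (hs : 0 < s) : ContDiff ℝ 2 (logWeight s) := by
  refine contDiff_iff_contDiffAt.2 fun t => ?_
  rcases eq_or_ne t 0 with rfl | ht
  · refine (contDiffAt_const (c := (0 : ℝ))).congr_of_eventuallyEq ?_
    filter_upwards [Iio_mem_nhds (half_pos hs)] with t ht
    rw [logWeight, logCutoff_of_le hs ht.le, zero_div]
  · exact (contDiff_logCutoff s).contDiffAt.div contDiffAt_id ht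

lemma mul_logWeight (hs : 0 < s) (t : ℝ) : t * logWeight s t = logCutoff s t := by
  rcases eq_or_ne t 0 with rfl | ht
  · rw [zero_mul, logCutoff_of_le hs (by positivity)]
  · rw [logWeight]; field_simp

lemma mul_deriv_logWeight_add (hs : 0 < s) (t : ℝ) :
    t * deriv (logWeight s) t + logWeight s t = deriv (logCutoff s) t := by
  have h1 : HasDerivAt (logWeight s) (deriv (logWeight s) t) t :=
    ((contDiff_logWeight hs).differentiable two_ne_zero t).hasDerivAt
  have h2 := (hasDerivAt_id t).mul h1
  have h3 : (id * logWeight s) = logCutoff s := by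
    ext u; exact mul_logWeight hs u
  rw [h3] at h2
  rw [h2.deriv]; simp; ring

lemma logWeight_nonneg_le (hs : 0 < s) (t : ℝ) : logWeight s t ∈ Icc 0 (2 / s) := by
  rcases le_total t (s / 2) with ht | ht
  · rw [logWeight, logCutoff_of_le hs ht, zero_div]; exact ⟨le_rfl, by positivity⟩
  · have ht0 : 0 < t := lt_of_lt_of_le (half_pos hs) ht
    refine ⟨div_nonneg (logCutoff_nonneg _ _) ht0.le, ?_⟩
    calc logCutoff s t / t ≤ 1 / (s / 2) :=
          div_le_div₀ zero_le_one (logCutoff_le_one _ _) (half_pos hs) ht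
      _ = _ := by field_simp

lemma hasDerivAt_logPrim (hs : 0 < s) (t : ℝ) :
    HasDerivAt (logPrim s) (logWeight s t / 2) t := by
  have hc : Continuous fun u => logWeight s u / 2 := (contDiff_logWeight hs).continuous.div_const 2
  exact (intervalIntegral.integral_hasDerivAt_right (hc.intervalIntegrable _ _)
    hc.stronglyMeasurable.stronglyMeasurableAtFilter hc.continuousAt).const_add _

lemma logPrim_of_ge (hs : 0 < s) {t : ℝ} (ht : s ≤ t) : logPrim s t = Real.log t / 2 := by
  have : ∫ u in s..t, logWeight s u / 2 = ∫ u in s..t, u⁻¹ / 2 := by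
    refine intervalIntegral.integral_congr fun u hu => ?_
    rw [uIcc_of_le ht] at hu
    simp only [logWeight, logCutoff_of_ge hs hu.1, one_div]
  rw [logPrim, this, intervalIntegral.integral_div, integral_inv_of_pos hs (hs.trans_le ht),
    Real.log_div (hs.trans_le ht).ne' hs.ne']
  ring

lemma abs_logPrim_le (hs : 0 < s) (hs1 : s ≤ 1) {t : ℝ} (h0 : 0 ≤ t) (h1 : t ≤ 1) :
    |logPrim s t| ≤ |Real.log s| / 2 + 1 / s := by
  have h := intervalIntegral.norm_integral_le_of_norm_le_const (a := s) (b := t)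
    (f := fun u => logWeight s u / 2) (C := 1 / s) fun u _ => by
      have := logWeight_nonneg_le hs u
      rw [Real.norm_eq_abs, abs_of_nonneg (by linarith [this.1])]
      have h2 : 2 / s / 2 = 1 / s := by ring
      linarith [this.2]
  have h2 : |t - s| ≤ 1 := abs_le.2 ⟨by linarith, by linarith⟩
  have h3 : 1 / s * |t - s| ≤ 1 / s * 1 := mul_le_mul_of_nonneg_left h2 (by positivity)
  rw [Real.norm_eq_abs] at h
  calc _ ≤ |Real.log s / 2| + _ := abs_add_le _ _
    _ ≤ |Real.log s| / 2 + 1 / s := by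
      rw [abs_div, abs_of_pos (zero_lt_two' ℝ)]; linarith
end

section
variable {s : ℝ} {a : ℂ → ℂ}

/-- The regularised logarithmic derivative of `a`. -/
noncomputable def regLogDeriv (s : ℝ) (a : ℂ → ℂ) (z : ℂ) : ℂ :=
  logWeight s (normSq (a z)) * conj (a z) * deriv a z

/-- The source density `∂̄`-obstruction of `regLogDeriv`. -/
noncomputable def logSource (s : ℝ) (a : ℂ → ℂ) (z : ℂ) : ℝ :=
  2 * deriv (logCutoff s) (normSq (a z)) * ‖deriv a z‖ ^ 2

/-- The derivative of `regLogDeriv` in the direction `e`. -/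
noncomputable def regLogDerivDir (s : ℝ) (a : ℂ → ℂ) (e z : ℂ) : ℂ :=
  (deriv (logWeight s) (normSq (a z)) * (2 * (conj (a z) * (deriv a z * e)).re) : ℝ) *
      conj (a z) * deriv a z +
    logWeight s (normSq (a z)) * conj (deriv a z * e) * deriv a z +
    logWeight s (normSq (a z)) * conj (a z) * (deriv (deriv a) z * e)

lemma hasDerivAt_normSq {w : ℝ → ℂ} {w' : ℂ} {t : ℝ} (h : HasDerivAt w w' t) :
    HasDerivAt (fun t => normSq (w t)) (2 * (conj (w t) * w').re) t := by
  have h1 : HasDerivAt (fun t => (w t).re) w'.re t := reCLM.hasFDerivAt.comp_hasDerivAt t h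
  have h2 : HasDerivAt (fun t => (w t).im) w'.im t := imCLM.hasFDerivAt.comp_hasDerivAt t h
  have h3 := (h1.mul h1).add (h2.mul h2)
  refine h3.congr_deriv ?_
  simp; ring

lemma hasDerivAt_regLogDeriv_comp (hs : 0 < s) (ha : DifferentiableOn ℂ a UH) {γ : ℝ → ℂ} {e : ℂ} {t : ℝ}
    (hγ : HasDerivAt γ e t) (ht : γ t ∈ UH) :
    HasDerivAt (fun t => regLogDeriv s a (γ t)) (regLogDerivDir s a e (γ t)) t := by
  have h1 : HasDerivAt (fun t => a (γ t)) (deriv a (γ t) * e) t :=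
    (ha.differentiableAt_UH ht).hasDerivAt.comp t hγ
  have h2 : HasDerivAt (fun t => deriv a (γ t)) (deriv (deriv a) (γ t) * e) t :=
    ((ha.deriv isOpen_UH).differentiableAt_UH ht).hasDerivAt.comp t hγ
  have h3 : HasDerivAt (fun t => conj (a (γ t))) (conj (deriv a (γ t) * e)) t :=
    conjCLE.toContinuousLinearMap.hasFDerivAt.comp_hasDerivAt t h1
  have h4 : HasDerivAt (fun t => logWeight s (normSq (a (γ t)))) _ t :=
    (((contDiff_logWeight hs).differentiable two_ne_zero _).hasDerivAt).comp t (hasDerivAt_normSq h1)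
  refine ((h4.ofReal_comp.mul h3).mul h2).congr_deriv ?_
  simp only [regLogDerivDir, Pi.mul_apply]; ring

lemma hasDerivAt_logPrim_normSq_comp (hs : 0 < s) (ha : DifferentiableOn ℂ a UH) {γ : ℝ → ℂ} {e : ℂ}
    {t : ℝ} (hγ : HasDerivAt γ e t) (ht : γ t ∈ UH) :
    HasDerivAt (fun t => logPrim s (normSq (a (γ t)))) (regLogDeriv s a (γ t) * e).re t := by
  have h1 : HasDerivAt (fun t => a (γ t)) (deriv a (γ t) * e) t :=
    (ha.differentiableAt_UH ht).hasDerivAt.comp t hγ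
  have h2 := (hasDerivAt_logPrim hs (normSq (a (γ t)))).comp t (hasDerivAt_normSq h1)
  refine h2.congr_deriv ?_
  rw [regLogDeriv, mul_assoc, mul_assoc, re_ofReal_mul]
  ring

lemma continuousOn_regLogDeriv (hs : 0 < s) (ha : DifferentiableOn ℂ a UH) :
    ContinuousOn (regLogDeriv s a) UH := by
  have h0 := ha.continuousOn
  have h1 := (ha.deriv isOpen_UH).continuousOn
  have h3 := (continuous_ofReal.comp ((contDiff_logWeight hs).continuous.comp
    continuous_normSq)).comp_continuousOn h0
  exact (h3.mul (continuous_conj.comp_continuousOn h0)).mul h1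

lemma continuousOn_regLogDerivDir (hs : 0 < s) (ha : DifferentiableOn ℂ a UH) (e : ℂ) :
    ContinuousOn (regLogDerivDir s a e) UH := by
  have h0 := ha.continuousOn
  have h1 := (ha.deriv isOpen_UH).continuousOn
  have h2 := ((ha.deriv isOpen_UH).deriv isOpen_UH).continuousOn
  have h3 := (continuous_ofReal.comp ((contDiff_logWeight hs).continuous.comp
    continuous_normSq)).comp_continuousOn h0
  have h4 := (((contDiff_logWeight hs).continuous_deriv one_le_two).comp
    continuous_normSq).comp_continuousOn h0
  have h5 := continuous_conj.comp_continuousOn h0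
  have h6 := h1.mul (continuousOn_const (c := e))
  refine ((((continuous_ofReal.comp_continuousOn (h4.mul (continuousOn_const.mul
    (continuous_re.comp_continuousOn (h5.mul h6))))).mul h5).mul h1).add
    ((h3.mul (continuous_conj.comp_continuousOn h6)).mul h1)).add
    ((h3.mul h5).mul (h2.mul continuousOn_const))

lemma continuousOn_logSource (ha : DifferentiableOn ℂ a UH) :
    ContinuousOn (logSource s a) UH := by
  have h0 := ha.continuousOn
  have h1 := (ha.deriv isOpen_UH).continuousOn
  have h4 := (((contDiff_logCutoff s).continuous_deriv one_le_two).comp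
    continuous_normSq).comp_continuousOn h0
  exact (continuousOn_const.mul h4).mul (h1.norm.pow 2)

/-- The failure of `regLogDeriv` to be holomorphic. -/
lemma I_mul_regLogDerivDir_sub (hs : 0 < s) (z : ℂ) :
    I * regLogDerivDir s a 1 z - regLogDerivDir s a I z = I * logSource s a z := by
  have h := mul_deriv_logWeight_add hs (normSq (a z))
  have h2 : (‖deriv a z‖ ^ 2 : ℝ) = normSq (deriv a z) := (normSq_eq_norm_sq _).symm
  simp only [regLogDerivDir, logSource, ← h, h2]
  generalize deriv (logWeight s) (normSq (a z)) = m'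
  generalize logWeight s (normSq (a z)) = m
  generalize deriv (deriv a) z = w
  generalize deriv a z = v
  generalize a z = u
  apply Complex.ext <;> simp [normSq_apply] <;> ring

lemma logSource_nonneg (hs : 0 < s) (z : ℂ) : 0 ≤ logSource s a z :=
  mul_nonneg (mul_nonneg zero_le_two (deriv_logCutoff_nonneg hs _)) (sq_nonneg _)

lemma logSource_eq_zero (hs : 0 < s) {z : ℂ} (h : s ≤ ‖a z‖ ^ 2) : logSource s a z = 0 := by
  rw [logSource, deriv_logCutoff_of_ge hs (by rwa [normSq_eq_norm_sq]), mul_zero, zero_mul]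

lemma regLogDeriv_eq (hs : 0 < s) {z : ℂ} (h : s ≤ ‖a z‖ ^ 2) :
    regLogDeriv s a z = deriv a z / a z := by
  have h1 : s ≤ normSq (a z) := by rwa [normSq_eq_norm_sq]
  have h0 : a z ≠ 0 := fun h0 => by simp [h0] at h; linarith
  have h2 : (normSq (a z) : ℂ) = a z * conj (a z) := (mul_conj _).symm
  have h3 : conj (a z) ≠ 0 := by simpa using h0
  rw [regLogDeriv, logWeight, logCutoff_of_ge hs h1, one_div, ofReal_inv, h2]
  field_simp
end

end

section
open MeasureTheory Set Filter Topology

section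
variable {κ c : ℝ} {ω : ℝ × ℝ × ℝ → ℝ}

/-- The mass of the bump `ω (t, v, ·)`, bounded below by `κ v / 4`. -/
noncomputable def bumpMass (κ c : ℝ) (ω : ℝ × ℝ × ℝ → ℝ) (t v : ℝ) : ℝ :=
  max (∫ x in (t - κ * max v c)..(t + κ * max v c), ω (t, v, x)) (κ * max v c / 4)

lemma continuous_bumpMass (hω : Continuous ω) :
    Continuous fun p : ℝ × ℝ => bumpMass κ c ω p.1 p.2 := by
  unfold bumpMass
  have h1 : ∀ s : ℝ × ℝ → ℝ, Continuous s →
      Continuous fun p : ℝ × ℝ => ∫ x in (0 : ℝ)..(s p), ω (p.1, p.2, x) := fun s hs =>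
    intervalIntegral.continuous_parametric_intervalIntegral_of_continuous
      (f := fun (p : ℝ × ℝ) x => ω (p.1, p.2, x)) (by unfold Function.uncurry; fun_prop) hs
  have h2 : (fun p : ℝ × ℝ => ∫ x in (p.1 - κ * max p.2 c)..(p.1 + κ * max p.2 c), ω (p.1, p.2, x)) =
      fun p => (∫ x in (0 : ℝ)..(p.1 + κ * max p.2 c), ω (p.1, p.2, x)) -
        ∫ x in (0 : ℝ)..(p.1 - κ * max p.2 c), ω (p.1, p.2, x) := by
    ext p
    have : Continuous fun x => ω (p.1, p.2, x) := by fun_prop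
    rw [intervalIntegral.integral_interval_sub_left] <;> exact this.intervalIntegrable _ _
  have h3 := h1 (fun p => p.1 + κ * max p.2 c) (by fun_prop)
  have h4 := h1 (fun p => p.1 - κ * max p.2 c) (by fun_prop)
  refine Continuous.max ?_ (by fun_prop)
  rw [h2]
  exact h3.sub h4

lemma bumpMass_pos (hκ : 0 < κ) (hc : 0 < c) (t v : ℝ) : 0 < bumpMass κ c ω t v :=
  lt_max_of_lt_right (by have : 0 < max v c := lt_max_of_lt_right hc
                         positivity)

lemma exists_step_of_bump (hκ : 0 < κ) (hc : 0 < c) (hω : Continuous ω) (h0 : ∀ p, 0 ≤ ω p)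
    (h1 : ∀ p, ω p ≤ 1) (hz : ∀ t v x, κ * max v c ≤ |x - t| → ω (t, v, x) = 0) :
    ∃ k S : ℝ → ℝ → ℝ → ℝ, Continuous (fun p : ℝ × ℝ × ℝ => k p.1 p.2.1 p.2.2) ∧
      Continuous (fun p : ℝ × ℝ × ℝ => S p.1 p.2.1 p.2.2) ∧
      ∀ t v x, HasDerivAt (S t v) (k t v x) x ∧ (c ≤ v → 0 ≤ k t v x ∧ k t v x ≤ 4 / (κ * v) ∧
        (ω (t, v, x) = 0 → k t v x = 0) ∧ S t v x ∈ Icc 0 1 ∧ (x ≤ t - κ * v → S t v x = 0) ∧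
        (κ * v / 4 ≤ (∫ x in (t - κ * v)..(t + κ * v), ω (t, v, x)) → t + κ * v ≤ x →
          S t v x = 1)) := by
  have hkc : Continuous fun p : ℝ × ℝ × ℝ => ω p / bumpMass κ c ω p.1 p.2.1 := by
    refine hω.div ?_ fun p => (bumpMass_pos hκ hc _ _).ne'
    exact (continuous_bumpMass hω).comp (f := fun p : ℝ × ℝ × ℝ => (p.1, p.2.1)) (by fun_prop)
  have hkx : ∀ t v, Continuous fun x => ω (t, v, x) / bumpMass κ c ω t v := fun t v =>
    hkc.comp (f := fun x : ℝ => ((t, v, x) : ℝ × ℝ × ℝ)) (by fun_prop)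
  refine ⟨fun t v x => ω (t, v, x) / bumpMass κ c ω t v,
    fun t v x => ∫ y in (t - κ * max v c)..x, ω (t, v, y) / bumpMass κ c ω t v, hkc, ?_,
    fun t v x => ⟨?_, fun hv => ⟨?_, ?_, ?_, ?_, ?_, ?_⟩⟩⟩
  · have hS : ∀ s : ℝ × ℝ × ℝ → ℝ, Continuous s → Continuous fun p : ℝ × ℝ × ℝ =>
        ∫ y in (0 : ℝ)..(s p), ω (p.1, p.2.1, y) / bumpMass κ c ω p.1 p.2.1 := fun s hs =>
      intervalIntegral.continuous_parametric_intervalIntegral_of_continuous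
        (f := fun (p : ℝ × ℝ × ℝ) y => ω (p.1, p.2.1, y) / bumpMass κ c ω p.1 p.2.1)
        (hkc.comp (f := fun q : (ℝ × ℝ × ℝ) × ℝ => ((q.1.1, q.1.2.1, q.2) : ℝ × ℝ × ℝ))
          (by fun_prop)) hs
    have h3 := (hS (fun p => p.2.2) (by fun_prop)).sub
      (hS (fun p => p.1 - κ * max p.2.1 c) (by fun_prop))
    refine h3.congr fun p => ?_
    rw [Pi.sub_apply, intervalIntegral.integral_interval_sub_left] <;>
      exact (hkx _ _).intervalIntegrable _ _
  · exact intervalIntegral.integral_hasDerivAt_right ((hkx _ _).intervalIntegrable _ _)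
      (hkx t v).stronglyMeasurable.stronglyMeasurableAtFilter (hkx t v).continuousAt
  · exact div_nonneg (h0 _) (bumpMass_pos hκ hc _ _).le
  · have hv0 := hc.trans_le hv
    calc _ ≤ 1 / (κ * v / 4) := by
          refine div_le_div₀ zero_le_one (h1 _) (by positivity) ?_
          refine le_trans (le_of_eq ?_) (le_max_right _ _)
          rw [max_eq_left hv]
      _ = _ := by field_simp
  · intro h; simp [h]
  all_goals
    have hv0 := hc.trans_le hv
    have hkv : 0 < κ * v := by positivity
    simp only [max_eq_left hv] at hz ⊢
    have hintg : ∀ p q, IntervalIntegrable (fun x => ω (t, v, x) / bumpMass κ c ω t v) volume p q :=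
      fun p q => (hkx _ _).intervalIntegrable _ _
    have hnn : ∀ x, 0 ≤ ω (t, v, x) / bumpMass κ c ω t v :=
      fun x => div_nonneg (h0 _) (bumpMass_pos hκ hc _ _).le
    have hzk : ∀ x, κ * v ≤ |x - t| → ω (t, v, x) / bumpMass κ c ω t v = 0 := fun x hx => by
      rw [hz t v x (by rwa [max_eq_left hv]), zero_div]
    have hlo : ∀ x, x ≤ t - κ * v →
        ∫ y in (t - κ * v)..x, ω (t, v, y) / bumpMass κ c ω t v = 0 := by
      intro x hx
      rw [intervalIntegral.integral_congr (g := fun _ => (0 : ℝ)), intervalIntegral.integral_zero]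
      intro y hy
      rw [uIcc_of_ge hx] at hy
      exact hzk y (by rw [abs_of_neg (by linarith [hy.2])]; linarith [hy.2])
    have hhi : ∀ x, t + κ * v ≤ x → ∫ y in (t - κ * v)..x, ω (t, v, y) / bumpMass κ c ω t v =
        (∫ x in (t - κ * v)..(t + κ * v), ω (t, v, x)) / bumpMass κ c ω t v := by
      intro x hx
      rw [← intervalIntegral.integral_add_adjacent_intervals (hintg _ (t + κ * v)) (hintg _ _),
        intervalIntegral.integral_congr (a := t + κ * v) (g := fun _ => (0 : ℝ)),
        intervalIntegral.integral_zero, add_zero, intervalIntegral.integral_div]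
      intro y hy
      rw [uIcc_of_le hx] at hy
      exact hzk y (by rw [abs_of_pos (by linarith [hy.1])]; linarith [hy.1])
    have htot : (∫ x in (t - κ * v)..(t + κ * v), ω (t, v, x)) / bumpMass κ c ω t v ≤ 1 := by
      rw [div_le_one (bumpMass_pos hκ hc _ _)]
      refine le_trans (le_of_eq ?_) (le_max_left _ _)
      rw [max_eq_left hv]
  · rcases le_total x (t - κ * v) with hx | hx
    · rw [hlo x hx]; simp
    refine ⟨intervalIntegral.integral_nonneg hx fun y _ => hnn y, le_trans ?_ htot⟩
    rcases le_total (t + κ * v) x with hx' | hx'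
    · rw [hhi x hx']
    · rw [← hhi (t + κ * v) le_rfl,
        ← intervalIntegral.integral_add_adjacent_intervals (hintg _ x) (hintg _ (t + κ * v))]
      have := intervalIntegral.integral_nonneg (μ := volume) hx' fun y _ => hnn y
      linarith
  · exact hlo x
  · intro h hx
    rw [hhi x hx, bumpMass, max_eq_left hv, max_eq_left h, div_self]
    have : 0 < κ * v / 4 := by positivity
    exact (this.trans_le h).ne'
end

/-- The minimum of `‖b‖` over the vertical segment from height `c` to height `2 max v c`. -/
noncomputable def segMin (b : ℂ → ℂ) (c : ℝ) (v x : ℝ) : ℝ :=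
  sInf ((fun r : ℝ => ‖b ⟨x, max (c + r * (2 * max v c - c)) c⟩‖) '' Icc 0 1)

lemma continuous_segMin {b : ℂ → ℂ} (hb : ContinuousOn b UH) {c : ℝ} (hc : 0 < c) :
    Continuous fun p : ℝ × ℝ => segMin b c p.1 p.2 := by
  refine isCompact_Icc.continuous_sInf
    (f := fun (p : ℝ × ℝ) (r : ℝ) => ‖b ⟨p.2, max (c + r * (2 * max p.1 c - c)) c⟩‖) ?_
  exact ((continuous_mk_max hb hc).comp (f := fun q : (ℝ × ℝ) × ℝ =>
    ((q.1.2, c + q.2 * (2 * max q.1.1 c - c)) : ℝ × ℝ)) (by fun_prop)).norm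

lemma segMin_le {b : ℂ → ℂ} {c v x y : ℝ} (hc : 0 < c) (hv : c ≤ v) (hy : c ≤ y) (hy2 : y ≤ 2 * v) :
    segMin b c v x ≤ ‖b ⟨x, y⟩‖ := by
  refine csInf_le ⟨0, ?_⟩ ⟨(y - c) / (2 * v - c), ⟨?_, ?_⟩, ?_⟩
  · rintro _ ⟨r, -, rfl⟩; positivity
  · exact div_nonneg (by linarith) (by linarith)
  · exact div_le_one_of_le₀ (by linarith) (by linarith)
  · have : (2 * v - c) ≠ 0 := by linarith
    simp only [max_eq_left hv, div_mul_cancel₀ _ this, add_sub_cancel, max_eq_left hy]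

lemma le_segMin {b : ℂ → ℂ} {c v x ε : ℝ} (hc : 0 < c) (hv : c ≤ v)
    (h : ∀ y, 0 < y → y ≤ 2 * v → ε ≤ ‖b ⟨x, y⟩‖) : ε ≤ segMin b c v x := by
  refine le_csInf ((nonempty_Icc.2 zero_le_one).image _) ?_
  rintro _ ⟨r, ⟨hr0, hr1⟩, rfl⟩
  simp only [max_eq_left hv]
  have h1 : 0 ≤ r * (2 * v - c) := mul_nonneg hr0 (by linarith)
  have h2 : r * (2 * v - c) ≤ 1 * (2 * v - c) := mul_le_mul_of_nonneg_right hr1 (by linarith)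
  rw [max_eq_left (by linarith)]
  exact h _ (by linarith) (by linarith)

lemma exists_step_kernel {δ κ : ℝ} (hδ : 0 < δ) (hκ : 0 < κ) (hκ1 : κ ≤ 1) :
    ∃ ε : ℝ, 0 < ε ∧ ε < δ ∧ ∀ b : ℂ → ℂ, DifferentiableOn ℂ b UH → (∀ z ∈ UH, ‖b z‖ ≤ 1) →
      ∀ c : ℝ, 0 < c → ∃ k S : ℝ → ℝ → ℝ → ℝ,
        Continuous (fun p : ℝ × ℝ × ℝ => k p.1 p.2.1 p.2.2) ∧
        Continuous (fun p : ℝ × ℝ × ℝ => S p.1 p.2.1 p.2.2) ∧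
        ∀ t v x, HasDerivAt (S t v) (k t v x) x ∧ (c ≤ v → 0 ≤ k t v x ∧ k t v x ≤ 4 / (κ * v) ∧
          (κ * v ≤ |x - t| → k t v x = 0) ∧
          (∀ y, c ≤ y → y ≤ 2 * v → ‖b ⟨x, y⟩‖ ≤ ε → k t v x = 0) ∧
          S t v x ∈ Icc 0 1 ∧ (x ≤ t - κ * v → S t v x = 0) ∧
          (δ ≤ ‖b ⟨t, v⟩‖ → t + κ * v ≤ x → S t v x = 1)) := by
  obtain ⟨ε, hε, -, hεδ, hvol⟩ := exists_forall_volume_projection_le hδ (half_pos hκ)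
  refine ⟨ε / 2, half_pos hε, by linarith, fun b hb hb1 c hc => ?_⟩
  set ω : ℝ × ℝ × ℝ → ℝ := fun p => max 0 (1 - |p.2.2 - p.1| / (κ * max p.2.1 c)) *
    max 0 (min 1 (2 * segMin b c p.2.1 p.2.2 / ε - 1)) with hω
  have hmax : ∀ v, 0 < κ * max v c := fun v => mul_pos hκ (lt_max_of_lt_right hc)
  have hseg : Continuous fun p : ℝ × ℝ × ℝ => segMin b c p.2.1 p.2.2 :=
    (continuous_segMin hb.continuousOn hc).comp (f := fun p : ℝ × ℝ × ℝ => p.2) continuous_snd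
  have hωc : Continuous ω := by
    refine Continuous.mul ?_ (by fun_prop)
    refine continuous_const.max (continuous_const.sub (Continuous.div (by fun_prop) (by fun_prop) ?_))
    exact fun p => (hmax _).ne'
  have h0 : ∀ p, 0 ≤ ω p := fun p => mul_nonneg (le_max_left _ _) (le_max_left _ _)
  have hhat1 : ∀ p : ℝ × ℝ × ℝ, max 0 (1 - |p.2.2 - p.1| / (κ * max p.2.1 c)) ≤ 1 := fun p =>
    max_le zero_le_one (by have := div_nonneg (abs_nonneg (p.2.2 - p.1)) (hmax p.2.1).le; linarith)
  have h1 : ∀ p, ω p ≤ 1 := fun p =>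
    mul_le_one₀ (hhat1 p) (le_max_left _ _) (max_le zero_le_one (min_le_left _ _))
  have hz : ∀ t v x, κ * max v c ≤ |x - t| → ω (t, v, x) = 0 := by
    intro t v x h
    have : 1 ≤ |x - t| / (κ * max v c) := (one_le_div (hmax v)).2 h
    simp only [hω]
    rw [max_eq_left (by linarith), zero_mul]
  have hzb : ∀ t v x y, c ≤ v → c ≤ y → y ≤ 2 * v → ‖b ⟨x, y⟩‖ ≤ ε / 2 → ω (t, v, x) = 0 := by
    intro t v x y hv hy hy2 h
    have h2 := (segMin_le (b := b) (x := x) hc hv hy hy2).trans h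
    have : 2 * segMin b c v x / ε ≤ 1 := by rw [div_le_one hε]; linarith
    have h3 : min 1 (2 * segMin b c v x / ε - 1) ≤ 0 := (min_le_right _ _).trans (by linarith)
    simp only [hω]
    rw [max_eq_left h3, mul_zero]
  have hintg : ∀ t v, c ≤ v → δ ≤ ‖b ⟨t, v⟩‖ →
      κ * v / 4 ≤ ∫ x in (t - κ * v)..(t + κ * v), ω (t, v, x) := by
    intro t v hv hbt
    have hv0 := hc.trans_le hv
    have hkv : 0 < κ * v := by positivity
    have hkv1 : κ * v ≤ v := by nlinarith
    set E : Set ℝ := {x : ℝ | |x - t| ≤ 2 * v ∧ ∃ y, 0 < y ∧ y ≤ 2 * v ∧ ‖b ⟨x, y⟩‖ < ε} with hE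
    have hEv : volume E ≤ ENNReal.ofReal (κ / 2 * v) := hvol b hb hb1 ⟨t, v⟩ hv0 hbt
    set T : Set ℝ := Icc (t - κ * v / 2) (t + κ * v / 2) with hT
    have hlow : ∀ x ∈ T \ toMeasurable volume E, 1 / 2 ≤ ω (t, v, x) := by
      rintro x ⟨hxT, hxE⟩
      have hxE : x ∉ E := fun h => hxE (subset_toMeasurable _ _ h)
      have habs : |x - t| ≤ κ * v / 2 := by
        rw [abs_le]; constructor <;> linarith [hxT.1, hxT.2]
      have hm : ε ≤ segMin b c v x := by
        refine le_segMin hc hv fun y hy hy2 => ?_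
        by_contra hcon
        exact hxE ⟨by linarith, y, hy, hy2, not_le.1 hcon⟩
      have h2 : 2 ≤ 2 * segMin b c v x / ε := by rw [le_div_iff₀ hε]; linarith
      have h3 : |x - t| / (κ * v) ≤ 1 / 2 := by rw [div_le_iff₀ hkv]; linarith
      simp only [hω, max_eq_left hv]
      rw [min_eq_left (by linarith), max_eq_right zero_le_one, mul_one]
      exact le_max_of_le_right (by linarith)
    have hcx : Continuous fun x => ω (t, v, x) := by fun_prop
    have hsub : T \ toMeasurable volume E ⊆ Ioc (t - κ * v) (t + κ * v) := fun x hx =>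
      ⟨by linarith [hx.1.1], by linarith [hx.1.2]⟩
    have hmeasT : MeasurableSet (T \ toMeasurable volume E) :=
      measurableSet_Icc.diff (measurableSet_toMeasurable _ _)
    have hfin : IntegrableOn (fun x => ω (t, v, x)) (Ioc (t - κ * v) (t + κ * v)) volume :=
      (hcx.integrableOn_Icc).mono_set Ioc_subset_Icc_self
    have hvT : κ * v / 2 ≤ (volume (T \ toMeasurable volume E)).toReal := by
      have h4 : volume T = ENNReal.ofReal (κ * v) := by
        rw [hT, Real.volume_Icc]; congr 1; ring
      have h5 : ENNReal.ofReal (κ * v / 2) ≤ volume (T \ toMeasurable volume E) := by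
        refine le_trans ?_ (le_measure_sdiff)
        rw [measure_toMeasurable, h4]
        calc ENNReal.ofReal (κ * v / 2) = ENNReal.ofReal (κ * v) - ENNReal.ofReal (κ / 2 * v) := by
              rw [← ENNReal.ofReal_sub _ (by positivity)]; congr 1; ring
          _ ≤ _ := tsub_le_tsub_left hEv _
      have hf : volume (T \ toMeasurable volume E) ≠ ⊤ :=
        ((measure_mono sdiff_subset).trans_lt (by rw [h4]; exact ENNReal.ofReal_lt_top)).ne
      exact (ENNReal.ofReal_le_iff_le_toReal hf).1 h5
    rw [intervalIntegral.integral_of_le (by linarith)]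
    calc κ * v / 4 ≤ ∫ x in T \ toMeasurable volume E, (1 / 2 : ℝ) := by
          rw [setIntegral_const, smul_eq_mul, measureReal_def]; linarith
      _ ≤ ∫ x in T \ toMeasurable volume E, ω (t, v, x) := by
          refine setIntegral_mono_on ?_ (hfin.mono_set hsub) hmeasT hlow
          refine integrableOn_const (((measure_mono hsub).trans_lt ?_).ne)
          rw [Real.volume_Ioc]; exact ENNReal.ofReal_lt_top
      _ ≤ _ := setIntegral_mono_set hfin (Eventually.of_forall fun x => h0 _) hsub.eventuallyLE
  obtain ⟨k, S, hk, hS, h⟩ := exists_step_of_bump hκ hc hωc h0 h1 hz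
  refine ⟨k, S, hk, hS, fun t v x => ⟨(h t v x).1, fun hv => ?_⟩⟩
  obtain ⟨g1, g2, g3, g4, g5, g6⟩ := (h t v x).2 hv
  refine ⟨g1, g2, fun hx => g3 (hz _ _ _ (by rwa [max_eq_left hv])),
    fun y hy hy2 hby => g3 (hzb _ _ _ y hv hy hy2 hby), g4, g5, fun hbt => g6 (hintg t v hv hbt)⟩

end

section
open MeasureTheory Set Filter Topology Complex ComplexConjugate

section
variable {s c : ℝ} {a : ℂ → ℂ} {k S : ℝ → ℝ → ℝ → ℝ}

/-- The source density averaged against the kernel `k` over `|t| ≤ 2` at height `v`. -/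
noncomputable def sourceAvg (s : ℝ) (a : ℂ → ℂ) (c : ℝ) (k : ℝ → ℝ → ℝ → ℝ) (v x : ℝ) : ℝ :=
  ∫ t in (-2 : ℝ)..2, logSource s a ⟨t, max v c⟩ * k t v x

/-- The horizontal error of the flow. -/
noncomputable def flowN (s : ℝ) (a : ℂ → ℂ) (c : ℝ) (k : ℝ → ℝ → ℝ → ℝ) (z : ℂ) : ℝ :=
  ∫ v in z.im..1, sourceAvg s a c k v z.re

/-- The vertical error of the flow. -/
noncomputable def flowF (s : ℝ) (a : ℂ → ℂ) (c : ℝ) (S : ℝ → ℝ → ℝ → ℝ) (z : ℂ) : ℝ :=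
  (∫ t in (-2 : ℝ)..z.re, logSource s a ⟨t, z.im⟩) - sourceAvg s a c S z.im z.re

/-- The phase obtained by integrating `regLogDeriv` along a path. -/
noncomputable def flowPhase (s : ℝ) (a : ℂ → ℂ) (c : ℝ) (z : ℂ) : ℝ :=
  (∫ t in c..z.im, (regLogDeriv s a ⟨-2, t⟩).re) + ∫ t in (-2 : ℝ)..z.re, (regLogDeriv s a ⟨t, z.im⟩).im

/-- An almost holomorphic logarithm of `a`. -/
noncomputable def flow (s : ℝ) (a : ℂ → ℂ) (c : ℝ) (S : ℝ → ℝ → ℝ → ℝ) (z : ℂ) : ℂ :=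
  logPrim s (normSq (a z)) + I * ((flowPhase s a c z - flowN s a c S z : ℝ) : ℂ)

lemma hasDerivAt_mk_re (y x : ℝ) : HasDerivAt (fun x : ℝ => (⟨x, y⟩ : ℂ)) 1 x := by
  have : (fun x : ℝ => (⟨x, y⟩ : ℂ)) = fun x : ℝ => (x : ℂ) + (y : ℂ) * I := by
    ext x; simp [Complex.ext_iff]
  rw [this]
  exact (hasDerivAt_id x).ofReal_comp.add_const _

lemma hasDerivAt_mk_im (x y : ℝ) : HasDerivAt (fun y : ℝ => (⟨x, y⟩ : ℂ)) I y := by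
  have : (fun y : ℝ => (⟨x, y⟩ : ℂ)) = fun y : ℝ => (x : ℂ) + (y : ℂ) * I := by
    ext x; simp [Complex.ext_iff]
  rw [this]
  simpa using ((hasDerivAt_id y).ofReal_comp.mul_const I).const_add (x : ℂ)

lemma continuous_source_mul (hc : 0 < c) (ha : DifferentiableOn ℂ a UH)
    (hk : Continuous fun p : ℝ × ℝ × ℝ => k p.1 p.2.1 p.2.2) :
    Continuous fun p : (ℝ × ℝ) × ℝ => logSource s a ⟨p.2, max p.1.1 c⟩ * k p.2 p.1.1 p.1.2 := by
  have h1 := (continuous_mk_max (continuousOn_logSource (s := s) ha) hc).comp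
    (f := fun p : (ℝ × ℝ) × ℝ => (p.2, p.1.1)) (by fun_prop)
  have h2 := hk.comp (f := fun p : (ℝ × ℝ) × ℝ => (p.2, p.1.1, p.1.2)) (by fun_prop)
  exact h1.mul h2

lemma continuous_sourceAvg (hc : 0 < c) (ha : DifferentiableOn ℂ a UH)
    (hk : Continuous fun p : ℝ × ℝ × ℝ => k p.1 p.2.1 p.2.2) :
    Continuous fun p : ℝ × ℝ => sourceAvg s a c k p.1 p.2 :=
  intervalIntegral.continuous_parametric_intervalIntegral_of_continuous'
    (f := fun (p : ℝ × ℝ) t => logSource s a ⟨t, max p.1 c⟩ * k t p.1 p.2)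
    (continuous_source_mul hc ha hk) _ _

lemma hasDerivAt_sourceAvg (hc : 0 < c) (ha : DifferentiableOn ℂ a UH)
    (hk : Continuous fun p : ℝ × ℝ × ℝ => k p.1 p.2.1 p.2.2)
    (hS : Continuous fun p : ℝ × ℝ × ℝ => S p.1 p.2.1 p.2.2)
    (hd : ∀ t v x, HasDerivAt (S t v) (k t v x) x) (v x : ℝ) :
    HasDerivAt (sourceAvg s a c S v) (sourceAvg s a c k v x) x := by
  refine hasDerivAt_intervalIntegral_param
    (f := fun x t => logSource s a ⟨t, max v c⟩ * S t v x)
    (f' := fun x t => logSource s a ⟨t, max v c⟩ * k t v x) isOpen_univ (mem_univ _)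
    (fun x _ => ?_) (fun x _ t _ => (hd t v x).const_mul _) ?_
  · exact ((continuous_source_mul (s := s) hc ha hS).comp
      (f := fun t : ℝ => (((v, x), t) : (ℝ × ℝ) × ℝ)) (by fun_prop)).continuousOn
  · exact ((continuous_source_mul (s := s) hc ha hk).comp
      (f := fun p : ℝ × ℝ => (((v, p.1), p.2) : (ℝ × ℝ) × ℝ)) (by fun_prop)).continuousOn

lemma continuousOn_flowN (hc : 0 < c) (ha : DifferentiableOn ℂ a UH)
    (hk : Continuous fun p : ℝ × ℝ × ℝ => k p.1 p.2.1 p.2.2) :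
    Continuous (flowN s a c k) := by
  have h1 := intervalIntegral.continuous_parametric_intervalIntegral_of_continuous (μ := volume)
    (f := fun (z : ℂ) v => sourceAvg s a c k v z.re) (a₀ := 1) (s := fun z => z.im)
    ((continuous_sourceAvg hc ha hk).comp (f := fun q : ℂ × ℝ => (q.2, q.1.re)) (by fun_prop))
    (by fun_prop)
  exact h1.neg.congr fun z => (intervalIntegral.integral_symm _ _).symm

lemma hasDerivAt_flowN_re (hc : 0 < c) (ha : DifferentiableOn ℂ a UH)
    (hk : Continuous fun p : ℝ × ℝ × ℝ => k p.1 p.2.1 p.2.2)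
    (hS : Continuous fun p : ℝ × ℝ × ℝ => S p.1 p.2.1 p.2.2)
    (hd : ∀ t v x, HasDerivAt (S t v) (k t v x) x) (z : ℂ) :
    HasDerivAt (fun x : ℝ => flowN s a c S ⟨x, z.im⟩) (flowN s a c k z) z.re := by
  refine hasDerivAt_intervalIntegral_param
    (f := fun x v => sourceAvg s a c S v x)
    (f' := fun x v => sourceAvg s a c k v x) isOpen_univ (mem_univ _)
    (fun x _ => ?_) (fun x _ v _ => hasDerivAt_sourceAvg hc ha hk hS hd v x) ?_
  · exact ((continuous_sourceAvg (s := s) hc ha hS).comp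
      (f := fun v : ℝ => (v, x)) (by fun_prop)).continuousOn
  · exact ((continuous_sourceAvg (s := s) hc ha hk).comp
      (f := fun p : ℝ × ℝ => (p.2, p.1)) (by fun_prop)).continuousOn

lemma hasDerivAt_flowN_im (hc : 0 < c) (ha : DifferentiableOn ℂ a UH)
    (hS : Continuous fun p : ℝ × ℝ × ℝ => S p.1 p.2.1 p.2.2) (z : ℂ) :
    HasDerivAt (fun y : ℝ => flowN s a c S ⟨z.re, y⟩) (-sourceAvg s a c S z.im z.re) z.im := by
  have h : Continuous fun v => sourceAvg s a c S v z.re :=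
    (continuous_sourceAvg hc ha hS).comp (f := fun v : ℝ => (v, z.re)) (by fun_prop)
  exact intervalIntegral.integral_hasDerivAt_left (h.intervalIntegrable _ _)
    h.stronglyMeasurable.stronglyMeasurableAtFilter h.continuousAt

lemma ContinuousOn.continuous_horizontal {f : ℂ → ℝ} (hf : ContinuousOn f UH) {y : ℝ} (hy : 0 < y) :
    Continuous fun t : ℝ => f ⟨t, y⟩ :=
  hf.comp_continuous (f := fun t : ℝ => (⟨t, y⟩ : ℂ))
    (continuous_iff_continuousAt.2 fun t => (hasDerivAt_mk_re y t).continuousAt) fun _ => hy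

lemma ContinuousOn.continuousOn_vertical {f : ℂ → ℝ} (hf : ContinuousOn f UH) (x : ℝ) :
    ContinuousOn (fun t : ℝ => f ⟨x, t⟩) (Ioi 0) :=
  hf.comp (f := fun t : ℝ => (⟨x, t⟩ : ℂ))
    (fun t _ => (hasDerivAt_mk_im x t).continuousAt.continuousWithinAt) fun _ ht => ht

lemma hasDerivAt_flowPhase_re (hs : 0 < s) (ha : DifferentiableOn ℂ a UH) {z : ℂ}
    (hz : z ∈ UH) :
    HasDerivAt (fun x : ℝ => flowPhase s a c ⟨x, z.im⟩) (regLogDeriv s a z).im z.re := by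
  have h := ContinuousOn.continuous_horizontal
    (continuous_im.comp_continuousOn (continuousOn_regLogDeriv hs ha)) (y := z.im) hz
  have h1 : HasDerivAt (fun x : ℝ => ∫ t in (-2 : ℝ)..x, (regLogDeriv s a ⟨t, z.im⟩).im)
      (regLogDeriv s a z).im z.re :=
    intervalIntegral.integral_hasDerivAt_right (h.intervalIntegrable _ _)
      h.stronglyMeasurable.stronglyMeasurableAtFilter h.continuousAt
  exact h1.const_add (∫ t in c..z.im, (regLogDeriv s a ⟨-2, t⟩).re)

lemma hasDerivAt_flowPhase_im (hs : 0 < s) (hc : 0 < c) (ha : DifferentiableOn ℂ a UH) {z : ℂ}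
    (hz : c < z.im) :
    HasDerivAt (fun y : ℝ => flowPhase s a c ⟨z.re, y⟩)
      ((regLogDeriv s a z).re - ∫ t in (-2 : ℝ)..z.re, logSource s a ⟨t, z.im⟩) z.im := by
  have hz0 : 0 < z.im := hc.trans hz
  have hψ := continuousOn_regLogDeriv hs ha
  have h := ContinuousOn.continuousOn_vertical (continuous_re.comp_continuousOn hψ) (-2)
  have hsub : uIcc c z.im ⊆ Ioi 0 := by
    rw [uIcc_of_le hz.le]; exact fun t ht => hc.trans_le ht.1
  have h1 : HasDerivAt (fun y : ℝ => ∫ t in c..y, (regLogDeriv s a ⟨-2, t⟩).re)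
      (regLogDeriv s a ⟨-2, z.im⟩).re z.im :=
    intervalIntegral.integral_hasDerivAt_right ((h.mono hsub).intervalIntegrable)
      (h.stronglyMeasurableAtFilter isOpen_Ioi _ hz0) (h.continuousAt (Ioi_mem_nhds hz0))
  have hD := fun e => continuousOn_regLogDerivDir (s := s) hs ha e
  have h2 : HasDerivAt (fun y : ℝ => ∫ t in (-2 : ℝ)..z.re, (regLogDeriv s a ⟨t, y⟩).im)
      (∫ t in (-2 : ℝ)..z.re, (regLogDerivDir s a I ⟨t, z.im⟩).im) z.im := by
    refine hasDerivAt_intervalIntegral_param (f := fun y t => (regLogDeriv s a ⟨t, y⟩).im)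
      (f' := fun y t => (regLogDerivDir s a I ⟨t, y⟩).im) isOpen_Ioi (s := Ioi 0) hz0
      (fun y hy => ?_) (fun y hy t _ => ?_) ?_
    · exact (ContinuousOn.continuous_horizontal (continuous_im.comp_continuousOn hψ) hy).continuousOn
    · exact imCLM.hasFDerivAt.comp_hasDerivAt y
        (hasDerivAt_regLogDeriv_comp hs ha (hasDerivAt_mk_im t y) hy)
    · refine continuous_im.comp_continuousOn ((hD I).comp (f := fun p : ℝ × ℝ => (⟨p.2, p.1⟩ : ℂ))
        (Complex.equivRealProdCLM.symm.continuous.comp continuous_swap).continuousOn ?_)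
      exact fun p hp => hp.1
  refine (h1.add h2).congr_deriv ?_
  have h3 : ∀ t : ℝ, (regLogDerivDir s a I ⟨t, z.im⟩).im =
      (regLogDerivDir s a 1 ⟨t, z.im⟩).re - logSource s a ⟨t, z.im⟩ := by
    intro t
    have := congrArg Complex.im (I_mul_regLogDerivDir_sub (a := a) hs ⟨t, z.im⟩)
    simp at this
    linarith
  have h4 := ContinuousOn.continuous_horizontal (continuous_re.comp_continuousOn (hD 1)) hz0
  have h5 := ContinuousOn.continuous_horizontal (continuousOn_logSource (s := s) ha) hz0
  have h6 : ∫ t in (-2 : ℝ)..z.re, (regLogDerivDir s a 1 ⟨t, z.im⟩).re =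
      (regLogDeriv s a z).re - (regLogDeriv s a ⟨-2, z.im⟩).re := by
    refine intervalIntegral.integral_eq_sub_of_hasDerivAt
      (f := fun t : ℝ => (regLogDeriv s a ⟨t, z.im⟩).re) (fun t _ => ?_) (h4.intervalIntegrable _ _)
    exact reCLM.hasFDerivAt.comp_hasDerivAt t
      (hasDerivAt_regLogDeriv_comp hs ha (hasDerivAt_mk_re z.im t) hz0)
  have h7 := intervalIntegral.integral_sub (h4.intervalIntegrable (-2) z.re (μ := volume))
    (h5.intervalIntegrable (-2) z.re)
  simp only [Function.comp_apply] at h7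
  rw [intervalIntegral.integral_congr fun t _ => h3 t, h7, h6]
  ring

lemma continuousOn_flowF (hc : 0 < c) (ha : DifferentiableOn ℂ a UH)
    (hS : Continuous fun p : ℝ × ℝ × ℝ => S p.1 p.2.1 p.2.2) :
    ContinuousOn (flowF s a c S) UH :=
  (continuousOn_intervalIntegral_re (continuousOn_logSource ha) _).sub
    ((continuous_sourceAvg hc ha hS).comp (f := fun z : ℂ => (z.im, z.re))
      (by fun_prop)).continuousOn

variable (s a c k S) in
/-- The partial derivative of the flow in the real direction. -/
noncomputable def flowDx (z : ℂ) : ℂ := regLogDeriv s a z - I * flowN s a c k z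

variable (s a c k S) in
/-- The partial derivative of the flow in the imaginary direction. -/
noncomputable def flowDy (z : ℂ) : ℂ := I * (regLogDeriv s a z - flowF s a c S z)

lemma flow_regular (hs : 0 < s) (hc : 0 < c) (ha : DifferentiableOn ℂ a UH)
    (hk : Continuous fun p : ℝ × ℝ × ℝ => k p.1 p.2.1 p.2.2)
    (hS : Continuous fun p : ℝ × ℝ × ℝ => S p.1 p.2.1 p.2.2)
    (hd : ∀ t v x, HasDerivAt (S t v) (k t v x) x) :
    ContDiffOn ℝ 1 (flow s a c S) {z | c < z.im} ∧ ∀ z : ℂ, c < z.im →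
    HasFDerivAt (flow s a c S)
      (reCLM.smulRight (flowDx s c a k z) + imCLM.smulRight (flowDy s c a S z)) z := by
  have hU : IsOpen {z : ℂ | c < z.im} := isOpen_lt continuous_const continuous_im
  have hsub : {z : ℂ | c < z.im} ⊆ UH := fun z hz => hc.trans hz
  have hψ := (continuousOn_regLogDeriv hs ha).mono hsub
  have hcx : ContinuousOn (flowDx s c a k) {z | c < z.im} :=
    hψ.sub (continuousOn_const.mul
      (continuous_ofReal.comp (continuousOn_flowN hc ha hk)).continuousOn)
  have hcy : ContinuousOn (flowDy s c a S) {z | c < z.im} :=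
    continuousOn_const.mul (hψ.sub
      (continuous_ofReal.comp_continuousOn ((continuousOn_flowF hc ha hS).mono hsub)))
  have hx : ∀ z ∈ {z : ℂ | c < z.im},
      HasDerivAt (fun x : ℝ => flow s a c S ⟨x, z.im⟩) (flowDx s c a k z) z.re := by
    intro z hz
    have h1 := (hasDerivAt_logPrim_normSq_comp hs ha (hasDerivAt_mk_re z.im z.re) (hsub hz)).ofReal_comp
    have h2 := ((hasDerivAt_flowPhase_re (c := c) hs ha (hsub hz)).sub
      (hasDerivAt_flowN_re (s := s) hc ha hk hS hd z)).ofReal_comp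
    refine (h1.add (h2.const_mul I)).congr_deriv ?_
    apply Complex.ext <;> simp [flowDx]
  have hy : ∀ z ∈ {z : ℂ | c < z.im},
      HasDerivAt (fun y : ℝ => flow s a c S ⟨z.re, y⟩) (flowDy s c a S z) z.im := by
    intro z hz
    have h1 := (hasDerivAt_logPrim_normSq_comp hs ha (hasDerivAt_mk_im z.re z.im) (hsub hz)).ofReal_comp
    have h2 := ((hasDerivAt_flowPhase_im hs hc ha hz).sub
      (hasDerivAt_flowN_im (s := s) hc ha hS z)).ofReal_comp
    refine (h1.add (h2.const_mul I)).congr_deriv ?_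
    apply Complex.ext <;> simp [flowDy, flowF]
    ring
  exact ⟨contDiffOn_of_partials hU hcx hcy hx hy,
    fun z hz => hasFDerivAt_of_partials hU hcx hcy hx hy hz⟩

lemma dbar_flow (hs : 0 < s) (hc : 0 < c) (ha : DifferentiableOn ℂ a UH)
    (hk : Continuous fun p : ℝ × ℝ × ℝ => k p.1 p.2.1 p.2.2)
    (hS : Continuous fun p : ℝ × ℝ × ℝ => S p.1 p.2.1 p.2.2)
    (hd : ∀ t v x, HasDerivAt (S t v) (k t v x) x) {z : ℂ} (hz : c < z.im) :
    dbar (flow s a c S) z = (flowF s a c S z - I * flowN s a c k z) / 2 := by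
  rw [dbar, ((flow_regular hs hc ha hk hS hd).2 z hz).fderiv]
  simp [flowDx, flowDy]
  linear_combination (regLogDeriv s a z - flowF s a c S z) * I_mul_I
end

end

section
open MeasureTheory Set Filter Topology

lemma lintegral_lintegral_Icc_le {g : ℝ → ENNReal} (hg : Measurable g) {x₀ ℓ r : ℝ} (hr : r ≤ ℓ) :
    ∫⁻ x in Icc (x₀ - ℓ) (x₀ + ℓ), ∫⁻ t in Icc (x - r) (x + r), g t ≤
      ENNReal.ofReal (2 * r) * ∫⁻ t in Icc (x₀ - 2 * ℓ) (x₀ + 2 * ℓ), g t := by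
  have hm : MeasurableSet {p : ℝ × ℝ | p.1 - r ≤ p.2 ∧ p.2 ≤ p.1 + r} :=
    (measurableSet_le (measurable_fst.sub_const r) measurable_snd).inter
      (measurableSet_le measurable_snd (measurable_fst.add_const r))
  have h1 : ∀ x, ∫⁻ t in Icc (x - r) (x + r), g t =
      ∫⁻ t, {p : ℝ × ℝ | p.1 - r ≤ p.2 ∧ p.2 ≤ p.1 + r}.indicator (fun p => g p.2) (x, t) := fun x => by
    rw [← lintegral_indicator measurableSet_Icc]; rfl
  simp only [h1]
  rw [lintegral_lintegral_swap (f := fun x t =>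
      {p : ℝ × ℝ | p.1 - r ≤ p.2 ∧ p.2 ≤ p.1 + r}.indicator (fun p => g p.2) (x, t))
    ((hg.comp measurable_snd).indicator hm).aemeasurable,
    ← lintegral_indicator measurableSet_Icc,
    ← lintegral_const_mul _ (hg.indicator measurableSet_Icc)]
  refine lintegral_mono fun t => ?_
  by_cases ht : t ∈ Icc (x₀ - 2 * ℓ) (x₀ + 2 * ℓ)
  · rw [indicator_of_mem ht]
    calc ∫⁻ x in Icc (x₀ - ℓ) (x₀ + ℓ),
          {p : ℝ × ℝ | p.1 - r ≤ p.2 ∧ p.2 ≤ p.1 + r}.indicator (fun p => g p.2) (x, t)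
        ≤ ∫⁻ x, (Icc (t - r) (t + r)).indicator (fun _ => g t) x := by
          refine (setLIntegral_le_lintegral _ _).trans (lintegral_mono fun x => ?_)
          refine le_of_eq (indicator_eq_indicator (g := fun _ => g t) ?_ rfl)
          simp only [mem_ofPred_eq, mem_Icc]
          constructor <;> rintro ⟨h1, h2⟩ <;> constructor <;> linarith
      _ = ENNReal.ofReal (2 * r) * g t := by
          rw [lintegral_indicator measurableSet_Icc, setLIntegral_const, Real.volume_Icc, mul_comm]
          congr 2; ring
  · rw [indicator_of_notMem ht, mul_zero, nonpos_iff_eq_zero]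
    rw [setLIntegral_congr_fun (g := fun _ => 0) measurableSet_Icc, lintegral_zero]
    intro x hx
    refine indicator_of_notMem (fun h => ht ?_) _
    simp only [mem_ofPred_eq] at h
    exact ⟨by linarith [hx.1, h.1], by linarith [hx.2, h.2]⟩

lemma measurable_lintegral_Icc_param {R : ℝ × ℝ → ENNReal} (hR : Measurable R) (κ : ℝ) :
    Measurable fun p : ℝ × ℝ => ∫⁻ t in Icc (p.1 - κ * p.2) (p.1 + κ * p.2), R (t, p.2) := by
  have hm : MeasurableSet {q : (ℝ × ℝ) × ℝ | q.1.1 - κ * q.1.2 ≤ q.2 ∧ q.2 ≤ q.1.1 + κ * q.1.2} := by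
    have h1 : Measurable fun q : (ℝ × ℝ) × ℝ => q.1.1 - κ * q.1.2 := by fun_prop
    have h2 : Measurable fun q : (ℝ × ℝ) × ℝ => q.1.1 + κ * q.1.2 := by fun_prop
    exact (measurableSet_le h1 measurable_snd).inter (measurableSet_le measurable_snd h2)
  have h1 : Measurable fun q : (ℝ × ℝ) × ℝ => R (q.2, q.1.2) := by fun_prop
  have h2 := (h1.indicator hm).lintegral_prod_right' (ν := volume)
  convert h2 using 2 with p
  rw [← lintegral_indicator measurableSet_Icc]; rfl

lemma lintegral_box_near_le {R : ℝ × ℝ → ENNReal} (hR : Measurable R) {κ x₀ ℓ : ℝ}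
    (hκ : κ ≤ 1) :
    ∫⁻ x in Icc (x₀ - ℓ) (x₀ + ℓ), ∫⁻ y in Ioc 0 ℓ, ∫⁻ v in Ioc y ℓ,
        ∫⁻ t in Icc (x - κ * v) (x + κ * v), R (t, v) ≤
      ∫⁻ v in Ioc 0 ℓ, ∫⁻ t in Icc (x₀ - 2 * ℓ) (x₀ + 2 * ℓ), ENNReal.ofReal (2 * κ * v ^ 2) * R (t, v) := by
  have hm := measurable_lintegral_Icc_param hR κ
  have hmt : MeasurableSet {p : ℝ × ℝ | p.1 < p.2} := measurableSet_lt measurable_fst measurable_snd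
  have h1 : ∀ x, ∫⁻ y in Ioc 0 ℓ, ∫⁻ v in Ioc y ℓ, ∫⁻ t in Icc (x - κ * v) (x + κ * v), R (t, v) ≤
      ∫⁻ v in Ioc 0 ℓ, ENNReal.ofReal v * ∫⁻ t in Icc (x - κ * v) (x + κ * v), R (t, v) := by
    intro x
    have hmx : Measurable fun v => ∫⁻ t in Icc (x - κ * v) (x + κ * v), R (t, v) :=
      hm.comp (f := fun v : ℝ => (x, v)) (by fun_prop)
    have h2 : ∀ y ∈ Ioc 0 ℓ, ∫⁻ v in Ioc y ℓ, ∫⁻ t in Icc (x - κ * v) (x + κ * v), R (t, v) =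
        ∫⁻ v in Ioc 0 ℓ, {p : ℝ × ℝ | p.1 < p.2}.indicator
          (fun p => ∫⁻ t in Icc (x - κ * p.2) (x + κ * p.2), R (t, p.2)) (y, v) := by
      intro y hy
      rw [← lintegral_indicator measurableSet_Ioc, ← lintegral_indicator measurableSet_Ioc]
      congr 1; ext v
      by_cases hv : y < v
      · by_cases hvl : v ≤ ℓ
        · rw [indicator_of_mem (mem_Ioc.2 ⟨hv, hvl⟩), indicator_of_mem (mem_Ioc.2 ⟨hy.1.trans hv, hvl⟩),
            indicator_of_mem (show (y, v) ∈ {p : ℝ × ℝ | p.1 < p.2} from hv)]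
        · rw [indicator_of_notMem fun h => hvl h.2, indicator_of_notMem fun h => hvl h.2]
      · rw [indicator_of_notMem fun h => hv h.1, indicator_apply, indicator_of_notMem
          (show (y, v) ∉ {p : ℝ × ℝ | p.1 < p.2} from hv)]
        simp
    rw [setLIntegral_congr_fun measurableSet_Ioc h2, lintegral_lintegral_swap (f := fun y v =>
        {p : ℝ × ℝ | p.1 < p.2}.indicator
          (fun p => ∫⁻ t in Icc (x - κ * p.2) (x + κ * p.2), R (t, p.2)) (y, v))
      ((Measurable.indicator (f := fun p : ℝ × ℝ =>
        ∫⁻ t in Icc (x - κ * p.2) (x + κ * p.2), R (t, p.2)) (hmx.comp measurable_snd) hmt).aemeasurable)]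
    refine lintegral_mono fun v => ?_
    calc _ ≤ ∫⁻ y in Ioc 0 ℓ, (Iio v).indicator
          (fun _ => ∫⁻ t in Icc (x - κ * v) (x + κ * v), R (t, v)) y := by
          refine lintegral_mono fun y => le_of_eq ?_
          exact indicator_eq_indicator (Iff.rfl) rfl
      _ = volume (Iio v ∩ Ioc 0 ℓ) * _ := by
          rw [lintegral_indicator measurableSet_Iio, Measure.restrict_restrict measurableSet_Iio,
            setLIntegral_const, mul_comm]
      _ ≤ _ := by
          refine mul_le_mul_left ((measure_mono (t := Icc 0 v) ?_).trans ?_) _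
          · exact fun y hy => ⟨hy.2.1.le, hy.1.le⟩
          · rw [Real.volume_Icc, sub_zero]
  refine (lintegral_mono fun x => h1 x).trans ?_
  have hm2 : Measurable fun p : ℝ × ℝ => ENNReal.ofReal p.2 *
      ∫⁻ t in Icc (p.1 - κ * p.2) (p.1 + κ * p.2), R (t, p.2) := by fun_prop
  rw [lintegral_lintegral_swap hm2.aemeasurable]
  refine setLIntegral_mono' measurableSet_Ioc fun v hv => ?_
  have hRv : Measurable fun t => R (t, v) := by fun_prop
  have hmv : Measurable fun x => ∫⁻ t in Icc (x - κ * v) (x + κ * v), R (t, v) :=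
    hm.comp (f := fun x : ℝ => (x, v)) (by fun_prop)
  rw [lintegral_const_mul _ hmv, lintegral_const_mul _ hRv]
  have := lintegral_lintegral_Icc_le hRv (x₀ := x₀) (ℓ := ℓ) (r := κ * v) (by nlinarith [hv.1, hv.2])
  calc _ ≤ ENNReal.ofReal v * (ENNReal.ofReal (2 * (κ * v)) * _) := mul_le_mul_right this _
    _ = _ := by
      rw [← mul_assoc, ← ENNReal.ofReal_mul hv.1.le]; congr 2; ring

lemma lintegral_Ioi_inv_sq {A y : ℝ} (hA : 0 ≤ A) (hy : 0 < y) :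
    ∫⁻ v in Ioi y, ENNReal.ofReal (A / v ^ 2) = ENNReal.ofReal (A / y) := by
  have h := integrableOn_Ioi_rpow_of_lt (a := -2) (by norm_num) hy
  have h2 := integral_Ioi_rpow_of_lt (a := -2) (by norm_num) hy
  have h3 : ∀ v ∈ Ioi y, ENNReal.ofReal (A / v ^ 2) = ENNReal.ofReal (A * v ^ (-2 : ℝ)) := by
    intro v hv
    have : 0 < v := hy.trans hv
    rw [Real.rpow_neg this.le]; norm_num [div_eq_mul_inv]
  rw [setLIntegral_congr_fun measurableSet_Ioi h3, ← ofReal_integral_eq_lintegral_ofReal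
    (h.const_mul A), integral_const_mul, h2]
  · congr 1; norm_num; rw [Real.rpow_neg_one]; rfl
  · filter_upwards [ae_restrict_mem measurableSet_Ioi] with v hv
    have : 0 < v := hy.trans hv
    positivity

end

section
open MeasureTheory Set Filter Topology Complex

/-- A kernel `k` whose primitive `S` in the last variable is a smoothed step function at `t`, of
width `κ v`, which does not vary where `b` is small. -/
structure StepKernel (b : ℂ → ℂ) (δ κ ε c : ℝ) (k S : ℝ → ℝ → ℝ → ℝ) : Prop where
  cont_k : Continuous fun p : ℝ × ℝ × ℝ => k p.1 p.2.1 p.2.2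
  cont_S : Continuous fun p : ℝ × ℝ × ℝ => S p.1 p.2.1 p.2.2
  deriv : ∀ t v x, HasDerivAt (S t v) (k t v x) x
  nonneg : ∀ t v x, c ≤ v → 0 ≤ k t v x
  le : ∀ t v x, c ≤ v → k t v x ≤ 4 / (κ * v)
  zero : ∀ t v x, c ≤ v → κ * v ≤ |x - t| → k t v x = 0
  zero_small : ∀ t v x y, c ≤ v → c ≤ y → y ≤ 2 * v → ‖b ⟨x, y⟩‖ ≤ ε → k t v x = 0
  mem : ∀ t v x, c ≤ v → S t v x ∈ Icc 0 1
  left : ∀ t v x, c ≤ v → x ≤ t - κ * v → S t v x = 0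
  right : ∀ t v x, c ≤ v → δ ≤ ‖b ⟨t, v⟩‖ → t + κ * v ≤ x → S t v x = 1

lemma exists_stepKernel {δ κ : ℝ} (hδ : 0 < δ) (hκ : 0 < κ) (hκ1 : κ ≤ 1) :
    ∃ ε : ℝ, 0 < ε ∧ ε < δ ∧ ∀ b : ℂ → ℂ, DifferentiableOn ℂ b UH → (∀ z ∈ UH, ‖b z‖ ≤ 1) →
      ∀ c : ℝ, 0 < c → ∃ k S, StepKernel b δ κ ε c k S := by
  obtain ⟨ε, h1, h2, h⟩ := exists_step_kernel hδ hκ hκ1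
  refine ⟨ε, h1, h2, fun b hb hb1 c hc => ?_⟩
  obtain ⟨k, S, hk, hS, H⟩ := h b hb hb1 c hc
  exact ⟨k, S, hk, hS, fun t v x => (H t v x).1, fun t v x hv => ((H t v x).2 hv).1,
    fun t v x hv => ((H t v x).2 hv).2.1, fun t v x hv => ((H t v x).2 hv).2.2.1,
    fun t v x y hv => ((H t v x).2 hv).2.2.2.1 y, fun t v x hv => ((H t v x).2 hv).2.2.2.2.1,
    fun t v x hv => ((H t v x).2 hv).2.2.2.2.2.1, fun t v x hv => ((H t v x).2 hv).2.2.2.2.2.2⟩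

/-- The source density above height `c`, as an extended nonnegative function. -/
noncomputable def sourceDensity (s : ℝ) (a : ℂ → ℂ) (c : ℝ) : ℝ × ℝ → ENNReal :=
  {p : ℝ × ℝ | c ≤ p.2}.indicator fun p => ENNReal.ofReal (logSource s a ⟨p.1, max p.2 c⟩)

section
variable {s c : ℝ} {a b : ℂ → ℂ} {k S : ℝ → ℝ → ℝ → ℝ} {δ κ ε Λ : ℝ}

lemma measurable_sourceDensity (hc : 0 < c) (ha : DifferentiableOn ℂ a UH) :
    Measurable (sourceDensity s a c) :=
  (continuous_mk_max (continuousOn_logSource ha) hc).measurable.ennreal_ofReal.indicator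
    (measurableSet_le measurable_const measurable_snd)

lemma sourceDensity_of_le {t v : ℝ} (hv : c ≤ v) :
    sourceDensity s a c (t, v) = ENNReal.ofReal (logSource s a ⟨t, v⟩) := by
  rw [sourceDensity, indicator_of_mem (show (t, v) ∈ {p : ℝ × ℝ | c ≤ p.2} from hv)]
  simp only [max_eq_left hv]

lemma sourceDensity_le (hΛ : ∀ z ∈ UH, logSource s a z ≤ Λ * ‖deriv a z‖ ^ 2) {t v : ℝ}
    (hv : 0 < v) : sourceDensity s a c (t, v) ≤ ENNReal.ofReal (Λ * ‖deriv a ⟨t, v⟩‖ ^ 2) := by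
  by_cases h : c ≤ v
  · rw [sourceDensity_of_le h]
    exact ENNReal.ofReal_le_ofReal (hΛ _ hv)
  · rw [sourceDensity, indicator_of_notMem (show (t, v) ∉ {p : ℝ × ℝ | c ≤ p.2} from h)]
    exact zero_le

lemma exists_logSource_le (hs : 0 < s) : ∃ Λ, 0 < Λ ∧ ∀ a : ℂ → ℂ, ∀ z,
    logSource s a z ≤ Λ * ‖deriv a z‖ ^ 2 := by
  obtain ⟨C, hC, h⟩ := exists_deriv_logCutoff_bound hs
  refine ⟨2 * C, by positivity, fun a z => mul_le_mul_of_nonneg_right ?_ (sq_nonneg _)⟩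
  linarith [h (normSq (a z))]

lemma sourceDensity_le_div (hΛ0 : 0 ≤ Λ) (hΛ : ∀ z ∈ UH, logSource s a z ≤ Λ * ‖deriv a z‖ ^ 2)
    (ha : DifferentiableOn ℂ a UH) (ha1 : ∀ z ∈ UH, ‖a z‖ ≤ 1) {t v : ℝ}
    (hv : 0 < v) : sourceDensity s a c (t, v) ≤ ENNReal.ofReal (4 * Λ / v ^ 2) := by
  refine (sourceDensity_le hΛ hv).trans (ENNReal.ofReal_le_ofReal ?_)
  have h := norm_deriv_mul_im_le ha ha1 (z := ⟨t, v⟩) hv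
  have h2 : ‖deriv a ⟨t, v⟩‖ ≤ 2 / v := by rwa [le_div_iff₀ hv]
  calc Λ * ‖deriv a ⟨t, v⟩‖ ^ 2 ≤ Λ * (2 / v) ^ 2 :=
        mul_le_mul_of_nonneg_left (pow_le_pow_left₀ (norm_nonneg _) h2 2) hΛ0
    _ = _ := by ring

lemma lintegral_sourceDensity_le (hΛ0 : 0 ≤ Λ)
    (hΛ : ∀ z ∈ UH, logSource s a z ≤ Λ * ‖deriv a z‖ ^ 2)
    (ha : DifferentiableOn ℂ a UH) (ha1 : ∀ z ∈ UH, ‖a z‖ ≤ 1) {A x₀ ℓ : ℝ} (hA : 0 ≤ A)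
    (hℓ : 0 < ℓ) :
    ∫⁻ v in Ioc 0 ℓ, ∫⁻ t in Icc (x₀ - 2 * ℓ) (x₀ + 2 * ℓ),
      ENNReal.ofReal (A * v) * sourceDensity s a c (t, v) ≤ ENNReal.ofReal (22 * A * Λ * ℓ) := by
  have hm : Measurable fun z : ℂ => ENNReal.ofReal (A * Λ) * ENNReal.ofReal (‖deriv a z‖ ^ 2 * z.im) := by
    have h1 := measurable_deriv a
    have h2 := Complex.measurable_im
    fun_prop
  calc _ ≤ ∫⁻ v in Ioc 0 ℓ, ∫⁻ t in Icc (x₀ - 2 * ℓ) (x₀ + 2 * ℓ),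
        ENNReal.ofReal (A * Λ) * ENNReal.ofReal (‖deriv a ⟨t, v⟩‖ ^ 2 * v) := by
        refine setLIntegral_mono' measurableSet_Ioc fun v hv => lintegral_mono fun t => ?_
        refine (mul_le_mul_right (sourceDensity_le hΛ hv.1) _).trans (le_of_eq ?_)
        have := hv.1
        rw [← ENNReal.ofReal_mul (by positivity), ← ENNReal.ofReal_mul (by positivity)]
        congr 1; ring
    _ = ∫⁻ z in Icc (x₀ - 2 * ℓ) (x₀ + 2 * ℓ) ×ℂ Ioc 0 ℓ,
          ENNReal.ofReal (A * Λ) * ENNReal.ofReal (‖deriv a z‖ ^ 2 * z.im) :=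
        (setLIntegral_reProdIm_symm _ hm measurableSet_Icc measurableSet_Ioc).symm
    _ ≤ ∫⁻ z in cbox x₀ (2 * ℓ), ENNReal.ofReal (A * Λ) * ENNReal.ofReal (‖deriv a z‖ ^ 2 * z.im) := by
        refine lintegral_mono_set fun z hz => ?_
        obtain ⟨⟨h1, h2⟩, h3, h4⟩ := hz
        exact ⟨abs_le.2 ⟨by linarith, by linarith⟩, h3, by linarith⟩
    _ ≤ ENNReal.ofReal (A * Λ) * ENNReal.ofReal (11 * (2 * ℓ)) := by
        rw [lintegral_const_mul' _ _ ENNReal.ofReal_ne_top]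
        exact mul_le_mul_right (energy_cbox ha ha1 x₀ (by positivity)) _
    _ = _ := by rw [← ENNReal.ofReal_mul (by positivity)]; congr 1; ring

lemma enorm_flowF_le (hs : 0 < s) (hsδ : s ≤ δ ^ 2) (hκ : 0 < κ) (hδ : 0 < δ) (hc : 0 < c)
    (ha : DifferentiableOn ℂ a UH)
    (hab : ∀ z ∈ UH, δ ≤ ‖a z‖ ∨ δ ≤ ‖b z‖) (hK : StepKernel b δ κ ε c k S) {z : ℂ}
    (hx : |z.re| ≤ 2) (hy : c ≤ z.im) :
    ‖flowF s a c S z‖ₑ ≤ ∫⁻ t in Icc (z.re - κ * z.im) (z.re + κ * z.im),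
      sourceDensity s a c (t, z.im) := by
  have hz0 : 0 < z.im := hc.trans_le hy
  rw [abs_le] at hx
  have hρ := ContinuousOn.continuous_horizontal (continuousOn_logSource (s := s) ha) hz0
  have hSc : Continuous fun t => S t z.im z.re :=
    hK.cont_S.comp (f := fun t : ℝ => ((t, z.im, z.re) : ℝ × ℝ × ℝ)) (by fun_prop)
  have hi1 : IntegrableOn (fun t : ℝ => logSource s a ⟨t, z.im⟩) (Ioc (-2) 2) volume :=
    hρ.integrableOn_Icc.mono_set Ioc_subset_Icc_self
  have hi2 : IntegrableOn (fun t : ℝ => logSource s a ⟨t, z.im⟩ * S t z.im z.re) (Ioc (-2) 2) volume :=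
    (hρ.mul hSc).integrableOn_Icc.mono_set Ioc_subset_Icc_self
  have h1 : flowF s a c S z = ∫ t in Ioc (-2 : ℝ) 2,
      ((Iic z.re).indicator (fun t : ℝ => logSource s a ⟨t, z.im⟩) t -
        logSource s a ⟨t, z.im⟩ * S t z.im z.re) := by
    rw [integral_sub (hi1.indicator measurableSet_Iic) hi2, setIntegral_indicator measurableSet_Iic,
      flowF, sourceAvg, intervalIntegral.integral_of_le hx.1,
      intervalIntegral.integral_of_le (by norm_num), max_eq_left hy]
    congr 3
    ext t; simp only [mem_Ioc, mem_inter_iff, mem_Iic]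
    constructor
    · rintro ⟨h1, h2⟩; exact ⟨⟨h1, h2.trans hx.2⟩, h2⟩
    · rintro ⟨⟨h1, _⟩, h2⟩; exact ⟨h1, h2⟩
  rw [h1, ← lintegral_indicator measurableSet_Icc]
  refine (enorm_integral_le_lintegral_enorm _).trans
    ((setLIntegral_le_lintegral _ _).trans (lintegral_mono fun t => ?_))
  have hmem := hK.mem t z.im z.re hy
  have hρ0 := logSource_nonneg (a := a) hs ⟨t, z.im⟩
  rcases eq_or_ne (logSource s a ⟨t, z.im⟩) 0 with h0 | h0
  · have : (Iic z.re).indicator (fun t : ℝ => logSource s a ⟨t, z.im⟩) t = 0 := by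
      by_cases ht : t ∈ Iic z.re
      · rw [indicator_of_mem ht, h0]
      · rw [indicator_of_notMem ht]
    simp [this, h0]
  have hbt : δ ≤ ‖b ⟨t, z.im⟩‖ := by
    refine (hab ⟨t, z.im⟩ hz0).resolve_left fun h => h0 (logSource_eq_zero hs (hsδ.trans ?_))
    exact pow_le_pow_left₀ hδ.le h 2
  by_cases ht : t ∈ Icc (z.re - κ * z.im) (z.re + κ * z.im)
  · rw [indicator_of_mem ht, sourceDensity_of_le hy, ← ofReal_norm]
    refine ENNReal.ofReal_le_ofReal ?_
    rw [Real.norm_eq_abs, abs_le]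
    have h3 : (Iic z.re).indicator (fun t : ℝ => logSource s a ⟨t, z.im⟩) t ∈
        Icc 0 (logSource s a ⟨t, z.im⟩) := by
      by_cases ht : t ∈ Iic z.re
      · rw [indicator_of_mem ht]; exact ⟨hρ0, le_rfl⟩
      · rw [indicator_of_notMem ht]; exact ⟨le_rfl, hρ0⟩
    have h4 := mul_nonneg hρ0 hmem.1
    have h5 := mul_le_mul_of_nonneg_left hmem.2 hρ0
    constructor <;> linarith [h3.1, h3.2]
  · rw [indicator_of_notMem ht, nonpos_iff_eq_zero, enorm_eq_zero]
    have hkz : 0 < κ * z.im := by positivity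
    rcases not_and_or.1 ht with h | h
    · rw [not_le] at h
      rw [indicator_of_mem (show t ∈ Iic z.re by simp only [mem_Iic]; linarith),
        hK.right t _ _ hy hbt (by linarith)]
      ring
    · rw [not_le] at h
      rw [indicator_of_notMem (show t ∉ Iic z.re by simp only [mem_Iic]; linarith),
        hK.left t _ _ hy (by linarith)]
      ring

lemma enorm_flowN_le (hs : 0 < s) (hκ : 0 < κ) (hc : 0 < c)
    (hK : StepKernel b δ κ ε c k S) {z : ℂ} (hy : c ≤ z.im) (hy1 : z.im ≤ 1) :
    ‖flowN s a c k z‖ₑ ≤ ∫⁻ v in Ioc z.im 1, ∫⁻ t in Icc (z.re - κ * v) (z.re + κ * v),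
      ENNReal.ofReal (4 / (κ * v)) * sourceDensity s a c (t, v) := by
  rw [flowN, intervalIntegral.integral_of_le hy1]
  refine (enorm_integral_le_lintegral_enorm _).trans
    (setLIntegral_mono' measurableSet_Ioc fun v hv => ?_)
  have hv : c ≤ v := hy.trans hv.1.le
  have hv0 := hc.trans_le hv
  rw [sourceAvg, intervalIntegral.integral_of_le (by norm_num), ← lintegral_indicator measurableSet_Icc]
  refine (enorm_integral_le_lintegral_enorm _).trans
    ((setLIntegral_le_lintegral _ _).trans (lintegral_mono fun t => ?_))
  rw [max_eq_left hv]
  by_cases ht : t ∈ Icc (z.re - κ * v) (z.re + κ * v)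
  · rw [indicator_of_mem ht, sourceDensity_of_le hv, ← ofReal_norm,
      ← ENNReal.ofReal_mul (by positivity), mul_comm, norm_mul,
      Real.norm_of_nonneg (hK.nonneg _ _ _ hv), Real.norm_of_nonneg (logSource_nonneg hs _)]
    exact ENNReal.ofReal_le_ofReal (mul_le_mul_of_nonneg_right (hK.le _ _ _ hv) (logSource_nonneg hs _))
  · rw [indicator_of_notMem ht, hK.zero _ _ _ hv]
    · simp
    · by_contra h
      rw [not_le, abs_lt] at h
      exact ht ⟨by linarith [h.2], by linarith [h.1]⟩

lemma flowN_eq_zero (hK : StepKernel b δ κ ε c k S) {z : ℂ} (hc : 0 < c) (hy : c ≤ z.im)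
    (hy1 : z.im ≤ 1) (hbz : ‖b z‖ ≤ ε) : flowN s a c k z = 0 := by
  rw [flowN, intervalIntegral.integral_congr (g := fun _ => (0 : ℝ)), intervalIntegral.integral_zero]
  intro v hv
  rw [uIcc_of_le hy1] at hv
  have h : ∀ t, k t v z.re = 0 := fun t =>
    hK.zero_small t v z.re z.im (hy.trans hv.1) hy (by linarith [hv.1]) hbz
  simp [sourceAvg, h]

lemma flowF_eq_zero (hs : 0 < s) (hsδ : s ≤ δ ^ 2) (hκ : 0 < κ) (hκδ : 8 * κ ≤ δ) (hδ : 0 < δ)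
    (hc : 0 < c) (ha : DifferentiableOn ℂ a UH)
    (hb : DifferentiableOn ℂ b UH) (hb1 : ∀ z ∈ UH, ‖b z‖ ≤ 1)
    (hab : ∀ z ∈ UH, δ ≤ ‖a z‖ ∨ δ ≤ ‖b z‖) (hK : StepKernel b δ κ ε c k S) {z : ℂ}
    (hx : |z.re| ≤ 2) (hy : c ≤ z.im) (hbz : ‖b z‖ < δ / 2) : flowF s a c S z = 0 := by
  have h := enorm_flowF_le hs hsδ hκ hδ hc ha hab hK hx hy
  have hz0 : 0 < z.im := hc.trans_le hy
  rw [setLIntegral_congr_fun (g := fun _ => 0) measurableSet_Icc, lintegral_zero,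
    nonpos_iff_eq_zero, enorm_eq_zero] at h
  · exact h
  intro t ht
  simp only
  rw [sourceDensity_of_le hy, logSource_eq_zero hs, ENNReal.ofReal_zero]
  refine hsδ.trans (pow_le_pow_left₀ hδ.le ((hab ⟨t, z.im⟩ hz0).resolve_right fun hbt => ?_) 2)
  have h1 := norm_sub_le_of_UH hb hb1 (z := z) (w := ⟨t, z.im⟩) hz0 hz0
  have h2 : ‖(⟨t, z.im⟩ : ℂ) - z‖ ≤ κ * z.im := by
    have : (⟨t, z.im⟩ : ℂ) - z = ((t - z.re : ℝ) : ℂ) := by apply Complex.ext <;> simp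
    rw [this, Complex.norm_real, Real.norm_eq_abs, abs_le]
    constructor <;> linarith [ht.1, ht.2]
  have h3 : 4 * 1 * ‖(⟨t, z.im⟩ : ℂ) - z‖ / z.im ≤ 4 * κ := by
    rw [div_le_iff₀ hz0]; linarith
  have h4 := norm_sub_norm_le (b ⟨t, z.im⟩) (b z)
  linarith
end

section
variable {s c : ℝ} {a b : ℂ → ℂ} {k S : ℝ → ℝ → ℝ → ℝ} {δ κ ε Λ : ℝ}

lemma measurableSet_strip (c : ℝ) : MeasurableSet {z : ℂ | |z.re| ≤ 2 ∧ c < z.im ∧ z.im ≤ 1} :=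
  (measurableSet_le (measurable_re.abs) measurable_const).inter
    ((measurableSet_lt measurable_const measurable_im).inter
      (measurableSet_le measurable_im measurable_const))

lemma cbox_subset_reProdIm {x₀ ℓ : ℝ} : cbox x₀ ℓ ⊆ Icc (x₀ - ℓ) (x₀ + ℓ) ×ℂ Ioc 0 ℓ :=
  fun _ hz => ⟨⟨by linarith [(abs_le.1 hz.1).1], by linarith [(abs_le.1 hz.1).2]⟩, hz.2⟩

lemma lintegral_near_sourceDensity_le_div (hΛ0 : 0 ≤ Λ)
    (hΛ : ∀ z ∈ UH, logSource s a z ≤ Λ * ‖deriv a z‖ ^ 2) (ha : DifferentiableOn ℂ a UH)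
    (ha1 : ∀ z ∈ UH, ‖a z‖ ≤ 1) {A x v : ℝ} (hA : 0 ≤ A) (hv : 0 < v) :
    ∫⁻ t in Icc (x - κ * v) (x + κ * v), ENNReal.ofReal A * sourceDensity s a c (t, v) ≤
      ENNReal.ofReal (8 * κ * Λ * A / v) := by
  calc _ ≤ ∫⁻ t in Icc (x - κ * v) (x + κ * v), ENNReal.ofReal (A * (4 * Λ / v ^ 2)) := by
        refine lintegral_mono fun t => ?_
        rw [ENNReal.ofReal_mul hA]
        exact mul_le_mul_right (sourceDensity_le_div hΛ0 hΛ ha ha1 hv) _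
    _ = _ := by
        rw [setLIntegral_const, Real.volume_Icc, ← ENNReal.ofReal_mul (by positivity)]
        congr 1; field_simp; ring

lemma lintegral_far_sourceDensity_le (hΛ0 : 0 ≤ Λ)
    (hΛ : ∀ z ∈ UH, logSource s a z ≤ Λ * ‖deriv a z‖ ^ 2) (ha : DifferentiableOn ℂ a UH)
    (ha1 : ∀ z ∈ UH, ‖a z‖ ≤ 1) {x w : ℝ} (hκ : 0 < κ) (hw : 0 < w) :
    ∫⁻ v in Ioi w, ∫⁻ t in Icc (x - κ * v) (x + κ * v),
      ENNReal.ofReal (4 / (κ * v)) * sourceDensity s a c (t, v) ≤ ENNReal.ofReal (32 * Λ / w) := by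
  rw [← lintegral_Ioi_inv_sq (by positivity) hw]
  refine setLIntegral_mono' measurableSet_Ioi fun v hv => ?_
  have hv0 : 0 < v := hw.trans hv
  refine (lintegral_near_sourceDensity_le_div hΛ0 hΛ ha ha1 (by positivity) hv0).trans (le_of_eq ?_)
  congr 1; field_simp; ring

lemma lintegral_enorm_flowF_le (hs : 0 < s) (hsδ : s ≤ δ ^ 2) (hκ : 0 < κ) (hκ1 : κ ≤ 1)
    (hδ : 0 < δ) (hc : 0 < c) (hΛ0 : 0 ≤ Λ)
    (hΛ : ∀ z ∈ UH, logSource s a z ≤ Λ * ‖deriv a z‖ ^ 2) (ha : DifferentiableOn ℂ a UH)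
    (ha1 : ∀ z ∈ UH, ‖a z‖ ≤ 1)
    (hab : ∀ z ∈ UH, δ ≤ ‖a z‖ ∨ δ ≤ ‖b z‖) (hK : StepKernel b δ κ ε c k S) (x₀ : ℝ) {ℓ : ℝ}
    (hℓ : 0 < ℓ) :
    ∫⁻ z in cbox x₀ ℓ ∩ {z | |z.re| ≤ 2 ∧ c < z.im ∧ z.im ≤ 1}, ‖flowF s a c S z‖ₑ ≤
      ENNReal.ofReal (44 * Λ * ℓ) := by
  have hR := measurable_sourceDensity (s := s) hc ha
  have hm := measurable_lintegral_Icc_param hR κ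
  calc _ ≤ ∫⁻ z in cbox x₀ ℓ ∩ {z | |z.re| ≤ 2 ∧ c < z.im ∧ z.im ≤ 1},
        ∫⁻ t in Icc (z.re - κ * z.im) (z.re + κ * z.im), sourceDensity s a c (t, z.im) := by
        refine setLIntegral_mono' ?_ fun z hz =>
          enorm_flowF_le hs hsδ hκ hδ hc ha hab hK hz.2.1 hz.2.2.1.le
        exact (measurableSet_cbox _ _).inter (measurableSet_strip c)
    _ ≤ ∫⁻ z in Icc (x₀ - ℓ) (x₀ + ℓ) ×ℂ Ioc 0 ℓ,
        ∫⁻ t in Icc (z.re - κ * z.im) (z.re + κ * z.im), sourceDensity s a c (t, z.im) :=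
        lintegral_mono_set fun z hz => cbox_subset_reProdIm hz.1
    _ = ∫⁻ y in Ioc 0 ℓ, ∫⁻ x in Icc (x₀ - ℓ) (x₀ + ℓ),
        ∫⁻ t in Icc (x - κ * y) (x + κ * y), sourceDensity s a c (t, y) :=
        setLIntegral_reProdIm_symm _
          (hm.comp (measurable_re.prodMk measurable_im)) measurableSet_Icc measurableSet_Ioc
    _ ≤ ∫⁻ v in Ioc 0 ℓ, ∫⁻ t in Icc (x₀ - 2 * ℓ) (x₀ + 2 * ℓ),
          ENNReal.ofReal (2 * v) * sourceDensity s a c (t, v) := by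
        refine setLIntegral_mono' measurableSet_Ioc fun v hv => ?_
        have hg : Measurable fun t => sourceDensity s a c (t, v) := by fun_prop
        refine (lintegral_lintegral_Icc_le hg (r := κ * v) ?_).trans ?_
        · nlinarith [hv.1, hv.2]
        · rw [← lintegral_const_mul _ hg]
          refine lintegral_mono fun t => mul_le_mul_left (ENNReal.ofReal_le_ofReal ?_) _
          nlinarith [hv.1]
    _ ≤ _ := by
        refine (lintegral_sourceDensity_le hΛ0 hΛ ha ha1 (by norm_num) hℓ).trans (le_of_eq ?_)
        congr 1; ring

lemma lintegral_enorm_flowN_le (hs : 0 < s) (hκ : 0 < κ) (hκ1 : κ ≤ 1)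
    (hc : 0 < c) (hΛ0 : 0 ≤ Λ)
    (hΛ : ∀ z ∈ UH, logSource s a z ≤ Λ * ‖deriv a z‖ ^ 2) (ha : DifferentiableOn ℂ a UH)
    (ha1 : ∀ z ∈ UH, ‖a z‖ ≤ 1) (hK : StepKernel b δ κ ε c k S) (x₀ : ℝ) {ℓ : ℝ}
    (hℓ : 0 < ℓ) :
    ∫⁻ z in cbox x₀ ℓ ∩ {z | |z.re| ≤ 2 ∧ c < z.im ∧ z.im ≤ 1}, ‖flowN s a c k z‖ₑ ≤
      ENNReal.ofReal (240 * Λ * ℓ) := by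
  set R : ℝ × ℝ → ENNReal := fun p => ENNReal.ofReal (4 / (κ * p.2)) * sourceDensity s a c p with hRdef
  have hsd := measurable_sourceDensity (s := s) hc ha
  have hR : Measurable R := by fun_prop
  have hm := measurable_lintegral_Icc_param hR κ
  have hnear : Measurable fun z : ℂ => ∫⁻ v in Ioc z.im ℓ,
      ∫⁻ t in Icc (z.re - κ * v) (z.re + κ * v), R (t, v) := by
    have hms : MeasurableSet {q : ℂ × ℝ | q.1.im < q.2 ∧ q.2 ≤ ℓ} :=
      (measurableSet_lt (measurable_im.comp measurable_fst) measurable_snd).inter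
        (measurableSet_le measurable_snd measurable_const)
    have h1 : Measurable fun q : ℂ × ℝ => (q.1.re, q.2) :=
      (measurable_re.comp measurable_fst).prodMk measurable_snd
    have h2 := ((hm.comp h1).indicator hms).lintegral_prod_right' (ν := volume)
    convert h2 using 2 with z
    rw [← lintegral_indicator measurableSet_Ioc]; rfl
  have hvol : ∫⁻ z in Icc (x₀ - ℓ) (x₀ + ℓ) ×ℂ Ioc 0 ℓ, ENNReal.ofReal (32 * Λ / ℓ) =
      ENNReal.ofReal (64 * Λ * ℓ) := by
    rw [setLIntegral_reProdIm _ measurable_const measurableSet_Icc measurableSet_Ioc]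
    simp only [setLIntegral_const, Real.volume_Icc, Real.volume_Ioc]
    rw [← ENNReal.ofReal_mul (by positivity), ← ENNReal.ofReal_mul (by nlinarith [show 0 ≤ 32 * Λ / ℓ by positivity])]
    congr 1; field_simp; ring
  calc _ ≤ ∫⁻ z in cbox x₀ ℓ ∩ {z | |z.re| ≤ 2 ∧ c < z.im ∧ z.im ≤ 1},
        ((∫⁻ v in Ioc z.im ℓ, ∫⁻ t in Icc (z.re - κ * v) (z.re + κ * v), R (t, v)) +
          ENNReal.ofReal (32 * Λ / ℓ)) := by
        refine setLIntegral_mono' ((measurableSet_cbox _ _).inter (measurableSet_strip c)) fun z hz => ?_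
        refine (enorm_flowN_le hs hκ hc hK hz.2.2.1.le hz.2.2.2).trans ?_
        refine ((lintegral_mono_set (t := Ioc z.im ℓ ∪ Ioi ℓ) fun v hv => ?_).trans
          (lintegral_union_le _ _ _)).trans
          (add_le_add le_rfl (lintegral_far_sourceDensity_le hΛ0 hΛ ha ha1 hκ hℓ))
        rcases le_or_gt v ℓ with h | h
        · exact Or.inl ⟨hv.1, h⟩
        · exact Or.inr h
    _ ≤ ∫⁻ z in Icc (x₀ - ℓ) (x₀ + ℓ) ×ℂ Ioc 0 ℓ,
        ((∫⁻ v in Ioc z.im ℓ, ∫⁻ t in Icc (z.re - κ * v) (z.re + κ * v), R (t, v)) +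
          ENNReal.ofReal (32 * Λ / ℓ)) :=
        lintegral_mono_set fun z hz => cbox_subset_reProdIm hz.1
    _ = (∫⁻ x in Icc (x₀ - ℓ) (x₀ + ℓ), ∫⁻ y in Ioc 0 ℓ, ∫⁻ v in Ioc y ℓ,
        ∫⁻ t in Icc (x - κ * v) (x + κ * v), R (t, v)) + ENNReal.ofReal (64 * Λ * ℓ) := by
        rw [lintegral_add_left hnear, hvol,
          setLIntegral_reProdIm _ hnear measurableSet_Icc measurableSet_Ioc]
    _ ≤ ENNReal.ofReal (22 * 8 * Λ * ℓ) + ENNReal.ofReal (64 * Λ * ℓ) := by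
        refine add_le_add ?_ le_rfl
        refine (lintegral_box_near_le hR hκ1).trans (le_trans (le_of_eq ?_)
          (lintegral_sourceDensity_le (c := c) (x₀ := x₀) hΛ0 hΛ ha ha1 (by norm_num) hℓ))
        refine setLIntegral_congr_fun measurableSet_Ioc fun v hv => ?_
        have hv0 := hv.1
        refine lintegral_congr fun t => ?_
        simp only [hRdef]
        rw [← mul_assoc, ← ENNReal.ofReal_mul (by positivity)]
        congr 2; field_simp; ring
    _ = _ := by rw [← ENNReal.ofReal_add (by positivity) (by positivity)]; congr 1; ring
end

/-- An almost holomorphic logarithm: `V` is comparable to a logarithm of `a`, is one where `b` is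
small, and `∂̄V` is a Carleson measure with pointwise decay. -/
structure AlmostLog (a b : ℂ → ℂ) (ε C c : ℝ) (V : ℂ → ℂ) : Prop where
  smooth : ContDiffOn ℝ 1 V {z | c < z.im}
  re_le : ∀ z, c < z.im → |(V z).re| ≤ C
  dbar_le : ∀ z, |z.re| ≤ 2 → c < z.im → z.im ≤ 1 → ‖dbar V z‖ ≤ C / z.im
  dbar_zero : ∀ z, |z.re| ≤ 2 → c < z.im → z.im ≤ 1 → ‖b z‖ < ε → dbar V z = 0
  hasDerivAt : ∀ z, |z.re| ≤ 2 → c < z.im → z.im ≤ 1 → ‖b z‖ < ε → HasDerivAt V (deriv a z / a z) z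
  exp_re : ∀ z, |z.re| ≤ 2 → c < z.im → z.im ≤ 1 → ‖b z‖ < ε → Real.exp (V z).re = ‖a z‖
  carleson : ∀ x₀ ℓ : ℝ, 0 < ℓ →
    ∫⁻ z in cbox x₀ ℓ ∩ {z | |z.re| ≤ 2 ∧ c < z.im ∧ z.im ≤ 1}, ENNReal.ofReal ‖dbar V z‖ ≤
      ENNReal.ofReal (C * ℓ)

theorem exists_almostLog {δ : ℝ} (hδ : 0 < δ) (hδ1 : δ ≤ 1) :
    ∃ ε C : ℝ, 0 < ε ∧ ε ≤ δ ∧ 0 < C ∧ ∀ a b : ℂ → ℂ, DifferentiableOn ℂ a UH → (∀ z ∈ UH, ‖a z‖ ≤ 1) →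
      DifferentiableOn ℂ b UH → (∀ z ∈ UH, ‖b z‖ ≤ 1) →
      (∀ z ∈ UH, δ ≤ ‖a z‖ ∨ δ ≤ ‖b z‖) → ∀ c, 0 < c → ∃ V, AlmostLog a b ε C c V := by
  have hκ : 0 < δ / 8 := by positivity
  have hκ1 : δ / 8 ≤ 1 := by linarith
  have hs : 0 < (δ / 2) ^ 2 := by positivity
  have hs1 : (δ / 2) ^ 2 ≤ 1 := by nlinarith
  have hsδ : (δ / 2) ^ 2 ≤ δ ^ 2 := by nlinarith
  obtain ⟨ε, hε, hεδ, Hk⟩ := exists_stepKernel hδ hκ hκ1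
  obtain ⟨Λ, hΛ, HΛ⟩ := exists_logSource_le hs
  set M := |Real.log ((δ / 2) ^ 2)| / 2 + 1 / (δ / 2) ^ 2 with hM
  have hM0 : 0 < M := by positivity
  refine ⟨min ε (δ / 2), M + 300 * Λ, by positivity, (min_le_right _ _).trans (by linarith), by positivity,
    fun a b ha ha1 hb hb1 hab c hc => ?_⟩
  obtain ⟨k, S, hK⟩ := Hk b hb hb1 c hc
  have HΛ' : ∀ z ∈ UH, logSource ((δ / 2) ^ 2) a z ≤ Λ * ‖deriv a z‖ ^ 2 := fun z _ => HΛ a z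
  obtain ⟨hsm, hder⟩ := flow_regular hs hc ha hK.cont_k hK.cont_S hK.deriv
  have hdb := fun z hz => dbar_flow (z := z) hs hc ha hK.cont_k hK.cont_S hK.deriv hz
  have hre : ∀ z, (flow ((δ / 2) ^ 2) a c S z).re = logPrim ((δ / 2) ^ 2) (normSq (a z)) := fun z => by
    simp [flow]
  have hzero : ∀ z : ℂ, |z.re| ≤ 2 → c < z.im → z.im ≤ 1 → ‖b z‖ < min ε (δ / 2) →
      flowF ((δ / 2) ^ 2) a c S z = 0 ∧ flowN ((δ / 2) ^ 2) a c k z = 0 ∧ (δ / 2) ^ 2 ≤ ‖a z‖ ^ 2 := by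
    intro z hx hy hy1 hbz
    refine ⟨flowF_eq_zero hs hsδ hκ (by linarith) hδ hc ha hb hb1 hab hK hx hy.le
      (hbz.trans_le (min_le_right _ _)), flowN_eq_zero hK hc hy.le hy1 (hbz.trans_le (min_le_left _ _)).le, ?_⟩
    refine hsδ.trans (pow_le_pow_left₀ hδ.le ((hab z (hc.trans hy)).resolve_right fun h => ?_) 2)
    linarith [hbz.trans_le (min_le_right _ _)]
  have hnorm : ∀ z, c < z.im → ‖dbar (flow ((δ / 2) ^ 2) a c S) z‖ₑ ≤
      ‖flowF ((δ / 2) ^ 2) a c S z‖ₑ + ‖flowN ((δ / 2) ^ 2) a c k z‖ₑ := by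
    intro z hz
    rw [hdb z hz, ← ofReal_norm, ← ofReal_norm, ← ofReal_norm,
      ← ENNReal.ofReal_add (norm_nonneg _) (norm_nonneg _)]
    refine ENNReal.ofReal_le_ofReal ?_
    have h := norm_sub_le (flowF ((δ / 2) ^ 2) a c S z : ℂ) (I * flowN ((δ / 2) ^ 2) a c k z)
    rw [norm_mul, Complex.norm_I, one_mul, Complex.norm_real, Complex.norm_real] at h
    rw [norm_div, Complex.norm_two]
    linarith [norm_nonneg (flowF ((δ / 2) ^ 2) a c S z), norm_nonneg (flowN ((δ / 2) ^ 2) a c k z)]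
  refine ⟨flow ((δ / 2) ^ 2) a c S, hsm, fun z hz => ?_, fun z hx hy hy1 => ?_, fun z hx hy hy1 hbz => ?_,
    fun z hx hy hy1 hbz => ?_, fun z hx hy hy1 hbz => ?_, fun x₀ ℓ hℓ => ?_⟩
  · rw [hre]
    have h1 := ha1 z (hc.trans hz)
    refine (abs_logPrim_le hs hs1 (normSq_nonneg _) ?_).trans (by linarith)
    rw [normSq_eq_norm_sq]; nlinarith [norm_nonneg (a z)]
  · have hz0 : 0 < z.im := hc.trans hy
    have hF := enorm_flowF_le hs hsδ hκ hδ hc ha hab hK hx hy.le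
    have hF2 : ‖flowF ((δ / 2) ^ 2) a c S z‖ₑ ≤ ENNReal.ofReal (8 * (δ / 8) * Λ * 1 / z.im) := by
      refine hF.trans ?_
      have h := lintegral_near_sourceDensity_le_div (κ := δ / 8) (c := c) (x := z.re) hΛ.le HΛ' ha ha1 zero_le_one hz0
      simpa using h
    have hN2 : ‖flowN ((δ / 2) ^ 2) a c k z‖ₑ ≤ ENNReal.ofReal (32 * Λ / z.im) :=
      ((enorm_flowN_le hs hκ hc hK hy.le hy1).trans
        (lintegral_mono_set fun v hv => hv.1)).trans
        (lintegral_far_sourceDensity_le hΛ.le HΛ' ha ha1 hκ hz0)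
    have h := (hnorm z hy).trans (add_le_add hF2 hN2)
    rw [← ENNReal.ofReal_add (by positivity) (by positivity), ← ofReal_norm,
      ENNReal.ofReal_le_ofReal_iff (by positivity), ← add_div] at h
    refine h.trans ((div_le_div_iff_of_pos_right hz0).2 ?_)
    nlinarith
  · obtain ⟨h1, h2, -⟩ := hzero z hx hy hy1 hbz
    rw [hdb z hy, h1, h2]; simp
  · obtain ⟨h1, h2, h3⟩ := hzero z hx hy hy1 hbz
    rw [← regLogDeriv_eq hs h3]
    refine hasDerivAt_iff_hasFDerivAt.2 (hasFDerivAt_of_restrictScalars ℝ (hder z hy) ?_)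
    ext w
    simp [flowDx, flowDy, h1, h2]
    linear_combination (-regLogDeriv ((δ / 2) ^ 2) a z) * re_add_im w
  · obtain ⟨h1, h2, h3⟩ := hzero z hx hy hy1 hbz
    have h4 : 0 < ‖a z‖ := by
      rcases (norm_nonneg (a z)).eq_or_lt with h | h
      · rw [← h] at h3; nlinarith
      · exact h
    rw [hre, normSq_eq_norm_sq, logPrim_of_ge hs h3, Real.log_pow]
    push_cast
    rw [mul_div_cancel_left₀ _ two_ne_zero, Real.exp_log h4]
  · calc _ ≤ ∫⁻ z in cbox x₀ ℓ ∩ {z | |z.re| ≤ 2 ∧ c < z.im ∧ z.im ≤ 1},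
          (‖flowF ((δ / 2) ^ 2) a c S z‖ₑ + ‖flowN ((δ / 2) ^ 2) a c k z‖ₑ) := by
          refine setLIntegral_mono' ((measurableSet_cbox _ _).inter (measurableSet_strip c)) fun z hz => ?_
          rw [ofReal_norm]
          exact hnorm z hz.2.2.1
      _ = (∫⁻ z in cbox x₀ ℓ ∩ {z | |z.re| ≤ 2 ∧ c < z.im ∧ z.im ≤ 1}, ‖flowF ((δ / 2) ^ 2) a c S z‖ₑ) +
          ∫⁻ z in cbox x₀ ℓ ∩ {z | |z.re| ≤ 2 ∧ c < z.im ∧ z.im ≤ 1}, ‖flowN ((δ / 2) ^ 2) a c k z‖ₑ := by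
          refine lintegral_add_right' _ ?_
          exact (continuousOn_flowN hc ha hK.cont_k).aestronglyMeasurable.enorm
      _ ≤ ENNReal.ofReal (44 * Λ * ℓ) + ENNReal.ofReal (240 * Λ * ℓ) :=
          add_le_add (lintegral_enorm_flowF_le hs hsδ hκ hκ1 hδ hc hΛ.le HΛ' ha ha1 hab hK x₀ hℓ)
            (lintegral_enorm_flowN_le hs hκ hκ1 hc hΛ.le HΛ' ha ha1 hK x₀ hℓ)
      _ ≤ _ := by
          rw [← ENNReal.ofReal_add (by positivity) (by positivity)]
          refine ENNReal.ofReal_le_ofReal ?_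
          nlinarith [mul_pos hM0 hℓ, mul_pos hΛ hℓ]

/-- The open strip box in which the logarithms live. -/
def logBox (c : ℝ) : Set ℂ := {z | |z.re| < 2 ∧ c < z.im ∧ z.im < 1}

lemma isOpen_logBox (c : ℝ) : IsOpen (logBox c) :=
  (isOpen_lt continuous_re.abs continuous_const).inter
    ((isOpen_lt continuous_const continuous_im).inter (isOpen_lt continuous_im continuous_const))

/-- An almost holomorphic function which is a true logarithm of `a` where `b` is small. -/
structure RoundedLog (a b : ℂ → ℂ) (ε C c : ℝ) (V : ℂ → ℂ) : Prop where
  smooth : ContDiffOn ℝ 1 V (logBox c)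
  re_le : ∀ z ∈ logBox c, |(V z).re| ≤ C
  dbar_le : ∀ z ∈ logBox c, ‖dbar V z‖ ≤ C / z.im
  dbar_zero : ∀ z ∈ logBox c, ‖b z‖ < ε → dbar V z = 0
  exp_eq : ∀ z ∈ logBox c, ‖b z‖ < ε → exp (V z) = a z
  carleson : ∀ x₀ ℓ : ℝ, 0 < ℓ → ℓ ≤ 1 →
    ∫⁻ z in cbox x₀ ℓ ∩ logBox c, ENNReal.ofReal ‖dbar V z‖ ≤ ENNReal.ofReal (C * ℓ)

lemma norm_dbar_ofReal_le {χ : ℂ → ℝ} {z : ℂ} (h : DifferentiableAt ℝ χ z) :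
    ‖dbar (fun w => (χ w : ℂ)) z‖ ≤ ‖fderiv ℝ χ z‖ := by
  have h1 : fderiv ℝ (fun w => (χ w : ℂ)) z = ofRealCLM.comp (fderiv ℝ χ z) :=
    (ofRealCLM.hasFDerivAt.comp z h.hasFDerivAt).fderiv
  have h2 := (fderiv ℝ χ z).le_opNorm 1
  have h3 := (fderiv ℝ χ z).le_opNorm I
  rw [norm_one, mul_one] at h2
  rw [Complex.norm_I, mul_one] at h3
  have h4 := norm_add_le ((fderiv ℝ χ z 1 : ℝ) : ℂ) (I * (fderiv ℝ χ z I : ℝ))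
  rw [norm_mul, Complex.norm_I, one_mul, Complex.norm_real, Complex.norm_real] at h4
  rw [dbar, h1, norm_div, Complex.norm_two]
  simp only [ContinuousLinearMap.comp_apply, ofRealCLM_apply]
  linarith

lemma eventually_eq_of_deriv_div_exp {a V : ℂ → ℂ} {z : ℂ} 
    (ha : ∀ᶠ w in 𝓝 z, DifferentiableAt ℂ a w) (ha0 : ∀ᶠ w in 𝓝 z, a w ≠ 0)
    (hV : ∀ᶠ w in 𝓝 z, HasDerivAt V (deriv a w / a w) w) :
    ∀ᶠ w in 𝓝 z, exp (V w) / a w = exp (V z) / a z := by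
  obtain ⟨r, hr, h⟩ := Metric.eventually_nhds_iff_ball.1 (ha.and (ha0.and hV))
  have hd : ∀ w ∈ Metric.ball z r, HasDerivAt (fun w => exp (V w) / a w) 0 w := fun w hw => by
    obtain ⟨h1, h2, h3⟩ := h w hw
    refine (h3.cexp.div h1.hasDerivAt h2).congr_deriv ?_
    field_simp; ring
  refine Metric.eventually_nhds_iff_ball.2 ⟨r, hr, fun w hw => ?_⟩
  exact (convex_ball z r).is_const_of_fderivWithin_eq_zero (𝕜 := ℂ)
    (fun w hw => (hd w hw).differentiableAt.differentiableWithinAt)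
    (fun w hw => by
      rw [fderivWithin_of_isOpen Metric.isOpen_ball hw, (hd w hw).hasFDerivAt.fderiv]; simp) hw
    (Metric.mem_ball_self hr)

lemma exp_mul_exp_neg_arg {u v : ℂ} (hv : v ≠ 0) (h : ‖u‖ = ‖v‖) :
    u * exp (I * ((-(u / v).arg : ℝ) : ℂ)) = v := by
  have h1 := norm_mul_exp_arg_mul_I (u / v)
  have h2 : ‖u / v‖ = 1 := by rw [norm_div, h, div_self (norm_ne_zero_iff.2 hv)]
  rw [h2, ofReal_one, one_mul] at h1
  have h3 : I * ((-(u / v).arg : ℝ) : ℂ) = -((u / v).arg * I) := by push_cast; ring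
  have hu : u ≠ 0 := by rw [← norm_ne_zero_iff, h]; exact norm_ne_zero_iff.2 hv
  rw [h3, Complex.exp_neg, h1]
  field_simp

theorem exists_roundedLog {δ : ℝ} (hδ : 0 < δ) (hδ1 : δ ≤ 1) :
    ∃ ε C : ℝ, 0 < ε ∧ 0 < C ∧ ∀ a b : ℂ → ℂ, DifferentiableOn ℂ a UH → (∀ z ∈ UH, ‖a z‖ ≤ 1) →
      DifferentiableOn ℂ b UH → (∀ z ∈ UH, ‖b z‖ ≤ 1) →
      (∀ z ∈ UH, δ ≤ ‖a z‖ ∨ δ ≤ ‖b z‖) → ∀ c, 0 < c → ∃ V, RoundedLog a b ε C c V := by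
  obtain ⟨ε, C, hε, hεδ, hC, H⟩ := exists_almostLog hδ hδ1
  obtain ⟨ε₃, C', hε₃, hε₃ε, hC', H'⟩ := exists_carleson_cutoff (half_pos hε)
  refine ⟨ε₃, C + 4 * C', hε₃, by positivity, fun a b ha ha1 hb hb1 hab c hc => ?_⟩
  obtain ⟨V, hV⟩ := H a b ha ha1 hb hb1 hab c hc
  obtain ⟨χ, hχ, hχ1, hχ2⟩ := H' b hb hb1 c hc
  set r : ℂ → ℝ := fun z => -(exp (V z) / a z).arg with hr
  have hrπ : ∀ z, |r z| ≤ 4 := fun z => by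
    rw [hr]; simp only [abs_neg]; exact (abs_arg_le_pi _).trans (by linarith [Real.pi_lt_four])
  have hUH : ∀ z ∈ logBox c, z ∈ UH := fun z hz => hc.trans hz.2.1
  have hcb : ∀ z ∈ logBox c, ContinuousAt b z := fun z hz =>
    (hb.differentiableAt_UH (hUH z hz)).continuousAt
  have hev : ∀ z ∈ logBox c, ∀ᶠ w in 𝓝 z, w ∈ logBox c := fun z hz => (isOpen_logBox c).mem_nhds hz
  have hsmall : ∀ z ∈ logBox c, ∀ e, ‖b z‖ < e → ∀ᶠ w in 𝓝 z, w ∈ logBox c ∧ ‖b w‖ < e := fun z hz e he =>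
    (hev z hz).and ((hcb z hz).norm.eventually_lt_const he)
  have hχle : ∀ z ∈ logBox c, χ z ∈ Icc 0 1 ∧ (‖b z‖ < ε₃ → χ z = 1) ∧ (ε / 2 ≤ ‖b z‖ → χ z = 0) ∧
      ‖fderiv ℝ χ z‖ ≤ C' / z.im := fun z hz => hχ1 z hz.1.le hz.2.1.le hz.2.2.le
  have ha0 : ∀ z ∈ logBox c, ‖b z‖ < ε → a z ≠ 0 := fun z hz hbz h0 => by
    have := hV.exp_re z hz.1.le hz.2.1 hz.2.2.le hbz
    rw [h0, norm_zero] at this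
    exact (Real.exp_pos _).ne' this
  -- near each point the rounding is a constant multiple of `χ`
  have hconst : ∀ z ∈ logBox c, ∀ᶠ w in 𝓝 z,
      V w + I * ((χ w * r w : ℝ) : ℂ) = V w + I * r z * (χ w : ℂ) := by
    intro z hz
    rcases lt_or_ge ‖b z‖ ε with hbz | hbz
    · have h := hsmall z hz ε hbz
      filter_upwards [eventually_eq_of_deriv_div_exp
        (h.mono fun w hw => ha.differentiableAt_UH (hUH w hw.1)) (h.mono fun w hw => ha0 w hw.1 hw.2)
        (h.mono fun w hw => hV.hasDerivAt w hw.1.1.le hw.1.2.1 hw.1.2.2.le hw.2)] with w hw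
      rw [hr]; simp only [hw]; push_cast; ring
    · have h2 : ε / 2 < ‖b z‖ := by linarith
      filter_upwards [hev z hz, (hcb z hz).norm.eventually_const_lt h2] with w hw hw2
      simp [(hχle w hw).2.2.1 hw2.le]
  have hdχ : ∀ z, DifferentiableAt ℝ (fun w => (χ w : ℂ)) z := fun z =>
    ofRealCLM.differentiableAt.comp z (hχ.differentiable one_ne_zero z)
  have hdV : ∀ z ∈ logBox c, DifferentiableAt ℝ V z := fun z hz =>
    (hV.smooth.differentiableOn one_ne_zero z hz.2.1).differentiableAt
      ((isOpen_lt continuous_const continuous_im).mem_nhds hz.2.1)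
  have hdbar : ∀ z ∈ logBox c, dbar (fun w => V w + I * ((χ w * r w : ℝ) : ℂ)) z =
      dbar V z + I * r z * dbar (fun w => (χ w : ℂ)) z := by
    intro z hz
    have h1 : fderiv ℝ (fun w => V w + I * ((χ w * r w : ℝ) : ℂ)) z =
        fderiv ℝ V z + (I * r z) • fderiv ℝ (fun w => (χ w : ℂ)) z := by
      rw [Filter.EventuallyEq.fderiv_eq (hconst z hz)]
      exact ((hdV z hz).hasFDerivAt.add ((hdχ z).hasFDerivAt.const_mul _)).fderiv
    rw [dbar, h1]
    simp only [add_apply, smul_apply, smul_eq_mul, dbar]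
    ring
  have hnorm : ∀ z ∈ logBox c, ‖dbar (fun w => V w + I * ((χ w * r w : ℝ) : ℂ)) z‖ ≤
      ‖dbar V z‖ + 4 * ‖fderiv ℝ χ z‖ := by
    intro z hz
    rw [hdbar z hz]
    refine (norm_add_le _ _).trans (add_le_add le_rfl ?_)
    rw [norm_mul, norm_mul, Complex.norm_I, one_mul, Complex.norm_real]
    exact mul_le_mul (hrπ z) (norm_dbar_ofReal_le (hχ.differentiable one_ne_zero z)) (norm_nonneg _) (by norm_num)
  refine ⟨fun w => V w + I * ((χ w * r w : ℝ) : ℂ), fun z hz => ContDiffAt.contDiffWithinAt ?_,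
    fun z hz => ?_, fun z hz => ?_, fun z hz hbz => ?_, fun z hz hbz => ?_, fun x₀ ℓ hℓ hℓ1 => ?_⟩
  · refine ContDiffAt.congr_of_eventuallyEq ?_ (hconst z hz)
    exact (hV.smooth.contDiffAt ((isOpen_lt continuous_const continuous_im).mem_nhds hz.2.1)).add
      (contDiffAt_const.mul (ofRealCLM.contDiff.comp hχ).contDiffAt)
  · have : (V z + I * ((χ z * r z : ℝ) : ℂ)).re = (V z).re := by simp
    rw [this]
    linarith [hV.re_le z hz.2.1]
  · have h1 := hV.dbar_le z hz.1.le hz.2.1 hz.2.2.le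
    have h2 := (hχle z hz).2.2.2
    refine (hnorm z hz).trans ?_
    rw [add_div, mul_div_assoc]
    linarith
  · have h1 : (fun w => (χ w : ℂ)) =ᶠ[𝓝 z] fun _ => 1 :=
      (hsmall z hz ε₃ hbz).mono fun w hw => by simp [(hχle w hw.1).2.1 hw.2]
    rw [hdbar z hz, hV.dbar_zero z hz.1.le hz.2.1 hz.2.2.le (by linarith), dbar, h1.fderiv_eq]
    simp
  · have hbε : ‖b z‖ < ε := by linarith
    simp only [(hχle z hz).2.1 hbz, one_mul, Complex.exp_add]
    refine exp_mul_exp_neg_arg (ha0 z hz hbε) ?_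
    rw [Complex.norm_exp]
    exact hV.exp_re z hz.1.le hz.2.1 hz.2.2.le hbε
  · have hmb := (isOpen_logBox c).measurableSet
    calc _ ≤ ∫⁻ z in cbox x₀ ℓ ∩ logBox c, (ENNReal.ofReal ‖dbar V z‖ +
            ENNReal.ofReal 4 * ENNReal.ofReal ‖fderiv ℝ χ z‖) := by
          refine setLIntegral_mono' ((measurableSet_cbox _ _).inter hmb) fun z hz => ?_
          rw [← ENNReal.ofReal_mul (by norm_num), ← ENNReal.ofReal_add (by positivity) (by positivity)]
          exact ENNReal.ofReal_le_ofReal (hnorm z hz.2)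
      _ = (∫⁻ z in cbox x₀ ℓ ∩ logBox c, ENNReal.ofReal ‖dbar V z‖) +
            ENNReal.ofReal 4 * ∫⁻ z in cbox x₀ ℓ ∩ logBox c, ENNReal.ofReal ‖fderiv ℝ χ z‖ := by
          have hm : Measurable fun z => ENNReal.ofReal ‖fderiv ℝ χ z‖ :=
            (hχ.continuous_fderiv one_ne_zero).norm.measurable.ennreal_ofReal
          rw [lintegral_add_right _ (hm.const_mul _), lintegral_const_mul _ hm]
      _ ≤ ENNReal.ofReal (C * ℓ) + ENNReal.ofReal 4 * ENNReal.ofReal (C' * ℓ) := by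
          refine add_le_add ((lintegral_mono_set ?_).trans (hV.carleson x₀ ℓ hℓ))
            (mul_le_mul_right ((lintegral_mono_set ?_).trans (hχ2 x₀ ℓ hℓ hℓ1)) _)
          · exact fun z hz => ⟨hz.1, hz.2.1.le, hz.2.2.1, hz.2.2.2.le⟩
          · exact fun z hz => ⟨hz.1, hz.2.1.le, hz.2.2.1.le⟩
      _ = _ := by
          rw [← ENNReal.ofReal_mul (by norm_num), ← ENNReal.ofReal_add (by positivity) (by positivity)]
          congr 1; ring

end

section
open MeasureTheory Set Filter Topology Complex ComplexConjugate

/-- The box on which the corona-type problem is first solved. -/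
def coreBox (τ : ℝ) : Set ℂ := {z | |z.re| < 1 ∧ τ < z.im ∧ z.im < 1 / 2}

lemma isOpen_coreBox (c : ℝ) : IsOpen (coreBox c) :=
  (isOpen_lt continuous_re.abs continuous_const).inter
    ((isOpen_lt continuous_const continuous_im).inter (isOpen_lt continuous_im continuous_const))

lemma exists_box_cutoff {τ : ℝ} (hτ : 0 < τ) (hτ1 : τ < 1 / 2) :
    ∃ φ : ℂ → ℝ, ContDiff ℝ 1 φ ∧ HasCompactSupport φ ∧ tsupport φ ⊆ logBox (τ / 4) ∧
      (∀ z, φ z ∈ Icc 0 1) ∧ ∀ z ∈ coreBox τ, φ z = 1 := by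
  let f : ContDiffBump (0 : ℝ) := ⟨1, 3 / 2, by norm_num, by norm_num⟩
  let g : ContDiffBump ((τ + 1 / 2) / 2) :=
    ⟨(1 / 2 - τ) / 2, (1 / 2 - τ) / 2 + τ / 2, by linarith, by linarith⟩
  have hK : IsCompact (Icc (-(3 / 2) : ℝ) (3 / 2) ×ℂ Icc (τ / 2) (3 / 4)) :=
    isCompact_Icc.reProdIm isCompact_Icc
  have h0 : ∀ z ∉ Icc (-(3 / 2) : ℝ) (3 / 2) ×ℂ Icc (τ / 2) (3 / 4), f z.re * g z.im = 0 := by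
    intro z hz
    by_contra h
    have h1 : z.re ∈ Function.support f := left_ne_zero_of_mul h
    have h2 : z.im ∈ Function.support g := right_ne_zero_of_mul h
    rw [f.support_eq, Metric.mem_ball, Real.dist_eq, abs_lt] at h1
    rw [g.support_eq, Metric.mem_ball, Real.dist_eq, abs_lt] at h2
    simp only [f] at h1
    simp only [g] at h2
    exact hz ⟨⟨by linarith [h1.1], by linarith [h1.2]⟩, by linarith [h2.1], by linarith [h2.2]⟩
  refine ⟨fun z => f z.re * g z.im, ?_, HasCompactSupport.intro hK h0, ?_, fun z => ⟨?_, ?_⟩, fun z hz => ?_⟩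
  · exact (f.contDiff.comp reCLM.contDiff).mul (g.contDiff.comp imCLM.contDiff)
  · refine (closure_minimal (fun z hz => ?_) hK.isClosed).trans (fun z hz => ?_)
    · by_contra h
      exact hz (h0 z h)
    · obtain ⟨⟨h1, h2⟩, h3, h4⟩ := hz
      exact ⟨abs_lt.2 ⟨by linarith, by linarith⟩, by linarith, by linarith⟩
  · exact mul_nonneg f.nonneg g.nonneg
  · exact mul_le_one₀ f.le_one g.nonneg g.le_one
  · have h1 : f z.re = 1 := f.one_of_mem_closedBall (by
      rw [Metric.mem_closedBall, Real.dist_eq, sub_zero]; exact hz.1.le)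
    have h2 : g z.im = 1 := g.one_of_mem_closedBall (by
      rw [Metric.mem_closedBall, Real.dist_eq, abs_le]
      simp only [g]
      constructor <;> linarith [hz.2.1, hz.2.2])
    simp [h1, h2]

section
variable {a b V : ℂ → ℂ} {ε C c : ℝ} {φ : ℂ → ℝ}

lemma logBox_subset_UH (hc : 0 < c) : logBox c ⊆ UH := fun _ hz => hc.trans hz.2.1

lemma RoundedLog.continuousOn_dbar (hV : RoundedLog a b ε C c V) : ContinuousOn (dbar V) (logBox c) := by
  have h := hV.smooth.continuousOn_fderiv_of_isOpen (isOpen_logBox c) le_rfl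
  unfold dbar
  fun_prop

lemma tsupport_mono_of_zero {f : ℂ → ℂ} (h : ∀ z, φ z = 0 → f z = 0) : tsupport f ⊆ tsupport φ :=
  closure_mono fun z hz h0 => hz (h z h0)

lemma RoundedLog.jonesDatum (hV : RoundedLog a b ε C c V) (hε : 0 < ε) (hC : 0 < C) (hc : 0 < c)
    (hb : DifferentiableOn ℂ b UH) (hφ : Continuous φ) (hφc : HasCompactSupport φ)
    (hφs : tsupport φ ⊆ logBox c) (hφ1 : ∀ z, φ z ∈ Icc 0 1) :
    JonesDatum (fun z => φ z * dbar V z / b z) (8 * C / ε) := by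
  set g : ℂ → ℂ := fun z => φ z * dbar V z / b z with hg
  have hUH := logBox_subset_UH hc
  have hts : tsupport g ⊆ tsupport φ := tsupport_mono_of_zero fun z hz => by simp [hg, hz]
  have hg0 : ∀ z ∉ logBox c, g z = 0 := fun z hz =>
    image_eq_zero_of_notMem_tsupport fun h => hz (hφs (hts h))
  have hgle : ∀ z ∈ logBox c, ‖g z‖ ≤ ‖dbar V z‖ / ε := by
    intro z hz
    rcases lt_or_ge ‖b z‖ ε with h | h
    · simp [hg, hV.dbar_zero z hz h]
    · rw [hg]
      simp only [norm_div, norm_mul, Complex.norm_real, Real.norm_of_nonneg (hφ1 z).1]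
      exact div_le_div₀ (norm_nonneg _) (mul_le_of_le_one_left (norm_nonneg _) (hφ1 z).2) hε h
  have hcont : Continuous g := by
    refine continuous_of_tsupport fun z hz => ?_
    have hzQ := hφs (hts hz)
    have hcb := (hb.differentiableAt_UH (hUH hzQ)).continuousAt
    rcases lt_or_ge ‖b z‖ ε with h | h
    · refine (continuousAt_const (y := (0 : ℂ))).congr ?_
      filter_upwards [(isOpen_logBox c).mem_nhds hzQ, hcb.norm.eventually_lt_const h] with w hw hw2
      simp [hg, hV.dbar_zero w hw hw2]
    · refine ContinuousAt.div (ContinuousAt.mul ?_ ?_) hcb (norm_pos_iff.1 (hε.trans_le h))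
      · exact (continuous_ofReal.comp hφ).continuousAt
      · exact hV.continuousOn_dbar.continuousAt ((isOpen_logBox c).mem_nhds hzQ)
  have hsm : ∀ x₀ ℓ, 0 < ℓ → ℓ ≤ 1 → ∫⁻ z in cbox x₀ ℓ, ENNReal.ofReal ‖g z‖ ≤ ENNReal.ofReal (C / ε * ℓ) := by
    intro x₀ ℓ hℓ hℓ1
    have hm1 : MeasurableSet (cbox x₀ ℓ ∩ logBox c) :=
      (measurableSet_cbox _ _).inter (isOpen_logBox c).measurableSet
    calc _ = ∫⁻ z in cbox x₀ ℓ ∩ logBox c, ENNReal.ofReal ‖g z‖ := by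
          rw [← lintegral_indicator (measurableSet_cbox _ _), ← lintegral_indicator hm1]
          refine lintegral_congr fun z => ?_
          by_cases h1 : z ∈ cbox x₀ ℓ
          · by_cases h2 : z ∈ logBox c
            · rw [indicator_of_mem h1, indicator_of_mem (mem_inter h1 h2)]
            · rw [indicator_of_mem h1, indicator_of_notMem fun h => h2 h.2, hg0 z h2]; simp
          · rw [indicator_of_notMem h1, indicator_of_notMem fun h => h1 h.1]
      _ ≤ ∫⁻ z in cbox x₀ ℓ ∩ logBox c, ENNReal.ofReal (1 / ε) * ENNReal.ofReal ‖dbar V z‖ := by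
          refine setLIntegral_mono' hm1 fun z hz => ?_
          rw [← ENNReal.ofReal_mul (by positivity)]
          refine ENNReal.ofReal_le_ofReal ((hgle z hz.2).trans (le_of_eq (by ring)))
      _ ≤ ENNReal.ofReal (1 / ε) * ENNReal.ofReal (C * ℓ) := by
          rw [lintegral_const_mul' _ _ ENNReal.ofReal_ne_top]
          exact mul_le_mul_right (hV.carleson x₀ ℓ hℓ hℓ1) _
      _ = _ := by rw [← ENNReal.ofReal_mul (by positivity)]; congr 1; ring
  have hbox : ∀ x₀ ℓ, 0 < ℓ → ∫⁻ z in cbox x₀ ℓ, ENNReal.ofReal ‖g z‖ ≤ ENNReal.ofReal (2 * C / ε * ℓ) := by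
    intro x₀ ℓ hℓ
    have hCε : 0 < C / ε := by positivity
    rcases le_or_gt ℓ 1 with h | h
    · refine (hsm x₀ ℓ hℓ h).trans (ENNReal.ofReal_le_ofReal ?_)
      rw [mul_div_assoc]
      nlinarith [mul_pos hCε hℓ]
    · calc _ ≤ ∫⁻ z, ENNReal.ofReal ‖g z‖ := setLIntegral_le_lintegral _ _
        _ = ∫⁻ z in cbox (-1) 1 ∪ cbox 1 1, ENNReal.ofReal ‖g z‖ := by
            refine (setLIntegral_eq_of_support_subset ?_).symm
            intro z hz
            have hzQ : z ∈ logBox c := by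
              by_contra h
              exact hz (by simp [hg0 z h])
            obtain ⟨h1, h2, h3⟩ := hzQ
            rw [abs_lt] at h1
            rcases le_total z.re 0 with h | h
            · exact Or.inl ⟨abs_le.2 ⟨by linarith, by linarith⟩, hc.trans h2, h3.le⟩
            · exact Or.inr ⟨abs_le.2 ⟨by linarith, by linarith⟩, hc.trans h2, h3.le⟩
        _ ≤ ENNReal.ofReal (C / ε * 1) + ENNReal.ofReal (C / ε * 1) :=
            (lintegral_union_le _ _ _).trans
              (add_le_add (hsm _ _ one_pos le_rfl) (hsm _ _ one_pos le_rfl))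
        _ ≤ _ := by
            rw [← ENNReal.ofReal_add (by positivity) (by positivity)]
            refine ENNReal.ofReal_le_ofReal ?_
            rw [mul_div_assoc]
            nlinarith
  refine ⟨hcont, hφc.mono' ?_, hts.trans (hφs.trans hUH), fun ζ hζ => ?_, fun ζ hζ => ?_⟩
  · exact subset_closure.trans hts
  · have hζ0 : 0 < ζ.im := hζ
    by_cases h : ζ ∈ logBox c
    · refine (hgle ζ h).trans ?_
      calc _ ≤ C / ζ.im / ε := div_le_div_of_nonneg_right (hV.dbar_le ζ h) hε.le
        _ ≤ _ := by
          rw [div_div, div_div, div_le_div_iff₀ (by positivity) (by positivity)]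
          have : 0 < C * (ε * ζ.im) := by positivity
          nlinarith
    · rw [hg0 ζ h, norm_zero]; positivity
  · have hζ0 : 0 < ζ.im := hζ
    rw [integral_eq_lintegral_of_nonneg_ae (Eventually.of_forall fun ω => by positivity)
      (Measurable.aestronglyMeasurable (by fun_prop))]
    refine ENNReal.toReal_le_of_le_ofReal (by positivity) ?_
    refine le_trans (le_of_eq (lintegral_congr fun ω => ?_)) ((lintegral_poisson_le_of_cbox
      (f := fun ω => ENNReal.ofReal ‖g ω‖) (C := 2 * C / ε) ?_ ?_ (by positivity) hbox hζ).trans (le_of_eq ?_))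
    · rw [← ENNReal.ofReal_mul (by positivity)]
    · fun_prop
    · intro ω hω
      simp [hg0 ω fun h => hω (hUH h)]
    · congr 1; ring
end

end

section
open MeasureTheory Set Filter Topology Complex

section
variable {a b V : ℂ → ℂ} {ε C c : ℝ} {φ : ℂ → ℝ}

lemma norm_dslope_exp_le (x : ℂ) : ‖dslope exp 0 x‖ ≤ Real.exp ‖x‖ := by
  rcases eq_or_ne x 0 with rfl | hx
  · simp [dslope_same]
  · have h := norm_exp_sub_sum_le_norm_mul_exp x 1
    have hx0 := norm_pos_iff.2 hx
    rw [dslope_of_ne _ hx, slope_def_field, norm_div, sub_zero, Complex.exp_zero, div_le_iff₀ hx0]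
    simpa [mul_comm] using h

lemma continuous_mul_of_tsupport {f : ℂ → ℂ} {U : Set ℂ} (hU : IsOpen U) (hf : ContinuousOn f U)
    {ψ : ℂ → ℂ} (hψ : Continuous ψ) (hs : tsupport ψ ⊆ U) : Continuous fun z => ψ z * f z :=
  continuous_of_tsupport fun _ hz => hψ.continuousAt.mul
    (hf.continuousAt (hU.mem_nhds (hs (tsupport_mul_subset_left hz))))

lemma contDiff_mul_of_tsupport {f : ℂ → ℂ} {U : Set ℂ} (hU : IsOpen U) (hf : ContDiffOn ℝ 1 f U)
    {ψ : ℂ → ℂ} (hψ : ContDiff ℝ 1 ψ) (hs : tsupport ψ ⊆ U) : ContDiff ℝ 1 fun z => ψ z * f z := by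
  refine contDiff_iff_contDiffAt.2 fun z => ?_
  by_cases hz : z ∈ tsupport ψ
  · exact hψ.contDiffAt.mul (hf.contDiffAt (hU.mem_nhds (hs hz)))
  · refine (contDiffAt_const (c := (0 : ℂ))).congr_of_eventuallyEq ?_
    filter_upwards [notMem_tsupport_iff_eventuallyEq.1 hz] with w hw
    simp [hw]

lemma dbar_mul {f ψ : ℂ → ℂ} {z : ℂ} (hψ : DifferentiableAt ℝ ψ z) (hf : DifferentiableAt ℝ f z) :
    dbar (fun z => ψ z * f z) z = ψ z * dbar f z + f z * dbar ψ z := by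
  have h : fderiv ℝ (fun z => ψ z * f z) z = ψ z • fderiv ℝ f z + f z • fderiv ℝ ψ z :=
    (hψ.hasFDerivAt.mul hf.hasFDerivAt).fderiv
  rw [dbar, h]
  simp only [add_apply, smul_apply, smul_eq_mul, dbar]
  ring

lemma dbar_eq_zero_of_eventuallyEq_const {f : ℂ → ℂ} {z x : ℂ} (h : f =ᶠ[𝓝 z] fun _ => x) :
    dbar f z = 0 := by
  rw [dbar, h.fderiv_eq]; simp

lemma RoundedLog.exists_holomorphic_log (hV : RoundedLog a b ε C c V) (hε : 0 < ε) (hC : 0 < C)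
    (hc : 0 < c) (hb : DifferentiableOn ℂ b UH) (hb1 : ∀ z ∈ UH, ‖b z‖ ≤ 1) (hφ : ContDiff ℝ 1 φ)
    (hφc : HasCompactSupport φ) (hφs : tsupport φ ⊆ logBox c) (hφ1 : ∀ z, φ z ∈ Icc 0 1)
    {O : Set ℂ} (hO : IsOpen O) (hφO : ∀ z ∈ O, φ z = 1) :
    ∃ w : ℂ → ℂ, (∀ z ∈ O, ‖w z‖ ≤ (4 * Real.pi * (8 * C / ε) + 14) * Real.exp (2 * (8 * C / ε))) ∧
      DifferentiableOn ℂ (fun z => V z - b z * w z) O ∧ DifferentiableOn ℂ w {z ∈ O | ‖b z‖ < ε} := by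
  have hJ := hV.jonesDatum hε hC hc hb hφ.continuous hφc hφs hφ1
  set g : ℂ → ℂ := fun z => φ z * dbar V z / b z with hg
  set ψ : ℂ → ℂ := fun z => (φ z : ℂ) with hψdef
  have hψ : ContDiff ℝ 1 ψ := ofRealCLM.contDiff.comp hφ
  have hψs : tsupport ψ ⊆ tsupport φ := tsupport_mono_of_zero fun z hz => by simp [hψdef, hz]
  have hQ := isOpen_logBox c
  have hOQ : O ⊆ logBox c := fun z hz =>
    hφs (subset_closure (by rw [Function.mem_support, hφO z hz]; exact one_ne_zero))
  have hOU := hOQ.trans (logBox_subset_UH hc)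
  have hcpt : ∀ f : ℂ → ℂ, (∀ z ∉ tsupport φ, f z = 0) → HasCompactSupport f := fun f hf =>
    HasCompactSupport.intro hφc.isCompact hf
  have hψ0 : ∀ z ∉ tsupport φ, ψ z = 0 ∧ dbar ψ z = 0 := fun z hz =>
    ⟨image_eq_zero_of_notMem_tsupport fun h => hz (hψs h), dbar_eq_zero_of_eventuallyEq_const
      (notMem_tsupport_iff_eventuallyEq.1 fun h => hz (hψs h))⟩
  have hdψs : tsupport (dbar ψ) ⊆ tsupport φ :=
    closure_minimal (fun z hz => by_contra fun h => hz (hψ0 z h).2) isClosed_closure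
  have hψO : ∀ z ∈ O, dbar ψ z = 0 := fun z hz => dbar_eq_zero_of_eventuallyEq_const (x := 1) <| by
    filter_upwards [hO.mem_nhds hz] with w hw
    simp [hψdef, hφO w hw]
  have hbg : ∀ ζ, b ζ * g ζ = ψ ζ * dbar V ζ := by
    intro ζ
    by_cases hζ : ζ ∈ tsupport φ
    · rcases eq_or_ne (b ζ) 0 with h | h
      · rw [hV.dbar_zero ζ (hφs hζ) (by simpa [h] using hε), h]; simp
      · simp only [hg, hψdef]; field_simp
    · have := (hψ0 ζ hζ).1
      simp only [hψdef] at this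
      simp [hg, hψdef, this]
  refine ⟨jonesSol g, fun z hz => hJ.norm_jonesSol_le (hOU hz), ?_, ?_⟩
  · have h := differentiableOn_sub_mul_jonesSol (f := fun z => ψ z * V z) (k := fun z => dbar ψ z * V z)
      (contDiff_mul_of_tsupport hQ hV.smooth hψ (hψs.trans hφs))
      (hcpt _ fun z hz => by simp [(hψ0 z hz).1]) hJ
      (continuous_mul_of_tsupport hQ hV.smooth.continuousOn (continuous_dbar hψ) (hdψs.trans hφs))
      (hcpt _ fun z hz => by simp [(hψ0 z hz).2]) hb hb1 hO hOU (fun z hz => by simp [hψO z hz]) ?_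
    · refine h.congr fun z hz => ?_
      simp [hψdef, hφO z hz]
    · intro ζ
      rw [hbg]
      by_cases hζ : ζ ∈ tsupport φ
      · rw [dbar_mul (hψ.differentiable one_ne_zero ζ)
          ((hV.smooth.contDiffAt (hQ.mem_nhds (hφs hζ))).differentiableAt one_ne_zero)]
        ring
      · rw [(hψ0 ζ hζ).1, (hψ0 ζ hζ).2, dbar_eq_zero_of_eventuallyEq_const (x := 0)]
        · simp
        · filter_upwards [notMem_tsupport_iff_eventuallyEq.1 fun h => hζ (hψs h)] with w hw
          simp [hw]
  · have hO' : IsOpen {z ∈ O | ‖b z‖ < ε} :=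
      (hb.continuousOn.mono hOU).norm.isOpen_inter_preimage hO isOpen_Iio
    have h := differentiableOn_sub_mul_jonesSol (f := fun _ => 0) (k := fun z => -g z) (b := fun _ => 1)
      contDiff_const (hcpt _ fun z _ => rfl) hJ hJ.cont.neg hJ.cpt.neg (differentiableOn_const _)
      (fun z _ => by simp) hO' (fun z hz => hOU hz.1)
      (fun z hz => by simp [hg, hV.dbar_zero z (hOQ hz.1) hz.2])
      (fun ζ => by rw [dbar_eq_zero_of_eventuallyEq_const (x := 0) (by rfl)]; ring)
    exact h.neg.congr fun z _ => by simp
end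

theorem exists_coreBox_solution {δ : ℝ} (hδ : 0 < δ) (hδ1 : δ ≤ 1) :
    ∃ K : ℝ, 0 < K ∧ ∀ a b : ℂ → ℂ, DifferentiableOn ℂ a UH → (∀ z ∈ UH, ‖a z‖ ≤ 1) →
      DifferentiableOn ℂ b UH → (∀ z ∈ UH, ‖b z‖ ≤ 1) →
      (∀ z ∈ UH, δ ≤ ‖a z‖ ∨ δ ≤ ‖b z‖) → ∀ τ, 0 < τ → τ < 1 / 2 →
      ∃ q : ℂ → ℂ, DifferentiableOn ℂ q (coreBox τ) ∧
        ∀ z ∈ coreBox τ, ‖q z‖ ≤ K ∧ 1 ≤ K * ‖a z + q z * b z‖ := by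
  obtain ⟨ε, C, hε, hC, H⟩ := exists_roundedLog hδ hδ1
  set W := (4 * Real.pi * (8 * C / ε) + 14) * Real.exp (2 * (8 * C / ε)) with hW
  have hW0 : 0 < W := by have := Real.pi_pos; positivity
  set K := (Real.exp (C + W) + 1) / ε + W * Real.exp W + Real.exp (C + W) with hK
  refine ⟨K, by positivity, fun a b ha ha1 hb hb1 hab τ hτ hτ1 => ?_⟩
  have hc : 0 < τ / 4 := by positivity
  obtain ⟨V, hV⟩ := H a b ha ha1 hb hb1 hab (τ / 4) hc
  obtain ⟨φ, hφ, hφc, hφs, hφ1, hφO⟩ := exists_box_cutoff hτ hτ1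
  have hO := isOpen_coreBox τ
  obtain ⟨w, hw1, hh, hwd⟩ := hV.exists_holomorphic_log hε hC hc hb hb1 hφ hφc hφs hφ1 hO hφO
  have hOQ : coreBox τ ⊆ logBox (τ / 4) := fun z hz =>
    ⟨hz.1.trans (by norm_num), by linarith [hz.2.1], by linarith [hz.2.2]⟩
  have hOU := hOQ.trans (logBox_subset_UH hc)
  set D : ℂ → ℂ := dslope exp 0 with hD
  have hDd : Differentiable ℂ D := fun z =>
    ((Complex.differentiableOn_dslope univ_mem).2 Complex.differentiable_exp.differentiableOn).differentiableAt
      univ_mem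
  classical
  set q : ℂ → ℂ := fun z => if ‖b z‖ < ε then a z * -w z * D (-(b z * w z))
    else (exp (V z - b z * w z) - a z) / b z with hq
  have hq1 : ∀ z, ‖b z‖ < ε → q z = a z * -w z * D (-(b z * w z)) := fun z h => if_pos h
  have hq2 : ∀ z, ε ≤ ‖b z‖ → q z = (exp (V z - b z * w z) - a z) / b z := fun z h => if_neg h.not_gt
  have hkey : ∀ z ∈ coreBox τ, a z + q z * b z = exp (V z - b z * w z) := by
    intro z hz
    rcases lt_or_ge ‖b z‖ ε with h | h
    · have h1 := sub_smul_dslope exp 0 (-(b z * w z))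
      rw [sub_zero, smul_eq_mul, Complex.exp_zero] at h1
      rw [hq1 z h, sub_eq_add_neg, Complex.exp_add, hV.exp_eq z (hOQ hz) h]
      linear_combination a z * h1
    · have : b z ≠ 0 := norm_pos_iff.1 (hε.trans_le h)
      rw [hq2 z h]; field_simp; ring
  have hre : ∀ z ∈ coreBox τ, |(V z - b z * w z).re| ≤ C + W := by
    intro z hz
    rw [sub_re]
    have h1 := hV.re_le z (hOQ hz)
    have h2 : |(b z * w z).re| ≤ W := by
      refine (abs_re_le_norm _).trans ?_
      rw [norm_mul]
      nlinarith [hw1 z hz, hb1 z (hOU hz), norm_nonneg (b z), norm_nonneg (w z)]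
    exact (abs_sub _ _).trans (add_le_add h1 h2)
  refine ⟨q, fun z hz => DifferentiableAt.differentiableWithinAt ?_, fun z hz => ⟨?_, ?_⟩⟩
  · have hzU := hOU hz
    have hbz := hb.differentiableAt_UH hzU
    have haz := ha.differentiableAt_UH hzU
    rcases lt_or_ge ‖b z‖ ε with h | h
    · have hn : ∀ᶠ u in 𝓝 z, u ∈ coreBox τ ∧ ‖b u‖ < ε :=
        Filter.Eventually.and (hO.mem_nhds hz) (hbz.continuousAt.norm.eventually_lt_const h)
      have hwz : DifferentiableAt ℂ w z := hwd.differentiableAt hn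
      have h1 : DifferentiableAt ℂ (fun z => a z * -w z * D (-(b z * w z))) z :=
        (haz.mul hwz.neg).mul ((hDd _).comp z (hbz.mul hwz).neg)
      exact h1.congr_of_eventuallyEq (hn.mono fun u hu => hq1 u hu.2)
    · have hb0 : b z ≠ 0 := norm_pos_iff.1 (hε.trans_le h)
      have h1 : DifferentiableAt ℂ (fun z => (exp (V z - b z * w z) - a z) / b z) z :=
        ((hh.differentiableAt (hO.mem_nhds hz)).cexp.sub haz).div hbz hb0
      refine h1.congr_of_eventuallyEq ?_
      filter_upwards [hO.mem_nhds hz, hbz.continuousAt.eventually_ne hb0] with u hu hu0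
      rw [← hkey u hu]; field_simp; ring
  · have hE := Real.exp_pos (C + W)
    rcases lt_or_ge ‖b z‖ ε with h | h
    · have h1 : ‖b z * w z‖ ≤ W := by
        rw [norm_mul]
        nlinarith [hw1 z hz, hb1 z (hOU hz), norm_nonneg (b z), norm_nonneg (w z)]
      have h2 : ‖D (-(b z * w z))‖ ≤ Real.exp W := by
        refine (norm_dslope_exp_le _).trans (Real.exp_le_exp.2 ?_)
        rwa [norm_neg]
      have h3 : ‖q z‖ ≤ 1 * W * Real.exp W := by
        rw [hq1 z h, norm_mul, norm_mul, norm_neg]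
        exact mul_le_mul (mul_le_mul (ha1 z (hOU hz)) (hw1 z hz) (norm_nonneg _) zero_le_one) h2
          (norm_nonneg _) (by positivity)
      have h4 : 0 < (Real.exp (C + W) + 1) / ε := by positivity
      linarith
    · have h3 : ‖q z‖ ≤ (Real.exp (C + W) + 1) / ε := by
        rw [hq2 z h, norm_div]
        refine div_le_div₀ (by positivity) ((norm_sub_le _ _).trans (add_le_add ?_ (ha1 z (hOU hz)))) hε h
        rw [Complex.norm_exp]
        exact Real.exp_le_exp.2 (abs_le.1 (hre z hz)).2
      have h4 : 0 < W * Real.exp W := by positivity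
      linarith
  · rw [hkey z hz, Complex.norm_exp]
    have h1 : Real.exp (C + W) ≤ K := by
      have : 0 < (Real.exp (C + W) + 1) / ε + W * Real.exp W := by positivity
      linarith
    calc (1 : ℝ) = Real.exp (C + W) * Real.exp (-(C + W)) := by rw [← Real.exp_add]; simp
      _ ≤ _ := mul_le_mul h1 (Real.exp_le_exp.2 (abs_le.1 (hre z hz)).1) (Real.exp_pos _).le (by positivity)

lemma exists_locally_bounded_limit {U : Set ℂ} {B : ℕ → Set ℂ} {q : ℕ → ℂ → ℂ} {K : ℝ}
    (hB : ∀ z ∈ U, ∃ r > 0, Metric.ball z r ⊆ U ∧ ∀ᶠ n in atTop, Metric.ball z r ⊆ B n)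
    (hq : ∀ n, DifferentiableOn ℂ (q n) (B n)) (hK : ∀ n, ∀ z ∈ B n, ‖q n z‖ ≤ K) :
    ∃ (l : Filter ℕ) (Q : ℂ → ℂ), l.NeBot ∧ l ≤ atTop ∧ DifferentiableOn ℂ Q U ∧
      ∀ z ∈ U, Tendsto (fun n => q n z) l (𝓝 (Q z)) := by
  set l : Ultrafilter ℕ := Ultrafilter.of atTop with hl
  have hle : (l : Filter ℕ) ≤ atTop := Ultrafilter.of_le _
  have hlim : ∀ z, ∃ x, z ∈ U → Tendsto (fun n => q n z) l (𝓝 x) := by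
    intro z
    by_cases hz : z ∈ U
    · obtain ⟨r, hr, -, h⟩ := hB z hz
      have h1 : ∀ᶠ n in (l : Filter ℕ), q n z ∈ Metric.closedBall (0 : ℂ) K := by
        filter_upwards [hle h] with n hn
        rw [mem_closedBall_zero_iff]
        exact hK n z (hn (Metric.mem_ball_self hr))
      obtain ⟨x, -, hx⟩ := (isCompact_closedBall (0 : ℂ) K).ultrafilter_le_nhds (l.map fun n => q n z)
        (le_principal_iff.2 h1)
      exact ⟨x, fun _ => hx⟩
    · exact ⟨0, fun h => absurd h hz⟩
  choose Q hQ using hlim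
  refine ⟨l, Q, inferInstance, hle, ?_, fun z hz => hQ z hz⟩
  intro z hz
  obtain ⟨r, hr, hrU, hrB⟩ := hB z hz
  have hK0 : 0 ≤ K := by
    obtain ⟨n, hn⟩ := (hrB.exists)
    exact (norm_nonneg _).trans (hK n z (hn (Metric.mem_ball_self hr)))
  -- an equi-Lipschitz bound near each point
  have hlip : ∀ x ∈ Metric.ball z (r / 2), ∀ᶠ n in (l : Filter ℕ), ∀ y ∈ Metric.ball x (r / 2),
      dist (q n y) (q n x) ≤ 2 * K / (r / 2) * dist y x := by
    intro x hx
    filter_upwards [hle hrB] with n hn y hy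
    have hsub : Metric.ball x (r / 2) ⊆ B n := (Metric.ball_subset_ball' (by
      rw [Metric.mem_ball] at hx; linarith)).trans hn
    refine dist_le_div_mul_dist_of_mapsTo_ball ((hq n).mono hsub) (fun w hw => ?_) hy
    rw [Metric.mem_closedBall, dist_eq_norm]
    have hx2 := hK n x (hsub (Metric.mem_ball_self (by positivity)))
    linarith [norm_sub_le (q n w) (q n x), hK n w (hsub hw)]
  have hloc : TendstoLocallyUniformlyOn q Q l (Metric.ball z (r / 2)) := by
    rw [Metric.tendstoLocallyUniformlyOn_iff]
    intro e he x hx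
    set L := 2 * K / (r / 2) + 1 with hL
    have hL0 : 0 < L := by positivity
    refine ⟨Metric.ball x (min (r / 2) (e / (3 * L))) ∩ Metric.ball z (r / 2), ?_, ?_⟩
    · rw [inter_comm]
      exact inter_mem self_mem_nhdsWithin (mem_nhdsWithin_of_mem_nhds (Metric.ball_mem_nhds _ (by positivity)))
    have hxU : x ∈ U := hrU (Metric.ball_subset_ball (by linarith) hx)
    have hdist : ∀ y ∈ Metric.ball x (min (r / 2) (e / (3 * L))), L * dist y x ≤ e / 3 := by
      intro y hy
      have h1 : dist y x < e / (3 * L) := (Metric.mem_ball.1 hy).trans_le (min_le_right _ _)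
      rw [lt_div_iff₀ (by positivity)] at h1
      linarith
    have hstep : ∀ᶠ n in (l : Filter ℕ), ∀ y ∈ Metric.ball x (min (r / 2) (e / (3 * L))),
        dist (q n y) (q n x) ≤ e / 3 := by
      filter_upwards [hlip x hx] with n hn y hy
      refine (hn y (Metric.ball_subset_ball (min_le_left _ _) hy)).trans (le_trans ?_ (hdist y hy))
      exact mul_le_mul_of_nonneg_right (by linarith) dist_nonneg
    filter_upwards [hstep, (Metric.tendsto_nhds.1 (hQ x hxU)) (e / 3) (by positivity)] with n hn hnx y hy
    have hyU : y ∈ U := hrU (Metric.ball_subset_ball (by linarith) hy.2)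
    have h1 : dist (Q y) (Q x) ≤ e / 3 :=
      le_of_tendsto ((hQ y hyU).dist (hQ x hxU)) (hstep.mono fun m hm => hm y hy.1)
    have h2 := dist_triangle4 (Q y) (Q x) (q n x) (q n y)
    have h3 := hn y hy.1
    rw [dist_comm] at hnx
    rw [dist_comm] at h3
    linarith
  have hball := hloc.differentiableOn (hle (hrB.mono fun n hn => (hq n).mono
    ((Metric.ball_subset_ball (by linarith)).trans hn))) Metric.isOpen_ball
  exact (hball.differentiableAt (Metric.ball_mem_nhds z (by positivity))).differentiableWithinAt

theorem exists_UH_solution {δ : ℝ} (hδ : 0 < δ) (hδ1 : δ ≤ 1) :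
    ∃ K : ℝ, 0 < K ∧ ∀ a b : ℂ → ℂ, DifferentiableOn ℂ a UH → (∀ z ∈ UH, ‖a z‖ ≤ 1) →
      DifferentiableOn ℂ b UH → (∀ z ∈ UH, ‖b z‖ ≤ 1) →
      (∀ z ∈ UH, δ ≤ ‖a z‖ ∨ δ ≤ ‖b z‖) →
      ∃ q : ℂ → ℂ, DifferentiableOn ℂ q UH ∧ ∀ z ∈ UH, ‖q z‖ ≤ K ∧ 1 ≤ K * ‖a z + q z * b z‖ := by
  obtain ⟨K, hK, H⟩ := exists_coreBox_solution hδ hδ1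
  refine ⟨K, hK, fun a b ha ha1 hb hb1 hab => ?_⟩
  -- rescaled problems on an exhaustion
  set R : ℕ → ℝ := fun n => 2 * ((n : ℝ) + 2) with hR
  have hRpos : ∀ n, 0 < R n := fun n => by simp only [hR]; positivity
  set B : ℕ → Set ℂ := fun n => {z | |z.re| < R n ∧ 1 / ((n : ℝ) + 2) < z.im ∧ z.im < (n : ℝ) + 2} with hBdef
  have hsc : ∀ n z, z ∈ UH → (R n : ℂ) * z ∈ UH := fun n z hz => by
    show 0 < ((R n : ℂ) * z).im
    rw [im_ofReal_mul]
    exact mul_pos (hRpos n) hz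
  have hq : ∀ n, ∃ q : ℂ → ℂ, DifferentiableOn ℂ q (B n) ∧
      ∀ z ∈ B n, ‖q z‖ ≤ K ∧ 1 ≤ K * ‖a z + q z * b z‖ := by
    intro n
    have hn : (0 : ℝ) < (n : ℝ) + 2 := by positivity
    have hdiff : ∀ f : ℂ → ℂ, DifferentiableOn ℂ f UH →
        DifferentiableOn ℂ (fun w => f ((R n : ℂ) * w)) UH := fun f hf =>
      hf.comp (differentiable_id.const_mul (R n : ℂ)).differentiableOn fun w hw => hsc n w hw
    have hτ : (R n)⁻¹ * (1 / ((n : ℝ) + 2)) < 1 / 2 := by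
      rw [← one_div, div_mul_div_comm, one_mul, div_lt_div_iff₀ (by have := hRpos n; positivity) two_pos]
      simp only [hR]
      nlinarith [(Nat.cast_nonneg n : (0 : ℝ) ≤ n)]
    obtain ⟨q, hqd, hq⟩ := H (fun w => a ((R n : ℂ) * w)) (fun w => b ((R n : ℂ) * w))
      (hdiff a ha) (fun w hw => ha1 _ (hsc n w hw)) (hdiff b hb) (fun w hw => hb1 _ (hsc n w hw))
      (fun w hw => hab _ (hsc n w hw)) ((R n)⁻¹ * (1 / ((n : ℝ) + 2)))
      (mul_pos (inv_pos.2 (hRpos n)) (by positivity)) hτ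
    have hmaps : ∀ z ∈ B n, (((R n)⁻¹ : ℝ) : ℂ) * z ∈ coreBox ((R n)⁻¹ * (1 / ((n : ℝ) + 2))) := by
      rintro z ⟨h1, h2, h3⟩
      refine ⟨?_, ?_, ?_⟩
      · rw [re_ofReal_mul, abs_mul, abs_of_pos (inv_pos.2 (hRpos n)), inv_mul_lt_iff₀ (hRpos n), mul_one]
        exact h1
      · rw [im_ofReal_mul]
        exact mul_lt_mul_of_pos_left h2 (inv_pos.2 (hRpos n))
      · rw [im_ofReal_mul, inv_mul_lt_iff₀ (hRpos n)]
        simp only [hR]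
        linarith
    refine ⟨fun z => q ((((R n)⁻¹ : ℝ) : ℂ) * z),
      hqd.comp (differentiable_id.const_mul _).differentiableOn hmaps, fun z hz => ?_⟩
    have h := hq _ (hmaps z hz)
    have hz' : (R n : ℂ) * ((((R n)⁻¹ : ℝ) : ℂ) * z) = z := by
      rw [← mul_assoc, ← ofReal_mul, mul_inv_cancel₀ (hRpos n).ne', ofReal_one, one_mul]
    simp only [hz'] at h
    exact h
  choose q hqd hq1 using hq
  have hexh : ∀ z ∈ UH, ∃ r > 0, Metric.ball z r ⊆ UH ∧ ∀ᶠ n in atTop, Metric.ball z r ⊆ B n := by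
    intro z hz
    have hz : 0 < z.im := hz
    refine ⟨z.im / 2, by positivity, ball_subset_UH (by linarith), ?_⟩
    have hcast : Tendsto (fun n : ℕ => (n : ℝ) + 2) atTop atTop :=
      tendsto_atTop_add_const_right _ _ tendsto_natCast_atTop_atTop
    filter_upwards [hcast.eventually_gt_atTop (|z.re| + z.im / 2), hcast.eventually_gt_atTop (2 * z.im),
      hcast.eventually_gt_atTop (2 / z.im)] with n h1 h2 h3 w hw
    rw [Metric.mem_ball, dist_eq] at hw
    have hre := (abs_re_le_norm (w - z)).trans_lt hw
    have him := (abs_im_le_norm (w - z)).trans_lt hw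
    rw [sub_re] at hre
    rw [sub_im, abs_lt] at him
    have hn : (0 : ℝ) < (n : ℝ) + 2 := by positivity
    refine ⟨?_, ?_, by linarith⟩
    · have := abs_sub_abs_le_abs_sub w.re z.re
      simp only [hR]
      linarith
    · have h4 : 1 / ((n : ℝ) + 2) < z.im / 2 := by
        rw [div_lt_iff₀ hz] at h3
        rw [div_lt_iff₀ hn]
        linarith
      linarith
  obtain ⟨l, Q, hl, hle, hQd, hQ⟩ := exists_locally_bounded_limit hexh hqd fun n z hz => (hq1 n z hz).1
  refine ⟨Q, hQd, fun z hz => ?_⟩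
  obtain ⟨r, hr, -, hB⟩ := hexh z hz
  have hmem : ∀ᶠ n in l, z ∈ B n := hle (hB.mono fun n hn => hn (Metric.mem_ball_self hr))
  exact ⟨le_of_tendsto (hQ z hz).norm (hmem.mono fun n hn => (hq1 n z hn).1),
    ge_of_tendsto (((tendsto_const_nhds.add ((hQ z hz).mul_const (b z))).norm).const_mul K)
      (hmem.mono fun n hn => (hq1 n z hn).2)⟩

end

section
open Set Filter Topology Complex

lemma cayley_mem_UH {z : ℂ} (hz : z ∈ Metric.ball (0 : ℂ) 1) : I * (1 + z) / (1 - z) ∈ UH := by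
  rw [mem_ball_zero_iff] at hz
  have hne : (1 - z) ≠ 0 := sub_ne_zero.2 fun h => by rw [← h, norm_one] at hz; exact lt_irrefl _ hz
  have h2 : normSq z < 1 := by
    rw [normSq_eq_norm_sq]
    nlinarith [norm_nonneg z]
  have h3 : 0 < normSq (1 - z) := normSq_pos.2 hne
  have h1 : (I * (1 + z) / (1 - z)).im = (1 - normSq z) / normSq (1 - z) := by
    rw [div_im, div_sub_div_same]
    congr 1
    simp only [normSq_apply, mul_im, mul_re, I_re, I_im, add_re, add_im, sub_re, sub_im, one_re, one_im]
    ring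
  show 0 < (I * (1 + z) / (1 - z)).im
  rw [h1]
  exact div_pos (by linarith) h3

lemma cayley_inv_mem_ball {w : ℂ} (hw : w ∈ UH) : (w - I) / (w + I) ∈ Metric.ball (0 : ℂ) 1 := by
  have hw : 0 < w.im := hw
  have hne : w + I ≠ 0 := fun h => by
    have := congrArg im h
    simp only [add_im, I_im, zero_im] at this
    linarith
  rw [mem_ball_zero_iff, norm_div, div_lt_one (norm_pos_iff.2 hne)]
  refine lt_of_pow_lt_pow_left₀ 2 (norm_nonneg _) ?_
  rw [← normSq_eq_norm_sq, ← normSq_eq_norm_sq]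
  simp only [normSq_apply, add_re, add_im, sub_re, sub_im, I_re, I_im]
  nlinarith

/-- Stable rank one for the bounded analytic functions on the disc, with uniform bounds. -/
theorem exists_disc_solution {δ : ℝ} (hδ : 0 < δ) (hδ1 : δ ≤ 1) :
    ∃ K : ℝ, 0 < K ∧ ∀ a b : ℂ → ℂ, DifferentiableOn ℂ a (Metric.ball 0 1) →
      (∀ z ∈ Metric.ball (0 : ℂ) 1, ‖a z‖ ≤ 1) → DifferentiableOn ℂ b (Metric.ball 0 1) →
      (∀ z ∈ Metric.ball (0 : ℂ) 1, ‖b z‖ ≤ 1) →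
      (∀ z ∈ Metric.ball (0 : ℂ) 1, δ ≤ ‖a z‖ ∨ δ ≤ ‖b z‖) →
      ∃ q : ℂ → ℂ, DifferentiableOn ℂ q (Metric.ball 0 1) ∧
        ∀ z ∈ Metric.ball (0 : ℂ) 1, ‖q z‖ ≤ K ∧ 1 ≤ K * ‖a z + q z * b z‖ := by
  obtain ⟨K, hK, H⟩ := exists_UH_solution hδ hδ1
  refine ⟨K, hK, fun a b ha ha1 hb hb1 hab => ?_⟩
  have hdiff : DifferentiableOn ℂ (fun w : ℂ => (w - I) / (w + I)) UH := by
    intro w hw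
    have hw : 0 < w.im := hw
    have hne : w + I ≠ 0 := fun h => by
      have := congrArg im h
      simp only [add_im, I_im, zero_im] at this
      linarith
    exact ((differentiableAt_id.sub_const I).div (differentiableAt_id.add_const I) hne).differentiableWithinAt
  obtain ⟨q, hqd, hq⟩ := H (fun w => a ((w - I) / (w + I))) (fun w => b ((w - I) / (w + I)))
    (ha.comp hdiff fun w hw => cayley_inv_mem_ball hw) (fun w hw => ha1 _ (cayley_inv_mem_ball hw))
    (hb.comp hdiff fun w hw => cayley_inv_mem_ball hw) (fun w hw => hb1 _ (cayley_inv_mem_ball hw))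
    (fun w hw => hab _ (cayley_inv_mem_ball hw))
  have hne : ∀ z ∈ Metric.ball (0 : ℂ) 1, 1 - z ≠ 0 := fun z hz => sub_ne_zero.2 fun h => by
    rw [mem_ball_zero_iff, ← h, norm_one] at hz
    exact lt_irrefl _ hz
  have hdiff' : DifferentiableOn ℂ (fun z : ℂ => I * (1 + z) / (1 - z)) (Metric.ball 0 1) := fun z hz =>
    (((differentiableAt_id.const_add 1).const_mul I).div (differentiableAt_id.const_sub 1)
      (hne z hz)).differentiableWithinAt
  refine ⟨fun z => q (I * (1 + z) / (1 - z)), hqd.comp hdiff' fun z hz => cayley_mem_UH hz,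
    fun z hz => ?_⟩
  have h := hq _ (cayley_mem_UH hz)
  have hz' : (I * (1 + z) / (1 - z) - I) / (I * (1 + z) / (1 - z) + I) = z := by
    have h1 := hne z hz
    have h2 : I * (1 + z) / (1 - z) + I = 2 * I / (1 - z) := by field_simp; ring
    have h3 : I * (1 + z) / (1 - z) - I = 2 * I * z / (1 - z) := by field_simp; ring
    rw [h2, h3, div_div_div_cancel_right₀ h1, mul_div_cancel_left₀ _ (mul_ne_zero two_ne_zero I_ne_zero)]
  simp only [hz'] at h
  exact h

end

section
open Set Filter Topology Complex

namespace MemHinfN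

lemma const (c : ℂ) : MemHinfN fun _ _ => c :=
  ⟨fun _ => differentiableOn_const c, ‖c‖, fun _ _ _ => le_rfl⟩

lemma add {f g : ℂ → ℕ → ℂ} (hf : MemHinfN f) (hg : MemHinfN g) :
    MemHinfN fun z n => f z n + g z n := by
  obtain ⟨hfd, M, hM⟩ := hf
  obtain ⟨hgd, N, hN⟩ := hg
  exact ⟨fun n => (hfd n).add (hgd n), M + N, fun z hz n =>
    (norm_add_le _ _).trans (add_le_add (hM z hz n) (hN z hz n))⟩

lemma mul {f g : ℂ → ℕ → ℂ} (hf : MemHinfN f) (hg : MemHinfN g) :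
    MemHinfN fun z n => f z n * g z n := by
  obtain ⟨hfd, M, hM⟩ := hf
  obtain ⟨hgd, N, hN⟩ := hg
  refine ⟨fun n => (hfd n).mul (hgd n), M * N, fun z hz n => ?_⟩
  rw [norm_mul]
  exact mul_le_mul (hM z hz n) (hN z hz n) (norm_nonneg _) ((norm_nonneg _).trans (hM z hz n))

lemma exists_bound {f : ℂ → ℕ → ℂ} (hf : MemHinfN f) :
    ∃ M, 0 < M ∧ ∀ z ∈ Metric.ball (0 : ℂ) 1, ∀ n, ‖f z n‖ ≤ M := by
  obtain ⟨M, hM⟩ := hf.2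
  exact ⟨max M 1, by positivity, fun z hz n => (hM z hz n).trans (le_max_left _ _)⟩

lemma inv {f : ℂ → ℕ → ℂ} (hf : MemHinfN f) {m : ℝ} (hm : 0 < m)
    (h : ∀ z ∈ Metric.ball (0 : ℂ) 1, ∀ n, m ≤ ‖f z n‖) : MemHinfN fun z n => (f z n)⁻¹ := by
  refine ⟨fun n => (hf.1 n).inv fun z hz => norm_pos_iff.1 (hm.trans_le (h z hz n)), m⁻¹,
    fun z hz n => ?_⟩
  rw [norm_inv]
  exact inv_anti₀ hm (h z hz n)

end MemHinfN

/-- A pair `(1 + f, b)` bounded away from zero can be made uniformly non-vanishing by adding to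
`1 + f` a multiple of `f * b`. -/
lemma exists_memHinfN_reduction {f b : ℂ → ℕ → ℂ} (hf : MemHinfN f) (hb : MemHinfN b) {η : ℝ}
    (hη : 0 < η) (h : ∀ z ∈ Metric.ball (0 : ℂ) 1, ∀ n, η ≤ ‖1 + f z n‖ + ‖b z n‖) :
    ∃ q : ℂ → ℕ → ℂ, MemHinfN q ∧ ∃ m, 0 < m ∧ ∀ z ∈ Metric.ball (0 : ℂ) 1, ∀ n,
      m ≤ ‖1 + (f z n + q z n * b z n * f z n)‖ := by
  obtain ⟨M, hM, hfM⟩ := hf.exists_bound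
  obtain ⟨L, hL, hbL⟩ := hb.exists_bound
  set N : ℝ := (1 + M) * (1 + L) with hN
  have hN1 : 1 ≤ N := by rw [hN]; nlinarith [mul_pos hM hL]
  have hN0 : 0 < N := by linarith
  have hNC : ((N : ℝ) : ℂ) ≠ 0 := ofReal_ne_zero.2 hN0.ne'
  set e : ℝ := min η 1 with he
  have he0 : 0 < e := lt_min hη one_pos
  have he1 : e ≤ 1 := min_le_right _ _
  have hδ1 : e / (4 * N) ≤ 1 := by rw [div_le_one (by positivity)]; linarith
  obtain ⟨K, hK, H⟩ := exists_disc_solution (δ := e / (4 * N)) (by positivity) hδ1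
  have hnorm : ∀ x : ℂ, ‖x / (N : ℂ)‖ = ‖x‖ / N := fun x => by
    rw [norm_div, norm_real, Real.norm_of_nonneg hN0.le]
  have hq : ∀ n, ∃ q : ℂ → ℂ, DifferentiableOn ℂ q (Metric.ball 0 1) ∧
      ∀ z ∈ Metric.ball (0 : ℂ) 1, ‖q z‖ ≤ K ∧
        1 ≤ K * ‖(1 + f z n) / N + q z * (b z n * f z n / N)‖ := by
    intro n
    refine H (fun z => (1 + f z n) / N) (fun z => b z n * f z n / N)
      (((hf.1 n).const_add 1).div_const _) (fun z hz => ?_) (((hb.1 n).mul (hf.1 n)).div_const _)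
      (fun z hz => ?_) (fun z hz => ?_)
    · rw [hnorm, div_le_one hN0]
      have := norm_add_le 1 (f z n)
      rw [norm_one] at this
      nlinarith [hfM z hz n]
    · rw [hnorm, div_le_one hN0, norm_mul]
      have := mul_le_mul (hbL z hz n) (hfM z hz n) (norm_nonneg _) hL.le
      nlinarith
    · rw [hnorm, hnorm, div_le_div_iff₀ (by positivity) hN0, div_le_div_iff₀ (by positivity) hN0]
      by_cases h1 : e / 4 ≤ ‖1 + f z n‖
      · left
        nlinarith
      · right
        rw [not_le] at h1
        have h2 : 1 / 2 ≤ ‖f z n‖ := by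
          have := norm_sub_le (1 + f z n) (f z n)
          rw [add_sub_cancel_right, norm_one] at this
          linarith
        have h3 : e / 2 ≤ ‖b z n‖ := by
          have := h z hz n
          have := min_le_left η 1
          linarith
        have h4 : e / 4 ≤ ‖b z n * f z n‖ := by
          rw [norm_mul]
          have := mul_le_mul h3 h2 (by norm_num) (norm_nonneg _)
          linarith
        nlinarith
  choose q hqd hq using hq
  refine ⟨fun z n => q n z, ⟨hqd, K, fun z hz n => (hq n z hz).1⟩, N / K, by positivity,
    fun z hz n => ?_⟩
  have h1 := (hq n z hz).2
  have h2 : (1 + f z n) / N + q n z * (b z n * f z n / N) =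
      (1 + (f z n + q n z * b z n * f z n)) / N := by ring
  rw [h2, hnorm, mul_div_assoc', le_div_iff₀ hN0, one_mul] at h1
  rw [div_le_iff₀ hK]
  linarith

end

/-- **`H_J` is a B-ring.** Let `J` be a closed ideal of the Banach algebra
`H^∞(𝔻 × ℕ)` (closed in the sup norm, an additive subgroup stable under
multiplication by elements of `H^∞(𝔻 × ℕ)`), and let
`H_J = {c·1 + f : c ∈ ℂ, f ∈ J}`. If `a, b ∈ H_J` satisfy `u·a + v·b = 1` on
`𝔻 × ℕ` for some `u, v ∈ H_J`, then there exists `c ∈ H_J` such that `a + c·b`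
is invertible in `H_J`: it has a multiplicative inverse `w` lying in `H_J`. -/
theorem unitalHull_closedIdeal_Bring
    (J : Set (ℂ → ℕ → ℂ))
    (hJsub : ∀ f ∈ J, MemHinfN f)
    (hJzero : (fun _ _ => (0 : ℂ)) ∈ J)
    (hJadd : ∀ f ∈ J, ∀ g ∈ J, (fun z n => f z n + g z n) ∈ J)
    (hJneg : ∀ f ∈ J, (fun z n => -f z n) ∈ J)
    (hJmul : ∀ f ∈ J, ∀ g : ℂ → ℕ → ℂ, MemHinfN g →
      (fun z n => g z n * f z n) ∈ J)
    (hJclosed : ∀ f : ℂ → ℕ → ℂ, MemHinfN f →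
      (∀ ε : ℝ, 0 < ε → ∃ g ∈ J,
        ∀ z ∈ Metric.ball (0 : ℂ) 1, ∀ n : ℕ, ‖f z n - g z n‖ ≤ ε) →
      f ∈ J)
    (a b u v : ℂ → ℕ → ℂ)
    (ha : a ∈ unitalHull J) (hb : b ∈ unitalHull J)
    (hu : u ∈ unitalHull J) (hv : v ∈ unitalHull J)
    (hunim : ∀ z ∈ Metric.ball (0 : ℂ) 1, ∀ n : ℕ,
      u z n * a z n + v z n * b z n = 1) :
    ∃ c ∈ unitalHull J, ∃ w ∈ unitalHull J,
      ∀ z ∈ Metric.ball (0 : ℂ) 1, ∀ n : ℕ,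
        (a z n + c z n * b z n) * w z n = 1 := by
  have hmem : ∀ h ∈ unitalHull J, MemHinfN h := by
    rintro h ⟨c, f, hf, rfl⟩
    exact (MemHinfN.const c).add (hJsub f hf)
  have hsmul : ∀ (c : ℂ), ∀ f ∈ J, (fun z n => c * f z n) ∈ J := fun c f hf =>
    hJmul f hf _ (MemHinfN.const c)
  have hbH := hmem b hb
  -- shift `a` by a multiple of `b` so that its constant term does not vanish
  obtain ⟨γ, hγ, c₀, f, hf, hshift⟩ : ∃ γ : ℂ, γ ≠ 0 ∧ ∃ c₀ : ℂ, ∃ f ∈ J,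
      ∀ z n, a z n + c₀ * b z n = γ * (1 + f z n) := by
    have haJ := ha
    obtain ⟨α, f, hf, rfl⟩ := ha
    obtain ⟨β, g, hg, rfl⟩ := hb
    by_cases hβ : β = 0
    · by_cases hα : α = 0
      · have h1 : (fun _ _ => (1 : ℂ)) ∈ J := by
          refine hJclosed _ (MemHinfN.const 1) fun ε hε => ⟨_, hJadd _ (hJmul f hf u (hmem u hu)) _
            (hJmul g hg v (hmem v hv)), fun z hz n => ?_⟩
          have := hunim z hz n
          simp only [hα, hβ, zero_add] at this
          rw [this, sub_self, norm_zero]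
          exact hε.le
        refine ⟨1, one_ne_zero, 0, _, hJadd f hf _ (hJneg _ h1), fun z n => ?_⟩
        simp only [hα]
        ring
      · refine ⟨α, hα, 0, _, hsmul α⁻¹ f hf, fun z n => ?_⟩
        field_simp
        ring
    · refine ⟨1, one_ne_zero, (1 - α) / β, _, hJadd f hf _ (hsmul ((1 - α) / β) g hg),
        fun z n => ?_⟩
      field_simp
      ring
  have hfH := hJsub f hf
  obtain ⟨U, hU0, hU⟩ := (hmem u hu).exists_bound
  obtain ⟨V, hV0, hV⟩ := (hmem v hv).exists_bound
  set S : ℝ := U * ‖γ‖ + (V + U * ‖c₀‖) with hS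
  have hS0 : 0 < S := by positivity
  have hlow : ∀ z ∈ Metric.ball (0 : ℂ) 1, ∀ n, 1 / S ≤ ‖1 + f z n‖ + ‖b z n‖ := by
    intro z hz n
    have h1 : u z n * (γ * (1 + f z n)) + (v z n - u z n * c₀) * b z n = 1 := by
      rw [← hshift, ← hunim z hz n]
      ring
    have h2 : ‖u z n * (γ * (1 + f z n))‖ ≤ U * ‖γ‖ * ‖1 + f z n‖ := by
      rw [norm_mul, norm_mul, ← mul_assoc]
      exact mul_le_mul_of_nonneg_right (mul_le_mul_of_nonneg_right (hU z hz n) (norm_nonneg _))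
        (norm_nonneg _)
    have h3 : ‖(v z n - u z n * c₀) * b z n‖ ≤ (V + U * ‖c₀‖) * ‖b z n‖ := by
      rw [norm_mul]
      refine mul_le_mul_of_nonneg_right ((norm_sub_le _ _).trans (add_le_add (hV z hz n) ?_))
        (norm_nonneg _)
      rw [norm_mul]
      exact mul_le_mul_of_nonneg_right (hU z hz n) (norm_nonneg _)
    have h4 := norm_add_le (u z n * (γ * (1 + f z n))) ((v z n - u z n * c₀) * b z n)
    rw [h1, norm_one] at h4
    have h5 : 0 ≤ U * ‖γ‖ := by positivity
    have h6 : 0 ≤ V + U * ‖c₀‖ := by positivity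
    rw [div_le_iff₀ hS0, hS]
    nlinarith [mul_nonneg h5 (norm_nonneg (b z n)), mul_nonneg h6 (norm_nonneg (1 + f z n))]
  obtain ⟨q, hq, m, hm, hqm⟩ := exists_memHinfN_reduction hfH hbH (by positivity) hlow
  have hj : (fun z n => f z n + q z n * b z n * f z n) ∈ J := hJadd f hf _ (hJmul f hf _ (hq.mul hbH))
  have hinv := ((MemHinfN.const 1).add (hJsub _ hj)).inv hm hqm
  refine ⟨_, ⟨c₀, _, hsmul γ _ (hJmul f hf q hq), rfl⟩, _,
    ⟨γ⁻¹, _, hsmul (-γ⁻¹) _ (hJmul _ hj _ hinv), rfl⟩, fun z hz n => ?_⟩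
  have hne : 1 + (f z n + q z n * b z n * f z n) ≠ 0 := norm_pos_iff.1 (hm.trans_le (hqm z hz n))
  have h1 : a z n + (c₀ + γ * (q z n * f z n)) * b z n =
      γ * (1 + (f z n + q z n * b z n * f z n)) := by
    linear_combination hshift z n
  have h2 : ∀ j : ℂ, 1 + j ≠ 0 → γ * (1 + j) * (γ⁻¹ + -γ⁻¹ * ((1 + j)⁻¹ * j)) = 1 := fun j h => by
    field_simp
    ring
  simp only [h1]
  exact h2 _ hne
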